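/- Let Δ = {(x_i,y_i) ∈ [0,1]×ℝ : i = 0,…,m} with 0 = x_0 < x_1 < ⋯ < x_m = 1 and let α_i ∈ (−1,1)∖{0} for i = 1,…,m. Let G : [0,1] → ℝ be the continuous fractal interpolation function with G(x_i) = y_i for all i whose graph satisfies graph(G) = ⋃_{i=1}^m F̃_i(graph(G)) for the affine maps F̃_i of the context. Assume Σ_{i=1}^m |α_i| > 1 and that there exist i ≠ j with x_i − x_{i−1} ≠ α_i, x_j − x_{j−1} ≠ α_j and (y_i − y_{i−1} − α_i(y_m − y_0))/(x_i − x_{i−1} − α_i) ≠ (y_j − y_{j−1} − α_j(y_m − y_0))/(x_j − x_{j−1} − α_j). Then the Hausdorff dimension of graph(G) = {(x,G(x)) : x ∈ [0,1]} equals the unique s satisfying Σ_{i=1}^m |α_i|·(x_i − x_{i−1})^{s−1} = 1. -/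

import Mathlib

/-- The affine maps of the fractal interpolation IFS for the data set
`(x_i, y_i)_{i=0}^m` and vertical scaling parameters `α_i`. -/
noncomputable def fifMap (m : ℕ) (x y : Fin (m + 1) → ℝ) (α : Fin m → ℝ) (i : Fin m)
    (p : ℝ × ℝ) : ℝ × ℝ :=
  ((x i.succ - x i.castSucc) * p.1 + x i.castSucc,
    (y i.succ - y i.castSucc - α i * (y (Fin.last m) - y 0)) * p.1 + α i * p.2
      + y i.castSucc - α i * y 0)

set_option linter.unusedSectionVars false

namespace FIF

open Finset

section Entropy

variable {Ω : Type*} [Fintype Ω] {κ κ' κ'' ι : Type*}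

open Classical in
/-- The weight of the level set of `f` through `ω`. -/
noncomputable def mass (p : Ω → ℝ) (f : Ω → κ) (ω : Ω) : ℝ :=
  ∑ ω₁, if f ω₁ = f ω then p ω₁ else 0

/-- Entropy of `f` for a (not necessarily normalised) weight `p`. -/
noncomputable def ent (p : Ω → ℝ) (f : Ω → κ) : ℝ :=
  -∑ ω, p ω * Real.log (mass p f ω)

/-- Conditional entropy of `f` given `g`. -/
noncomputable def cent (p : Ω → ℝ) (f : Ω → κ) (g : Ω → κ') : ℝ :=
  ent p (fun ω => (f ω, g ω)) - ent p g

variable {p : Ω → ℝ}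

theorem mass_congr {f : Ω → κ} {g : Ω → κ'} (h : ∀ ω ω', f ω = f ω' ↔ g ω = g ω') (ω : Ω) :
    mass p f ω = mass p g ω := by
  classical
  unfold mass
  refine Finset.sum_congr rfl fun ω' _ => ?_
  simp only [h ω' ω]

theorem mass_eq_of_eq {f : Ω → κ} {ω ω' : Ω} (h : f ω = f ω') : mass p f ω = mass p f ω' := by
  unfold mass; rw [h]

theorem mass_nonneg (hp : ∀ ω, 0 ≤ p ω) (f : Ω → κ) (ω : Ω) : 0 ≤ mass p f ω := by
  classical
  exact Finset.sum_nonneg fun ω' _ => by split_ifs <;> simp [hp]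

theorem le_mass (hp : ∀ ω, 0 ≤ p ω) (f : Ω → κ) (ω : Ω) : p ω ≤ mass p f ω := by
  classical
  unfold mass
  have := Finset.single_le_sum (f := fun ω' => if f ω' = f ω then p ω' else 0)
    (fun ω' _ => by split_ifs <;> simp [hp]) (Finset.mem_univ ω)
  simpa using this

theorem mass_pos (hp : ∀ ω, 0 ≤ p ω) (f : Ω → κ) {ω : Ω} (h : 0 < p ω) : 0 < mass p f ω :=
  h.trans_le (le_mass hp f ω)

theorem mass_mono (hp : ∀ ω, 0 ≤ p ω) {f : Ω → κ} {g : Ω → κ'} {ω : Ω}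
    (h : ∀ ω', f ω' = f ω → g ω' = g ω) : mass p f ω ≤ mass p g ω := by
  classical
  unfold mass
  refine Finset.sum_le_sum fun ω' _ => ?_
  by_cases h1 : f ω' = f ω
  · simp [h1, h ω' h1]
  · simp only [h1, if_false]; split_ifs <;> simp [hp]

theorem mass_const (c : κ) (ω : Ω) : mass p (fun _ => c) ω = ∑ ω, p ω := by
  simp [mass]

theorem mass_id (ω : Ω) : mass p id ω = p ω := by
  classical
  simp [mass]

/-- Summing `p / mass` over any set of points on one level set gives at most one. -/
theorem sum_div_mass_le_one (hp : ∀ ω, 0 ≤ p ω) (f : Ω → κ) (y : κ) (s : Finset Ω)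
    (hs : ∀ ω ∈ s, f ω = y) : ∑ ω ∈ s, p ω / mass p f ω ≤ 1 := by
  classical
  rcases s.eq_empty_or_nonempty with rfl | ⟨ω₀, h₀⟩
  · simp
  have h1 : ∀ ω ∈ s, p ω / mass p f ω = p ω / mass p f ω₀ := fun ω hω => by
    rw [mass_eq_of_eq (p := p) (f := f) (ω := ω) (ω' := ω₀) ((hs ω hω).trans (hs ω₀ h₀).symm)]
  rw [Finset.sum_congr rfl h1, ← Finset.sum_div]
  refine div_le_one_of_le₀ ?_ (mass_nonneg hp f ω₀)
  unfold mass
  rw [← Finset.sum_filter]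
  refine Finset.sum_le_sum_of_subset_of_nonneg (fun ω hω => ?_) fun ω _ _ => hp ω
  simp [hs ω hω, hs ω₀ h₀]

theorem cent_eq_sum (hp : ∀ ω, 0 ≤ p ω) (f : Ω → κ) (g : Ω → κ') :
    cent p f g = ∑ ω, p ω * Real.log (mass p g ω / mass p (fun ω => (f ω, g ω)) ω) := by
  unfold cent ent
  rw [neg_sub_neg, ← Finset.sum_sub_distrib]
  refine Finset.sum_congr rfl fun ω _ => ?_
  rcases (hp ω).eq_or_lt with h | h
  · simp [← h]
  · rw [Real.log_div (mass_pos hp _ h).ne' (mass_pos hp _ h).ne']; ring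

open Classical in
/-- Core of Gibbs' inequality. -/
theorem sum_mul_mass_div_le (hp : ∀ ω, 0 ≤ p ω) (f : Ω → κ) (g : Ω → κ') (q : κ → κ' → ℝ)
    (hq : ∀ y z, 0 ≤ q y z) (c : ℝ)
    (hsum : ∀ ω, ∑ y ∈ univ.image f, q y (g ω) ≤ c) :
    ∑ ω, p ω * (mass p g ω * q (f ω) (g ω) / mass p (fun ω => (f ω, g ω)) ω) ≤
      c * ∑ ω, p ω := by
  have h1 : ∑ ω, p ω * (mass p g ω * q (f ω) (g ω) / mass p (fun ω => (f ω, g ω)) ω) =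
      ∑ ω', p ω' * ∑ ω, if g ω' = g ω then
        q (f ω) (g ω') * (p ω / mass p (fun ω => (f ω, g ω)) ω) else 0 := by
    simp_rw [Finset.mul_sum]
    rw [Finset.sum_comm]
    refine Finset.sum_congr rfl fun ω _ => ?_
    rw [show mass p g ω = ∑ ω', if g ω' = g ω then p ω' else 0 from rfl, Finset.sum_mul,
      Finset.sum_div, Finset.mul_sum]
    refine Finset.sum_congr rfl fun ω' _ => ?_
    by_cases h : g ω' = g ω
    · simp only [h, if_true]; ring
    · simp [h]
  rw [h1, Finset.mul_sum]
  refine Finset.sum_le_sum fun ω' _ => ?_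
  rw [mul_comm c]
  refine mul_le_mul_of_nonneg_left ?_ (hp ω')
  refine le_trans ?_ (hsum ω')
  rw [← Finset.sum_filter, ← Finset.sum_fiberwise_of_maps_to (t := univ.image f) (g := f)
    (fun i _ => Finset.mem_image_of_mem _ (Finset.mem_univ i))]
  refine Finset.sum_le_sum fun y _ => ?_
  have h2 : ∀ ω ∈ Finset.filter (fun ω => f ω = y) (Finset.filter (fun ω => g ω' = g ω) univ),
      q (f ω) (g ω') * (p ω / mass p (fun ω => (f ω, g ω)) ω) =
      q y (g ω') * (p ω / mass p (fun ω => (f ω, g ω)) ω) := by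
    intro ω hω
    rw [(Finset.mem_filter.1 hω).2]
  rw [Finset.sum_congr rfl h2, ← Finset.mul_sum]
  refine mul_le_of_le_one_right (hq _ _) ?_
  refine sum_div_mass_le_one hp _ (y, g ω') _ fun ω hω => ?_
  simp only [Finset.mem_filter, Finset.mem_univ, true_and] at hω
  rw [hω.2, hω.1]

open Classical in
theorem gibbs (hp : ∀ ω, 0 ≤ p ω) (f : Ω → κ) (g : Ω → κ') (q : κ → κ' → ℝ)
    (hq : ∀ y z, 0 ≤ q y z) (hqp : ∀ ω, 0 < p ω → 0 < q (f ω) (g ω))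
    (hsum : ∀ ω, ∑ y ∈ univ.image f, q y (g ω) ≤ 1) :
    cent p f g ≤ -∑ ω, p ω * Real.log (q (f ω) (g ω)) := by
  rw [cent_eq_sum hp]
  have key := sum_mul_mass_div_le hp f g q hq 1 hsum
  have h : ∀ ω, p ω * Real.log (mass p g ω / mass p (fun ω => (f ω, g ω)) ω) ≤
      p ω * (mass p g ω * q (f ω) (g ω) / mass p (fun ω => (f ω, g ω)) ω) - p ω
      - p ω * Real.log (q (f ω) (g ω)) := by
    intro ω
    rcases (hp ω).eq_or_lt with h | h
    · simp [← h]
    have h1 := mass_pos hp g h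
    have h2 := mass_pos hp (fun ω => (f ω, g ω)) h
    have h3 := hqp ω h
    have h4 := Real.log_le_sub_one_of_pos (x := mass p g ω * q (f ω) (g ω) /
      mass p (fun ω => (f ω, g ω)) ω) (by positivity)
    rw [mul_div_right_comm, Real.log_mul (by positivity) (by positivity)] at h4
    rw [mul_div_right_comm]
    nlinarith [mul_le_mul_of_nonneg_left h4 h.le]
  have := Finset.sum_le_sum fun ω (_ : ω ∈ univ) => h ω
  simp only [Finset.sum_sub_distrib] at this
  linarith

theorem ent_congr {f : Ω → κ} {g : Ω → κ'} (h : ∀ ω ω', f ω = f ω' ↔ g ω = g ω') :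
    ent p f = ent p g := by
  unfold ent
  simp_rw [mass_congr h]

theorem cent_congr {κ₁ κ₂ : Type*} {f : Ω → κ} {g : Ω → κ'} {f' : Ω → κ₁} {g' : Ω → κ₂}
    (h : ∀ ω ω', g ω = g ω' ↔ g' ω = g' ω')
    (h' : ∀ ω ω', g ω = g ω' → (f ω = f ω' ↔ f' ω = f' ω')) :
    cent p f g = cent p f' g' := by
  unfold cent
  congr 1
  · refine ent_congr fun ω ω' => ?_
    simp only [Prod.mk.injEq]
    constructor
    · rintro ⟨h1, h2⟩; exact ⟨(h' _ _ h2).1 h1, (h _ _).1 h2⟩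
    · rintro ⟨h1, h2⟩; exact ⟨(h' _ _ ((h _ _).2 h2)).2 h1, (h _ _).2 h2⟩
  · exact ent_congr h

theorem ent_mono (hp : ∀ ω, 0 ≤ p ω) {f : Ω → κ} {g : Ω → κ'}
    (h : ∀ ω ω', f ω = f ω' → g ω = g ω') : ent p g ≤ ent p f := by
  unfold ent
  refine neg_le_neg (Finset.sum_le_sum fun ω _ => ?_)
  rcases (hp ω).eq_or_lt with h0 | h0
  · simp [← h0]
  · exact mul_le_mul_of_nonneg_left
      (Real.log_le_log (mass_pos hp _ h0) (mass_mono hp fun ω' => h ω' ω)) h0.le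

theorem cent_nonneg (hp : ∀ ω, 0 ≤ p ω) (f : Ω → κ) (g : Ω → κ') : 0 ≤ cent p f g :=
  sub_nonneg.2 (ent_mono hp fun _ _ h => (Prod.mk.inj h).2)

/-- Submodularity, in the form: conditioning on more reduces entropy. -/
theorem cent_pair_le (hp : ∀ ω, 0 ≤ p ω) (f : Ω → κ) (g : Ω → κ') (h : Ω → κ'') :
    cent p f (fun ω => (g ω, h ω)) ≤ cent p f g := by
  classical
  set q : κ → κ' → ℝ := fun y z =>
    (∑ ω, if f ω = y ∧ g ω = z then p ω else 0) / (∑ ω, if g ω = z then p ω else 0) with hqdef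
  have hq : ∀ ω, q (f ω) (g ω) = mass p (fun ω => (f ω, g ω)) ω / mass p g ω := by
    intro ω
    simp only [hqdef, mass, Prod.mk.injEq]
  have hq0 : ∀ y z, 0 ≤ q y z := fun y z => div_nonneg
    (Finset.sum_nonneg fun ω _ => by split_ifs <;> simp [hp])
    (Finset.sum_nonneg fun ω _ => by split_ifs <;> simp [hp])
  have := gibbs hp f (fun ω => (g ω, h ω)) (fun y z => q y z.1) (fun y z => hq0 _ _)
    (fun ω hω => by
      simp only [hq]
      exact div_pos (mass_pos hp _ hω) (mass_pos hp _ hω))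
    (fun ω => by
      simp only [hqdef]
      rw [← Finset.sum_div]
      refine div_le_one_of_le₀ ?_
        (Finset.sum_nonneg fun ω _ => by split_ifs <;> simp [hp])
      rw [Finset.sum_comm]
      refine Finset.sum_le_sum fun ω' _ => ?_
      by_cases hg : g ω' = g ω
      · simp only [hg, and_true, if_true]
        rw [Finset.sum_ite_eq]
        split_ifs <;> simp [hp]
      · simp [hg])
  refine this.trans (le_of_eq ?_)
  rw [cent_eq_sum hp, ← Finset.sum_neg_distrib]
  refine Finset.sum_congr rfl fun ω _ => ?_
  simp only [hq]
  rw [← inv_div, Real.log_inv]; ring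

theorem cent_anti (hp : ∀ ω, 0 ≤ p ω) (f : Ω → κ) {g : Ω → κ'} {g' : Ω → κ''}
    (h : ∀ ω ω', g' ω = g' ω' → g ω = g ω') : cent p f g' ≤ cent p f g := by
  refine le_trans (le_of_eq ?_) (cent_pair_le hp f g g')
  refine cent_congr (fun ω ω' => ?_) fun _ _ _ => Iff.rfl
  simp only [Prod.mk.injEq]
  exact ⟨fun h' => ⟨h _ _ h', h'⟩, fun h' => h'.2⟩

theorem cent_mono (hp : ∀ ω, 0 ≤ p ω) {f : Ω → κ} {f' : Ω → ι} {g : Ω → κ'}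
    (h : ∀ ω ω', g ω = g ω' → f' ω = f' ω' → f ω = f ω') : cent p f g ≤ cent p f' g := by
  unfold cent
  refine sub_le_sub_right (ent_mono hp fun ω ω' h' => ?_) _
  simp only [Prod.mk.injEq] at h' ⊢
  exact ⟨h _ _ h'.2 h'.1, h'.2⟩

theorem cent_chain (f : Ω → κ) (h : Ω → κ'') (g : Ω → κ') :
    cent p (fun ω => (f ω, h ω)) g = cent p h g + cent p f (fun ω => (h ω, g ω)) := by
  unfold cent
  have : ent p (fun ω => ((f ω, h ω), g ω)) = ent p (fun ω => (f ω, (h ω, g ω))) :=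
    ent_congr fun ω ω' => by simp [and_assoc]
  rw [this]; ring

theorem cent_eq_zero {f : Ω → κ} {g : Ω → κ'}
    (h : ∀ ω ω', g ω = g ω' → f ω = f ω') : cent p f g = 0 := by
  unfold cent
  rw [ent_congr (f := fun ω => (f ω, g ω)) (g := g)]
  · ring
  · intro ω ω'
    simp only [Prod.mk.injEq]
    exact ⟨fun hf => hf.2, fun hf => ⟨h _ _ hf, hf⟩⟩

/-- If `f` takes at most `k` values on each level set of `g` then its conditional entropy is at
most `log k`.  Here the values are listed by `s`. -/
theorem cent_le_log (hp : ∀ ω, 0 ≤ p ω) (f : Ω → κ) (g : Ω → κ') (s : κ' → Finset κ)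
    (hs : ∀ ω, f ω ∈ s (g ω)) {k : ℝ} (hk : 0 < k) (hcard : ∀ z, ((s z).card : ℝ) ≤ k) :
    cent p f g ≤ (∑ ω, p ω) * Real.log k := by
  classical
  have := gibbs hp f g (fun y z => if y ∈ s z then 1 / k else 0)
    (fun y z => by split_ifs <;> positivity)
    (fun ω _ => by simp [hs ω, hk])
    (fun ω => by
      rw [← Finset.sum_filter, Finset.sum_const, nsmul_eq_mul, mul_one_div, div_le_one hk]
      refine le_trans ?_ (hcard (g ω))
      exact_mod_cast Finset.card_le_card fun y hy => (Finset.mem_filter.1 hy).2)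
  refine this.trans (le_of_eq ?_)
  simp only [hs, if_true, one_div, Real.log_inv]
  rw [Finset.sum_mul, ← Finset.sum_neg_distrib]
  exact Finset.sum_congr rfl fun ω _ => by ring

theorem cent_le_log_card [Fintype κ] [Nonempty κ] (hp : ∀ ω, 0 ≤ p ω) (f : Ω → κ)
    (g : Ω → κ') : cent p f g ≤ (∑ ω, p ω) * Real.log (Fintype.card κ) := by
  refine cent_le_log hp f g (fun _ => univ) (by simp) (by exact_mod_cast Fintype.card_pos) ?_
  simp

theorem card_Icc_of_diam (s : Finset ℤ) (D : ℕ) (h : ∀ a ∈ s, ∀ b ∈ s, a ≤ b + D) :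
    s.card ≤ D + 1 := by
  rcases s.eq_empty_or_nonempty with rfl | hs
  · simp
  have : s ⊆ Finset.Icc (s.min' hs) (s.min' hs + D) := fun a ha => by
    rw [Finset.mem_Icc]
    exact ⟨Finset.min'_le _ _ ha, h a ha _ (Finset.min'_mem _ _)⟩
  refine (Finset.card_le_card this).trans ?_
  rw [Int.card_Icc]; omega

/-- An integer valued function of oscillation at most `D` on level sets of `g`. -/
theorem cent_le_of_diam (hp : ∀ ω, 0 ≤ p ω) (f : Ω → ℤ) (g : Ω → κ') (D : ℕ)
    (h : ∀ ω ω', g ω = g ω' → f ω ≤ f ω' + D) :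
    cent p f g ≤ (∑ ω, p ω) * Real.log (D + 1) := by
  classical
  refine cent_le_log hp f g (fun z => (univ.filter fun ω => g ω = z).image f)
    (fun ω => ?_) (by positivity) (fun z => ?_)
  · exact Finset.mem_image.2 ⟨ω, by simp, rfl⟩
  · have := card_Icc_of_diam ((univ.filter fun ω => g ω = z).image f) D (by
      intro a ha b hb
      obtain ⟨ω, hω, rfl⟩ := Finset.mem_image.1 ha
      obtain ⟨ω', hω', rfl⟩ := Finset.mem_image.1 hb
      simp only [Finset.mem_filter, Finset.mem_univ, true_and] at hω hω'
      exact h _ _ (hω.trans hω'.symm))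
    exact_mod_cast this

theorem cent_le_add (hp : ∀ ω, 0 ≤ p ω) (f : Ω → κ) (f' : Ω → ι) (g : Ω → κ') :
    cent p f g ≤ cent p f' g + cent p f (fun ω => (f' ω, g ω)) := by
  rw [← cent_chain]
  exact cent_mono hp fun ω ω' _ h => (Prod.mk.inj h).1

/-- If integer-valued `f` is determined by `f'` up to `D` given `g`. -/
theorem cent_le_add_log (hp : ∀ ω, 0 ≤ p ω) (f : Ω → ℤ) (f' : Ω → ι) (g : Ω → κ') (D : ℕ)
    (h : ∀ ω ω', g ω = g ω' → f' ω = f' ω' → f ω ≤ f ω' + D) :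
    cent p f g ≤ cent p f' g + (∑ ω, p ω) * Real.log (D + 1) := by
  refine (cent_le_add hp f f' g).trans (add_le_add_right ?_ _)
  refine cent_le_of_diam hp f _ D fun ω ω' hω => ?_
  simp only [Prod.mk.injEq] at hω
  exact h _ _ hω.2 hω.1

/-- Conditioning on an additional variable `h` lowers entropy at most by the entropy of `h`. -/
theorem cent_sub_le (hp : ∀ ω, 0 ≤ p ω) (f : Ω → κ) (g : Ω → κ') (h : Ω → κ'') :
    cent p f g - cent p h g ≤ cent p f (fun ω => (h ω, g ω)) := by
  have := cent_le_add hp f h g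
  linarith

/-- Submodularity. -/
theorem ent_submod (hp : ∀ ω, 0 ≤ p ω) (f : Ω → κ) (g : Ω → κ') (h : Ω → κ'') :
    cent p (fun ω => (f ω, g ω)) h ≤ cent p f h + cent p g h := by
  rw [cent_chain]
  have := cent_anti hp f (g := h) (g' := fun ω => (g ω, h ω)) fun ω ω' h => (Prod.mk.inj h).2
  linarith

end Entropy

section Entropy2

variable {Ω Ω' : Type*} [Fintype Ω] [Fintype Ω'] {κ κ' κ'' ι : Type*} {p : Ω → ℝ}

open Classical in
/-- Pushing a weight forward does not change the entropy of functions that factor. -/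
theorem mass_map (p' : Ω' → ℝ) (π : Ω' → Ω) (hπ : ∀ ω, p ω = ∑ ω', if π ω' = ω then p' ω' else 0)
    (f : Ω → κ) (ω' : Ω') : mass p f (π ω') = mass p' (f ∘ π) ω' := by
  unfold mass
  simp_rw [hπ, ← Finset.sum_filter]
  rw [Finset.sum_comm' (t' := univ.filter fun τ => f (π τ) = f (π ω')) (s' := fun τ => {π τ})]
  · simp
  · intro x y; simp only [mem_filter, mem_univ, true_and, mem_singleton]
    constructor
    · rintro ⟨h1, h2⟩; exact ⟨h2.symm, h2 ▸ h1⟩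
    · rintro ⟨h1, h2⟩; exact ⟨h1 ▸ h2, h1.symm⟩

open Classical in
theorem sum_map (p' : Ω' → ℝ) (π : Ω' → Ω) (hπ : ∀ ω, p ω = ∑ ω', if π ω' = ω then p' ω' else 0)
    (φ : Ω → ℝ) : ∑ ω, p ω * φ ω = ∑ ω', p' ω' * φ (π ω') := by
  simp_rw [hπ, Finset.sum_mul]
  rw [Finset.sum_comm]
  refine Finset.sum_congr rfl fun ω' _ => ?_
  simp only [ite_mul, zero_mul, Finset.sum_ite_eq, Finset.mem_univ, if_true]

open Classical in
theorem ent_map (p' : Ω' → ℝ) (π : Ω' → Ω) (hπ : ∀ ω, p ω = ∑ ω', if π ω' = ω then p' ω' else 0)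
    (f : Ω → κ) : ent p f = ent p' (fun ω' => f (π ω')) := by
  unfold ent
  rw [sum_map p' π hπ]
  simp_rw [mass_map p' π hπ]
  rfl

open Classical in
theorem cent_map (p' : Ω' → ℝ) (π : Ω' → Ω) (hπ : ∀ ω, p ω = ∑ ω', if π ω' = ω then p' ω' else 0)
    (f : Ω → κ) (g : Ω → κ') :
    cent p f g = cent p' (fun ω' => f (π ω')) (fun ω' => g (π ω')) := by
  unfold cent
  rw [ent_map p' π hπ, ent_map p' π hπ]

theorem cent_equiv (e : Ω' ≃ Ω) (f : Ω → κ) (g : Ω → κ') :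
    cent p f g = cent (fun ω' => p (e ω')) (fun ω' => f (e ω')) (fun ω' => g (e ω')) := by
  classical
  refine cent_map _ e (fun ω => ?_) f g
  rw [Finset.sum_eq_single (e.symm ω)]
  · simp
  · intro b _ hb; rw [if_neg]; rintro rfl; simp at hb
  · simp

/-- Functions that agree wherever the weight is positive have the same entropy. -/
theorem ent_congr_ae (hp : ∀ ω, 0 ≤ p ω) {f : Ω → κ} {g : Ω → κ'}
    (h : ∀ ω ω', 0 < p ω → 0 < p ω' → (f ω = f ω' ↔ g ω = g ω')) : ent p f = ent p g := by
  classical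
  unfold ent
  congr 1
  refine Finset.sum_congr rfl fun ω _ => ?_
  rcases (hp ω).eq_or_lt with h0 | h0
  · simp [← h0]
  congr 2
  unfold mass
  refine Finset.sum_congr rfl fun ω' _ => ?_
  rcases (hp ω').eq_or_lt with h1 | h1
  · simp [← h1]
  · simp only [h ω' ω h1 h0]

theorem cent_congr_ae {κ₁ κ₂ : Type*} (hp : ∀ ω, 0 ≤ p ω) {f : Ω → κ} {g : Ω → κ'}
    {f' : Ω → κ₁} {g' : Ω → κ₂}
    (h : ∀ ω ω', 0 < p ω → 0 < p ω' → (g ω = g ω' ↔ g' ω = g' ω'))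
    (h' : ∀ ω ω', 0 < p ω → 0 < p ω' → (f ω = f ω' ↔ f' ω = f' ω')) :
    cent p f g = cent p f' g' := by
  unfold cent
  congr 1
  · refine ent_congr_ae hp fun ω ω' h1 h2 => ?_
    simp only [Prod.mk.injEq, h _ _ h1 h2, h' _ _ h1 h2]
  · exact ent_congr_ae hp h

theorem mass_skew (q : Ω → Ω' → ℝ) (F : Ω × Ω' → κ) (ω : Ω) (τ : Ω') :
    mass (fun x : Ω × Ω' => p x.1 * q x.1 x.2) (fun x => (F x, x.1)) (ω, τ) =
      p ω * mass (q ω) (fun τ => F (ω, τ)) τ := by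
  classical
  unfold mass
  rw [Fintype.sum_prod_type, Finset.sum_eq_single ω]
  · simp only [Prod.mk.injEq, and_true, Finset.mul_sum, mul_ite, mul_zero]
  · intro ω' _ hne
    simp [hne]
  · simp

theorem ent_skew (hp : ∀ ω, 0 ≤ p ω) {q : Ω → Ω' → ℝ} (hq : ∀ ω τ, 0 ≤ q ω τ)
    (F : Ω × Ω' → κ) :
    ent (fun x : Ω × Ω' => p x.1 * q x.1 x.2) (fun x => (F x, x.1)) =
      ∑ ω, p ω * ent (q ω) (fun τ => F (ω, τ)) - ∑ ω, p ω * Real.log (p ω) * ∑ τ, q ω τ := by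
  unfold ent
  rw [Fintype.sum_prod_type, ← Finset.sum_neg_distrib, ← Finset.sum_sub_distrib]
  refine Finset.sum_congr rfl fun ω _ => ?_
  rw [mul_neg, Finset.mul_sum, ← neg_add', Finset.mul_sum, ← Finset.sum_add_distrib]
  congr 1
  refine Finset.sum_congr rfl fun τ _ => ?_
  rw [mass_skew]
  dsimp only
  rcases (hp ω).eq_or_lt with h0 | h0
  · simp [← h0]
  rcases (hq ω τ).eq_or_lt with h1 | h1
  · simp [← h1]
  rw [Real.log_mul h0.ne' (mass_pos (hq ω) _ h1).ne']; ring

/-- Entropy on a skew product, conditionally on the base. -/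
theorem cent_skew (hp : ∀ ω, 0 ≤ p ω) {q : Ω → Ω' → ℝ} (hq : ∀ ω τ, 0 ≤ q ω τ)
    (f : Ω × Ω' → κ) (g : Ω × Ω' → κ') :
    cent (fun x : Ω × Ω' => p x.1 * q x.1 x.2) f (fun x => (g x, x.1)) =
      ∑ ω, p ω * cent (q ω) (fun τ => f (ω, τ)) (fun τ => g (ω, τ)) := by
  unfold cent
  have h := ent_skew hp hq (fun x => (f x, g x))
  have h1 : ent (fun x : Ω × Ω' => p x.1 * q x.1 x.2) (fun x => (f x, (g x, x.1))) =
      ent (fun x : Ω × Ω' => p x.1 * q x.1 x.2) (fun x => ((f x, g x), x.1)) :=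
    ent_congr fun ω ω' => by simp [and_assoc]
  rw [h1, h, ent_skew hp hq g]
  simp only [mul_sub, Finset.sum_sub_distrib]
  ring

/-- Restriction of a weight to an event. -/
noncomputable def restr (p : Ω → ℝ) (E : Set Ω) : Ω → ℝ := E.indicator p

theorem restr_nonneg (hp : ∀ ω, 0 ≤ p ω) (E : Set Ω) (ω : Ω) : 0 ≤ restr p E ω :=
  Set.indicator_nonneg (fun ω _ => hp ω) ω

theorem restr_le (hp : ∀ ω, 0 ≤ p ω) (E : Set Ω) (ω : Ω) : restr p E ω ≤ p ω :=
  Set.indicator_le_self' (fun ω _ => hp ω) ω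

theorem restr_add_compl (E : Set Ω) (ω : Ω) : restr p E ω + restr p Eᶜ ω = p ω := by
  classical
  unfold restr; by_cases h : ω ∈ E <;> simp [h]

theorem mass_restr_le (hp : ∀ ω, 0 ≤ p ω) (E : Set Ω) (f : Ω → κ) (ω : Ω) :
    mass (restr p E) f ω ≤ mass p f ω := by
  classical
  unfold mass
  refine Finset.sum_le_sum fun ω' _ => ?_
  split_ifs
  · exact restr_le hp E ω'
  · exact le_rfl

theorem mass_restr (E : Set Ω) (f : Ω → κ) (hE : ∀ ω ω', f ω = f ω' → (ω ∈ E ↔ ω' ∈ E)) {ω : Ω}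
    (hω : ω ∈ E) : mass (restr p E) f ω = mass p f ω := by
  classical
  unfold mass restr
  refine Finset.sum_congr rfl fun ω' _ => ?_
  split_ifs with h
  · rw [Set.indicator_of_mem ((hE _ _ h).2 hω)]
  · rfl

theorem ent_split (E : Set Ω) (f : Ω → κ) (hE : ∀ ω ω', f ω = f ω' → (ω ∈ E ↔ ω' ∈ E)) :
    ent p f = ent (restr p E) f + ent (restr p Eᶜ) f := by
  classical
  unfold ent
  rw [← neg_add, ← Finset.sum_add_distrib]
  congr 1
  refine Finset.sum_congr rfl fun ω _ => ?_
  by_cases h : ω ∈ E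
  · rw [mass_restr E f hE h]; simp [restr, h]
  · rw [mass_restr Eᶜ f (fun ω ω' h => by simpa using not_congr (hE ω ω' h)) h]; simp [restr, h]

theorem cent_split (E : Set Ω) (f : Ω → κ) (g : Ω → κ')
    (hE : ∀ ω ω', g ω = g ω' → (ω ∈ E ↔ ω' ∈ E)) :
    cent p f g = cent (restr p E) f g + cent (restr p Eᶜ) f g := by
  unfold cent
  rw [ent_split E _ fun ω ω' h => hE ω ω' (Prod.mk.inj h).2, ent_split E g hE]
  ring

/-- The conditional weight of `p` given the level set of `Z` through `ω₀`. -/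
noncomputable def condw (p : Ω → ℝ) (Z : Ω → κ) (ω₀ ω : Ω) : ℝ := by
  classical exact if Z ω = Z ω₀ then p ω / mass p Z ω₀ else 0

variable {Z : Ω → κ}

theorem condw_nonneg (hp : ∀ ω, 0 ≤ p ω) (ω₀ ω : Ω) : 0 ≤ condw p Z ω₀ ω := by
  unfold condw; split_ifs
  · exact div_nonneg (hp _) (mass_nonneg hp _ _)
  · exact le_rfl

theorem condw_pos_imp {ω₀ ω : Ω} (h : 0 < condw p Z ω₀ ω) : Z ω = Z ω₀ := by
  unfold condw at h; split_ifs at h with h1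
  · exact h1
  · exact absurd h (lt_irrefl _)

theorem sum_condw (hp : ∀ ω, 0 ≤ p ω) {ω₀ : Ω} (h : 0 < p ω₀) : ∑ ω, condw p Z ω₀ ω = 1 := by
  classical
  have := mass_pos hp Z h
  unfold condw
  rw [← Finset.sum_filter, ← Finset.sum_div, Finset.sum_filter]
  exact div_self this.ne'

theorem sum_condw_mul (hp : ∀ ω, 0 ≤ p ω) (φ : Ω → ℝ) :
    ∑ ω₀, p ω₀ * ∑ ω, condw p Z ω₀ ω * φ ω = ∑ ω, p ω * φ ω := by
  classical
  simp_rw [Finset.mul_sum]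
  rw [Finset.sum_comm]
  refine Finset.sum_congr rfl fun ω _ => ?_
  rcases (hp ω).eq_or_lt with h0 | h0
  · simp [condw, ← h0]
  have hm := mass_pos hp Z h0
  have : ∀ ω₀, p ω₀ * (condw p Z ω₀ ω * φ ω) =
      (if Z ω₀ = Z ω then p ω₀ else 0) * (p ω * φ ω / mass p Z ω) := by
    intro ω₀
    unfold condw
    by_cases h : Z ω₀ = Z ω
    · rw [if_pos h.symm, if_pos h, mass_eq_of_eq (p := p) h]; ring
    · rw [if_neg (Ne.symm h), if_neg h]; ring
  rw [Finset.sum_congr rfl fun ω₀ _ => this ω₀, ← Finset.sum_mul]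
  change mass p Z ω * _ = _
  field_simp

theorem mass_condw {ω₀ ω : Ω} (h : Z ω = Z ω₀) (f : Ω → ι) :
    mass (condw p Z ω₀) f ω = mass p (fun ω => (f ω, Z ω)) ω / mass p Z ω₀ := by
  classical
  unfold condw
  rw [mass, show mass p (fun ω => (f ω, Z ω)) ω =
    ∑ ω', if (f ω', Z ω') = (f ω, Z ω) then p ω' else 0 by unfold mass; congr!, Finset.sum_div]
  refine Finset.sum_congr rfl fun ω' _ => ?_
  rw [h]
  by_cases h1 : f ω' = f ω <;> by_cases h2 : Z ω' = Z ω₀ <;> simp [h1, h2]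

/-- Conditional entropy as an average over conditional weights. -/
theorem cent_eq_sum_condw (hp : ∀ ω, 0 ≤ p ω) (f : Ω → κ') (g : Ω → κ'') :
    cent p f (fun ω => (g ω, Z ω)) = ∑ ω₀, p ω₀ * cent (condw p Z ω₀) f g := by
  rw [cent_eq_sum hp, ← sum_condw_mul (Z := Z) hp]
  refine Finset.sum_congr rfl fun ω₀ _ => ?_
  congr 1
  rw [cent_eq_sum (condw_nonneg hp ω₀)]
  refine Finset.sum_congr rfl fun ω _ => ?_
  rcases (condw_nonneg (Z := Z) hp ω₀ ω).eq_or_lt with h0 | h0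
  · simp [← h0]
  have hZ := condw_pos_imp h0
  rw [mass_condw hZ, mass_condw hZ]
  have hp0 : 0 < p ω := by
    rcases (hp ω).eq_or_lt with h1 | h1
    · simp [condw, ← h1] at h0
    · exact h1
  have hm : 0 < mass p Z ω₀ := by rw [← mass_eq_of_eq hZ]; exact mass_pos hp Z hp0
  congr 2
  rw [div_div_div_cancel_right₀ hm.ne']
  congr 1
  exact mass_congr (fun ω ω' => by simp [and_assoc]) ω

theorem ent_eq_sum_condw (hp : ∀ ω, 0 ≤ p ω) (f : Ω → κ') :
    cent p f Z = ∑ ω₀, p ω₀ * cent (condw p Z ω₀) f (fun _ => ()) := by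
  rw [← cent_eq_sum_condw hp]
  exact cent_congr (fun ω ω' => by simp) fun _ _ _ => Iff.rfl

/-- A pointwise upper bound on level masses gives a lower bound on entropy. -/
theorem cent_unit (h1 : ∑ ω, p ω = 1) (f : Ω → κ) :
    cent p f (fun _ => ()) = ent p f := by
  unfold cent
  have : ent p (fun _ : Ω => ()) = 0 := by
    unfold ent; simp [mass_const, h1]
  rw [this, sub_zero]
  exact ent_congr fun ω ω' => by simp

end Entropy2

section Product

variable {Ω : Type*} [Fintype Ω] {κ : Type*} {ν : Ω → ℝ}

/-- The product weight. -/
noncomputable def prodw (ν : Ω → ℝ) (m : ℕ) (τ : Fin m → Ω) : ℝ := ∏ i, ν (τ i)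

theorem prodw_nonneg (hν : ∀ ω, 0 ≤ ν ω) {m : ℕ} (τ : Fin m → Ω) : 0 ≤ prodw ν m τ :=
  Finset.prod_nonneg fun _ _ => hν _

theorem sum_prodw_prod {m : ℕ} (φ : Fin m → Ω → ℝ) :
    ∑ τ : Fin m → Ω, prodw ν m τ * ∏ i, φ i (τ i) = ∏ i, ∑ ω, ν ω * φ i ω := by
  classical
  rw [Finset.prod_univ_sum, Fintype.piFinset_univ]
  refine Finset.sum_congr rfl fun τ _ => ?_
  rw [prodw, Finset.prod_mul_distrib]

theorem sum_prodw (h1 : ∑ ω, ν ω = 1) (m : ℕ) : ∑ τ, prodw ν m τ = 1 := by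
  have := sum_prodw_prod (ν := ν) (m := m) (fun _ _ => 1)
  simpa [h1] using this

theorem sum_prodw_coord (h1 : ∑ ω, ν ω = 1) {m : ℕ} (i : Fin m) (φ : Ω → ℝ) :
    ∑ τ, prodw ν m τ * φ (τ i) = ∑ ω, ν ω * φ ω := by
  classical
  have := sum_prodw_prod (ν := ν) (m := m) (fun j ω => if j = i then φ ω else 1)
  simp only [Finset.prod_ite_eq', Finset.mem_univ, if_true] at this
  rw [this, Finset.prod_eq_single i]
  · simp
  · intro j _ hj; simp [hj, h1]
  · simp

theorem sum_prodw_coord₂ (h1 : ∑ ω, ν ω = 1) {m : ℕ} {i j : Fin m} (hij : i ≠ j) (φ ψ : Ω → ℝ) :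
    ∑ τ, prodw ν m τ * (φ (τ i) * ψ (τ j)) = (∑ ω, ν ω * φ ω) * ∑ ω, ν ω * ψ ω := by
  classical
  have := sum_prodw_prod (ν := ν) (m := m)
    (fun k ω => (if k = i then φ ω else 1) * (if k = j then ψ ω else 1))
  simp only [Finset.prod_mul_distrib, Finset.prod_ite_eq', Finset.mem_univ, if_true] at this
  rw [this, ← Finset.prod_subset (Finset.subset_univ {i, j}), Finset.prod_pair hij]
  · simp [hij, hij.symm]
  · intro k _ hk
    simp only [Finset.mem_insert, Finset.mem_singleton, not_or] at hk
    simp [hk.1, hk.2, h1]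

theorem mass_prodw {m : ℕ} (f : Ω → κ) (τ : Fin m → Ω) :
    mass (prodw ν m) (fun τ i => f (τ i)) τ = ∏ i, mass ν f (τ i) := by
  classical
  unfold mass
  rw [Finset.prod_univ_sum, Fintype.piFinset_univ]
  refine Finset.sum_congr rfl fun τ' _ => ?_
  rw [funext_iff]
  split_ifs with h
  · exact Finset.prod_congr rfl fun i _ => by rw [if_pos (h i)]
  · obtain ⟨i, hi⟩ := not_forall.1 h
    exact (Finset.prod_eq_zero (Finset.mem_univ i) (if_neg hi)).symm

theorem ent_prodw (hν : ∀ ω, 0 ≤ ν ω) (h1 : ∑ ω, ν ω = 1) (m : ℕ) (f : Ω → κ) :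
    ent (prodw ν m) (fun τ i => f (τ i)) = m * ent ν f := by
  have : ent (prodw ν m) (fun τ i => f (τ i)) =
      ∑ i : Fin m, -∑ τ, prodw ν m τ * Real.log (mass ν f (τ i)) := by
    unfold ent
    rw [Finset.sum_neg_distrib, Finset.sum_comm]
    congr 1
    refine Finset.sum_congr rfl fun τ _ => ?_
    rw [mass_prodw, ← Finset.mul_sum]
    rcases (prodw_nonneg hν τ).eq_or_lt with h0 | h0
    · simp [← h0]
    rw [Real.log_prod]
    intro i _
    refine (mass_pos hν f ?_).ne'
    exact lt_of_le_of_ne (hν _) fun h => h0.ne' (Finset.prod_eq_zero (Finset.mem_univ i) h.symm)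
  rw [this, Finset.sum_congr rfl fun i _ => by
    rw [sum_prodw_coord h1 i (fun ω => Real.log (mass ν f ω))]]
  simp [ent]

end Product

section Star

variable {Ω : Type*} [Fintype Ω] {κ κ' κ'' ι : Type*} {p : Ω → ℝ} {Z : Ω → κ} {M : ℕ}

/-- A point `ω` together with `M` points sampled independently from the conditional weight of `p`
given `Z = Z ω`. -/
noncomputable def starw (p : Ω → ℝ) (Z : Ω → κ) (M : ℕ) (x : Ω × (Fin M → Ω)) : ℝ :=
  p x.1 * prodw (condw p Z x.1) M x.2

theorem starw_nonneg (hp : ∀ ω, 0 ≤ p ω) (x : Ω × (Fin M → Ω)) : 0 ≤ starw p Z M x :=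
  mul_nonneg (hp _) (prodw_nonneg (condw_nonneg hp _) _)

theorem sum_starw_mul (φ : Ω → (Fin M → Ω) → ℝ) :
    ∑ x, starw p Z M x * φ x.1 x.2 = ∑ ω, p ω * ∑ τ, prodw (condw p Z ω) M τ * φ ω τ := by
  rw [Fintype.sum_prod_type]
  refine Finset.sum_congr rfl fun ω _ => ?_
  rw [Finset.mul_sum]
  exact Finset.sum_congr rfl fun τ _ => by simp only [starw]; ring

theorem mul_congr_of_pos {c a b : ℝ} (hc : 0 ≤ c) (h : 0 < c → a = b) : c * a = c * b := by
  rcases hc.eq_or_lt with h0 | h0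
  · simp [← h0]
  · rw [h h0]

theorem sum_starw_fst (hp : ∀ ω, 0 ≤ p ω) (φ : Ω → ℝ) :
    ∑ x, starw p Z M x * φ x.1 = ∑ ω, p ω * φ ω := by
  rw [sum_starw_mul (fun ω _ => φ ω)]
  refine Finset.sum_congr rfl fun ω _ => mul_congr_of_pos (hp ω) fun hω => ?_
  rw [← Finset.sum_mul, sum_prodw (sum_condw hp hω), one_mul]

theorem sum_starw_coord (hp : ∀ ω, 0 ≤ p ω) (i : Fin M) (φ : Ω → ℝ) :
    ∑ x, starw p Z M x * φ (x.2 i) = ∑ ω, p ω * φ ω := by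
  rw [sum_starw_mul (fun _ τ => φ (τ i))]
  refine Eq.trans ?_ (sum_condw_mul (Z := Z) hp φ)
  refine Finset.sum_congr rfl fun ω _ => mul_congr_of_pos (hp ω) fun hω => ?_
  rw [sum_prodw_coord (sum_condw hp hω)]

theorem starw_pos_imp (hp : ∀ ω, 0 ≤ p ω) {x : Ω × (Fin M → Ω)} (h : 0 < starw p Z M x)
    (i : Fin M) : Z (x.2 i) = Z x.1 := by
  have h1 : condw p Z x.1 (x.2 i) ≠ 0 := fun h0 => by
    rw [starw, prodw, Finset.prod_eq_zero (Finset.mem_univ i) h0, mul_zero] at h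
    exact lt_irrefl _ h
  exact condw_pos_imp (lt_of_le_of_ne (condw_nonneg hp _ _) h1.symm)

theorem cent_starw_fst (hp : ∀ ω, 0 ≤ p ω) (f : Ω → κ') (g : Ω → κ'') :
    cent (starw p Z M) (fun x => f x.1) (fun x => g x.1) = cent p f g := by
  classical
  symm
  refine cent_map _ (fun x : Ω × (Fin M → Ω) => x.1) (fun ω => ?_) f g
  have := sum_starw_fst (Z := Z) (M := M) hp (fun ω' => if ω' = ω then 1 else 0)
  simpa using this.symm

theorem cent_starw_coord (hp : ∀ ω, 0 ≤ p ω) (i : Fin M) (f : Ω → κ') (g : Ω → κ'') :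
    cent (starw p Z M) (fun x => f (x.2 i)) (fun x => g (x.2 i)) = cent p f g := by
  classical
  symm
  refine cent_map _ (fun x : Ω × (Fin M → Ω) => x.2 i) (fun ω => ?_) f g
  have := sum_starw_coord (Z := Z) (M := M) hp i (fun ω' => if ω' = ω then 1 else 0)
  simpa using this.symm

theorem cent_starw_given (hp : ∀ ω, 0 ≤ p ω) (f : (Fin M → Ω) → κ') (g : (Fin M → Ω) → κ'') :
    cent (starw p Z M) (fun x => f x.2) (fun x => (g x.2, x.1)) =
      ∑ ω, p ω * cent (prodw (condw p Z ω) M) f g :=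
  cent_skew hp (q := fun ω => prodw (condw p Z ω) M)
    (fun ω τ => prodw_nonneg (condw_nonneg hp ω) τ) (fun x => f x.2) (fun x => g x.2)

theorem cent_starw_given' (hp : ∀ ω, 0 ≤ p ω) (f : (Fin M → Ω) → κ') :
    cent (starw p Z M) (fun x => f x.2) (fun x => x.1) =
      ∑ ω, p ω * ent (prodw (condw p Z ω) M) f := by
  rw [cent_congr (f' := fun x => f x.2) (g' := fun x : Ω × (Fin M → Ω) => ((), x.1))
    (fun ω ω' => by simp) fun _ _ _ => Iff.rfl, cent_starw_given hp f (fun _ => ())]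
  refine Finset.sum_congr rfl fun ω _ => mul_congr_of_pos (hp ω) fun hω => ?_
  exact cent_unit (sum_prodw (sum_condw hp hω) M) _

theorem cent_starw_vec (hp : ∀ ω, 0 ≤ p ω) (A : Ω → κ') :
    cent (starw p Z M) (fun x (i : Fin M) => A (x.2 i)) (fun x => x.1) = M * cent p A Z := by
  rw [cent_starw_given' hp (fun τ i => A (τ i)), ent_eq_sum_condw hp, Finset.mul_sum]
  refine Finset.sum_congr rfl fun ω _ => ?_
  rw [← mul_assoc, mul_comm _ (p ω), mul_assoc]
  refine mul_congr_of_pos (hp ω) fun hω => ?_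
  rw [ent_prodw (condw_nonneg hp ω) (sum_condw hp hω), cent_unit (sum_condw hp hω)]

theorem cent_starw_coord_given (hp : ∀ ω, 0 ≤ p ω) (A : Ω → κ') (i : Fin M) :
    cent (starw p Z M) (fun x => A (x.2 i)) (fun x => x.1) ≤ cent p A Z := by
  rw [← cent_starw_coord (Z := Z) hp i A Z]
  have h : cent (starw p Z M) (fun x => A (x.2 i)) (fun x => Z (x.2 i)) =
      cent (starw p Z M) (fun x => A (x.2 i)) (fun x => Z x.1) := by
    refine cent_congr_ae (starw_nonneg hp) (fun x y hx hy => ?_) fun _ _ _ _ => Iff.rfl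
    rw [starw_pos_imp hp hx, starw_pos_imp hp hy]
  rw [h]
  exact cent_anti (starw_nonneg hp) _ fun x y h => by rw [h]

variable {Q : Ω → κ'} {V A : Ω → ℤ}

/-- The first `k` sampled values of `A`, padded by zeros. -/
def trunc (A : Ω → ℤ) (M k : ℕ) (x : Ω × (Fin M → Ω)) (i : Fin M) : ℤ :=
  if (i : ℕ) < k then A (x.2 i) else 0

/-- The sum of the first `k` sampled values of `A`. -/
def psum (A : Ω → ℤ) (M k : ℕ) (x : Ω × (Fin M → Ω)) : ℤ := ∑ i, trunc A M k x i

theorem trunc_succ_eq_iff {k : ℕ} (hk : k < M) (x y : Ω × (Fin M → Ω)) :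
    trunc A M (k + 1) x = trunc A M (k + 1) y ↔
      A (x.2 ⟨k, hk⟩) = A (y.2 ⟨k, hk⟩) ∧ trunc A M k x = trunc A M k y := by
  simp only [funext_iff, trunc]
  constructor
  · intro h
    refine ⟨by simpa using h ⟨k, hk⟩, fun i => ?_⟩
    have := h i
    split_ifs with h1
    · simpa [h1, Nat.lt_succ_of_lt h1] using this
    · rfl
  · rintro ⟨h1, h2⟩ i
    rcases lt_trichotomy (i : ℕ) k with h | h | h
    · simpa [h, Nat.lt_succ_of_lt h] using h2 i
    · have : i = ⟨k, hk⟩ := Fin.ext h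
      subst this; simpa using h1
    · simp [show ¬ (i : ℕ) < k + 1 by omega]

theorem psum_succ {k : ℕ} (hk : k < M) (x : Ω × (Fin M → Ω)) :
    psum A M (k + 1) x = psum A M k x + A (x.2 ⟨k, hk⟩) := by
  have : ∀ i : Fin M, trunc A M (k + 1) x i =
      trunc A M k x i + if i = ⟨k, hk⟩ then A (x.2 i) else 0 := by
    intro i
    simp only [trunc, Fin.ext_iff]
    rcases lt_trichotomy (i : ℕ) k with h | h | h
    · simp [h, Nat.lt_succ_of_lt h, h.ne]
    · simp [h]
    · simp [show ¬ (i : ℕ) < k + 1 by omega, show ¬ (i : ℕ) < k by omega, h.ne']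
  unfold psum
  rw [Finset.sum_congr rfl fun i _ => this i, Finset.sum_add_distrib]
  simp

theorem cent_trunc_succ {κ₁ : Type*} {k : ℕ} (hk : k < M) (g : Ω × (Fin M → Ω) → κ₁)
    (P : Ω × (Fin M → Ω) → ℝ) :
    cent P (trunc A M (k + 1)) g = cent P (fun x => A (x.2 ⟨k, hk⟩)) g +
      cent P (trunc A M k) (fun x => (A (x.2 ⟨k, hk⟩), g x)) := by
  rw [← cent_chain]
  refine cent_congr (fun _ _ => Iff.rfl) fun x y _ => ?_
  rw [trunc_succ_eq_iff hk, Prod.mk.injEq, and_comm]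

/-- Upper bounds for the conditional entropy of the truncated vector. -/
theorem cent_trunc_le {κ₁ : Type*} (g : Ω × (Fin M → Ω) → κ₁) (hp : ∀ ω, 0 ≤ p ω) {a : ℝ}
    (ha : ∀ i, cent (starw p Z M) (fun x => A (x.2 i)) g ≤ a) {k l : ℕ} (hkl : k ≤ l) (hl : l ≤ M) :
    cent (starw p Z M) (trunc A M l) g ≤ cent (starw p Z M) (trunc A M k) g + (l - k) * a := by
  induction l, hkl using Nat.le_induction with
  | base => simp
  | succ l hkl ih =>
    have hl' : l < M := hl
    rw [cent_trunc_succ hl']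
    have h1 := ha ⟨l, hl'⟩
    have h2 := cent_anti (starw_nonneg (Z := Z) (M := M) hp) (trunc A M l) (g := g)
      (g' := fun x => (A (x.2 ⟨l, hl'⟩), g x)) fun x y h => (Prod.mk.inj h).2
    have h3 := ih hl'.le
    push_cast
    linarith

theorem le_cent_trunc (hp : ∀ ω, 0 ≤ p ω) {k : ℕ} (hk : k ≤ M) :
    k * cent p A Z ≤ cent (starw p Z M) (trunc A M k) (fun x => x.1) := by
  have h1 := cent_trunc_le (p := p) (Z := Z) (A := A) (fun x : Ω × (Fin M → Ω) => x.1) hp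
    (cent_starw_coord_given hp A) hk le_rfl
  have h2 : cent (starw p Z M) (trunc A M M) (fun x => x.1) = M * cent p A Z := by
    rw [← cent_starw_vec hp A]
    refine cent_congr (fun _ _ => Iff.rfl) fun x y _ => ?_
    simp [trunc, funext_iff]
  rw [h2] at h1
  linarith

theorem le_cent_trunc' (hp : ∀ ω, 0 ≤ p ω) {k : ℕ} (hk : k < M) :
    k * cent p A Z ≤
      cent (starw p Z M) (trunc A M k) (fun x => (A (x.2 ⟨k, hk⟩), x.1)) := by
  have h1 := le_cent_trunc (p := p) (Z := Z) (A := A) hp (Nat.succ_le_of_lt hk)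
  rw [cent_trunc_succ hk] at h1
  have := cent_starw_coord_given (Z := Z) hp A ⟨k, hk⟩
  push_cast at h1
  linarith

theorem cent_trunc_Q_le (hp : ∀ ω, 0 ≤ p ω) (hQ : ∀ ω ω', Z ω = Z ω' → Q ω = Q ω') {k : ℕ}
    (hk : k ≤ M) : cent (starw p Z M) (trunc A M k) (fun x => Q x.1) ≤ k * cent p A Q := by
  have h1 := cent_trunc_le (p := p) (Z := Z) (A := A) (fun x : Ω × (Fin M → Ω) => Q x.1) hp
    (a := cent p A Q) (fun i => by
      rw [← cent_starw_coord (Z := Z) hp i A Q]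
      refine le_of_eq (cent_congr_ae (starw_nonneg hp) (fun x y hx hy => ?_) fun _ _ _ _ => Iff.rfl)
      rw [hQ _ _ (starw_pos_imp hp hx i), hQ _ _ (starw_pos_imp hp hy i)]) (Nat.zero_le k) hk
  have h2 : cent (starw p Z M) (trunc A M 0) (fun x => Q x.1) = 0 :=
    cent_eq_zero fun x y _ => by simp [trunc, funext_iff]
  rw [h2] at h1
  simpa using h1

/-- Data processing for the partial sums. -/
theorem le_cent_psum {κ₁ : Type*} (hp : ∀ ω, 0 ≤ p ω) (hQ : ∀ ω ω', Z ω = Z ω' → Q ω = Q ω')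
    {ε : ℝ} (hε : cent p A Q - cent p A Z ≤ ε) {k : ℕ} (hk : k ≤ M)
    (g : Ω × (Fin M → Ω) → κ₁) (hg : ∀ x y, g x = g y → Q x.1 = Q y.1)
    (hlow : k * cent p A Z ≤ cent (starw p Z M) (trunc A M k) g) :
    cent (starw p Z M) (psum A M k) (fun x => Q x.1) ≤
      cent (starw p Z M) (psum A M k) g + k * ε := by
  have hP := starw_nonneg (Z := Z) (M := M) hp
  have hfun : ∀ x y : Ω × (Fin M → Ω), trunc A M k x = trunc A M k y →
      psum A M k x = psum A M k y := fun x y h => by unfold psum; rw [h]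
  have chain : ∀ {κ₂ : Type _} (g : Ω × (Fin M → Ω) → κ₂), cent (starw p Z M) (trunc A M k) g =
      cent (starw p Z M) (psum A M k) g +
        cent (starw p Z M) (trunc A M k) (fun x => (psum A M k x, g x)) := by
    intro κ₂ g
    rw [← cent_chain]
    refine cent_congr (fun _ _ => Iff.rfl) fun x y _ => ?_
    rw [Prod.mk.injEq]
    exact ⟨fun h => ⟨h, hfun _ _ h⟩, fun h => h.1⟩
  have chainQ : cent (starw p Z M) (trunc A M k) (fun x => Q x.1) =
      cent (starw p Z M) (psum A M k) (fun x => Q x.1) +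
        cent (starw p Z M) (trunc A M k) (fun x => (psum A M k x, Q x.1)) := by
    rw [← cent_chain]
    refine cent_congr (fun _ _ => Iff.rfl) fun x y _ => ?_
    rw [Prod.mk.injEq]
    exact ⟨fun h => ⟨h, hfun _ _ h⟩, fun h => h.1⟩
  have h1 := cent_trunc_Q_le (A := A) hp hQ hk
  have h2 : cent (starw p Z M) (trunc A M k) (fun x => (psum A M k x, g x)) ≤
      cent (starw p Z M) (trunc A M k) (fun x => (psum A M k x, Q x.1)) :=
    cent_anti hP _ fun x y h => by
      simp only [Prod.mk.injEq] at h ⊢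
      exact ⟨h.1, hg _ _ h.2⟩
  have h3 := chain g
  have hk0 : (0 : ℝ) ≤ k := Nat.cast_nonneg k
  nlinarith [mul_le_mul_of_nonneg_left hε hk0]

/-- One step of the Kaimanovich--Vershik argument. -/
theorem cent_sub_psum_succ (hp : ∀ ω, 0 ≤ p ω) (hQ : ∀ ω ω', Z ω = Z ω' → Q ω = Q ω')
    (hV : ∀ ω ω', Z ω = Z ω' → V ω = V ω') {ε D : ℝ} (hε : cent p A Q - cent p A Z ≤ ε)
    (hD : cent p (fun ω => V ω - A ω) Q ≤ cent p V Q + D) {k : ℕ} (hk : k < M) :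
    cent (starw p Z M) (fun x => V x.1 - psum A M (k + 1) x) (fun x => Q x.1) ≤
      cent (starw p Z M) (fun x => V x.1 - psum A M k x) (fun x => Q x.1) + D + ε + k * ε := by
  have hP := starw_nonneg (Z := Z) (M := M) hp
  set P := starw p Z M with hPdef
  set q : Ω × (Fin M → Ω) → κ' := fun x => Q x.1 with hq
  set v : Ω × (Fin M → Ω) → ℤ := fun x => V x.1 with hv
  set a : Ω × (Fin M → Ω) → ℤ := fun x => A (x.2 ⟨k, hk⟩) with ha
  set c : Ω × (Fin M → Ω) → ℤ := psum A M k with hc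
  have e1 : cent P (fun x => V x.1 - psum A M (k + 1) x) q = cent P (fun x => v x - a x - c x) q :=
    by
    congr 1; ext x; rw [psum_succ hk]; simp only [hv, ha, hc]; ring
  rw [e1]
  change _ ≤ cent P (fun x => v x - c x) q + D + ε + k * ε
  -- submodularity
  have sub : cent P (fun x => (v x, (a x, c x))) q + cent P (fun x => v x - a x - c x) q ≤
      cent P (fun x => (v x - c x, a x)) q + cent P (fun x => (v x - a x, c x)) q := by
    have c1 : cent P (fun x => (v x - c x, a x)) q = cent P (fun x => v x - a x - c x) q +
        cent P (fun x => (v x - c x, a x)) (fun x => (v x - a x - c x, q x)) := by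
      rw [← cent_chain]
      refine cent_congr (fun _ _ => Iff.rfl) fun x y _ => ?_
      simp only [Prod.mk.injEq]; constructor
      · rintro ⟨h1, h2⟩; exact ⟨⟨h1, h2⟩, by linarith⟩
      · exact fun h => h.1
    have c2 : cent P (fun x => (v x, (a x, c x))) q = cent P (fun x => (v x - a x, c x)) q +
        cent P (fun x => (v x - c x, a x)) (fun x => ((v x - a x, c x), q x)) := by
      rw [← cent_chain]
      refine cent_congr (fun _ _ => Iff.rfl) fun x y _ => ?_
      simp only [Prod.mk.injEq]; constructor
      · rintro ⟨h1, h2, h3⟩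
        exact ⟨⟨by rw [h1, h3], h2⟩, by rw [h1, h2], h3⟩
      · rintro ⟨⟨h1, h2⟩, h3, h4⟩
        exact ⟨by linarith, h2, h4⟩
    have c3 : cent P (fun x => (v x - c x, a x)) (fun x => ((v x - a x, c x), q x)) ≤
        cent P (fun x => (v x - c x, a x)) (fun x => (v x - a x - c x, q x)) :=
      cent_anti hP _ fun x y h => by
        simp only [Prod.mk.injEq] at h ⊢
        exact ⟨by rw [h.1.1, h.1.2], h.2⟩
    linarith
  have s1 := ent_submod hP (fun x => v x - c x) a q
  have s2 := ent_submod hP (fun x => v x - a x) c q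
  -- the four terms
  have t1 : cent P v q = cent p V Q := cent_starw_fst hp V Q
  have t2 : cent P a q = cent p A Q := by
    rw [← cent_starw_coord (Z := Z) hp ⟨k, hk⟩ A Q]
    refine (cent_congr_ae hP (fun x y hx hy => ?_) fun _ _ _ _ => Iff.rfl)
    simp only [hq]
    rw [hQ _ _ (starw_pos_imp hp hx ⟨k, hk⟩), hQ _ _ (starw_pos_imp hp hy ⟨k, hk⟩)]
  have t3 : cent P (fun x => v x - a x) q = cent p (fun ω => V ω - A ω) Q := by
    rw [← cent_starw_coord (Z := Z) hp ⟨k, hk⟩ (fun ω => V ω - A ω) Q]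
    refine (cent_congr_ae hP (fun x y hx hy => ?_) fun x y hx hy => ?_)
    · simp only [hq]
      rw [hQ _ _ (starw_pos_imp hp hx ⟨k, hk⟩), hQ _ _ (starw_pos_imp hp hy ⟨k, hk⟩)]
    · simp only [hv, ha]
      rw [hV _ _ (starw_pos_imp hp hx ⟨k, hk⟩), hV _ _ (starw_pos_imp hp hy ⟨k, hk⟩)]
  have t4 : cent P (fun x => (v x, (a x, c x))) q = cent P v q + cent P a (fun x => (v x, q x)) +
      cent P c (fun x => (a x, (v x, q x))) := by
    rw [cent_congr (f' := fun x => ((c x, a x), v x)) (g' := q) (fun _ _ => Iff.rfl)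
      (fun x y _ => by simp only [Prod.mk.injEq]; tauto)]
    rw [cent_chain, cent_chain]; ring
  have hvZ : ∀ x y : Ω × (Fin M → Ω), x.1 = y.1 → v x = v y ∧ q x = q y := fun x y h => by
    simp only [hv, hq, h, and_self]
  have t5 : cent p A Z ≤ cent P a (fun x => (v x, q x)) := by
    have h := le_cent_trunc (p := p) (Z := Z) (A := A) hp (Nat.succ_le_of_lt hk)
    have h0 := le_cent_trunc' (p := p) (Z := Z) (A := A) hp hk
    have hh : cent p A Z ≤ cent P a (fun x => x.1) := by
      have hcoord := cent_starw_coord (Z := Z) hp ⟨k, hk⟩ A Z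
      have e2 := cent_trunc_le (p := p) (Z := Z) (A := A) (fun x : Ω × (Fin M → Ω) => x.1) hp
        (cent_starw_coord_given hp A) (Nat.zero_le k) hk.le
      have e3 : cent (starw p Z M) (trunc A M 0) (fun x => x.1) = 0 :=
        cent_eq_zero fun x y _ => by simp [trunc, funext_iff]
      rw [cent_trunc_succ hk] at h
      have e4 := cent_anti hP (trunc A M k) (g := fun x : Ω × (Fin M → Ω) => x.1)
        (g' := fun x => (A (x.2 ⟨k, hk⟩), x.1)) fun x y h => (Prod.mk.inj h).2
      rw [e3] at e2
      push_cast at h e2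
      simp only [hPdef, ha]
      linarith
    refine hh.trans (cent_anti hP _ fun x y h => ?_)
    rw [Prod.mk.injEq]; exact hvZ _ _ h
  have t6 : cent P c q ≤ cent P c (fun x => (a x, (v x, q x))) + k * ε := by
    have h := le_cent_psum hp hQ hε hk.le (fun x => (A (x.2 ⟨k, hk⟩), x.1))
      (fun x y h => by rw [(Prod.mk.inj h).2]) (le_cent_trunc' hp hk)
    refine h.trans (add_le_add_left (cent_anti hP _ fun x y h => ?_) _)
    simp only [Prod.mk.injEq] at h ⊢
    exact ⟨h.1, hvZ _ _ h.2⟩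
  linarith

theorem cent_sub_psum_le (hp : ∀ ω, 0 ≤ p ω) (hQ : ∀ ω ω', Z ω = Z ω' → Q ω = Q ω')
    (hV : ∀ ω ω', Z ω = Z ω' → V ω = V ω') {ε D : ℝ} (hε : cent p A Q - cent p A Z ≤ ε)
    (hε0 : 0 ≤ ε) (hD : cent p (fun ω => V ω - A ω) Q ≤ cent p V Q + D) {k : ℕ} (hk : k ≤ M) :
    cent (starw p Z M) (fun x => V x.1 - psum A M k x) (fun x => Q x.1) ≤
      cent p V Q + k * (D + ε) + k * k * ε := by
  induction k with
  | zero =>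
    refine le_of_eq ?_
    simp only [psum, trunc, Nat.not_lt_zero, if_false, Finset.sum_const_zero, sub_zero]
    rw [cent_starw_fst hp V Q]; simp
  | succ k ih =>
    have h1 := cent_sub_psum_succ (V := V) hp hQ hV hε hD hk
    have h2 := ih (Nat.le_of_succ_le hk)
    push_cast
    nlinarith [(Nat.cast_nonneg k : (0:ℝ) ≤ k)]

/-- The partial sums carry little information on `V`. -/
theorem cent_psum_le_given (hp : ∀ ω, 0 ≤ p ω) (hQ : ∀ ω ω', Z ω = Z ω' → Q ω = Q ω')
    {ε : ℝ} (hε : cent p A Q - cent p A Z ≤ ε) {k : ℕ} (hk : k ≤ M) :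
    cent (starw p Z M) (psum A M k) (fun x => Q x.1) ≤
      cent (starw p Z M) (psum A M k) (fun x => (V x.1, Q x.1)) + k * ε := by
  have h := le_cent_psum hp hQ hε hk (fun x : Ω × (Fin M → Ω) => x.1)
      (fun x y h => by rw [h]) (le_cent_trunc hp hk)
  refine h.trans (add_le_add_left (cent_anti (starw_nonneg hp) _ fun x y h => ?_) _)
  rw [h]

end Star

theorem centralBinom_sq_le (n : ℕ) : n.centralBinom ^ 2 * (2 * n + 1) ≤ 16 ^ n := by
  induction n with
  | zero => simp
  | succ n ih =>
    have h := Nat.succ_mul_centralBinom_succ n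
    have h1 : (n + 1) ^ 2 * ((n + 1).centralBinom ^ 2 * (2 * (n + 1) + 1)) =
        4 * (2 * n + 1) * (2 * n + 3) * (n.centralBinom ^ 2 * (2 * n + 1)) := by
      rw [← mul_assoc, ← mul_pow, h]; ring
    have h2 : 4 * (2 * n + 1) * (2 * n + 3) ≤ 16 * (n + 1) ^ 2 := by nlinarith
    have h3 := Nat.mul_le_mul h2 ih
    rw [← h1] at h3
    refine le_of_mul_le_mul_left (a := (n + 1) ^ 2) ?_ (pow_pos n.succ_pos 2)
    calc _ ≤ _ := h3
      _ = _ := by ring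

theorem choose_half_sq_le (R : ℕ) : (R.choose (R / 2)) ^ 2 * (R + 1) ≤ 4 ^ R := by
  rcases Nat.even_or_odd' R with ⟨n, rfl | rfl⟩
  · have := centralBinom_sq_le n
    rw [Nat.centralBinom_eq_two_mul_choose] at this
    rw [Nat.mul_div_cancel_left n two_pos, pow_mul]
    exact this
  · have := centralBinom_sq_le (n + 1)
    rw [Nat.centralBinom_eq_two_mul_choose] at this
    rw [show (2 * n + 1) / 2 = n by omega]
    have h2 : (2 * (n + 1)).choose (n + 1) = 2 * (2 * n + 1).choose n := by
      rw [show 2 * (n + 1) = (2 * n + 1) + 1 by ring, Nat.choose_succ_succ,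
        Nat.choose_symm_half]; ring
    rw [h2] at this
    have h3 : (4:ℕ) ^ (2 * n + 1) * 4 = 16 ^ (n + 1) := by
      rw [← pow_succ, show 2 * n + 1 + 1 = 2 * (n + 1) by ring, pow_mul]; norm_num
    nlinarith [Nat.zero_le ((2 * n + 1).choose n ^ 2)]

/-- Littlewood--Offord bound: two-valued sums whose `D`-increments are at least `2 ^ k`. -/
theorem card_coin_le {m k : ℕ} (a a' : Fin m → ℤ) (D : Finset (Fin m))
    (hD : ∀ i ∈ D, 2 ^ k ≤ |a i - a' i|) (v y : ℤ) :
    ((univ.filter fun c : Fin m → Bool =>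
      (v - ∑ i, if c i then a i else a' i) / 2 ^ k = y).card : ℝ) ≤
      2 ^ m / Real.sqrt (D.card + 1) := by
  classical
  have hcount : (univ.filter fun c : Fin m → Bool =>
      (v - ∑ i, if c i then a i else a' i) / 2 ^ k = y).card ≤
      (D.card.choose (D.card / 2)) * 2 ^ (m - D.card) := by
    have ht : (univ : Finset ({i // i ∉ D} → Bool)).card = 2 ^ (m - D.card) := by
      rw [Finset.card_univ, Fintype.card_fun, Fintype.card_bool, Fintype.card_subtype_compl]
      simp
    rw [← ht]
    refine Finset.card_le_mul_card_image_of_maps_to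
      (f := fun (c : Fin m → Bool) (i : {i // i ∉ D}) => c i) (fun _ _ => Finset.mem_univ _) _ ?_
    intro b _
    set s := (univ.filter fun c : Fin m → Bool =>
      (v - ∑ i, if c i then a i else a' i) / 2 ^ k = y).filter
      fun c => (fun i : {i // i ∉ D} => c i) = b with hs
    let U : (Fin m → Bool) → Finset {i // i ∈ D} := fun c =>
      univ.filter fun i => c i = decide (a' i < a i)
    have hinj : Set.InjOn U s := by
      intro c hc c' hc' h
      ext i
      by_cases hi : i ∈ D
      · have h1 : (⟨i, hi⟩ : {i // i ∈ D}) ∈ U c ↔ (⟨i, hi⟩ : {i // i ∈ D}) ∈ U c' := by rw [h]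
        simp only [U, Finset.mem_filter, Finset.mem_univ, true_and] at h1
        revert h1
        cases c i <;> cases c' i <;> cases decide (a' i < a i) <;> simp
      · have h1 := (Finset.mem_filter.1 hc).2
        have h2 := (Finset.mem_filter.1 hc').2
        have := congrFun (h1.trans h2.symm) ⟨i, hi⟩
        exact this
    rw [← Finset.card_image_of_injOn hinj]
    have hanti : IsAntichain (· ⊆ ·) (SetLike.coe (s.image U)) := by
      intro B hB B' hB' hne hsub
      obtain ⟨c, hc, rfl⟩ := Finset.mem_image.1 hB
      obtain ⟨c', hc', rfl⟩ := Finset.mem_image.1 hB'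
      have hex : ∃ i, i ∈ U c' ∧ i ∉ U c := by
        by_contra hcon
        push Not at hcon
        exact hne (Finset.Subset.antisymm hsub hcon)
      obtain ⟨⟨i₀, hi₀⟩, hi1, hi2⟩ := hex
      have hval : ∀ i, (if c i then a i else a' i) ≤ (if c' i then a i else a' i) := by
        intro i
        by_cases hi : i ∈ D
        · by_cases hm : (⟨i, hi⟩ : {i // i ∈ D}) ∈ U c
          · have h1 := (Finset.mem_filter.1 hm).2
            have h2 := (Finset.mem_filter.1 (hsub hm)).2
            dsimp only at h1 h2
            rw [h1, h2]
          · have h1 : ¬ c i = decide (a' i < a i) := fun h => hm (by simp [U, h])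
            by_cases hlt : a' i < a i
            · simp only [hlt, decide_true, Bool.not_eq_true] at h1
              rw [h1]; split_ifs <;> simp_all [le_of_lt]
            · simp only [hlt, decide_false, Bool.not_eq_false] at h1
              rw [h1]; push Not at hlt; split_ifs <;> simp_all
        · have h1 := (Finset.mem_filter.1 hc).2
          have h2 := (Finset.mem_filter.1 hc').2
          have : c i = c' i := congrFun (h1.trans h2.symm) ⟨i, hi⟩
          rw [this]
      have hval0 : (if c i₀ then a i₀ else a' i₀) + 2 ^ k ≤ (if c' i₀ then a i₀ else a' i₀) := by
        have h1 : ¬ c i₀ = decide (a' i₀ < a i₀) := fun h => hi2 (by simp [U, h])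
        have h2 : c' i₀ = decide (a' i₀ < a i₀) := (Finset.mem_filter.1 hi1).2
        have h3 := hD i₀ hi₀
        by_cases hlt : a' i₀ < a i₀
        · simp only [hlt, decide_true, Bool.not_eq_true] at h1 h2
          rw [h1, h2]; rw [abs_of_pos (by linarith)] at h3; simp; linarith
        · simp only [hlt, decide_false, Bool.not_eq_false] at h1 h2
          rw [h1, h2]; push Not at hlt; rw [abs_of_nonpos (by linarith)] at h3; simp; linarith
      have hsum : (∑ i, if c i then a i else a' i) + 2 ^ k ≤ ∑ i, if c' i then a i else a' i := by
        rw [← Finset.add_sum_erase _ _ (Finset.mem_univ i₀),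
          ← Finset.add_sum_erase _ (fun i => if c' i then a i else a' i) (Finset.mem_univ i₀)]
        have := Finset.sum_le_sum fun i (_ : i ∈ univ.erase i₀) => hval i
        linarith
      have e1 := (Finset.mem_filter.1 (Finset.mem_filter.1 hc).1).2
      have e2 := (Finset.mem_filter.1 (Finset.mem_filter.1 hc').1).2
      have hpos : (0:ℤ) < 2 ^ k := by positivity
      have b1 := Int.mul_ediv_add_emod (v - ∑ i, if c i then a i else a' i) (2 ^ k)
      have b2 := Int.mul_ediv_add_emod (v - ∑ i, if c' i then a i else a' i) (2 ^ k)
      have b3 := Int.emod_lt_of_pos (v - ∑ i, if c i then a i else a' i) hpos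
      have b4 := Int.emod_nonneg (v - ∑ i, if c' i then a i else a' i) hpos.ne'
      rw [e1] at b1; rw [e2] at b2
      linarith
    refine (hanti.sperner).trans ?_
    simp
  have hDm : D.card ≤ m := by simpa using Finset.card_le_univ D
  have hsq := choose_half_sq_le D.card
  set R := D.card
  have h1 : (R.choose (R / 2) : ℝ) ≤ 2 ^ R / Real.sqrt (R + 1) := by
    rw [le_div_iff₀ (by positivity)]
    refine (sq_le_sq₀ (by positivity) (by positivity)).1 ?_
    rw [mul_pow, Real.sq_sqrt (by positivity), ← pow_mul, mul_comm R 2, pow_mul]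
    norm_num
    exact_mod_cast hsq
  calc _ ≤ ((R.choose (R / 2) * 2 ^ (m - R) : ℕ) : ℝ) := by exact_mod_cast hcount
    _ = (R.choose (R / 2) : ℝ) * 2 ^ (m - R) := by push_cast; ring
    _ ≤ 2 ^ R / Real.sqrt (R + 1) * 2 ^ (m - R) := by gcongr
    _ = 2 ^ m / Real.sqrt (R + 1) := by
      rw [div_mul_eq_mul_div, ← pow_add, Nat.add_sub_cancel' hDm]

/-- A pointwise upper bound on level masses gives a lower bound on entropy. -/
theorem le_ent_of_mass_le {Ω : Type*} [Fintype Ω] {κ : Type*} {p : Ω → ℝ} (hp : ∀ ω, 0 ≤ p ω)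
    (h1 : ∑ ω, p ω = 1) (f : Ω → κ) {c : ℝ} (hc : ∀ ω, mass p f ω ≤ c) :
    -Real.log c ≤ ent p f := by
  unfold ent
  refine neg_le_neg ?_
  calc ∑ ω, p ω * Real.log (mass p f ω) ≤ ∑ ω, p ω * Real.log c := by
        refine Finset.sum_le_sum fun ω _ => ?_
        rcases (hp ω).eq_or_lt with h0 | h0
        · simp [← h0]
        · exact mul_le_mul_of_nonneg_left (Real.log_le_log (mass_pos hp f h0) (hc ω)) h0.le
    _ = Real.log c := by rw [← Finset.sum_mul, h1, one_mul]

/-- The fair coin. -/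
noncomputable def coin : Bool → ℝ := fun _ => 1 / 2

theorem coin_nonneg (b : Bool) : 0 ≤ coin b := by unfold coin; norm_num

theorem sum_coin : ∑ b, coin b = 1 := by simp [coin]

/-- Geometric weights on the integers. -/
noncomputable def geomZ : ℝ := ∑' y : ℤ, (1 / 2 : ℝ) ^ y.natAbs

theorem summable_geomZ : Summable fun y : ℤ => (1 / 2 : ℝ) ^ y.natAbs := by
  have h : Summable fun n : ℕ => (1 / 2 : ℝ) ^ n := summable_geometric_two
  refine Summable.of_nat_of_neg ?_ ?_ <;> simpa using h

theorem geomZ_pos : 0 < geomZ := by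
  refine summable_geomZ.tsum_pos (fun _ => by positivity) 0 (by simp)

theorem sum_geomZ_le (s : Finset ℤ) (y₀ : ℤ) :
    ∑ y ∈ s, (1 / 2 : ℝ) ^ (y - y₀).natAbs ≤ geomZ := by
  have : ∑ y ∈ s, (1 / 2 : ℝ) ^ (y - y₀).natAbs =
      ∑ y ∈ s.map (Equiv.subRight y₀).toEmbedding, (1 / 2 : ℝ) ^ y.natAbs := by
    rw [Finset.sum_map]; rfl
  rw [this]
  exact summable_geomZ.sum_le_tsum _ fun _ _ => by positivity

/-- Entropy of an integer variable is controlled by its mean absolute deviation. -/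
theorem ent_le_of_deviation {Ω : Type*} [Fintype Ω] {p : Ω → ℝ} (hp : ∀ ω, 0 ≤ p ω)
    (h1 : ∑ ω, p ω = 1) (f : Ω → ℤ) (y₀ : ℤ) :
    ent p f ≤ Real.log geomZ + Real.log 2 * ∑ ω, p ω * |(f ω - y₀ : ℝ)| := by
  classical
  rw [← cent_unit h1]
  have := gibbs hp f (fun _ => ()) (fun y _ => (1 / 2 : ℝ) ^ (y - y₀).natAbs / geomZ)
    (fun y _ => div_nonneg (by positivity) geomZ_pos.le)
    (fun ω _ => div_pos (by positivity) geomZ_pos)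
    (fun ω => by
      rw [← Finset.sum_div]
      exact div_le_one_of_le₀ (sum_geomZ_le _ _) geomZ_pos.le)
  refine this.trans (le_of_eq ?_)
  have h2 : ∀ ω, p ω * Real.log ((1 / 2 : ℝ) ^ (f ω - y₀).natAbs / geomZ) =
      -(p ω * Real.log geomZ) - Real.log 2 * (p ω * |(f ω - y₀ : ℝ)|) := by
    intro ω
    rw [Real.log_div (by positivity) geomZ_pos.ne', Real.log_pow, one_div, Real.log_inv,
      Nat.cast_natAbs]
    push_cast; ring
  rw [Finset.sum_congr rfl fun ω _ => h2 ω, Finset.sum_sub_distrib, Finset.sum_neg_distrib,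
    ← Finset.sum_mul, h1, ← Finset.mul_sum]
  ring

section Coins

variable {m : ℕ} (a a' : Fin m → ℤ)

theorem prodw_coin (c : Fin m → Bool) : prodw coin m c = (1 / 2) ^ m := by
  simp [prodw, coin]

theorem coin_second_moment (d : Fin m → ℝ) :
    ∑ c, prodw coin m c * (∑ i, if c i then d i / 2 else -(d i / 2)) ^ 2 =
      ∑ i, d i ^ 2 / 4 := by
  classical
  have h : ∀ c : Fin m → Bool, prodw coin m c * (∑ i, if c i then d i / 2 else -(d i / 2)) ^ 2 =
      ∑ i, ∑ j, prodw coin m c * ((if c i then d i / 2 else -(d i / 2)) *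
        (if c j then d j / 2 else -(d j / 2))) := by
    intro c
    rw [sq, Finset.sum_mul_sum, Finset.mul_sum]
    exact Finset.sum_congr rfl fun i _ => by rw [Finset.mul_sum]
  rw [Finset.sum_congr rfl fun c _ => h c, Finset.sum_comm]
  refine Finset.sum_congr rfl fun i _ => ?_
  rw [Finset.sum_comm, Finset.sum_eq_single i]
  · have := sum_prodw_coord sum_coin i
      (fun b => (if b then d i / 2 else -(d i / 2)) * (if b then d i / 2 else -(d i / 2)))
    rw [this]
    simp [coin]; ring
  · intro j _ hij
    have := sum_prodw_coord₂ sum_coin hij.symm (fun b => (if b then d i / 2 else -(d i / 2)))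
      (fun b => if b then d j / 2 else -(d j / 2))
    rw [this]
    simp [coin]
  · simp

theorem le_ent_coin (k : ℕ) (D : Finset (Fin m)) (hD : ∀ i ∈ D, 2 ^ k ≤ |a i - a' i|) (v : ℤ) :
    Real.log (D.card + 1) / 2 ≤
      ent (prodw coin m) (fun c => (v - ∑ i, if c i then a i else a' i) / 2 ^ k) := by
  classical
  have := le_ent_of_mass_le (prodw_nonneg coin_nonneg) (sum_prodw sum_coin m)
    (fun c => (v - ∑ i, if c i then a i else a' i) / 2 ^ k) (c := 1 / Real.sqrt (D.card + 1))
    (fun c => by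
      unfold mass
      simp only [← Finset.sum_filter, prodw_coin, Finset.sum_const, nsmul_eq_mul]
      have := card_coin_le a a' D hD v ((v - ∑ i, if c i then a i else a' i) / 2 ^ k)
      calc _ ≤ (2 ^ m / Real.sqrt (D.card + 1)) * (1 / 2) ^ m := by gcongr
        _ = _ := by
          rw [div_mul_eq_mul_div, ← mul_pow]; norm_num)
  rw [one_div, Real.log_inv, neg_neg, Real.log_sqrt (by positivity)] at this
  exact this

theorem ent_coin_le (K : ℕ) (v : ℤ) {b : ℝ} (hb : ∑ i, ((a i - a' i : ℤ) : ℝ) ^ 2 ≤ b * 4 ^ K) :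
    ent (prodw coin m) (fun c => (v - ∑ i, if c i then a i else a' i) / 2 ^ K) ≤
      Real.log geomZ + Real.log 2 * (3 + b / 4) := by
  classical
  set μ : ℝ := v - ∑ i, ((a i + a' i : ℤ) : ℝ) / 2 with hμ
  refine (ent_le_of_deviation (prodw_nonneg coin_nonneg) (sum_prodw sum_coin m) _
    ⌊μ / 2 ^ K⌋).trans ?_
  have h0 : 0 ≤ Real.log 2 := Real.log_nonneg one_le_two
  gcongr
  have hdev : ∀ c : Fin m → Bool,
      |((((v - ∑ i, if c i then a i else a' i) / 2 ^ K : ℤ) : ℝ) - (⌊μ / 2 ^ K⌋ : ℝ))| ≤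
      3 + (∑ i, if c i then ((a i - a' i : ℤ) : ℝ) / 2 else -(((a i - a' i : ℤ) : ℝ) / 2)) ^ 2
        / 4 ^ K := by
    intro c
    set S : ℤ := v - ∑ i, if c i then a i else a' i with hS
    set t : ℝ := ∑ i, if c i then ((a i - a' i : ℤ) : ℝ) / 2 else -(((a i - a' i : ℤ) : ℝ) / 2)
      with ht
    have hSt : (S : ℝ) = μ - t := by
      rw [hS, hμ, ht]
      push_cast
      rw [sub_sub, ← Finset.sum_add_distrib]
      congr 1
      refine Finset.sum_congr rfl fun i _ => ?_
      split_ifs <;> ring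
    have hdiv : ((S / 2 ^ K : ℤ) : ℝ) = ⌊(S : ℝ) / 2 ^ K⌋ := by
      have := Int.floor_div_natCast (S : ℝ) (2 ^ K)
      push_cast at this
      rw [this]; simp
    rw [hdiv]
    have e1 := Int.floor_le ((S : ℝ) / 2 ^ K)
    have e2 := Int.lt_floor_add_one ((S : ℝ) / 2 ^ K)
    have e3 := Int.floor_le (μ / 2 ^ K)
    have e4 := Int.lt_floor_add_one (μ / 2 ^ K)
    have e5 : (S : ℝ) / 2 ^ K = μ / 2 ^ K - t / 2 ^ K := by rw [hSt]; ring
    have e6 : t ^ 2 / 4 ^ K = (t / 2 ^ K) ^ 2 := by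
      rw [div_pow, ← pow_mul, mul_comm K, pow_mul]; norm_num
    rw [e6, abs_le]
    constructor <;> nlinarith [sq_nonneg (t / 2 ^ K - 1), sq_nonneg (t / 2 ^ K + 1)]
  have hp0 := prodw_nonneg (ν := coin) coin_nonneg (m := m)
  refine (Finset.sum_le_sum fun c _ => mul_le_mul_of_nonneg_left (hdev c) (hp0 c)).trans ?_
  simp only [mul_add, Finset.sum_add_distrib, mul_div_assoc']
  rw [← Finset.sum_mul, sum_prodw sum_coin, one_mul, ← Finset.sum_div, coin_second_moment,
    ← Finset.sum_div, div_div]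
  have hK : (0 : ℝ) < 4 ^ K := by positivity
  have : (∑ i, ((a i - a' i : ℤ) : ℝ) ^ 2) / (4 * 4 ^ K) ≤ b / 4 := by
    rw [div_le_div_iff₀ (by positivity) (by norm_num)]
    linarith
  linarith

end Coins

section Low

variable {Ω : Type*} [Fintype Ω] {κ κ' : Type*} {ν : Ω → ℝ} {pre : Ω → κ}

/-- Two points, conditionally independent given `pre`. -/
noncomputable def pairw (ν : Ω → ℝ) (pre : Ω → κ) (x : Ω × Ω) : ℝ :=
  ν x.1 * condw ν pre x.1 x.2

theorem pairw_nonneg (hν : ∀ ω, 0 ≤ ν ω) (x : Ω × Ω) : 0 ≤ pairw ν pre x :=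
  mul_nonneg (hν _) (condw_nonneg hν _ _)

theorem sum_pairw_fst (hν : ∀ ω, 0 ≤ ν ω) (φ : Ω → ℝ) :
    ∑ x, pairw ν pre x * φ x.1 = ∑ ω, ν ω * φ ω := by
  rw [Fintype.sum_prod_type]
  refine Finset.sum_congr rfl fun ω _ => ?_
  simp only [pairw]
  rw [← Finset.sum_mul, ← Finset.mul_sum]
  rcases (hν ω).eq_or_lt with h | h
  · simp [← h]
  · rw [sum_condw hν h, mul_one]

theorem sum_pairw_snd (hν : ∀ ω, 0 ≤ ν ω) (φ : Ω → ℝ) :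
    ∑ x, pairw ν pre x * φ x.2 = ∑ ω, ν ω * φ ω := by
  rw [Fintype.sum_prod_type, ← sum_condw_mul (Z := pre) hν φ]
  refine Finset.sum_congr rfl fun ω _ => ?_
  simp only [pairw]
  rw [Finset.mul_sum]
  exact Finset.sum_congr rfl fun ω' _ => by ring

theorem sum_pairw (hν : ∀ ω, 0 ≤ ν ω) (h1 : ∑ ω, ν ω = 1) : ∑ x, pairw ν pre x = 1 := by
  simpa [h1] using sum_pairw_fst (pre := pre) hν (fun _ => 1)

theorem pairw_pos_imp (hν : ∀ ω, 0 ≤ ν ω) {x : Ω × Ω} (h : 0 < pairw ν pre x) :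
    0 < ν x.1 ∧ 0 < ν x.2 ∧ pre x.1 = pre x.2 := by
  have h1 : 0 < ν x.1 := (hν _).lt_of_ne fun h0 => by simp [pairw, ← h0] at h
  have h2 : 0 < condw ν pre x.1 x.2 := pos_of_mul_pos_right h h1.le
  refine ⟨h1, (hν _).lt_of_ne fun h0 => ?_, (condw_pos_imp h2).symm⟩
  simp [condw, ← h0] at h2

theorem prodw_pos_imp {m : ℕ} (hν : ∀ ω, 0 ≤ ν ω) {τ : Fin m → Ω} (h : 0 < prodw ν m τ)
    (i : Fin m) : 0 < ν (τ i) :=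
  (hν _).lt_of_ne fun h0 => h.ne' (Finset.prod_eq_zero (mem_univ i) h0.symm)

/-- Choose a coordinate of each pair by a coin. -/
def coinSel {m : ℕ} (x : (Fin m → Ω × Ω) × (Fin m → Bool)) (i : Fin m) : Ω :=
  if x.2 i then (x.1 i).1 else (x.1 i).2

theorem prodw_eq_sum_coinSel (hν : ∀ ω, 0 ≤ ν ω) {m : ℕ} [DecidableEq (Fin m → Ω)]
    (τ : Fin m → Ω) :
    prodw ν m τ = ∑ x : (Fin m → Ω × Ω) × (Fin m → Bool),
      if coinSel x = τ then prodw (pairw ν pre) m x.1 * prodw coin m x.2 else 0 := by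
  classical
  rw [Fintype.sum_prod_type_right]
  have h : ∀ c : Fin m → Bool, (∑ q : Fin m → Ω × Ω, if coinSel (q, c) = τ then
      prodw (pairw ν pre) m q * prodw coin m c else 0) = prodw coin m c * prodw ν m τ := by
    intro c
    have h2 : ∀ q : Fin m → Ω × Ω, (if coinSel (q, c) = τ then
      prodw (pairw ν pre) m q * prodw coin m c else 0) = prodw coin m c *
        (prodw (pairw ν pre) m q *
          ∏ i, if (if c i then (q i).1 else (q i).2) = τ i then (1 : ℝ) else 0) := by
      intro q
      by_cases hq : coinSel (q, c) = τ
      · rw [if_pos hq, Finset.prod_eq_one]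
        · ring
        · intro i _
          rw [if_pos]
          exact congrFun hq i
      · rw [if_neg hq]
        obtain ⟨i, hi⟩ := Function.ne_iff.1 hq
        rw [Finset.prod_eq_zero (mem_univ i)]
        · ring
        · rw [if_neg]
          exact hi
    rw [Finset.sum_congr rfl fun q _ => h2 q, ← Finset.mul_sum,
      sum_prodw_prod (fun i (x : Ω × Ω) => if (if c i then x.1 else x.2) = τ i then (1 : ℝ) else 0)]
    congr 1
    refine Finset.prod_congr rfl fun i _ => ?_
    by_cases hc : c i
    · simp only [hc, if_true]
      rw [sum_pairw_fst hν (fun ω => if ω = τ i then (1 : ℝ) else 0)]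
      simp
    · simp only [hc]
      have := sum_pairw_snd (pre := pre) hν (fun ω => if ω = τ i then (1 : ℝ) else 0)
      simpa using this
  rw [Finset.sum_congr rfl fun c _ => h c, ← Finset.sum_mul, sum_prodw sum_coin, one_mul]

theorem log_mul_one_sub_exp_le {y R : ℝ} (hy : 1 ≤ y) (hR : 0 ≤ R) :
    Real.log y * (1 - Real.exp (y - R)) ≤ Real.log (R + 1) := by
  have h0 := Real.log_nonneg hy
  rcases le_total y R with h | h
  · have h1 : Real.log y ≤ Real.log (R + 1) := Real.log_le_log (by linarith) (by linarith)
    nlinarith [Real.exp_pos (y - R)]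
  · have h1 : 1 ≤ Real.exp (y - R) := Real.one_le_exp (by linarith)
    have h2 : 0 ≤ Real.log (R + 1) := Real.log_nonneg (by linarith)
    nlinarith

theorem le_sum_log_card (hν : ∀ ω, 0 ≤ ν ω) (h1 : ∑ ω, ν ω = 1) (B : Ω → Prop)
    [DecidablePred B] (m : ℕ) {y : ℝ} (hy : 1 ≤ y)
    (hym : 2 * y = (∑ ω, if B ω then ν ω else 0) * m) :
    Real.log y - 5 ≤
      ∑ τ, prodw ν m τ * Real.log ((univ.filter fun i => B (τ i)).card + 1) := by
  set κ₀ := ∑ ω, if B ω then ν ω else 0 with hκ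
  have hexp : ∑ τ, prodw ν m τ * Real.exp (y - (univ.filter fun i => B (τ i)).card) ≤
      Real.exp (-(y / 5)) := by
    have e1 : ∀ τ : Fin m → Ω, Real.exp (y - (univ.filter fun i => B (τ i)).card) =
        Real.exp y * ∏ i, if B (τ i) then Real.exp (-1) else 1 := by
      intro τ
      rw [Finset.prod_ite, Finset.prod_const, Finset.prod_const_one, mul_one, ← Real.exp_nat_mul,
        ← Real.exp_add]
      congr 1; ring
    have e2 : ∑ ω, ν ω * (if B ω then Real.exp (-1) else 1) = 1 - κ₀ * (1 - Real.exp (-1)) := by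
      have : ∑ ω, ν ω * (if B ω then Real.exp (-1) else 1) =
          ∑ ω, ν ω - ∑ ω, (if B ω then ν ω else 0) * (1 - Real.exp (-1)) := by
        rw [← Finset.sum_sub_distrib]
        refine Finset.sum_congr rfl fun ω _ => ?_
        split_ifs <;> ring
      rw [this, h1, hκ, Finset.sum_mul]
    rw [Finset.sum_congr rfl fun τ _ => by rw [e1 τ, mul_left_comm], ← Finset.mul_sum,
      sum_prodw_prod (fun _ ω => if B ω then Real.exp (-1) else 1), Finset.prod_const, e2,
      Finset.card_univ, Fintype.card_fin]
    have h5 : Real.exp (-1) < 0.4 := by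
      have := Real.exp_one_gt_d9
      rw [Real.exp_neg, inv_lt_comm₀ (Real.exp_pos 1) (by norm_num)]
      norm_num at this ⊢; linarith
    have hκ0 : 0 ≤ κ₀ := Finset.sum_nonneg fun ω _ => by split_ifs; exacts [hν ω, le_rfl]
    have hκ1 : κ₀ ≤ 1 := by
      rw [← h1]
      refine Finset.sum_le_sum fun ω _ => ?_
      split_ifs; exacts [le_rfl, hν ω]
    have h6 : 1 - κ₀ * (1 - Real.exp (-1)) ≤ Real.exp (-(κ₀ * (1 - Real.exp (-1)))) := by
      have := Real.add_one_le_exp (-(κ₀ * (1 - Real.exp (-1))))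
      linarith
    have h7 : 0 ≤ 1 - κ₀ * (1 - Real.exp (-1)) := by nlinarith [Real.exp_pos (-1)]
    calc _ ≤ Real.exp y * Real.exp (-(κ₀ * (1 - Real.exp (-1)))) ^ m := by gcongr
      _ = Real.exp (y - 2 * y * (1 - Real.exp (-1))) := by
          rw [← Real.exp_nat_mul, ← Real.exp_add, hym]; congr 1; ring
      _ ≤ _ := by
          rw [Real.exp_le_exp]
          nlinarith
  have hp0 := prodw_nonneg (m := m) hν
  have hlog := Real.log_nonneg hy
  have hle : ∑ τ, prodw ν m τ * (Real.log y *
      (1 - Real.exp (y - (univ.filter fun i => B (τ i)).card))) ≤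
      ∑ τ, prodw ν m τ * Real.log ((univ.filter fun i => B (τ i)).card + 1) :=
    Finset.sum_le_sum fun τ _ => mul_le_mul_of_nonneg_left
      (log_mul_one_sub_exp_le hy (Nat.cast_nonneg _)) (hp0 τ)
  have heq : ∑ τ, prodw ν m τ * (Real.log y *
      (1 - Real.exp (y - (univ.filter fun i => B (τ i)).card))) = Real.log y - Real.log y *
      ∑ τ, prodw ν m τ * Real.exp (y - (univ.filter fun i => B (τ i)).card) := by
    have : Real.log y = ∑ τ, prodw ν m τ * Real.log y := by
      rw [← Finset.sum_mul, sum_prodw h1, one_mul]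
    nth_rewrite 2 [this]
    rw [Finset.mul_sum, ← Finset.sum_sub_distrib]
    exact Finset.sum_congr rfl fun τ _ => by ring
  have h8 : Real.log y * Real.exp (-(y / 5)) ≤ 5 := by
    have := Real.log_le_sub_one_of_pos (show 0 < y by linarith)
    have h9 := Real.add_one_le_exp (y / 5)
    rw [Real.exp_neg, ← div_eq_mul_inv, div_le_iff₀ (Real.exp_pos _)]
    linarith
  have := mul_le_mul_of_nonneg_left hexp hlog
  linarith

open Classical in
/-- A sum of many conditionally independent integer variables, each carrying a random bit at
scale `2 ^ k`, has large entropy at that scale relative to the scale `2 ^ (k + L)`. -/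
theorem le_cent_sum_of_bits (hν : ∀ ω, 0 ≤ ν ω) (h1 : ∑ ω, ν ω = 1) (A : Ω → ℤ)
    (letter : Ω → κ') (k L m : ℕ) (b : ℝ)
    (hlow : ∀ ω ω', 0 < ν ω → 0 < ν ω' → pre ω = pre ω' → letter ω ≠ letter ω' →
      2 ^ k ≤ |A ω - A ω'|)
    (hup : ∀ ω ω', 0 < ν ω → 0 < ν ω' → pre ω = pre ω' → |((A ω - A ω' : ℤ) : ℝ)| ≤ b * 2 ^ k)
    (v : ℤ) {y : ℝ} (hy : 1 ≤ y)
    (hym : 2 * y = (∑ x : Ω × Ω, if letter x.1 ≠ letter x.2 then pairw ν pre x else 0) * m) :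
    (Real.log y - 5) / 2 - (Real.log geomZ + Real.log 2 * (3 + m * b ^ 2 / 4 ^ L / 4)) ≤
      cent (prodw ν m) (fun τ => (v - ∑ i, A (τ i)) / 2 ^ k)
        (fun τ => (v - ∑ i, A (τ i)) / 2 ^ (k + L)) := by
  rw [cent_map (fun x : (Fin m → Ω × Ω) × (Fin m → Bool) =>
    prodw (pairw ν pre) m x.1 * prodw coin m x.2) coinSel
    (fun τ => by convert prodw_eq_sum_coinSel (pre := pre) hν τ)]
  have hπ := pairw_nonneg (pre := pre) hν
  have hP0 := prodw_nonneg (m := m) hπ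
  have hc0 := prodw_nonneg (m := m) coin_nonneg
  refine le_trans ?_ (cent_pair_le (fun x => mul_nonneg (hP0 _) (hc0 _)) _ _ (fun x => x.1))
  rw [cent_skew hP0 (q := fun _ => prodw coin m) (fun _ => hc0)]
  have hsum : ∀ (q : Fin m → Ω × Ω) (c : Fin m → Bool), ∑ i, A (coinSel (q, c) i) =
      ∑ i, if c i then A (q i).1 else A (q i).2 := fun q c =>
    Finset.sum_congr rfl fun i _ => by simp only [coinSel]; split_ifs <;> rfl
  have hterm : ∀ q : Fin m → Ω × Ω, prodw (pairw ν pre) m q *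
      (Real.log ((univ.filter fun i => letter (q i).1 ≠ letter (q i).2).card + 1) / 2 -
        (Real.log geomZ + Real.log 2 * (3 + m * b ^ 2 / 4 ^ L / 4))) ≤
      prodw (pairw ν pre) m q * cent (prodw coin m)
        (fun c => (v - ∑ i, A (coinSel (q, c) i)) / 2 ^ k)
        (fun c => (v - ∑ i, A (coinSel (q, c) i)) / 2 ^ (k + L)) := by
    intro q
    rcases (hP0 q).eq_or_lt with h0 | h0
    · simp [← h0]
    refine mul_le_mul_of_nonneg_left ?_ h0.le
    have hq := fun i => pairw_pos_imp hν (prodw_pos_imp hπ h0 i)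
    simp only [hsum]
    have e1 := le_ent_coin (fun i => A (q i).1) (fun i => A (q i).2) k
      (univ.filter fun i => letter (q i).1 ≠ letter (q i).2)
      (fun i hi => hlow _ _ (hq i).1 (hq i).2.1 (hq i).2.2 (Finset.mem_filter.1 hi).2) v
    have e2 := ent_coin_le (fun i => A (q i).1) (fun i => A (q i).2) (k + L) v
      (b := m * b ^ 2 / 4 ^ L) (by
        calc ∑ i, ((A (q i).1 - A (q i).2 : ℤ) : ℝ) ^ 2 ≤ ∑ _i : Fin m, (b * 2 ^ k) ^ 2 := by
              refine Finset.sum_le_sum fun i _ => ?_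
              rw [← sq_abs]
              exact pow_le_pow_left₀ (abs_nonneg _)
                (hup _ _ (hq i).1 (hq i).2.1 (hq i).2.2) 2
          _ = m * (b * 2 ^ k) ^ 2 := by simp
          _ = m * b ^ 2 / 4 ^ L * 4 ^ (k + L) := by
              rw [mul_pow, ← pow_mul, mul_comm k 2, pow_mul, pow_add]
              norm_num
              field_simp)
    have e3 := ent_mono hc0
      (f := fun c : Fin m → Bool => ((v - ∑ i, if c i then A (q i).1 else A (q i).2) / 2 ^ k,
        (v - ∑ i, if c i then A (q i).1 else A (q i).2) / 2 ^ (k + L)))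
      (g := fun c => (v - ∑ i, if c i then A (q i).1 else A (q i).2) / 2 ^ k)
      (fun c c' h => (Prod.ext_iff.1 h).1)
    unfold cent
    linarith
  refine le_trans ?_ (Finset.sum_le_sum fun q _ => hterm q)
  have hs1 := sum_pairw (pre := pre) hν h1
  have := le_sum_log_card hπ hs1 (fun x => letter x.1 ≠ letter x.2) m hy hym
  simp only [mul_sub, Finset.sum_sub_distrib, mul_div_assoc']
  rw [← Finset.sum_mul, ← Finset.sum_div, sum_prodw hs1]
  linarith

end Low

theorem floor_le_of_le_add {x y d : ℝ} (h : x ≤ y + d) : ⌊x⌋ ≤ ⌊y⌋ + (⌈d⌉₊ : ℤ) := by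
  have h1 : x ≤ y + ((⌈d⌉₊ : ℤ) : ℝ) := by
    have := Nat.le_ceil d
    push_cast; linarith
  calc ⌊x⌋ ≤ ⌊y + ((⌈d⌉₊ : ℤ) : ℝ)⌋ := Int.floor_le_floor h1
    _ = _ := by rw [Int.floor_add_intCast]

theorem abs_sub_lt_of_floor_eq {x y : ℝ} (h : ⌊x⌋ = ⌊y⌋) : |x - y| < 1 :=
  Int.abs_sub_lt_one_of_floor_eq_floor h

section

variable {Ω : Type*} [Fintype Ω] {κ κ' : Type*} {p : Ω → ℝ}

/-- If a real quantity is determined up to `d` by `f'` and `g`, then its integer part has little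
more entropy than `f'`. -/
theorem cent_floor_le (hp : ∀ ω, 0 ≤ p ω) (x : Ω → ℝ) (f' : Ω → κ) (g : Ω → κ') (d : ℝ)
    (h : ∀ ω ω', g ω = g ω' → f' ω = f' ω' → x ω ≤ x ω' + d) :
    cent p (fun ω => ⌊x ω⌋) g ≤ cent p f' g + (∑ ω, p ω) * Real.log (⌈d⌉₊ + 1) :=
  cent_le_add_log hp _ f' g ⌈d⌉₊ fun ω ω' hg hf => floor_le_of_le_add (h ω ω' hg hf)

theorem ent_floor_le (hp : ∀ ω, 0 ≤ p ω) (h1 : ∑ ω, p ω = 1) (x : Ω → ℝ) (f' : Ω → κ) (d : ℝ)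
    (h : ∀ ω ω', f' ω = f' ω' → x ω ≤ x ω' + d) :
    ent p (fun ω => ⌊x ω⌋) ≤ ent p f' + Real.log (⌈d⌉₊ + 1) := by
  have := cent_floor_le hp x f' (fun _ => ()) d fun ω ω' _ => h ω ω'
  rwa [h1, one_mul, cent_unit h1, cent_unit h1] at this

/-- Conditioning additionally on a quantity with few values costs little. -/
theorem cent_le_cent_pair_add (hp : ∀ ω, 0 ≤ p ω) (x : Ω → ℝ) {ι : Type*} (f : Ω → ι) (g : Ω → κ)
    (d : ℝ) (h : ∀ ω ω', g ω = g ω' → x ω ≤ x ω' + d) :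
    cent p f g ≤ cent p f (fun ω => (⌊x ω⌋, g ω)) + (∑ ω, p ω) * Real.log (⌈d⌉₊ + 1) := by
  have h1 := cent_sub_le hp f g (fun ω => ⌊x ω⌋)
  have h2 := cent_le_of_diam hp (fun ω => ⌊x ω⌋) g ⌈d⌉₊
    fun ω ω' hg => floor_le_of_le_add (h ω ω' hg)
  linarith

end

/-- A homogeneous planar self-affine system, with linear parts `(r, 0; b w, α)` and translations
`(ξ w, c w)`. -/
structure Sys (W : Type*) where
  r : ℝ
  α : ℝ
  ξ : W → ℝ
  b : W → ℝ
  c : W → ℝ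
  r_pos : 0 < r
  r_le : r ≤ 1 / 2
  r_lt : r < α
  α_lt : α < 1

namespace Sys

variable {W : Type*} (S : Sys W)

theorem α_pos : 0 < S.α := S.r_pos.trans S.r_lt

/-- The action of the system on slopes. -/
noncomputable def T (w : W) (z : ℝ) : ℝ := (S.r * z - S.b w) / S.α

/-- The horizontal coordinate of a cylinder. -/
noncomputable def X : List W → ℝ
  | [] => 0
  | w :: l => S.ξ w + S.r * X l

/-- The projection of a cylinder along the direction of slope `z`. -/
noncomputable def V : ℝ → List W → ℝ
  | _, [] => 0
  | z, w :: l => S.c w - z * S.ξ w + S.α * V (S.T w z) l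

/-- The action of words on slopes. -/
noncomputable def Tl : ℝ → List W → ℝ
  | z, [] => z
  | z, w :: l => Tl (S.T w z) l

@[simp] theorem X_nil : S.X [] = 0 := rfl
@[simp] theorem X_cons (w : W) (l : List W) : S.X (w :: l) = S.ξ w + S.r * S.X l := rfl
@[simp] theorem V_nil (z : ℝ) : S.V z [] = 0 := rfl
@[simp] theorem V_cons (z : ℝ) (w : W) (l : List W) :
    S.V z (w :: l) = S.c w - z * S.ξ w + S.α * S.V (S.T w z) l := rfl
@[simp] theorem Tl_nil (z : ℝ) : S.Tl z [] = z := rfl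
@[simp] theorem Tl_cons (z : ℝ) (w : W) (l : List W) : S.Tl z (w :: l) = S.Tl (S.T w z) l := rfl

theorem X_append (l l' : List W) : S.X (l ++ l') = S.X l + S.r ^ l.length * S.X l' := by
  induction l with
  | nil => simp
  | cons w l ih => simp [ih, pow_succ]; ring

theorem V_append (z : ℝ) (l l' : List W) :
    S.V z (l ++ l') = S.V z l + S.α ^ l.length * S.V (S.Tl z l) l' := by
  induction l generalizing z with
  | nil => simp
  | cons w l ih => simp [ih, pow_succ]; ring

theorem T_add (w : W) (z a : ℝ) : S.T w (z + a) = S.T w z + S.r * a / S.α := by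
  unfold T; ring

theorem V_add (z a : ℝ) (l : List W) : S.V (z + a) l = S.V z l - a * S.X l := by
  induction l generalizing z a with
  | nil => simp
  | cons w l ih =>
    have := S.α_pos.ne'
    rw [V_cons, V_cons, X_cons, T_add, ih]
    field_simp
    ring

variable [Fintype W]

noncomputable def B : ℝ := ∑ w, (|S.ξ w| + |S.b w| + |S.c w|)

noncomputable def Z₀ : ℝ := S.B / (S.α - S.r)

noncomputable def R : ℝ := (S.B + S.Z₀ * S.B) / (1 - S.α) + 2 * S.B

theorem le_B (w : W) : |S.ξ w| + |S.b w| + |S.c w| ≤ S.B :=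
  Finset.single_le_sum (f := fun w => |S.ξ w| + |S.b w| + |S.c w|)
    (fun _ _ => by positivity) (mem_univ w)

theorem B_nonneg : 0 ≤ S.B := Finset.sum_nonneg fun _ _ => by positivity

theorem Z₀_nonneg : 0 ≤ S.Z₀ := div_nonneg S.B_nonneg (sub_nonneg.2 S.r_lt.le)

theorem R_nonneg : 0 ≤ S.R := by
  have := S.B_nonneg
  have := S.Z₀_nonneg
  have := S.α_lt
  unfold R
  have : 0 < 1 - S.α := by linarith
  positivity

/-- The invariant interval of slopes. -/
def K : Set ℝ := {z | |z| ≤ S.Z₀}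

theorem zero_mem_K : (0 : ℝ) ∈ S.K := by
  simp [K, S.Z₀_nonneg]

theorem T_mem {z : ℝ} (hz : z ∈ S.K) (w : W) : S.T w z ∈ S.K := by
  have hz : |z| ≤ S.Z₀ := hz
  have h1 := S.le_B w
  have h2 := S.r_lt
  have h3 : S.Z₀ * (S.α - S.r) = S.B := div_mul_cancel₀ _ (by linarith)
  change |S.T w z| ≤ S.Z₀
  unfold T
  rw [abs_div, abs_of_pos S.α_pos, div_le_iff₀ S.α_pos]
  have h4 : |S.r * z - S.b w| ≤ S.r * |z| + |S.b w| := by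
    refine (abs_sub _ _).trans ?_
    rw [abs_mul, abs_of_pos S.r_pos]
  have := abs_nonneg (S.ξ w)
  have := abs_nonneg (S.c w)
  nlinarith [S.r_pos]

theorem Tl_mem {z : ℝ} (hz : z ∈ S.K) (l : List W) : S.Tl z l ∈ S.K := by
  induction l generalizing z with
  | nil => exact hz
  | cons w l ih => exact ih (S.T_mem hz w)

theorem abs_V_le' {z : ℝ} (hz : z ∈ S.K) (l : List W) :
    |S.V z l| ≤ (S.B + S.Z₀ * S.B) / (1 - S.α) := by
  have hα : 0 < 1 - S.α := by linarith [S.α_lt]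
  induction l generalizing z with
  | nil =>
    have := S.B_nonneg; have := S.Z₀_nonneg
    simp; positivity
  | cons w l ih =>
    have h := ih (S.T_mem hz w)
    have hz : |z| ≤ S.Z₀ := hz
    have h1 := S.le_B w
    rw [le_div_iff₀ hα] at h ⊢
    have h2 : |S.V z (w :: l)| ≤ |S.c w| + |z| * |S.ξ w| + S.α * |S.V (S.T w z) l| := by
      rw [V_cons]
      refine (abs_add_le _ _).trans (add_le_add ((abs_sub _ _).trans ?_) ?_)
      · rw [abs_mul]
      · rw [abs_mul, abs_of_pos S.α_pos]
    have h3 : |S.c w| ≤ S.B := by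
      have := abs_nonneg (S.ξ w); have := abs_nonneg (S.b w); linarith
    have h4 : |S.ξ w| ≤ S.B := by
      have := abs_nonneg (S.c w); have := abs_nonneg (S.b w); linarith
    have h5 : |z| * |S.ξ w| ≤ S.Z₀ * S.B := mul_le_mul hz h4 (abs_nonneg _) S.Z₀_nonneg
    have h6 := mul_le_mul_of_nonneg_left h S.α_pos.le
    have h7 := mul_le_mul_of_nonneg_right h2 hα.le
    nlinarith

theorem abs_V_le {z : ℝ} (hz : z ∈ S.K) (l : List W) : |S.V z l| ≤ S.R := by
  have := S.abs_V_le' hz l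
  have := S.B_nonneg
  unfold R; linarith

theorem abs_X_le (l : List W) : |S.X l| ≤ S.R := by
  have : |S.X l| ≤ 2 * S.B := by
    have hB := S.B_nonneg
    induction l with
    | nil => simp [hB]
    | cons w l ih =>
      have h1 := S.le_B w
      have h2 := S.r_le
      have h3 : |S.X (w :: l)| ≤ |S.ξ w| + S.r * |S.X l| := by
        rw [X_cons]
        refine (abs_add_le _ _).trans ?_
        rw [abs_mul, abs_of_pos S.r_pos]
      have := abs_nonneg (S.b w); have := abs_nonneg (S.c w)
      have := mul_le_mul_of_nonneg_left ih S.r_pos.le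
      nlinarith
  have hB := S.B_nonneg; have := S.Z₀_nonneg
  have hα : 0 < 1 - S.α := by linarith [S.α_lt]
  have : 0 ≤ (S.B + S.Z₀ * S.B) / (1 - S.α) := by positivity
  unfold R; linarith

end Sys

/-- Uniform weights on words. -/
noncomputable def uw (W : Type*) [Fintype W] (n : ℕ) : (Fin n → W) → ℝ :=
  fun _ => (1 / Fintype.card W : ℝ) ^ n

section Words

variable {W : Type*} [Fintype W] {κ κ' : Type*}

theorem uw_nonneg {n : ℕ} (ω : Fin n → W) : 0 ≤ uw W n ω := by unfold uw; positivity

theorem uw_pos [Nonempty W] {n : ℕ} (ω : Fin n → W) : 0 < uw W n ω := by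
  have : 0 < Fintype.card W := Fintype.card_pos
  unfold uw; positivity

theorem sum_uw [Nonempty W] (n : ℕ) : ∑ ω, uw W n ω = 1 := by
  have : 0 < Fintype.card W := Fintype.card_pos
  simp only [uw, Finset.sum_const, Finset.card_univ, Fintype.card_fun, Fintype.card_fin,
    nsmul_eq_mul]
  push_cast
  rw [← mul_pow, mul_one_div_cancel (by positivity), one_pow]

theorem sum_uw_mul_const [Nonempty W] (n : ℕ) (a : ℝ) : ∑ ω, uw W n ω * a = a := by
  rw [← Finset.sum_mul, sum_uw, one_mul]

theorem uw_append {s t : ℕ} (u : Fin s → W) (v : Fin t → W) :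
    uw W (s + t) (Fin.append u v) = uw W s u * uw W t v := by
  simp [uw, pow_add]

/-- Sums over long words split. -/
theorem sum_append {s t : ℕ} (φ : (Fin (s + t) → W) → ℝ) :
    ∑ ω, uw W (s + t) ω * φ ω = ∑ u, uw W s u * ∑ v, uw W t v * φ (Fin.append u v) := by
  rw [← (Fin.appendEquiv s t).sum_comp, Fintype.sum_prod_type]
  refine Finset.sum_congr rfl fun u _ => ?_
  rw [Finset.mul_sum]
  refine Finset.sum_congr rfl fun v _ => ?_
  change uw W (s + t) (Fin.append u v) * φ (Fin.append u v) = _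
  rw [uw_append, mul_assoc]

/-- The first `i` letters of a word. -/
def pre {n : ℕ} (i : ℕ) (ω : Fin n → W) : List W := (List.ofFn ω).take i

theorem pre_append {s t : ℕ} (u : Fin s → W) (v : Fin t → W) :
    pre s (Fin.append u v) = List.ofFn u := by
  unfold pre
  rw [List.ofFn_fin_append, List.take_left']
  simp

theorem length_pre {n i : ℕ} (hi : i ≤ n) (ω : Fin n → W) : (pre i ω).length = i := by
  simp [pre, hi]

theorem pre_eq_of_le {n i j : ℕ} (hij : i ≤ j) {ω ω' : Fin n → W} (h : pre j ω = pre j ω') :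
    pre i ω = pre i ω' := by
  have := congrArg (List.take i) h
  simpa [pre, List.take_take, hij] using this

theorem ofFn_eq_pre_append {n : ℕ} (i : ℕ) (ω : Fin n → W) :
    List.ofFn ω = pre i ω ++ (List.ofFn ω).drop i := (List.take_append_drop i _).symm

theorem cent_append {s t : ℕ} (f : (Fin (s + t) → W) → κ) (g : (Fin (s + t) → W) → κ') :
    cent (uw W (s + t)) f (fun ω => (g ω, pre s ω)) =
      ∑ u, uw W s u * cent (uw W t) (fun v => f (Fin.append u v))
        (fun v => g (Fin.append u v)) := by
  rw [cent_equiv (Fin.appendEquiv s t),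
    ← cent_skew (p := uw W s) (q := fun _ => uw W t) uw_nonneg (fun _ => uw_nonneg)
      (fun x => f (Fin.append x.1 x.2)) (fun x => g (Fin.append x.1 x.2))]
  have : (fun x : (Fin s → W) × (Fin t → W) => uw W (s + t) (Fin.appendEquiv s t x)) =
      fun x => uw W s x.1 * uw W t x.2 := funext fun x => uw_append x.1 x.2
  rw [this]
  refine cent_congr (fun x x' => ?_) (fun x x' _ => Iff.rfl)
  change (_, pre s (Fin.append x.1 x.2)) = (_, pre s (Fin.append x'.1 x'.2)) ↔ _
  rw [pre_append, pre_append]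
  simp only [Prod.mk.injEq, List.ofFn_inj]
  rfl

theorem ent_append [Nonempty W] {s t : ℕ} (f : (Fin (s + t) → W) → κ) :
    cent (uw W (s + t)) f (pre s) =
      ∑ u, uw W s u * ent (uw W t) (fun v => f (Fin.append u v)) := by
  have := cent_append f (fun _ : Fin (s + t) → W => ())
  simp only [cent_unit (sum_uw t)] at this
  rw [← this]
  exact cent_congr (fun _ _ => by simp) (fun _ _ _ => Iff.rfl)

theorem ent_pre_comp [Nonempty W] {s t : ℕ} (f : List W → κ) :
    ent (uw W (s + t)) (fun ω => f (pre s ω)) = ent (uw W s) (fun u => f (List.ofFn u)) := by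
  classical
  rw [ent_map (p := uw W s) (uw W (s + t)) (fun ω i => ω (Fin.castAdd t i))]
  · refine ent_congr fun ω ω' => ?_
    have h : ∀ ω : Fin (s + t) → W, pre s ω = List.ofFn fun i => ω (Fin.castAdd t i) := by
      intro ω
      obtain ⟨⟨u, v⟩, rfl⟩ := (Fin.appendEquiv s t).surjective ω
      change pre s (Fin.append u v) = List.ofFn fun i => Fin.append u v (Fin.castAdd t i)
      rw [pre_append]
      simp
    rw [h, h]
  · intro u
    have := sum_append (s := s) (t := t)
      (fun ω : Fin (s + t) → W => if (fun i => ω (Fin.castAdd t i)) = u then 1 else 0)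
    simp only [Fin.append_left, mul_ite, mul_one, mul_zero] at this
    have h : ∀ x : Fin s → W, (∑ v : Fin t → W, if (fun i => x i) = u then uw W t v else 0) =
        if x = u then 1 else 0 := by
      intro x
      by_cases hx : x = u
      · simp [hx, sum_uw]
      · simp [hx]
    simp only [h] at this
    simp only [mul_ite, mul_one, mul_zero, Finset.sum_ite_eq', Finset.mem_univ, if_true] at this
    rw [← this]
    exact Finset.sum_congr rfl fun _ _ => by congr!

end Words

namespace Sys

variable {W : Type*} [Fintype W] [Nonempty W] (S : Sys W)

/-- The cell of size `δ` containing the projection of a word. -/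
noncomputable def cell (δ z : ℝ) {n : ℕ} (ω : Fin n → W) : ℤ := ⌊S.V z (List.ofFn ω) / δ⌋

/-- Entropy of the projection of words of length `n` at scale `α ^ n`. -/
noncomputable def H (n : ℕ) (z : ℝ) : ℝ := ent (uw W n) (S.cell (S.α ^ n) z)

/-- A bound for the entropy of an integer variable with bounded oscillation. -/
noncomputable def e₀ : ℝ := Real.log (⌈2 * S.R + 2⌉₊ + 1)

theorem log_ceil_le_e₀ {d : ℝ} (hd : d ≤ 2 * S.R + 2) : Real.log (⌈d⌉₊ + 1) ≤ S.e₀ := by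
  have : (⌈d⌉₊ : ℝ) ≤ ⌈2 * S.R + 2⌉₊ := by exact_mod_cast Nat.ceil_le_ceil hd
  exact Real.log_le_log (by positivity) (by linarith)

theorem e₀_nonneg : 0 ≤ S.e₀ := Real.log_nonneg (by
  have : (0 : ℝ) ≤ ⌈2 * S.R + 2⌉₊ := Nat.cast_nonneg _
  linarith)

theorem abs_V_sub_pre {n i : ℕ} (hi : i ≤ n) {z : ℝ} (hz : z ∈ S.K) (ω : Fin n → W) :
    |S.V z (List.ofFn ω) - S.V z (pre i ω)| ≤ S.α ^ i * S.R := by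
  have : 0 < S.α ^ i := pow_pos S.α_pos i
  rw [ofFn_eq_pre_append i, V_append, length_pre hi, add_sub_cancel_left, abs_mul,
    abs_of_pos this]
  exact mul_le_mul_of_nonneg_left (S.abs_V_le (S.Tl_mem hz _) _) this.le

/-- Words with the same prefix have close projections. -/
theorem V_div_le_of_pre_eq {n i : ℕ} (hi : i ≤ n) {z : ℝ} (hz : z ∈ S.K) {ω ω' : Fin n → W}
    (h : pre i ω = pre i ω') {δ : ℝ} (hδ : S.α ^ i ≤ δ) :
    S.V z (List.ofFn ω) / δ ≤ S.V z (List.ofFn ω') / δ + 2 * S.R := by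
  have h0 : 0 < S.α ^ i := pow_pos S.α_pos i
  have hδ0 : 0 < δ := h0.trans_le hδ
  have h1 := abs_le.1 (S.abs_V_sub_pre hi hz ω)
  have h2 := abs_le.1 (S.abs_V_sub_pre hi hz ω')
  rw [h] at h1
  have h3 : S.α ^ i * S.R ≤ δ * S.R := mul_le_mul_of_nonneg_right hδ S.R_nonneg
  rw [div_add' _ _ _ hδ0.ne']
  exact div_le_div_of_nonneg_right (by linarith) hδ0.le

theorem le_ent_cell {s t : ℕ} {z : ℝ} (hz : z ∈ S.K) :
    S.H s z ≤ ent (uw W (s + t)) (S.cell (S.α ^ s) z) + S.e₀ := by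
  have h0 : 0 < S.α ^ s := pow_pos S.α_pos s
  have := ent_pre_comp (s := s) (t := t) (fun l : List W => ⌊S.V z l / S.α ^ s⌋)
  unfold H cell
  rw [← this]
  refine (ent_floor_le uw_nonneg (sum_uw _) (fun ω => S.V z (pre s ω) / S.α ^ s)
    (fun ω => ⌊S.V z (List.ofFn ω) / S.α ^ s⌋) (2 * S.R + 2) fun ω ω' h => ?_).trans
    (add_le_add_right (S.log_ceil_le_e₀ le_rfl) _)
  have h1 := abs_lt.1 (abs_sub_lt_of_floor_eq h)
  have h2 := abs_le.1 (S.abs_V_sub_pre (Nat.le_add_right s t) hz ω)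
  have h3 := abs_le.1 (S.abs_V_sub_pre (Nat.le_add_right s t) hz ω')
  rw [← sub_div, lt_div_iff₀ h0, div_lt_iff₀ h0] at h1
  rw [div_add' _ _ _ h0.ne']
  refine div_le_div_of_nonneg_right ?_ h0.le
  linarith

theorem V_append_div {s t : ℕ} (z : ℝ) (u : Fin s → W) (v : Fin t → W) :
    S.V z (List.ofFn (Fin.append u v)) / S.α ^ (s + t) =
      S.V z (List.ofFn u) / S.α ^ (s + t) + S.V (S.Tl z (List.ofFn u)) (List.ofFn v) / S.α ^ t := by
  have := S.α_pos.ne'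
  rw [List.ofFn_fin_append, V_append, List.length_ofFn, pow_add]
  field_simp

theorem cent_cell_pre_le {s t : ℕ} (z : ℝ) :
    cent (uw W (s + t)) (S.cell (S.α ^ (s + t)) z) (pre s) ≤
      (∑ u, uw W s u * S.H t (S.Tl z (List.ofFn u))) + S.e₀ := by
  rw [ent_append, ← sum_uw_mul_const (W := W) s S.e₀, ← Finset.sum_add_distrib]
  refine Finset.sum_le_sum fun u _ => ?_
  rw [← mul_add]
  refine mul_le_mul_of_nonneg_left ?_ (uw_nonneg u)
  refine (ent_floor_le uw_nonneg (sum_uw _)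
    (fun v => S.V z (List.ofFn (Fin.append u v)) / S.α ^ (s + t))
    (S.cell (S.α ^ t) (S.Tl z (List.ofFn u))) 1 fun ω ω' h => ?_).trans
    (add_le_add_right (S.log_ceil_le_e₀ (by linarith [S.R_nonneg])) _)
  have h1 := abs_lt.1 (abs_sub_lt_of_floor_eq h)
  rw [V_append_div, V_append_div]
  linarith

theorem le_cent_cell_pre {s t : ℕ} (z : ℝ) :
    (∑ u, uw W s u * S.H t (S.Tl z (List.ofFn u))) ≤
      cent (uw W (s + t)) (S.cell (S.α ^ (s + t)) z) (pre s) + S.e₀ := by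
  rw [ent_append, ← sum_uw_mul_const (W := W) s S.e₀, ← Finset.sum_add_distrib]
  refine Finset.sum_le_sum fun u _ => ?_
  rw [← mul_add]
  refine mul_le_mul_of_nonneg_left ?_ (uw_nonneg u)
  refine (ent_floor_le uw_nonneg (sum_uw _)
    (fun v => S.V (S.Tl z (List.ofFn u)) (List.ofFn v) / S.α ^ t)
    (fun v => S.cell (S.α ^ (s + t)) z (Fin.append u v)) 1 fun ω ω' h => ?_).trans
    (add_le_add_right (S.log_ceil_le_e₀ (by linarith [S.R_nonneg])) _)
  have h1 := abs_lt.1 (abs_sub_lt_of_floor_eq h)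
  rw [V_append_div, V_append_div] at h1
  linarith

/-- Splitting the entropy of a fine cell along a coarse cell. -/
theorem ent_cell_add_cent_le {n : ℕ} {δ δ' : ℝ} (hδ : 0 < δ) (hδ' : δ ≤ δ') (z : ℝ) :
    ent (uw W n) (S.cell δ' z) + cent (uw W n) (S.cell δ z) (S.cell δ' z) ≤
      ent (uw W n) (S.cell δ z) + S.e₀ := by
  have h1 := cent_floor_le (p := uw W n) uw_nonneg (fun ω => S.V z (List.ofFn ω) / δ')
    (fun _ => ()) (S.cell δ z) 1 fun ω ω' h _ => by
      have h1 := abs_lt.1 (abs_sub_lt_of_floor_eq h)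
      rw [← sub_div, lt_div_iff₀ hδ, div_lt_iff₀ hδ] at h1
      have hδ0 := hδ.trans_le hδ'
      rw [div_add' _ _ _ hδ0.ne']
      exact div_le_div_of_nonneg_right (by linarith) hδ0.le
  rw [cent_eq_zero (f := fun _ => ()) (fun _ _ _ => rfl), sum_uw] at h1
  have h2 := S.log_ceil_le_e₀ (d := 1) (by linarith [S.R_nonneg])
  have h3 : cent (uw W n) (S.cell δ' z) (S.cell δ z) ≤ S.e₀ := by
    rw [zero_add, one_mul] at h1
    exact h1.trans h2
  unfold cent at h3 ⊢
  have h4 : ent (uw W n) (fun ω => (S.cell δ' z ω, S.cell δ z ω)) =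
      ent (uw W n) (fun ω => (S.cell δ z ω, S.cell δ' z ω)) :=
    ent_congr fun _ _ => by simp [and_comm]
  linarith

/-- Given a prefix, a cell at the scale of the prefix is almost determined. -/
theorem cent_le_cent_cell_pre {n i : ℕ} (hi : i ≤ n) {z : ℝ} (hz : z ∈ S.K) {κ κ' : Type*}
    {p : (Fin n → W) → ℝ} (hp : ∀ ω, 0 ≤ p ω)
    (f : (Fin n → W) → κ) (g : (Fin n → W) → κ') (hg : ∀ ω ω', g ω = g ω' → pre i ω = pre i ω')
    {δ : ℝ} (hδ : S.α ^ i ≤ δ) :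
    cent p f g ≤ cent p f (fun ω => (S.cell δ z ω, g ω)) + (∑ ω, p ω) * S.e₀ := by
  refine (cent_le_cent_pair_add hp (fun ω => S.V z (List.ofFn ω) / δ) f g (2 * S.R)
    fun ω ω' h => S.V_div_le_of_pre_eq hi hz (hg _ _ h) hδ).trans ?_
  have := mul_le_mul_of_nonneg_left (S.log_ceil_le_e₀ (d := 2 * S.R) (by linarith))
    (Finset.sum_nonneg fun ω (_ : ω ∈ univ) => hp ω)
  unfold cell
  linarith

/-- The entropies are almost superadditive. -/
theorem H_superadd (s t : ℕ) {z : ℝ} (hz : z ∈ S.K) :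
    S.H s z + ∑ u, uw W s u * S.H t (S.Tl z (List.ofFn u)) ≤ S.H (s + t) z + 4 * S.e₀ := by
  have hαs : S.α ^ (s + t) ≤ S.α ^ s :=
    pow_le_pow_of_le_one S.α_pos.le S.α_lt.le (Nat.le_add_right s t)
  have h1 := S.ent_cell_add_cent_le (n := s + t) (pow_pos S.α_pos (s + t)) hαs z
  have h2 := S.le_ent_cell (s := s) (t := t) hz
  have h3 := S.le_cent_cell_pre (s := s) (t := t) z
  have h4 := S.cent_le_cent_cell_pre (Nat.le_add_right s t) hz (p := uw W (s + t)) uw_nonneg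
    (S.cell (S.α ^ (s + t)) z) (pre s) (fun _ _ h => h) le_rfl
  have h5 := cent_pair_le (p := uw W (s + t)) uw_nonneg (S.cell (S.α ^ (s + t)) z)
    (S.cell (S.α ^ s) z) (pre s)
  rw [sum_uw] at h4
  unfold H at *
  linarith

theorem H_nonneg (n : ℕ) (z : ℝ) : 0 ≤ S.H n z := by
  unfold H
  rw [← cent_unit (sum_uw n)]
  exact cent_nonneg uw_nonneg _ _

theorem ent_id_uw (n : ℕ) : ent (uw W n) id = n * Real.log (Fintype.card W) := by
  unfold ent
  simp only [mass_id]
  have : ∀ ω : Fin n → W, Real.log (uw W n ω) = -(n * Real.log (Fintype.card W)) := by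
    intro ω
    rw [uw, Real.log_pow, one_div, Real.log_inv]; ring
  simp only [this]
  rw [sum_uw_mul_const, neg_neg]

theorem H_le (n : ℕ) (z : ℝ) : S.H n z ≤ n * Real.log (Fintype.card W) := by
  rw [← ent_id_uw]
  exact ent_mono uw_nonneg fun ω ω' h => by rw [show ω = ω' from h]

instance : Nonempty S.K := ⟨⟨0, S.zero_mem_K⟩⟩

/-- The least entropy over invariant slopes. -/
noncomputable def h (n : ℕ) : ℝ := ⨅ z : S.K, S.H n z

theorem h_le (n : ℕ) {z : ℝ} (hz : z ∈ S.K) : S.h n ≤ S.H n z :=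
  ciInf_le (f := fun z : S.K => S.H n z) ⟨0, by rintro _ ⟨z, rfl⟩; exact S.H_nonneg n z⟩ ⟨z, hz⟩

theorem h_nonneg (n : ℕ) : 0 ≤ S.h n := le_ciInf fun z => S.H_nonneg n z

theorem exists_H_le (n : ℕ) : ∃ z ∈ S.K, S.H n z ≤ S.h n + 1 := by
  obtain ⟨z, hz⟩ := exists_lt_of_ciInf_lt (show S.h n < S.h n + 1 by linarith)
  exact ⟨z, z.2, hz.le⟩

theorem h_superadd (s t : ℕ) : S.h s + S.h t ≤ S.h (s + t) + 4 * S.e₀ := by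
  suffices S.h s + S.h t - 4 * S.e₀ ≤ S.h (s + t) by linarith
  refine le_ciInf fun z => ?_
  have h1 := S.H_superadd s t z.2
  have h2 := S.h_le s z.2
  have h3 : S.h t ≤ ∑ u, uw W s u * S.H t (S.Tl z (List.ofFn u)) := by
    rw [← sum_uw_mul_const (W := W) s (S.h t)]
    exact Finset.sum_le_sum fun u _ => mul_le_mul_of_nonneg_left
      (S.h_le t (S.Tl_mem z.2 _)) (uw_nonneg u)
  linarith

theorem subadditive_h : Subadditive fun n => 4 * S.e₀ - S.h n := fun s t => by
  have := S.h_superadd s t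
  linarith

/-- The entropy rate. -/
noncomputable def β : ℝ := -S.subadditive_h.lim

theorem bddBelow_h : BddBelow (Set.range fun n : ℕ => (4 * S.e₀ - S.h n) / n) := by
  refine ⟨-Real.log (Fintype.card W), ?_⟩
  rintro _ ⟨n, rfl⟩
  have h0 := S.e₀_nonneg
  have h1 := (S.h_le n S.zero_mem_K).trans (S.H_le n 0)
  have hN : 0 ≤ Real.log (Fintype.card W) := Real.log_natCast_nonneg _
  rcases n.eq_zero_or_pos with rfl | hn
  · simp [hN]
  · have : (0 : ℝ) < n := by exact_mod_cast hn
    simp only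
    rw [le_div_iff₀ this]
    linarith

theorem h_le_β (n : ℕ) : S.h n ≤ S.β * n + 4 * S.e₀ := by
  rcases n.eq_zero_or_pos with rfl | hn
  · have h1 := (S.h_le 0 S.zero_mem_K).trans (S.H_le 0 0)
    have := S.e₀_nonneg
    simp at h1 ⊢; linarith
  · have h1 := S.subadditive_h.lim_le_div S.bddBelow_h hn.ne'
    have : (0 : ℝ) < n := by exact_mod_cast hn
    rw [le_div_iff₀ this] at h1
    unfold β
    linarith

theorem exists_le_H {ε : ℝ} (hε : 0 < ε) :
    ∃ n₀ : ℕ, ∀ n ≥ n₀, ∀ z ∈ S.K, (S.β - ε) * n ≤ S.H n z := by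
  have h1 := S.subadditive_h.tendsto_lim S.bddBelow_h
  have h2 := h1.eventually (gt_mem_nhds (show S.subadditive_h.lim < S.subadditive_h.lim + ε by
    linarith))
  obtain ⟨n₀, hn₀⟩ := Filter.eventually_atTop.1 h2
  refine ⟨n₀ + 1, fun n hn z hz => ?_⟩
  have h3 := hn₀ n (by lia)
  have : (0 : ℝ) < n := by exact_mod_cast (by lia : 0 < n)
  rw [div_lt_iff₀ this] at h3
  have h4 := S.h_le n hz
  have h5 := S.e₀_nonneg
  unfold β
  linarith

theorem exists_const_le_H {ε : ℝ} (hε : 0 < ε) :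
    ∃ C : ℝ, 0 ≤ C ∧ ∀ n, ∀ z ∈ S.K, (S.β - ε) * n ≤ S.H n z + C := by
  obtain ⟨n₀, hn₀⟩ := S.exists_le_H hε
  refine ⟨|S.β - ε| * n₀, by positivity, fun n z hz => ?_⟩
  rcases le_total n₀ n with h | h
  · have := hn₀ n h z hz
    have : 0 ≤ |S.β - ε| * n₀ := by positivity
    linarith
  · have h1 := S.H_nonneg n z
    have h2 : (n : ℝ) ≤ n₀ := by exact_mod_cast h
    have h3 : (S.β - ε) * n ≤ |S.β - ε| * n₀ :=
      (mul_le_mul_of_nonneg_right (le_abs_self _) n.cast_nonneg).trans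
        (mul_le_mul_of_nonneg_left h2 (abs_nonneg _))
    linarith

theorem β_nonneg : 0 ≤ S.β := by
  by_contra! hneg
  have h1 : ∀ n : ℕ, 0 ≤ S.β * n + 4 * S.e₀ := fun n => (S.h_nonneg n).trans (S.h_le_β n)
  obtain ⟨n, hn⟩ := exists_nat_gt (4 * S.e₀ / -S.β)
  rw [div_lt_iff₀ (by linarith)] at hn
  have := h1 n
  linarith

/-- Near-minimal slopes have near-minimal children. -/
theorem exists_H_T_le {ε : ℝ} (hε : 0 < ε) :
    ∃ n₀ : ℕ, ∀ n ≥ n₀, ∃ z ∈ S.K, ∀ w, S.H n (S.T w z) ≤ (S.β + ε) * n := by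
  classical
  set N : ℝ := (Fintype.card W : ℝ) with hN
  have hN0 : 1 ≤ N := by
    have : 1 ≤ Fintype.card W := Fintype.card_pos
    rw [hN]; exact_mod_cast this
  obtain ⟨n₁, hn₁⟩ := S.exists_le_H (show 0 < ε / (2 * N) by positivity)
  obtain ⟨n₂, hn₂⟩ := exists_nat_gt (2 * N * (S.β + 8 * S.e₀ + 1) / ε)
  refine ⟨max n₁ n₂, fun n hn => ?_⟩
  obtain ⟨z, hz, hzH⟩ := S.exists_H_le (1 + n)
  refine ⟨z, hz, fun w => ?_⟩
  have h1 := S.H_superadd 1 n hz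
  have h2 := S.h_le_β (1 + n)
  have h3 := S.H_nonneg 1 z
  have h4 : ∑ u : Fin 1 → W, uw W 1 u * S.H n (S.Tl z (List.ofFn u)) =
      ∑ w, (1 / N) * S.H n (S.T w z) := by
    rw [← (Equiv.funUnique (Fin 1) W).symm.sum_comp]
    refine Finset.sum_congr rfl fun w _ => ?_
    simp [uw, hN]
  have h5 : ∀ w', (S.β - ε / (2 * N)) * n ≤ S.H n (S.T w' z) := fun w' =>
    hn₁ n ((le_max_left _ _).trans hn) _ (S.T_mem hz w')
  have h6 : (N - 1) * ((S.β - ε / (2 * N)) * n) + S.H n (S.T w z) ≤ ∑ w, S.H n (S.T w z) := by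
    rw [← Finset.add_sum_erase _ _ (mem_univ w), add_comm]
    refine add_le_add_right ?_ _
    have := Finset.card_nsmul_le_sum (univ.erase w) (fun w' => S.H n (S.T w' z)) _
      fun w' _ => h5 w'
    rw [nsmul_eq_mul, Finset.card_erase_of_mem (mem_univ w), Finset.card_univ,
      Nat.cast_sub Fintype.card_pos] at this
    simpa [hN] using this
  rw [h4, ← Finset.mul_sum] at h1
  push_cast at h2
  have h7 : 2 * N * (S.β + 8 * S.e₀ + 1) < n * ε := by
    have h8 : (n₂ : ℝ) ≤ n := by exact_mod_cast (le_max_right _ _).trans hn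
    rw [div_lt_iff₀ hε] at hn₂
    nlinarith
  have h8 : 1 / N * ∑ w, S.H n (S.T w z) ≤ S.β * (1 + n) + 8 * S.e₀ + 1 := by linarith
  rw [one_div, inv_mul_le_iff₀ (by linarith)] at h8
  have h9 : (N - 1) * ((S.β - ε / (2 * N)) * n) =
      N * S.β * n - S.β * n - ε * n / 2 + ε / (2 * N) * n := by
    field_simp
    ring
  have h10 : 0 ≤ ε / (2 * N) * n := by positivity
  nlinarith

end Sys

theorem sum_div_le_one_of_le {ι : Type*} (s : Finset ι) (p N : ι → ℝ) (hp : ∀ i ∈ s, 0 < p i)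
    (h : ∀ i ∈ s, ∑ j ∈ s, p j ≤ N i) : ∑ i ∈ s, p i / N i ≤ 1 := by
  rcases s.eq_empty_or_nonempty with rfl | hs
  · simp
  have hpos : 0 < ∑ j ∈ s, p j := Finset.sum_pos hp hs
  calc ∑ i ∈ s, p i / N i ≤ ∑ i ∈ s, p i / ∑ j ∈ s, p j :=
        Finset.sum_le_sum fun i hi => div_le_div_of_nonneg_left (hp i hi).le hpos (h i hi)
    _ = 1 := by rw [← Finset.sum_div, div_self hpos.ne']

namespace Sys

variable {W : Type*} [Fintype W] [Nonempty W] (S : Sys W)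

/-- The radius of neighbourhoods, in units of `α ^ n`. -/
noncomputable def D : ℝ := (2 * S.R + 1) / (1 - S.α)

theorem D_mul : S.D * (1 - S.α) = 2 * S.R + 1 :=
  div_mul_cancel₀ _ (by linarith [S.α_lt])

theorem le_D : 2 * S.R + 1 ≤ S.D := by
  have h1 := S.D_mul
  have h2 := S.R_nonneg
  have h3 := S.α_pos
  have h4 := S.α_lt
  have h5 : 0 ≤ S.D := div_nonneg (by linarith) (by linarith)
  nlinarith

/-- The proportion of words of length `n` whose projection is close to that of a given word. -/
noncomputable def NN (n : ℕ) (z : ℝ) (ω : Fin n → W) : ℝ :=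
  ∑ ω' : Fin n → W, if |S.V z (List.ofFn ω') - S.V z (List.ofFn ω)| ≤ S.D * S.α ^ n
    then uw W n ω' else 0

theorem le_NN (n : ℕ) (z : ℝ) (ω : Fin n → W) : uw W n ω ≤ S.NN n z ω := by
  have h := Finset.single_le_sum (f := fun ω' : Fin n → W =>
    if |S.V z (List.ofFn ω') - S.V z (List.ofFn ω)| ≤ S.D * S.α ^ n then uw W n ω' else 0)
    (fun ω' _ => by split_ifs; exacts [uw_nonneg _, le_rfl]) (mem_univ ω)
  have h1 := S.le_D
  have h2 := S.R_nonneg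
  have h3 : 0 < S.α ^ n := pow_pos S.α_pos n
  simp only [sub_self, abs_zero] at h
  rwa [if_pos (by nlinarith)] at h

theorem NN_pos (n : ℕ) (z : ℝ) (ω : Fin n → W) : 0 < S.NN n z ω :=
  (uw_pos ω).trans_le (S.le_NN n z ω)

theorem NN_le_one (n : ℕ) (z : ℝ) (ω : Fin n → W) : S.NN n z ω ≤ 1 := by
  rw [← sum_uw (W := W) n]
  exact Finset.sum_le_sum fun ω' _ => by split_ifs; exacts [le_rfl, uw_nonneg _]

theorem abs_V_sub_le_of_append {s t : ℕ} (ht : 1 ≤ t) {z : ℝ} (hz : z ∈ S.K) {u u' : Fin s → W}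
    {v v' : Fin t → W}
    (h : |S.V z (List.ofFn (Fin.append u' v')) - S.V z (List.ofFn (Fin.append u v))| ≤
      S.D * S.α ^ (s + t)) :
    |S.V z (List.ofFn u') - S.V z (List.ofFn u)| ≤ S.D * S.α ^ s := by
  have h1 := S.abs_V_sub_pre (Nat.le_add_right s t) hz (Fin.append u v)
  have h2 := S.abs_V_sub_pre (Nat.le_add_right s t) hz (Fin.append u' v')
  rw [pre_append] at h1 h2
  have h3 : 0 < S.α ^ s := pow_pos S.α_pos s
  have h4 : S.D * S.α ^ (s + t) ≤ S.D * S.α ^ s * S.α := by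
    rw [pow_add, mul_assoc S.D]
    have h5 : S.α ^ t ≤ S.α := by
      simpa using pow_le_pow_of_le_one S.α_pos.le S.α_lt.le ht
    have := S.le_D; have := S.R_nonneg
    gcongr
    linarith
  have h6 := S.D_mul
  have h7 : S.D * S.α ^ s * S.α + 2 * S.R * S.α ^ s ≤ S.D * S.α ^ s := by
    nlinarith
  rw [abs_le] at *
  constructor <;> linarith

theorem NN_append_le {s t : ℕ} (ht : 1 ≤ t) {z : ℝ} (hz : z ∈ S.K) (u : Fin s → W)
    (v : Fin t → W) : S.NN (s + t) z (Fin.append u v) ≤ S.NN s z u := by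
  have h := sum_append (s := s) (t := t) (W := W) fun ω' =>
    if |S.V z (List.ofFn ω') - S.V z (List.ofFn (Fin.append u v))| ≤ S.D * S.α ^ (s + t)
    then 1 else 0
  simp only [mul_ite, mul_one, mul_zero] at h
  unfold NN
  rw [h]
  refine Finset.sum_le_sum fun u' _ => ?_
  split_ifs with hu
  · refine mul_le_of_le_one_right (uw_nonneg _) ?_
    rw [← sum_uw (W := W) t]
    exact Finset.sum_le_sum fun ω' _ => by split_ifs; exacts [le_rfl, uw_nonneg _]
  · rw [Finset.sum_eq_zero, mul_zero]
    intro v' _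
    rw [if_neg]
    exact fun h => hu (S.abs_V_sub_le_of_append ht hz h)

theorem sum_near_div_NN_le (t : ℕ) (z y : ℝ) :
    ∑ v, (if |S.V z (List.ofFn v) - y| ≤ S.D * S.α ^ t then uw W t v / S.NN t z v else 0) ≤ 2 := by
  classical
  have key : ∀ s : Finset (Fin t → W), (∀ v ∈ s, ∀ v' ∈ s,
      |S.V z (List.ofFn v') - S.V z (List.ofFn v)| ≤ S.D * S.α ^ t) →
      ∑ v ∈ s, uw W t v / S.NN t z v ≤ 1 := by
    intro s hs
    refine sum_div_le_one_of_le s _ _ (fun v _ => uw_pos v) fun v hv => ?_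
    unfold NN
    rw [← Finset.sum_filter]
    refine Finset.sum_le_sum_of_subset_of_nonneg (fun v' hv' => ?_) fun _ _ _ => uw_nonneg _
    exact Finset.mem_filter.2 ⟨mem_univ _, hs v hv v' hv'⟩
  rw [← Finset.sum_filter, ← Finset.sum_filter_add_sum_filter_not _
    (fun v => S.V z (List.ofFn v) ≤ y)]
  have h1 := key ((univ.filter fun v => |S.V z (List.ofFn v) - y| ≤ S.D * S.α ^ t).filter
    fun v => S.V z (List.ofFn v) ≤ y) (by
      intro v hv v' hv'
      simp only [Finset.mem_filter, Finset.mem_univ, true_and, abs_le] at hv hv' ⊢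
      constructor <;> linarith [hv.1.1, hv.1.2, hv'.1.1, hv'.1.2])
  have h2 := key ((univ.filter fun v => |S.V z (List.ofFn v) - y| ≤ S.D * S.α ^ t).filter
    fun v => ¬ S.V z (List.ofFn v) ≤ y) (by
      intro v hv v' hv'
      simp only [Finset.mem_filter, Finset.mem_univ, true_and, abs_le, not_le] at hv hv' ⊢
      constructor <;> linarith [hv.1.1, hv.1.2, hv'.1.1, hv'.1.2])
  linarith

theorem sum_NN_append_div_le {s t : ℕ} (ht : 1 ≤ t) {z : ℝ} (hz : z ∈ S.K) (u : Fin s → W) :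
    ∑ v, uw W t v * (S.NN (s + t) z (Fin.append u v) / S.NN t (S.Tl z (List.ofFn u)) v) ≤
      2 * S.NN s z u := by
  have hαs : 0 < S.α ^ s := pow_pos S.α_pos s
  set z' := S.Tl z (List.ofFn u) with hz'
  let y : (Fin s → W) → (Fin t → W) → ℝ := fun u' v' =>
    (S.V z (List.ofFn u') + S.α ^ s * S.V (S.Tl z (List.ofFn u')) (List.ofFn v') -
      S.V z (List.ofFn u)) / S.α ^ s
  have hiff : ∀ (u' : Fin s → W) (v' v : Fin t → W), |S.V z (List.ofFn (Fin.append u' v')) -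
      S.V z (List.ofFn (Fin.append u v))| ≤ S.D * S.α ^ (s + t) →
      |S.V z' (List.ofFn v) - y u' v'| ≤ S.D * S.α ^ t := by
    intro u' v' v h
    rw [List.ofFn_fin_append, List.ofFn_fin_append, V_append, V_append, List.length_ofFn,
      List.length_ofFn, pow_add] at h
    have e : S.V z' (List.ofFn v) - y u' v' = -((S.V z (List.ofFn u') +
      S.α ^ s * S.V (S.Tl z (List.ofFn u')) (List.ofFn v') -
      (S.V z (List.ofFn u) + S.α ^ s * S.V z' (List.ofFn v))) / S.α ^ s) := by
      simp only [y]; field_simp; ring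
    rw [e, abs_neg, abs_div, abs_of_pos hαs, div_le_iff₀ hαs]
    linarith
  have hNN : ∀ v, S.NN (s + t) z (Fin.append u v) ≤ ∑ u', uw W s u' *
      ∑ v', (if |S.V z (List.ofFn u') - S.V z (List.ofFn u)| ≤ S.D * S.α ^ s then
        uw W t v' * (if |S.V z' (List.ofFn v) - y u' v'| ≤ S.D * S.α ^ t then 1 else 0)
        else 0) := by
    intro v
    have h := sum_append (s := s) (t := t) (W := W) fun ω' =>
      if |S.V z (List.ofFn ω') - S.V z (List.ofFn (Fin.append u v))| ≤ S.D * S.α ^ (s + t)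
      then 1 else 0
    simp only [mul_ite, mul_one, mul_zero] at h
    unfold NN
    rw [h]
    refine Finset.sum_le_sum fun u' _ => mul_le_mul_of_nonneg_left
      (Finset.sum_le_sum fun v' _ => ?_) (uw_nonneg _)
    by_cases hc : |S.V z (List.ofFn (Fin.append u' v')) -
      S.V z (List.ofFn (Fin.append u v))| ≤ S.D * S.α ^ (s + t)
    · rw [if_pos hc, if_pos (S.abs_V_sub_le_of_append ht hz hc), if_pos (hiff _ _ _ hc), mul_one]
    · rw [if_neg hc]
      have := uw_nonneg v'
      split_ifs <;> simp [this]
  have hpos := S.NN_pos t z'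
  calc _ ≤ ∑ v, uw W t v * ((∑ u', uw W s u' *
      ∑ v', (if |S.V z (List.ofFn u') - S.V z (List.ofFn u)| ≤ S.D * S.α ^ s then
        uw W t v' * (if |S.V z' (List.ofFn v) - y u' v'| ≤ S.D * S.α ^ t then 1 else 0)
        else 0)) / S.NN t z' v) := by
        refine Finset.sum_le_sum fun v _ => mul_le_mul_of_nonneg_left ?_ (uw_nonneg _)
        exact div_le_div_of_nonneg_right (hNN v) (hpos v).le
    _ = ∑ u', (if |S.V z (List.ofFn u') - S.V z (List.ofFn u)| ≤ S.D * S.α ^ s then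
          uw W s u' * ∑ v', uw W t v' * ∑ v,
            (if |S.V z' (List.ofFn v) - y u' v'| ≤ S.D * S.α ^ t then
              uw W t v / S.NN t z' v else 0) else 0) := by
        simp only [Finset.sum_div, Finset.mul_sum]
        rw [Finset.sum_comm]
        refine Finset.sum_congr rfl fun u' _ => ?_
        split_ifs with hu
        · rw [Finset.sum_comm]
          refine Finset.sum_congr rfl fun v' _ => ?_
          refine Finset.sum_congr rfl fun v _ => ?_
          split_ifs <;> ring
        · simp
    _ ≤ ∑ u', (if |S.V z (List.ofFn u') - S.V z (List.ofFn u)| ≤ S.D * S.α ^ s then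
          uw W s u' * 2 else 0) := by
        refine Finset.sum_le_sum fun u' _ => ?_
        split_ifs with hu
        · refine mul_le_mul_of_nonneg_left ?_ (uw_nonneg _)
          rw [← sum_uw_mul_const (W := W) t 2]
          exact Finset.sum_le_sum fun v' _ => mul_le_mul_of_nonneg_left
            (S.sum_near_div_NN_le t z' _) (uw_nonneg _)
        · exact le_rfl
    _ = _ := by
        unfold NN
        rw [Finset.mul_sum]
        refine Finset.sum_congr rfl fun u' _ => ?_
        split_ifs <;> ring

theorem sum_NN_div_mass_le (n : ℕ) (z : ℝ) :
    ∑ ω, uw W n ω * (S.NN n z ω / mass (uw W n) (S.cell (S.α ^ n) z) ω) ≤ 2 * S.D + 3 := by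
  classical
  have hα : 0 < S.α ^ n := pow_pos S.α_pos n
  have hD : 0 ≤ S.D := by have := S.le_D; have := S.R_nonneg; linarith
  set M := mass (uw W n) (S.cell (S.α ^ n) z) with hM
  have hMpos : ∀ ω, 0 < M ω := fun ω => mass_pos uw_nonneg _ (uw_pos ω)
  calc _ = ∑ ω', uw W n ω' * ∑ ω ∈ univ.filter (fun ω =>
          |S.V z (List.ofFn ω') - S.V z (List.ofFn ω)| ≤ S.D * S.α ^ n), uw W n ω / M ω := by
        unfold NN
        simp only [Finset.sum_div, Finset.mul_sum, Finset.sum_filter]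
        rw [Finset.sum_comm]
        refine Finset.sum_congr rfl fun ω' _ => Finset.sum_congr rfl fun ω _ => ?_
        split_ifs <;> ring
    _ ≤ ∑ ω' : Fin n → W, uw W n ω' * (2 * S.D + 3) := by
        refine Finset.sum_le_sum fun ω' _ => mul_le_mul_of_nonneg_left ?_ (uw_nonneg _)
        set x' := S.V z (List.ofFn ω') / S.α ^ n with hx'
        rw [← Finset.sum_fiberwise_of_maps_to (t := Finset.Icc ⌊x' - S.D⌋ ⌊x' + S.D⌋)
          (g := S.cell (S.α ^ n) z)]
        · refine (Finset.sum_le_card_nsmul _ _ 1 fun y _ =>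
            sum_div_mass_le_one uw_nonneg (S.cell (S.α ^ n) z) y _ fun ω hω =>
              (Finset.mem_filter.1 hω).2).trans ?_
          rw [nsmul_eq_mul, mul_one, Int.card_Icc]
          have h1 := Int.floor_le (x' + S.D)
          have h2 := Int.lt_floor_add_one (x' - S.D)
          have h3 : (((⌊x' + S.D⌋ + 1 - ⌊x' - S.D⌋).toNat : ℤ) : ℝ) ≤ 2 * S.D + 3 := by
            rw [Int.toNat_of_nonneg]
            · push_cast; linarith
            · have : ⌊x' - S.D⌋ ≤ ⌊x' + S.D⌋ := Int.floor_le_floor (by linarith)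
              linarith
          exact_mod_cast h3
        · intro ω hω
          have h := (Finset.mem_filter.1 hω).2
          rw [Finset.mem_Icc]
          have h' : |x' - S.V z (List.ofFn ω) / S.α ^ n| ≤ S.D := by
            rw [hx', ← sub_div, abs_div, abs_of_pos hα, div_le_iff₀ hα]
            exact h
          rw [abs_le] at h'
          exact ⟨Int.floor_le_floor (by linarith), Int.floor_le_floor (by linarith)⟩
    _ = 2 * S.D + 3 := sum_uw_mul_const _ _

theorem sum_log_NN_le (n : ℕ) (z : ℝ) :
    ∑ ω, uw W n ω * Real.log (S.NN n z ω) ≤ -S.H n z + (2 * S.D + 3) := by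
  refine le_trans ?_ (add_le_add_right (S.sum_NN_div_mass_le n z) _)
  unfold H ent
  rw [neg_neg, ← Finset.sum_add_distrib]
  refine Finset.sum_le_sum fun ω _ => ?_
  rw [← mul_add]
  refine mul_le_mul_of_nonneg_left ?_ (uw_nonneg _)
  have hMpos : 0 < mass (uw W n) (S.cell (S.α ^ n) z) ω := mass_pos uw_nonneg _ (uw_pos ω)
  have h1 := Real.log_le_sub_one_of_pos (div_pos (S.NN_pos n z ω) hMpos)
  rw [Real.log_div (S.NN_pos n z ω).ne' hMpos.ne'] at h1
  linarith

theorem neg_log_NN_le (n : ℕ) (z : ℝ) (ω : Fin n → W) :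
    -Real.log (S.NN n z ω) ≤ n * Real.log (Fintype.card W) := by
  have h := Real.log_le_log (uw_pos ω) (S.le_NN n z ω)
  rw [uw, Real.log_pow, one_div, Real.log_inv] at h
  linarith

theorem sum_exp_log_NN_le (n : ℕ) (z : ℝ) {δ : ℝ} (hδ : 0 ≤ δ)
    (hδ1 : δ * (n * Real.log (Fintype.card W)) ≤ 1) :
    ∑ ω, uw W n ω * Real.exp (δ * Real.log (S.NN n z ω)) ≤
      Real.exp (δ * (-S.H n z + (2 * S.D + 3)) + δ ^ 2 * (n * Real.log (Fintype.card W)) ^ 2) := by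
  set q := n * Real.log (Fintype.card W) with hq
  have hpt : ∀ ω : Fin n → W, Real.exp (δ * Real.log (S.NN n z ω)) ≤
      1 + δ * Real.log (S.NN n z ω) + δ ^ 2 * q ^ 2 := by
    intro ω
    have h1 := S.neg_log_NN_le n z ω
    have h2 : Real.log (S.NN n z ω) ≤ 0 := Real.log_nonpos (S.NN_pos n z ω).le (S.NN_le_one n z ω)
    have h3 : |δ * Real.log (S.NN n z ω)| ≤ δ * q := by
      rw [abs_mul, abs_of_nonneg hδ, abs_of_nonpos h2]
      exact mul_le_mul_of_nonneg_left h1 hδ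
    have h4 := Real.abs_exp_sub_one_sub_id_le (h3.trans hδ1)
    have h5 := (abs_le.1 h4).2
    have h6 : (δ * Real.log (S.NN n z ω)) ^ 2 ≤ (δ * q) ^ 2 := sq_le_sq' (by
      linarith [(abs_le.1 h3).1]) (abs_le.1 h3).2
    nlinarith
  calc _ ≤ ∑ ω, uw W n ω * (1 + δ * Real.log (S.NN n z ω) + δ ^ 2 * q ^ 2) :=
        Finset.sum_le_sum fun ω _ => mul_le_mul_of_nonneg_left (hpt ω) (uw_nonneg _)
    _ = 1 + δ * ∑ ω, uw W n ω * Real.log (S.NN n z ω) + δ ^ 2 * q ^ 2 := by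
        simp only [mul_add, Finset.sum_add_distrib]
        rw [sum_uw_mul_const, sum_uw_mul_const, Finset.mul_sum]
        congr 2
        exact Finset.sum_congr rfl fun _ _ => by ring
    _ ≤ δ * (-S.H n z + (2 * S.D + 3)) + δ ^ 2 * q ^ 2 + 1 := by
        have := mul_le_mul_of_nonneg_left (S.sum_log_NN_le n z) hδ
        linarith
    _ ≤ _ := Real.add_one_le_exp _

theorem exists_block_weight {t₀ : ℕ} (ht₀ : 1 ≤ t₀) {δ ρ : ℝ}
    (hρ : ∀ z ∈ S.K, ∑ v, uw W t₀ v * Real.exp (δ * Real.log (S.NN t₀ z v)) ≤ ρ) (k : ℕ) :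
    ∀ n, n = k * t₀ → ∀ z ∈ S.K, ∃ m : (Fin n → W) → ℝ, (∀ u, 0 < m u) ∧
      ∑ u, uw W n u * (S.NN n z u / m u) ≤ 2 ^ k ∧
      ∑ u, uw W n u * Real.exp (δ * Real.log (m u)) ≤ ρ ^ k := by
  have hρ0 : 0 ≤ ρ := le_trans (Finset.sum_nonneg fun v _ =>
    mul_nonneg (uw_nonneg v) (Real.exp_pos _).le) (hρ 0 S.zero_mem_K)
  induction k with
  | zero =>
    intro n hn z hz
    refine ⟨fun _ => 1, fun _ => one_pos, ?_, ?_⟩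
    · rw [pow_zero]
      refine le_trans (Finset.sum_le_sum fun u _ => ?_) (sum_uw (W := W) n).le
      rw [div_one]
      exact mul_le_of_le_one_right (uw_nonneg u) (S.NN_le_one n z u)
    · simp [sum_uw]
  | succ k ih =>
    intro n hn z hz
    obtain rfl : n = k * t₀ + t₀ := by rw [hn]; ring
    obtain ⟨m, hm0, hm1, hm2⟩ := ih _ rfl z hz
    refine ⟨fun ω => m (fun i => ω (Fin.castAdd t₀ i)) *
      S.NN t₀ (S.Tl z (List.ofFn fun i => ω (Fin.castAdd t₀ i)))
        (fun i => ω (Fin.natAdd (k * t₀) i)), fun ω => mul_pos (hm0 _) (S.NN_pos _ _ _), ?_, ?_⟩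
    · rw [sum_append]
      simp only [Fin.append_left, Fin.append_right]
      calc _ = ∑ u, uw W (k * t₀) u * ((∑ v, uw W t₀ v *
            (S.NN (k * t₀ + t₀) z (Fin.append u v) / S.NN t₀ (S.Tl z (List.ofFn u)) v)) / m u) := by
            refine Finset.sum_congr rfl fun u _ => ?_
            rw [Finset.sum_div]
            congr 1
            refine Finset.sum_congr rfl fun v _ => ?_
            rw [mul_div_assoc, div_div, mul_comm (m u)]
        _ ≤ ∑ u, uw W (k * t₀) u * (2 * S.NN (k * t₀) z u / m u) :=
            Finset.sum_le_sum fun u _ => mul_le_mul_of_nonneg_left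
              (div_le_div_of_nonneg_right (S.sum_NN_append_div_le ht₀ hz u) (hm0 u).le)
              (uw_nonneg u)
        _ = 2 * ∑ u, uw W (k * t₀) u * (S.NN (k * t₀) z u / m u) := by
            rw [Finset.mul_sum]
            exact Finset.sum_congr rfl fun u _ => by ring
        _ ≤ 2 ^ (k + 1) := by rw [pow_succ]; linarith
    · rw [sum_append]
      simp only [Fin.append_left, Fin.append_right]
      calc _ = ∑ u, uw W (k * t₀) u * (Real.exp (δ * Real.log (m u)) * ∑ v, uw W t₀ v *
            Real.exp (δ * Real.log (S.NN t₀ (S.Tl z (List.ofFn u)) v))) := by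
            refine Finset.sum_congr rfl fun u _ => ?_
            simp only [Finset.mul_sum]
            refine Finset.sum_congr rfl fun v _ => ?_
            rw [Real.log_mul (hm0 u).ne' (S.NN_pos _ _ _).ne', mul_add, Real.exp_add]
            ring
        _ ≤ ∑ u, uw W (k * t₀) u * (Real.exp (δ * Real.log (m u)) * ρ) :=
            Finset.sum_le_sum fun u _ => mul_le_mul_of_nonneg_left
              (mul_le_mul_of_nonneg_left (hρ _ (S.Tl_mem hz _)) (Real.exp_pos _).le)
              (uw_nonneg u)
        _ = (∑ u, uw W (k * t₀) u * Real.exp (δ * Real.log (m u))) * ρ := by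
            rw [Finset.sum_mul]
            exact Finset.sum_congr rfl fun u _ => by ring
        _ ≤ ρ ^ (k + 1) := by
            rw [pow_succ]; exact mul_le_mul_of_nonneg_right hm2 hρ0

theorem markov_two (δ : ℝ) {n : ℕ} {z : ℝ} {m : (Fin n → W) → ℝ} (hm : ∀ u, 0 < m u)
    (hδ : 0 ≤ δ) (A B : ℝ) :
    ∑ u, (if Real.exp (-A) ≤ S.NN n z u then uw W n u else 0) ≤
      Real.exp (-B) * ∑ u, uw W n u * (S.NN n z u / m u) +
      Real.exp (δ * (A + B)) * ∑ u, uw W n u * Real.exp (δ * Real.log (m u)) := by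
  rw [Finset.mul_sum, Finset.mul_sum, ← Finset.sum_add_distrib]
  refine Finset.sum_le_sum fun u _ => ?_
  have hu := uw_nonneg u
  have hN := S.NN_pos n z u
  have h1 : 0 ≤ Real.exp (-B) * (uw W n u * (S.NN n z u / m u)) := by
    have := hm u; positivity
  have h2 : 0 ≤ Real.exp (δ * (A + B)) * (uw W n u * Real.exp (δ * Real.log (m u))) := by
    positivity
  split_ifs with h
  swap
  · linarith
  rcases le_total (Real.log (m u)) (-(A + B)) with h3 | h3
  · have h4 : m u ≤ Real.exp (-A) * Real.exp (-B) := by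
      rw [← Real.exp_add, ← Real.log_le_iff_le_exp (hm u)]; linarith
    have h5 : 1 ≤ Real.exp (-B) * (S.NN n z u / m u) := by
      rw [← mul_div_assoc, le_div_iff₀ (hm u), one_mul]
      calc m u ≤ Real.exp (-A) * Real.exp (-B) := h4
        _ ≤ _ := by rw [mul_comm]; gcongr
    nlinarith
  · have h5 : 1 ≤ Real.exp (δ * (A + B)) * Real.exp (δ * Real.log (m u)) := by
      rw [← Real.exp_add]
      refine Real.one_le_exp ?_
      nlinarith
    nlinarith

/-- Large deviations for the concentration of the projections. -/
theorem exists_tail {ε : ℝ} (hε : 0 < ε) : ∃ C c : ℝ, 0 < C ∧ 0 < c ∧ ∀ n : ℕ, ∀ z ∈ S.K,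
    ∑ ω, (if C * Real.exp (-(S.β - ε) * n) < S.NN n z ω then uw W n ω else 0) ≤
      C * Real.exp (-c * n) := by
  obtain ⟨n₀, hn₀⟩ := S.exists_le_H (ε := ε / 4) (by positivity)
  obtain ⟨n₁, hn₁⟩ := exists_nat_gt ((2 * S.D + 4) / (ε / 4))
  set t₀ := max n₀ (max n₁ 1) with ht₀def
  have ht₀ : 1 ≤ t₀ := by simp [ht₀def]
  have ht₀' : (1 : ℝ) ≤ t₀ := by exact_mod_cast ht₀
  have hbig : 2 * S.D + 4 ≤ ε / 4 * t₀ := by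
    rw [div_lt_iff₀ (by positivity)] at hn₁
    have : (n₁ : ℝ) ≤ t₀ := by exact_mod_cast (le_max_left n₁ 1).trans (le_max_right n₀ _)
    nlinarith
  set q := t₀ * Real.log (Fintype.card W) with hq
  have hq0 : 0 ≤ q := mul_nonneg (by positivity) (Real.log_natCast_nonneg _)
  set δ := 1 / (q ^ 2 + q + 1) with hδ
  have hδ0 : 0 < δ := by positivity
  have hδ1 : δ * (q ^ 2 + q + 1) = 1 := by rw [hδ]; field_simp
  have hδq : δ * q ≤ 1 := by nlinarith [mul_nonneg hδ0.le (sq_nonneg q)]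
  have hδq2 : δ * q ^ 2 ≤ 1 := by nlinarith [mul_nonneg hδ0.le hq0]
  set ρ := Real.exp (δ * (-((S.β - ε / 4) * t₀) + (2 * S.D + 3)) + δ) with hρdef
  have hρ : ∀ z ∈ S.K, ∑ v, uw W t₀ v * Real.exp (δ * Real.log (S.NN t₀ z v)) ≤ ρ := by
    intro z hz
    refine (S.sum_exp_log_NN_le t₀ z hδ0.le hδq).trans (Real.exp_le_exp.2 ?_)
    have h1 := hn₀ t₀ (le_max_left _ _) z hz
    have h2 := mul_le_mul_of_nonneg_left h1 hδ0.le
    have h3 : δ ^ 2 * q ^ 2 ≤ δ := by nlinarith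
    rw [← hq]
    linarith
  have hkey : ∀ k : ℕ, ∀ z ∈ S.K, ∑ u, (if Real.exp (-((S.β - ε) * (k * t₀))) ≤
      S.NN (k * t₀) z u then uw W (k * t₀) u else 0) ≤
      Real.exp (-(1 - Real.log 2) * k) + Real.exp (-δ * k) := by
    intro k z hz
    obtain ⟨m, hm0, hm1, hm2⟩ := S.exists_block_weight ht₀ hρ k _ rfl z hz
    refine (S.markov_two δ hm0 hδ0.le _ (ε / 4 * (k * t₀))).trans (add_le_add ?_ ?_)
    · refine (mul_le_mul_of_nonneg_left hm1 (Real.exp_pos _).le).trans ?_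
      rw [← Real.exp_log (show (0 : ℝ) < 2 ^ k by positivity), Real.log_pow, ← Real.exp_add]
      refine Real.exp_le_exp.2 ?_
      have hD := S.le_D
      have hR := S.R_nonneg
      have : (k : ℝ) * 1 ≤ k * (ε / 4 * t₀) :=
        mul_le_mul_of_nonneg_left (by linarith) (by positivity)
      linarith
    · refine (mul_le_mul_of_nonneg_left hm2 (Real.exp_pos _).le).trans ?_
      rw [hρdef, ← Real.exp_nat_mul, ← Real.exp_add]
      refine Real.exp_le_exp.2 ?_
      have h4 : 0 ≤ k * (δ * (ε / 4 * t₀ - (2 * S.D + 4))) := by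
        have : 0 ≤ ε / 4 * t₀ - (2 * S.D + 4) := by linarith
        positivity
      have h5 : 0 ≤ k * (δ * (ε / 4 * t₀ - 1)) := by
        have hD := S.le_D
        have hR := S.R_nonneg
        have : 0 ≤ ε / 4 * t₀ - 1 := by linarith
        positivity
      nlinarith
  have hlog2 : 0 < 1 - Real.log 2 := by linarith [Real.log_two_lt_d9]
  set c₀ := min (1 - Real.log 2) δ with hc₀
  have hc₀pos : 0 < c₀ := lt_min hlog2 hδ0
  refine ⟨max (Real.exp (|S.β - ε| * t₀)) (2 * Real.exp c₀), c₀ / t₀,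
    lt_max_of_lt_left (Real.exp_pos _), by positivity, ?_⟩
  set C := max (Real.exp (|S.β - ε| * t₀)) (2 * Real.exp c₀) with hC
  intro n z hz
  obtain ⟨k, t, ht, rfl⟩ : ∃ k t : ℕ, t < t₀ ∧ n = k * t₀ + t :=
    ⟨n / t₀, n % t₀, Nat.mod_lt _ ht₀, by rw [mul_comm, Nat.div_add_mod]⟩
  have ht' : (t : ℝ) ≤ t₀ := by exact_mod_cast ht.le
  have hthr : Real.exp (-((S.β - ε) * (k * t₀))) ≤
      C * Real.exp (-(S.β - ε) * ((k * t₀ + t : ℕ) : ℝ)) := by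
    refine le_trans ?_ (mul_le_mul_of_nonneg_right (le_max_left _ _) (Real.exp_pos _).le)
    rw [← Real.exp_add]
    refine Real.exp_le_exp.2 ?_
    push_cast
    have h1 : (S.β - ε) * t ≤ |S.β - ε| * t₀ :=
      (mul_le_mul_of_nonneg_right (le_abs_self _) (by positivity)).trans
        (mul_le_mul_of_nonneg_left ht' (abs_nonneg _))
    linarith
  have hle : ∑ ω, (if C * Real.exp (-(S.β - ε) * ((k * t₀ + t : ℕ) : ℝ)) <
      S.NN (k * t₀ + t) z ω then uw W (k * t₀ + t) ω else 0) ≤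
      ∑ u, (if Real.exp (-((S.β - ε) * (k * t₀))) ≤ S.NN (k * t₀) z u
        then uw W (k * t₀) u else 0) := by
    rcases Nat.eq_zero_or_pos t with rfl | htpos
    · refine Finset.sum_le_sum fun ω _ => ?_
      have := uw_nonneg ω
      split_ifs with h1 h2
      · exact le_rfl
      · exact absurd (hthr.trans h1.le) h2
      · exact this
      · exact le_rfl
    · have h := sum_append (s := k * t₀) (t := t) (W := W) fun ω =>
        if C * Real.exp (-(S.β - ε) * ((k * t₀ + t : ℕ) : ℝ)) < S.NN (k * t₀ + t) z ω
        then 1 else 0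
      simp only [mul_ite, mul_one, mul_zero] at h
      rw [h]
      refine Finset.sum_le_sum fun u _ => ?_
      have hu := uw_nonneg u
      split_ifs with h1
      · refine mul_le_of_le_one_right hu ?_
        refine le_trans (Finset.sum_le_sum fun v _ => ?_) (sum_uw (W := W) t).le
        split_ifs
        exacts [le_rfl, uw_nonneg v]
      · rw [Finset.sum_eq_zero, mul_zero]
        intro v _
        rw [if_neg]
        exact fun h2 => h1 (hthr.trans (h2.le.trans (S.NN_append_le htpos hz u v)))
  refine hle.trans ((hkey k z hz).trans ?_)
  have e1 : Real.exp (-(1 - Real.log 2) * k) ≤ Real.exp (-c₀ * k) := by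
    refine Real.exp_le_exp.2 ?_
    have := mul_le_mul_of_nonneg_right (min_le_left (1 - Real.log 2) δ) (Nat.cast_nonneg (α := ℝ) k)
    linarith
  have e2 : Real.exp (-δ * k) ≤ Real.exp (-c₀ * k) := by
    refine Real.exp_le_exp.2 ?_
    have := mul_le_mul_of_nonneg_right (min_le_right (1 - Real.log 2) δ)
      (Nat.cast_nonneg (α := ℝ) k)
    linarith
  calc _ ≤ 2 * Real.exp (-c₀ * k) := by linarith
    _ ≤ 2 * Real.exp c₀ * Real.exp (-(c₀ / t₀) * ((k * t₀ + t : ℕ) : ℝ)) := by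
        rw [mul_assoc, ← Real.exp_add]
        refine mul_le_mul_of_nonneg_left (Real.exp_le_exp.2 ?_) two_pos.le
        push_cast
        have h1 : c₀ / t₀ * (k * t₀ + t) ≤ c₀ * k + c₀ := by
          have h2 : c₀ / t₀ * (k * t₀ + t) = c₀ * k + c₀ * (t / t₀) := by field_simp
          have h3 : (t : ℝ) / t₀ ≤ 1 := by rw [div_le_one (by linarith)]; exact ht'
          rw [h2]
          nlinarith
        linarith
    _ ≤ _ := mul_le_mul_of_nonneg_right (le_max_right _ _) (Real.exp_pos _).le

end Sys

section Win

variable {Ω : Type*} [Fintype Ω] {κ κ' κ'' ι : Type*} {p : Ω → ℝ}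

theorem ediv_pow_congr {a a' : ℤ} {k l : ℕ} (hkl : k ≤ l) (h : a / 2 ^ k = a' / 2 ^ k) :
    a / 2 ^ l = a' / 2 ^ l := by
  obtain ⟨t, rfl⟩ := Nat.exists_eq_add_of_le hkl
  rw [pow_add, ← Int.ediv_ediv_of_nonneg (by positivity), ← Int.ediv_ediv_of_nonneg (by positivity),
    h]

theorem sub_ediv_le {a a' c : ℤ} {k : ℕ} (h : a / 2 ^ k = a' / 2 ^ k) :
    (a - c) / 2 ^ k ≤ (a' - c) / 2 ^ k + 1 := by
  have hd : (0 : ℤ) < 2 ^ k := by positivity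
  have h1 := Int.emod_add_mul_ediv a (2 ^ k)
  have h2 := Int.emod_add_mul_ediv a' (2 ^ k)
  have h3 := Int.emod_lt_of_pos a hd
  have h4 := Int.emod_nonneg a' hd.ne'
  rw [← Int.add_mul_ediv_left _ _ hd.ne']
  refine Int.ediv_le_ediv hd ?_
  rw [h] at h1
  linarith

/-- The mutual information lost by restricting to an event. -/
theorem cent_restr_le_given (hp : ∀ ω, 0 ≤ p ω) (f : Ω → κ) (c : Ω → κ') (g : Ω → κ'')
    (E : Set Ω) :
    cent (restr p E) f g ≤ cent (restr p E) f (fun ω => (c ω, g ω)) +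
      (cent p c g - cent p c (fun ω => (f ω, g ω)) + (∑ ω, p ω) * Real.log 2) := by
  have key : ∀ q : Ω → ℝ, cent q f g - cent q f (fun ω => (c ω, g ω)) =
      cent q c g - cent q c (fun ω => (f ω, g ω)) := by
    intro q
    have h1 := cent_chain (p := q) f c g
    have h2 := cent_chain (p := q) c f g
    have h3 : cent q (fun ω => (f ω, c ω)) g = cent q (fun ω => (c ω, f ω)) g :=
      cent_congr (fun _ _ => Iff.rfl) (fun ω ω' _ => by simp only [Prod.mk.injEq]; tauto)
    linarith
  have hpE := restr_nonneg hp E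
  have hpE' := restr_nonneg hp Eᶜ
  have h1 := cent_split (p := p) E c (fun ω => (ω ∈ E, g ω))
    (fun ω ω' h => by simpa using (Prod.mk.inj h).1)
  have h2 := cent_split (p := p) E c (fun ω => (ω ∈ E, f ω, g ω))
    (fun ω ω' h => by simpa using (Prod.mk.inj h).1)
  have h3 : cent p c (fun ω => (f ω, g ω)) ≤ cent p (fun ω => ω ∈ E) (fun ω => (f ω, g ω)) +
      cent p c (fun ω => (ω ∈ E, f ω, g ω)) := cent_le_add hp _ _ _
  have h4 : cent p (fun ω => ω ∈ E) (fun ω => (f ω, g ω)) ≤ (∑ ω, p ω) * Real.log 2 := by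
    have := cent_le_log_card hp (fun ω => ω ∈ E) (fun ω => (f ω, g ω))
    simpa using this
  have h5 : cent p c (fun ω => (ω ∈ E, g ω)) ≤ cent p c g :=
    cent_anti hp _ fun ω ω' h => (Prod.mk.inj h).2
  have hmem : ∀ (F : Set Ω) (ω : Ω), 0 < restr p F ω → ω ∈ F := by
    intro F ω h
    by_contra hc
    simp [restr, hc] at h
  have e1 : ∀ F : Set Ω, (F = E ∨ F = Eᶜ) → cent (restr p F) c (fun ω => (ω ∈ E, g ω)) =
      cent (restr p F) c g := by
    rintro F hF
    refine cent_congr_ae (restr_nonneg hp F) (fun ω ω' h h' => ?_) (fun _ _ _ _ => Iff.rfl)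
    have i1 := hmem F ω h
    have i2 := hmem F ω' h'
    have : ω ∈ E ↔ ω' ∈ E := by
      rcases hF with rfl | rfl
      · exact iff_of_true i1 i2
      · exact iff_of_false i1 i2
    simp [this]
  have e2 : ∀ F : Set Ω, (F = E ∨ F = Eᶜ) → cent (restr p F) c (fun ω => (ω ∈ E, f ω, g ω)) =
      cent (restr p F) c (fun ω => (f ω, g ω)) := by
    rintro F hF
    refine cent_congr_ae (restr_nonneg hp F) (fun ω ω' h h' => ?_) (fun _ _ _ _ => Iff.rfl)
    have i1 := hmem F ω h
    have i2 := hmem F ω' h'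
    have : ω ∈ E ↔ ω' ∈ E := by
      rcases hF with rfl | rfl
      · exact iff_of_true i1 i2
      · exact iff_of_false i1 i2
    simp [this]
  rw [e1 E (Or.inl rfl), e1 Eᶜ (Or.inr rfl)] at h1
  rw [e2 E (Or.inl rfl), e2 Eᶜ (Or.inr rfl)] at h2
  have h6 := key (restr p E)
  have h7 : cent (restr p Eᶜ) c (fun ω => (f ω, g ω)) ≤ cent (restr p Eᶜ) c g :=
    cent_anti hpE' _ fun ω ω' h => (Prod.mk.inj h).2
  linarith

variable {Z : Ω → κ} {Q : Ω → κ'} {V A : Ω → ℤ} {m : ℕ}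

theorem cent_restr_fst (hp : ∀ ω, 0 ≤ p ω) (E : Set Ω) (f : Ω → ι) (g : Ω → κ'') :
    cent (restr p E) f g = cent (restr (starw p Z m) (Prod.fst ⁻¹' E)) (fun x => f x.1)
      (fun x => g x.1) := by
  classical
  refine cent_map _ (fun x : Ω × (Fin m → Ω) => x.1) (fun ω => ?_) f g
  have := sum_starw_fst (Z := Z) (M := m) hp
    (fun ω' => if ω' ∈ E then if ω' = ω then 1 else 0 else 0)
  simp only [mul_ite, mul_one, mul_zero] at this
  have e : restr p E ω = ∑ ω', if ω' ∈ E then if ω' = ω then p ω' else 0 else 0 := by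
    rw [Finset.sum_eq_single ω]
    · simp [restr, Set.indicator_apply]
    · intro b _ hb; simp [hb]
    · simp
  rw [e, ← this]
  refine Finset.sum_congr rfl fun x _ => ?_
  simp only [restr, Set.indicator_apply, Set.mem_preimage]
  split_ifs <;> rfl

theorem window_term (hp : ∀ ω, 0 ≤ p ω) (h1 : ∑ ω, p ω = 1) (k L : ℕ) (G : Set Ω) {a : ℝ}
    (ha : ∀ ω ∈ G, 0 < p ω → a ≤ cent (prodw (condw p Z ω) m)
      (fun τ => (V ω - ∑ i, A (τ i)) / 2 ^ k) (fun τ => (V ω - ∑ i, A (τ i)) / 2 ^ (k + L))) :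
    (∑ ω, restr p G ω) * a +
      cent (restr p Gᶜ) (fun ω => V ω / 2 ^ k) (fun ω => (V ω / 2 ^ (k + L), Q ω)) ≤
    cent (starw p Z m) (fun x => (V x.1 - psum A m m x) / 2 ^ k)
      (fun x => ((V x.1 - psum A m m x) / 2 ^ (k + L), Q x.1)) +
    (cent (starw p Z m) (psum A m m) (fun x => (V x.1 / 2 ^ (k + L), Q x.1)) -
      cent (starw p Z m) (psum A m m) (fun x => (V x.1 / 2 ^ k, Q x.1))) + 3 * Real.log 2 := by
  classical
  set P := starw p Z m with hP
  have hP0 : ∀ x, 0 ≤ P x := starw_nonneg hp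
  have hP1 : ∑ x, P x = 1 := by
    have := sum_starw_fst (Z := Z) (M := m) hp (fun _ => 1)
    simpa [h1] using this
  have hlog2 : 0 ≤ Real.log 2 := Real.log_nonneg one_le_two
  set E : Set (Ω × (Fin m → Ω)) := Prod.fst ⁻¹' G with hE
  set C := psum A m m with hC
  have hCe : ∀ x, C x = ∑ i, A (x.2 i) := fun x => by
    simp [hC, psum, trunc]
  let U : ℕ → Ω × (Fin m → Ω) → ℤ := fun k x => (V x.1 - C x) / 2 ^ k
  have hEn := restr_nonneg hP0 E
  have hEn' := restr_nonneg hP0 Eᶜ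
  have hE1 : ∑ x, restr P Eᶜ x ≤ 1 := by
    rw [← hP1]; exact Finset.sum_le_sum fun x _ => restr_le hP0 _ x
  have s1 : cent P (U k) (fun x => (x.1 ∈ G, U (k + L) x, Q x.1)) ≤
      cent P (U k) (fun x => (U (k + L) x, Q x.1)) :=
    cent_anti hP0 _ fun x y h => (Prod.mk.inj h).2
  rw [cent_split (p := P) E (U k) (fun x => (x.1 ∈ G, U (k + L) x, Q x.1))
    (fun x y h => by simpa [hE] using (Prod.mk.inj h).1)] at s1
  have s2 : cent (restr P E) (U k) (fun x => (U (k + L) x, x.1)) ≤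
      cent (restr P E) (U k) (fun x => (x.1 ∈ G, U (k + L) x, Q x.1)) := by
    refine cent_anti hEn _ fun x y h => ?_
    obtain ⟨h1, h2⟩ := Prod.mk.inj h
    rw [h1, h2]
  have s3 : (∑ ω, restr p G ω) * a ≤ cent (restr P E) (U k) (fun x => (U (k + L) x, x.1)) := by
    have e : restr P E = fun x => restr p G x.1 * prodw (condw p Z x.1) m x.2 := by
      funext x
      simp only [restr, Set.indicator_apply, hE, Set.mem_preimage, hP, starw]
      split_ifs <;> simp
    rw [e, cent_skew (restr_nonneg hp G)
      (q := fun ω τ => prodw (condw p Z ω) m τ)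
      (fun ω τ => prodw_nonneg (condw_nonneg hp ω) τ), Finset.sum_mul]
    refine Finset.sum_le_sum fun ω _ => ?_
    by_cases hω : ω ∈ G ∧ 0 < p ω
    · refine mul_le_mul_of_nonneg_left ?_ (restr_nonneg hp G ω)
      simpa only [U, hCe] using ha ω hω.1 hω.2
    · have : restr p G ω = 0 := by
        simp only [restr, Set.indicator_apply]
        split_ifs with h
        · exact le_antisymm (not_lt.1 fun h' => hω ⟨h, h'⟩) (hp ω)
        · rfl
      simp [this]
  have s4 : cent (restr P Eᶜ) (U k) (fun x => (C x, U (k + L) x, Q x.1)) ≤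
      cent (restr P Eᶜ) (U k) (fun x => (x.1 ∈ G, U (k + L) x, Q x.1)) := by
    rw [cent_congr_ae (p := restr P Eᶜ) (f := U k) (f' := U k)
      (g := fun x => (x.1 ∈ G, U (k + L) x, Q x.1))
      (g' := fun x => (U (k + L) x, Q x.1)) hEn' (fun x y hx hy => ?_) fun _ _ _ _ => Iff.rfl]
    · exact cent_anti hEn' _ fun x y h => (Prod.mk.inj h).2
    · have hmem : ∀ x, 0 < restr P Eᶜ x → x.1 ∉ G := fun x hx hc => by
        simp [restr, hE, hc] at hx
      simp [hmem x hx, hmem y hy]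
  let Y : ℕ → Ω × (Fin m → Ω) → ℤ := fun k x => V x.1 / 2 ^ k
  have s5 : cent (restr P Eᶜ) (Y k) (fun x => (C x, Y (k + L) x, Q x.1)) ≤
      cent (restr P Eᶜ) (U k) (fun x => (C x, U (k + L) x, Q x.1)) + 2 * Real.log 2 := by
    have t1 : cent (restr P Eᶜ) (Y k) (fun x => (C x, Y (k + L) x, Q x.1)) ≤
        cent (restr P Eᶜ) (U (k + L)) (fun x => (C x, Y (k + L) x, Q x.1)) +
        cent (restr P Eᶜ) (Y k) (fun x => (U (k + L) x, C x, Y (k + L) x, Q x.1)) :=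
      cent_le_add hEn' _ _ _
    have t2 : cent (restr P Eᶜ) (U (k + L)) (fun x => (C x, Y (k + L) x, Q x.1)) ≤
        (∑ x, restr P Eᶜ x) * Real.log ((1 : ℕ) + 1) := by
      refine cent_le_of_diam hEn' _ _ 1 fun x y h => ?_
      simp only [Prod.mk.injEq] at h
      simp only [U]
      rw [h.1]
      exact_mod_cast sub_ediv_le h.2.1
    have t3 : cent (restr P Eᶜ) (Y k) (fun x => (U (k + L) x, C x, Y (k + L) x, Q x.1)) ≤
        cent (restr P Eᶜ) (Y k) (fun x => (C x, U (k + L) x, Q x.1)) := by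
      refine cent_anti hEn' _ fun x y h => ?_
      simp only [Prod.mk.injEq] at h ⊢
      tauto
    have t4 : cent (restr P Eᶜ) (Y k) (fun x => (C x, U (k + L) x, Q x.1)) ≤
        cent (restr P Eᶜ) (U k) (fun x => (C x, U (k + L) x, Q x.1)) +
        (∑ x, restr P Eᶜ x) * Real.log ((1 : ℕ) + 1) := by
      refine cent_le_add_log hEn' _ _ _ 1 fun x y h hU => ?_
      simp only [Prod.mk.injEq] at h
      have := sub_ediv_le (c := -C x) hU
      rw [h.1] at this
      simp only [Y]
      rw [← h.1, sub_neg_eq_add, sub_neg_eq_add, sub_add_cancel, h.1, sub_add_cancel] at this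
      exact_mod_cast this
    have : (∑ x, restr P Eᶜ x) * Real.log ((1 : ℕ) + 1) ≤ Real.log 2 := by
      norm_num
      exact mul_le_of_le_one_left hlog2 hE1
    linarith
  have s6 := cent_restr_le_given hP0 (Y k) C (fun x => (Y (k + L) x, Q x.1)) Eᶜ
  have s7 : cent (restr p Gᶜ) (fun ω => V ω / 2 ^ k) (fun ω => (V ω / 2 ^ (k + L), Q ω)) =
      cent (restr P Eᶜ) (Y k) (fun x => (Y (k + L) x, Q x.1)) :=
    cent_restr_fst hp Gᶜ _ _
  have s8 : cent P C (fun x => (Y k x, Y (k + L) x, Q x.1)) =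
      cent P C (fun x => (Y k x, Q x.1)) := by
    refine cent_congr (fun x y => ?_) fun _ _ _ => Iff.rfl
    simp only [Prod.mk.injEq]
    exact ⟨fun h => ⟨h.1, h.2.2⟩, fun h => ⟨h.1, ediv_pow_congr (Nat.le_add_right k L) h.1, h.2⟩⟩
  rw [hP1, one_mul, s8] at s6
  rw [s7]
  simp only [U, Y] at *
  linarith

theorem sum_sub_shift_le {f : ℕ → ℝ} {a : ℝ} (h0 : ∀ k, 0 ≤ f k) (ha : ∀ k, f k ≤ a) (K L : ℕ) :
    ∑ k ∈ range K, (f k - f (k + L)) ≤ L * a := by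
  have h1 : ∑ k ∈ range K, f k + ∑ k ∈ range L, f (K + k) =
      ∑ k ∈ range L, f k + ∑ k ∈ range K, f (L + k) := by
    rw [← Finset.sum_range_add, ← Finset.sum_range_add, add_comm K L]
  have h2 : ∑ k ∈ range L, f k ≤ L * a := by
    simpa using Finset.sum_le_sum (s := range L) fun k _ => ha k
  have h3 : 0 ≤ ∑ k ∈ range L, f (K + k) := Finset.sum_nonneg fun k _ => h0 _
  rw [Finset.sum_sub_distrib]
  simp only [add_comm _ L] at *
  linarith

theorem windows_le (hp : ∀ ω, 0 ≤ p ω) (h1 : ∑ ω, p ω = 1)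
    (hQ : ∀ ω ω', Z ω = Z ω' → Q ω = Q ω') (hV : ∀ ω ω', Z ω = Z ω' → V ω = V ω')
    {ε D : ℝ} (hε : cent p A Q - cent p A Z ≤ ε) (hε0 : 0 ≤ ε)
    (hD : cent p (fun ω => V ω - A ω) Q ≤ cent p V Q + D) (K L : ℕ) (G : ℕ → Set Ω) {a : ℝ}
    (ha : ∀ k < K, ∀ ω ∈ G k, 0 < p ω → a ≤ cent (prodw (condw p Z ω) m)
      (fun τ => (V ω - ∑ i, A (τ i)) / 2 ^ k) (fun τ => (V ω - ∑ i, A (τ i)) / 2 ^ (k + L))) :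
    ∑ k ∈ range K, ((∑ ω, restr p (G k) ω) * a +
      cent (restr p (G k)ᶜ) (fun ω => V ω / 2 ^ k) (fun ω => (V ω / 2 ^ (k + L), Q ω))) ≤
    L * (cent p V Q + m * (D + ε) + m * m * ε) + L * (m * ε) + K * (3 * Real.log 2) := by
  set P := starw p Z m with hP
  have hP0 : ∀ x, 0 ≤ P x := starw_nonneg hp
  set U : ℕ → Ω × (Fin m → Ω) → ℤ := fun k x => (V x.1 - psum A m m x) / 2 ^ k
  set f : ℕ → ℝ := fun k => cent P (U k) (fun x => Q x.1)
  set g : ℕ → ℝ := fun k => cent P (psum A m m) (fun x => Q x.1) -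
    cent P (psum A m m) (fun x => (V x.1 / 2 ^ k, Q x.1))
  have hf : ∀ k, cent P (U k) (fun x => (U (k + L) x, Q x.1)) = f k - f (k + L) := by
    intro k
    have := cent_chain (p := P) (U k) (U (k + L)) (fun x => Q x.1)
    have e : cent P (fun x => (U k x, U (k + L) x)) (fun x => Q x.1) = f k :=
      cent_congr (fun _ _ => Iff.rfl) fun x y _ => by
        simp only [Prod.mk.injEq]
        exact ⟨fun h => h.1, fun h => ⟨h, ediv_pow_congr (Nat.le_add_right k L) h⟩⟩
    rw [e] at this
    simp only [f] at *
    linarith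
  have hfa : ∀ k, f k ≤ cent p V Q + m * (D + ε) + m * m * ε := by
    intro k
    refine le_trans ?_ (cent_sub_psum_le (V := V) (M := m) hp hQ hV hε hε0 hD le_rfl)
    refine cent_mono hP0 fun x y _ h => ?_
    simp only [U, h]
  have hga : ∀ k, g k ≤ m * ε := by
    intro k
    have h1 := cent_psum_le_given (V := V) (M := m) hp hQ hε le_rfl
    have h2 : cent P (psum A m m) (fun x => (V x.1, Q x.1)) ≤
        cent P (psum A m m) (fun x => (V x.1 / 2 ^ k, Q x.1)) :=
      cent_anti hP0 _ fun x y h => by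
        obtain ⟨h1, h2⟩ := Prod.mk.inj h
        rw [h1, h2]
    simp only [g]
    linarith
  have hg0 : ∀ k, 0 ≤ g k := fun k => sub_nonneg.2 (cent_anti hP0 _ fun x y h => (Prod.mk.inj h).2)
  have hf0 : ∀ k, 0 ≤ f k := fun k => cent_nonneg hP0 _ _
  have h2 := sum_sub_shift_le hf0 hfa K L
  have h3 := sum_sub_shift_le hg0 hga K L
  calc _ ≤ ∑ k ∈ range K, ((f k - f (k + L)) + (g k - g (k + L)) + 3 * Real.log 2) := by
        refine Finset.sum_le_sum fun k hk => ?_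
        have := window_term (Q := Q) hp h1 k L (G k) (ha k (Finset.mem_range.1 hk))
        rw [← hf]
        simp only [g]
        linarith
    _ = ∑ k ∈ range K, (f k - f (k + L)) + ∑ k ∈ range K, (g k - g (k + L)) +
          K * (3 * Real.log 2) := by
        simp [Finset.sum_add_distrib]
    _ ≤ _ := by linarith

end Win

section Words

variable {W : Type*} {i t q : ℕ}

/-- The first block of a word. -/
def fstw (ω : Fin (i + (t + q)) → W) : Fin i → W := fun a => ω (Fin.castAdd (t + q) a)

/-- The middle block of a word. -/
def midw (ω : Fin (i + (t + q)) → W) : Fin t → W := fun a => ω (Fin.natAdd i (Fin.castAdd q a))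

theorem append_fstw_midw (ω : Fin (i + (t + q)) → W) :
    ω = Fin.append (fstw ω) (Fin.append (midw ω)
      fun a => ω (Fin.natAdd i (Fin.natAdd t a))) := by
  conv_lhs => rw [← Fin.append_castAdd_natAdd (f := ω)]
  congr 1
  conv_lhs => rw [← Fin.append_castAdd_natAdd (f := fun a => ω (Fin.natAdd i a))]
  rfl

theorem pre_eq_fstw [Fintype W] (ω : Fin (i + (t + q)) → W) : pre i ω = List.ofFn (fstw ω) := by
  conv_lhs => rw [append_fstw_midw ω]
  exact pre_append _ _

theorem pre_eq_iff_fstw [Fintype W] (ω ω' : Fin (i + (t + q)) → W) :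
    pre i ω = pre i ω' ↔ fstw ω = fstw ω' := by
  rw [pre_eq_fstw, pre_eq_fstw, List.ofFn_inj]

theorem sum_fstw_midw [Fintype W] [Nonempty W] (φ : (Fin i → W) → (Fin t → W) → ℝ) :
    ∑ ω, uw W (i + (t + q)) ω * φ (fstw ω) (midw ω) =
      ∑ u, uw W i u * ∑ v, uw W t v * φ u v := by
  have e1 : ∀ (u : Fin i → W) (v : Fin t → W) (w : Fin q → W),
      fstw (Fin.append u (Fin.append v w)) = u := fun u v w => by
    funext a; simp only [fstw, Fin.append_left]
  have e2 : ∀ (u : Fin i → W) (v : Fin t → W) (w : Fin q → W),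
      midw (Fin.append u (Fin.append v w)) = v := fun u v w => by
    funext a; simp only [midw, Fin.append_right, Fin.append_left]
  simp only [sum_append, e1, e2, sum_uw_mul_const]

end Words

theorem neg_one_le_sum_log_mass {Ω : Type*} [Fintype Ω] {κ : Type*} [Fintype κ] [Nonempty κ]
    {p : Ω → ℝ} (hp : ∀ ω, 0 ≤ p ω) (f : Ω → κ) :
    -1 ≤ ∑ ω, p ω * Real.log (mass p f ω * Fintype.card κ) := by
  classical
  have hN : (0 : ℝ) < Fintype.card κ := by exact_mod_cast Fintype.card_pos
  calc (-1 : ℝ) ≤ -∑ ω, p ω / mass p f ω / Fintype.card κ := by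
        rw [neg_le_neg_iff, ← Finset.sum_div, div_le_one hN,
          ← Finset.sum_fiberwise_of_maps_to (t := univ) (g := f) (fun _ _ => mem_univ _)]
        refine (Finset.sum_le_card_nsmul _ _ 1 fun y _ =>
            sum_div_mass_le_one hp f y _ fun ω hω => (Finset.mem_filter.1 hω).2).trans ?_
        simp
    _ ≤ _ := by
        rw [← Finset.sum_neg_distrib]
        refine Finset.sum_le_sum fun ω _ => ?_
        rcases (hp ω).eq_or_lt with h | h
        · simp [← h]
        have hm := mass_pos hp f h
        have h1 := Real.one_sub_inv_le_log_of_pos (mul_pos hm hN)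
        have h2 : -(p ω / mass p f ω / Fintype.card κ) =
            p ω * (-(mass p f ω * Fintype.card κ)⁻¹) := by
          field_simp
        rw [h2]
        exact mul_le_mul_of_nonneg_left (by linarith) h.le

theorem mul_exp_neg_le {c : ℝ} (hc : 0 < c) (t : ℝ) : t * Real.exp (-c * t) ≤ 1 / c := by
  have h := Real.add_one_le_exp (c * t)
  rw [neg_mul, Real.exp_neg, ← div_eq_mul_inv, div_le_div_iff₀ (Real.exp_pos _) hc]
  linarith

namespace Sys

variable {W : Type*} [Fintype W] [Nonempty W] (S : Sys W) {i t q : ℕ}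

theorem mass_cell_pre_le {z δ : ℝ} (hz : z ∈ S.K) (hδ : 0 < δ) (hδt : δ ≤ S.α ^ (i + t))
    (ω : Fin (i + (t + q)) → W) :
    mass (uw W (i + (t + q))) (fun ω => (S.cell δ z ω, pre i ω)) ω ≤
      (1 / Fintype.card W) ^ i * S.NN t (S.Tl z (List.ofFn (fstw ω))) (midw ω) := by
  classical
  set z' := S.Tl z (List.ofFn (fstw ω)) with hz'
  have hz'K : z' ∈ S.K := S.Tl_mem hz _
  have key : ∀ ω' : Fin (i + (t + q)) → W, (S.cell δ z ω', pre i ω') = (S.cell δ z ω, pre i ω) →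
      fstw ω' = fstw ω ∧
      |S.V z' (List.ofFn (midw ω')) - S.V z' (List.ofFn (midw ω))| ≤ S.D * S.α ^ t := by
    intro ω' h
    obtain ⟨h1, h2⟩ := Prod.mk.inj h
    rw [pre_eq_iff_fstw] at h2
    refine ⟨h2, ?_⟩
    have h3 := abs_sub_lt_of_floor_eq h1
    rw [← sub_div, abs_div, abs_of_pos hδ, div_lt_one hδ, append_fstw_midw ω,
      append_fstw_midw ω', h2, List.ofFn_fin_append, List.ofFn_fin_append, V_append, V_append,
      List.ofFn_fin_append, List.ofFn_fin_append, V_append, V_append] at h3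
    simp only [List.length_ofFn] at h3
    rw [← hz'] at h3
    set a := S.V z' (List.ofFn (midw ω'))
    set b := S.V z' (List.ofFn (midw ω))
    set c := S.V (S.Tl z' (List.ofFn (midw ω'))) _ with hc
    set d := S.V (S.Tl z' (List.ofFn (midw ω))) _ with hd
    have hcR : |c| ≤ S.R := S.abs_V_le (S.Tl_mem hz'K _) _
    have hdR : |d| ≤ S.R := S.abs_V_le (S.Tl_mem hz'K _) _
    have hi : 0 < S.α ^ i := pow_pos S.α_pos i
    have ht : 0 < S.α ^ t := pow_pos S.α_pos t
    have h4 : |a - b + S.α ^ t * (c - d)| ≤ S.α ^ t := by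
      have h5 := h3.le.trans hδt
      rw [show ∀ x : ℝ, x + S.α ^ i * (a + S.α ^ t * c) - (x + S.α ^ i * (b + S.α ^ t * d)) =
        S.α ^ i * (a - b + S.α ^ t * (c - d)) by intro x; ring, abs_mul, abs_of_pos hi,
        pow_add] at h5
      exact le_of_mul_le_mul_left h5 hi
    have h6 : |S.α ^ t * (c - d)| ≤ S.α ^ t * (2 * S.R) := by
      rw [abs_mul, abs_of_pos ht]
      refine mul_le_mul_of_nonneg_left ?_ ht.le
      rw [abs_le] at *
      constructor <;> linarith
    have hD := S.le_D
    have h7 : S.α ^ t * (2 * S.R + 1) ≤ S.D * S.α ^ t := by nlinarith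
    rw [abs_le] at *
    constructor <;> linarith
  have h := sum_fstw_midw (q := q) (W := W) fun (u : Fin i → W) (v : Fin t → W) =>
    if u = fstw ω then if |S.V z' (List.ofFn v) - S.V z' (List.ofFn (midw ω))| ≤ S.D * S.α ^ t
      then 1 else 0 else 0
  calc _ ≤ ∑ ω', uw W (i + (t + q)) ω' * (if fstw ω' = fstw ω then
          if |S.V z' (List.ofFn (midw ω')) - S.V z' (List.ofFn (midw ω))| ≤ S.D * S.α ^ t
          then 1 else 0 else 0) := by
        unfold mass
        refine Finset.sum_le_sum fun ω' _ => ?_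
        have := uw_nonneg ω'
        split_ifs with h1 h2 h3 h4 <;> try simp [this]
        · exact absurd (key ω' h1).2 h3
        · exact absurd (key ω' h1).1 h2
    _ = _ := by
        rw [h, Finset.sum_eq_single (fstw ω)]
        · simp only [if_true, NN, mul_ite, mul_one, mul_zero]
          rfl
        · intro u _ hu
          simp [hu]
        · simp

/-- Restricted to an arbitrary event, the conditional entropy of fine scales is almost maximal. -/
theorem exists_le_cent_restr {ε : ℝ} (hε : 0 < ε) : ∃ C : ℝ, 0 ≤ C ∧ ∀ i t q : ℕ, ∀ z ∈ S.K,
    ∀ δ : ℝ, 0 < δ → δ ≤ S.α ^ (i + t) → ∀ E : Set (Fin (i + (t + q)) → W),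
    (∑ ω, restr (uw W _) E ω) * ((S.β - ε) * t) - C ≤
      cent (restr (uw W _) E) (S.cell δ z) (pre i) := by
  classical
  obtain ⟨C₀, c, hC₀, hc, htail⟩ := S.exists_tail hε
  set C := max C₀ 1 with hC
  have hC1 : 1 ≤ C := le_max_right _ _
  have hβ := S.β_nonneg
  refine ⟨1 + (Real.log C + S.β * (C / c)), by
    have := Real.log_nonneg hC1
    positivity, fun i t q z hz δ hδ hδt E => ?_⟩
  set p := uw W (i + (t + q)) with hp
  have hp0 : ∀ ω, 0 ≤ p ω := uw_nonneg
  set pE := restr p E with hpE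
  have hpE0 : ∀ ω, 0 ≤ pE ω := restr_nonneg hp0 E
  have hpEle : ∀ ω, pE ω ≤ p ω := restr_le hp0 E
  have hcard : (0 : ℝ) < Fintype.card W := by exact_mod_cast Fintype.card_pos
  set N : (Fin (i + (t + q)) → W) → ℝ := fun ω => S.NN t (S.Tl z (List.ofFn (fstw ω))) (midw ω)
  have hNpos : ∀ ω, 0 < N ω := fun ω => S.NN_pos _ _ _
  set bad : (Fin (i + (t + q)) → W) → ℝ := fun ω =>
    if C * Real.exp (-(S.β - ε) * t) < N ω then 1 else 0
  have hbad0 : ∀ ω, 0 ≤ bad ω := fun ω => by simp only [bad]; split_ifs <;> norm_num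
  have hbad : ∑ ω, p ω * bad ω ≤ C * Real.exp (-c * t) := by
    have h := sum_fstw_midw (q := q) (W := W) fun (u : Fin i → W) (v : Fin t → W) =>
      if C * Real.exp (-(S.β - ε) * t) < S.NN t (S.Tl z (List.ofFn u)) v then 1 else 0
    rw [h, ← sum_uw_mul_const (W := W) i (C * Real.exp (-c * t))]
    refine Finset.sum_le_sum fun (u : Fin i → W) _ => mul_le_mul_of_nonneg_left ?_ (uw_nonneg u)
    refine le_trans ?_ ((htail t _ (S.Tl_mem hz (List.ofFn u))).trans
      (mul_le_mul_of_nonneg_right (le_max_left _ _) (Real.exp_pos _).le))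
    refine Finset.sum_le_sum fun v _ => ?_
    have hv := uw_nonneg v
    have hle : C₀ * Real.exp (-(S.β - ε) * t) ≤ C * Real.exp (-(S.β - ε) * t) :=
      mul_le_mul_of_nonneg_right (le_max_left _ _) (Real.exp_pos _).le
    split_ifs with h1 h2
    · simp
    · exact absurd (hle.trans_lt h1) h2
    · simpa using hv
    · simp
  have hpt : ∀ ω, (S.β - ε) * t - Real.log C - S.β * t * bad ω ≤ -Real.log (N ω) := by
    intro ω
    simp only [bad]
    split_ifs with h
    · have h1 : Real.log (N ω) ≤ 0 := Real.log_nonpos (hNpos ω).le (S.NN_le_one _ _ _)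
      have h2 := Real.log_nonneg hC1
      have h3 : 0 ≤ ε * t := by positivity
      linarith
    · have h1 := Real.log_le_log (hNpos ω) (not_lt.1 h)
      rw [Real.log_mul (by linarith) (Real.exp_pos _).ne', Real.log_exp] at h1
      linarith
  have hmain : ∑ ω, pE ω * (-Real.log (N ω)) ≥
      (∑ ω, pE ω) * ((S.β - ε) * t) - (Real.log C + S.β * (C / c)) := by
    have hsum1 : ∑ ω, pE ω ≤ 1 := by
      rw [← sum_uw (W := W) (i + (t + q))]
      exact Finset.sum_le_sum fun ω _ => hpEle ω
    have hb2 : ∑ ω, pE ω * bad ω ≤ ∑ ω, p ω * bad ω :=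
      Finset.sum_le_sum fun ω _ => mul_le_mul_of_nonneg_right (hpEle ω) (hbad0 ω)
    have hb3 : S.β * t * ∑ ω, pE ω * bad ω ≤ S.β * (C / c) := by
      calc _ ≤ S.β * t * (C * Real.exp (-c * t)) :=
            mul_le_mul_of_nonneg_left (hb2.trans hbad) (by positivity)
        _ = S.β * C * (t * Real.exp (-c * t)) := by ring
        _ ≤ S.β * C * (1 / c) := mul_le_mul_of_nonneg_left (mul_exp_neg_le hc _) (by positivity)
        _ = _ := by ring
    calc _ ≥ ∑ ω, pE ω * ((S.β - ε) * t - Real.log C - S.β * t * bad ω) :=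
          Finset.sum_le_sum fun ω _ => mul_le_mul_of_nonneg_left (hpt ω) (hpE0 ω)
      _ = (∑ ω, pE ω) * ((S.β - ε) * t) - (∑ ω, pE ω) * Real.log C -
          S.β * t * ∑ ω, pE ω * bad ω := by
          simp only [Finset.sum_mul, Finset.mul_sum, ← Finset.sum_sub_distrib]
          exact Finset.sum_congr rfl fun _ _ => by ring
      _ ≥ _ := by
          have := mul_le_of_le_one_left (Real.log_nonneg hC1) hsum1
          linarith
  have hfirst := neg_one_le_sum_log_mass (κ := Fin i → W) hpE0 fstw
  have hmf : ∀ ω, mass pE (pre i) ω = mass pE fstw ω := fun ω =>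
    mass_congr (fun ω ω' => pre_eq_iff_fstw ω ω') ω
  rw [cent_eq_sum hpE0]
  calc _ ≤ ∑ ω, pE ω * Real.log (mass pE fstw ω * Fintype.card (Fin i → W)) +
        ∑ ω, pE ω * (-Real.log (N ω)) := by linarith
    _ ≤ _ := by
        rw [← Finset.sum_add_distrib]
        refine Finset.sum_le_sum fun ω _ => ?_
        rcases (hpE0 ω).eq_or_lt with h | h
        · simp [← h]
        rw [← mul_add]
        refine mul_le_mul_of_nonneg_left ?_ h.le
        have h1 := mass_pos hpE0 fstw h
        have h2 : 0 < mass pE (fun ω => (S.cell δ z ω, pre i ω)) ω := mass_pos hpE0 _ h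
        have h3 := (mass_restr_le hp0 E (fun ω => (S.cell δ z ω, pre i ω)) ω).trans
          (S.mass_cell_pre_le hz hδ hδt ω)
        have h4 : (0 : ℝ) < Fintype.card (Fin i → W) := by exact_mod_cast Fintype.card_pos
        rw [← sub_eq_add_neg, ← Real.log_div (by positivity) (hNpos ω).ne', hmf]
        refine Real.log_le_log (by have := hNpos ω; positivity) ?_
        rw [div_le_div_iff₀ (hNpos ω) h2]
        have h5 : (Fintype.card (Fin i → W) : ℝ) * (1 / Fintype.card W) ^ i = 1 := by
          rw [Fintype.card_fun, Fintype.card_fin]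
          push_cast
          rw [← mul_pow, mul_one_div_cancel hcard.ne', one_pow]
        calc _ ≤ mass pE fstw ω * Fintype.card (Fin i → W) * ((1 / Fintype.card W) ^ i * N ω) :=
              mul_le_mul_of_nonneg_left h3 (by positivity)
          _ = mass pE fstw ω * N ω * (Fintype.card (Fin i → W) * (1 / Fintype.card W) ^ i) := by
              ring
          _ = _ := by rw [h5, mul_one]

end Sys

namespace Sys
variable {W : Type*} [Fintype W] [Nonempty W] (S : Sys W)

theorem cell_two_pow_mul {n : ℕ} (k : ℕ) (δ z : ℝ) (ω : Fin n → W) :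
    S.cell (2 ^ k * δ) z ω = S.cell δ z ω / 2 ^ k := by
  unfold cell
  have h := Int.floor_div_natCast (S.V z (List.ofFn ω) / δ) (2 ^ k)
  push_cast at h
  rw [mul_comm, ← div_div]
  exact_mod_cast h

theorem cell_eq_of_eq {n : ℕ} {k : ℕ} {δ z : ℝ} {ω ω' : Fin n → W}
    (h : S.cell δ z ω = S.cell δ z ω') : S.cell (2 ^ k * δ) z ω = S.cell (2 ^ k * δ) z ω' := by
  rw [cell_two_pow_mul, cell_two_pow_mul, h]

variable {ε C : ℝ} (hC : ∀ n, ∀ z ∈ S.K, (S.β - ε) * n ≤ S.H n z + C)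
include hC

theorem le_cent_cell_given_pre {ℓ i : ℕ} (hi : i ≤ ℓ) {z : ℝ} (hz : z ∈ S.K) :
    (S.β - ε) * (ℓ - i) - (C + S.e₀) ≤ cent (uw W ℓ) (S.cell (S.α ^ ℓ) z) (pre i) := by
  obtain ⟨t, rfl⟩ := Nat.exists_eq_add_of_le hi
  have h1 := S.le_cent_cell_pre (s := i) (t := t) z
  have h2 : (S.β - ε) * t - C ≤ ∑ u, uw W i u * S.H t (S.Tl z (List.ofFn u)) := by
    rw [← sum_uw_mul_const (W := W) i ((S.β - ε) * t - C)]
    exact Finset.sum_le_sum fun u _ => mul_le_mul_of_nonneg_left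
      (by linarith [hC t _ (S.Tl_mem hz (List.ofFn u))]) (uw_nonneg u)
  push_cast
  have : (i : ℝ) + t - i = t := by ring
  rw [this]
  linarith

theorem cent_cell_given_pre_le {ℓ i : ℕ} (hi : i ≤ ℓ) {z : ℝ} (hz : z ∈ S.K)
    (hH : S.H ℓ z ≤ (S.β + ε) * ℓ) :
    cent (uw W ℓ) (S.cell (S.α ^ ℓ) z) (pre i) ≤
      (S.β + ε) * ℓ - (S.β - ε) * i + (C + 5 * S.e₀) := by
  obtain ⟨t, rfl⟩ := Nat.exists_eq_add_of_le hi
  have h1 := S.cent_cell_pre_le (s := i) (t := t) z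
  have h2 := S.H_superadd i t hz
  have h3 := hC i z hz
  linarith

theorem cent_cell_cell_le {ℓ n : ℕ} (hn : n ≤ ℓ) {z : ℝ} (hz : z ∈ S.K)
    (hH : S.H ℓ z ≤ (S.β + ε) * ℓ) {δ' : ℝ} (hδ : S.α ^ n ≤ δ') (hδ' : δ' ≤ 2 * S.α ^ n) :
    cent (uw W ℓ) (S.cell (S.α ^ ℓ) z) (S.cell δ' z) ≤
      (S.β + ε) * ℓ - (S.β - ε) * n + (C + 2 * S.e₀ + Real.log 3) := by
  have hα := S.α_pos
  have h1 := S.ent_cell_add_cent_le (W := W) (n := ℓ) (pow_pos hα ℓ)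
    ((pow_le_pow_of_le_one hα.le S.α_lt.le hn).trans hδ) z
  have h2 : ent (uw W ℓ) (S.cell (S.α ^ n) z) ≤ ent (uw W ℓ) (S.cell δ' z) + Real.log 3 := by
    have := ent_floor_le (p := uw W ℓ) uw_nonneg (sum_uw ℓ)
      (fun ω => S.V z (List.ofFn ω) / S.α ^ n) (S.cell δ' z) 2 fun ω ω' h => by
        have hp := pow_pos hα n
        have h3 := (abs_lt.1 (abs_sub_lt_of_floor_eq h)).2
        rw [← sub_div, div_lt_one (by linarith)] at h3
        have : S.V z (List.ofFn ω) ≤ S.V z (List.ofFn ω') + 2 * S.α ^ n := by linarith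
        calc _ ≤ (S.V z (List.ofFn ω') + 2 * S.α ^ n) / S.α ^ n := by gcongr
          _ = _ := by rw [add_div, mul_div_assoc, div_self hp.ne', mul_one]
    refine this.trans_eq ?_
    norm_num
  have h3 : S.H n z ≤ ent (uw W ℓ) (S.cell (S.α ^ n) z) + S.e₀ := by
    obtain ⟨t, rfl⟩ := Nat.exists_eq_add_of_le hn
    exact S.le_ent_cell hz
  have h4 : ent (uw W ℓ) (S.cell (S.α ^ ℓ) z) = S.H ℓ z := rfl
  have h5 := hC n z hz
  linarith

end Sys

theorem ent_id_uw_pre {W : Type*} [Fintype W] [Nonempty W] {ℓ n j : ℕ} (hj : j ≤ n) (hn : n ≤ ℓ) :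
    cent (uw W ℓ) (pre n) (pre j) = ((n : ℝ) - j) * Real.log (Fintype.card W) := by
  have key : ∀ i, i ≤ ℓ → ent (uw W ℓ) (pre i) = i * Real.log (Fintype.card W) := by
    intro i hi
    obtain ⟨t, rfl⟩ := Nat.exists_eq_add_of_le hi
    have h := ent_pre_comp (W := W) (s := i) (t := t) (fun l : List W => l)
    rw [h, ← Sys.ent_id_uw]
    exact ent_congr fun ω ω' => by simp [List.ofFn_injective.eq_iff]
  have h1 : cent (uw W ℓ) (pre n) (pre j) =
      ent (uw W ℓ) (fun ω => (pre n ω, pre j ω)) - ent (uw W ℓ) (pre j) := rfl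
  have h2 : ent (uw W ℓ) (fun ω => (pre n ω, pre j ω)) = ent (uw W ℓ) (pre n) :=
    ent_congr fun ω ω' => ⟨fun h => (Prod.ext_iff.1 h).1,
      fun h => Prod.ext h (pre_eq_of_le hj h)⟩
  rw [h1, h2, key n hn, key j (hj.trans hn)]
  ring

namespace Sys
variable {W : Type*} [Fintype W] [Nonempty W] (S : Sys W)

/-- The discretised horizontal displacement of the `n`-th approximation. -/
noncomputable def shift (a δ : ℝ) (n : ℕ) {ℓ : ℕ} (ω : Fin ℓ → W) : ℤ := ⌊a * S.X (pre n ω) / δ⌋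

/-- The entropy loss caused by replacing a shifted projection by the difference of cells. -/
noncomputable def shiftConst (a : ℝ) : ℝ :=
  Real.log (⌈2 * (|a| * S.R / S.α) + 3⌉₊ + 1) + Real.log (⌈1 + 2 * |a| * S.R⌉₊ + 1)

variable {ε C : ℝ} (hC : ∀ n, ∀ z ∈ S.K, (S.β - ε) * n ≤ S.H n z + C)
  {ℓ n j J : ℕ} (hj : j ≤ n) (hn : n ≤ ℓ) {z a : ℝ} (hz : z ∈ S.K) (hza : z + a ∈ S.K)
  (hH : S.H ℓ z ≤ (S.β + ε) * ℓ) (hHa : S.H ℓ (z + a) ≤ (S.β + ε) * ℓ)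
  (hJ : S.α ^ n ≤ 2 ^ J * S.α ^ ℓ) (hJ' : 2 ^ J * S.α ^ ℓ ≤ 2 * S.α ^ n)
  (hrj : S.r ^ j ≤ S.α ^ n) (hrn : S.r ^ n ≤ S.α ^ ℓ / S.α)

include hC hn hz hH hJ hJ' in
theorem cent_cell_coarse_le : cent (uw W ℓ) (S.cell (S.α ^ ℓ) z)
      (fun ω => (S.cell (2 ^ J * S.α ^ ℓ) z ω, pre j ω)) ≤
      (S.β + ε) * ℓ - (S.β - ε) * n + (C + 2 * S.e₀ + Real.log 3) :=
  (cent_anti uw_nonneg _ fun _ _ h => (Prod.ext_iff.1 h).1).trans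
    (S.cent_cell_cell_le hC hn hz hH hJ hJ')

include hC hj hn hz hJ in
theorem le_cent_cell_fine : (S.β - ε) * (ℓ - n) - (C + 2 * S.e₀) ≤
    cent (uw W ℓ) (S.cell (S.α ^ ℓ) z)
      (fun ω => (pre n ω, (S.cell (2 ^ J * S.α ^ ℓ) z ω, pre j ω))) := by
  have h1 := S.le_cent_cell_given_pre (W := W) hC hn hz
  have h2 := S.cent_le_cent_cell_pre (W := W) hn hz uw_nonneg (S.cell (S.α ^ ℓ) z) (pre n)
    (fun _ _ h => h) hJ
  rw [sum_uw, one_mul] at h2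
  have h3 : cent (uw W ℓ) (S.cell (S.α ^ ℓ) z)
      (fun ω => (S.cell (2 ^ J * S.α ^ ℓ) z ω, pre n ω)) ≤
      cent (uw W ℓ) (S.cell (S.α ^ ℓ) z)
      (fun ω => (pre n ω, (S.cell (2 ^ J * S.α ^ ℓ) z ω, pre j ω))) := by
    refine cent_anti uw_nonneg _ fun ω ω' h => ?_
    simp only [Prod.mk.injEq] at h ⊢
    exact ⟨h.2, h.1, pre_eq_of_le hj h.2⟩
  linarith

theorem abs_X_sub_pre {i : ℕ} (hi : i ≤ ℓ) (ω : Fin ℓ → W) :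
    |S.X (List.ofFn ω) - S.X (pre i ω)| ≤ S.r ^ i * S.R := by
  rw [ofFn_eq_pre_append i ω, X_append, length_pre hi, add_sub_cancel_left, abs_mul,
    abs_of_nonneg (pow_nonneg S.r_pos.le _)]
  exact mul_le_mul_of_nonneg_left (S.abs_X_le _) (pow_nonneg S.r_pos.le _)

include hn hrn in
theorem abs_shift_sub_le (ω : Fin ℓ → W) :
    |a * S.X (pre n ω) / S.α ^ ℓ - a * S.X (List.ofFn ω) / S.α ^ ℓ| ≤ |a| * S.R / S.α := by
  have hα := pow_pos S.α_pos ℓ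
  rw [← sub_div, ← mul_sub, abs_div, abs_mul, abs_of_pos hα, div_le_iff₀ hα, abs_sub_comm]
  calc _ ≤ |a| * (S.r ^ n * S.R) :=
        mul_le_mul_of_nonneg_left (S.abs_X_sub_pre hn ω) (abs_nonneg a)
    _ ≤ |a| * (S.α ^ ℓ / S.α * S.R) := by
        have := S.R_nonneg
        gcongr
    _ = _ := by ring

include hC hj hn hza hHa hJ hJ' hrj hrn in
theorem cent_cell_sub_shift_le : cent (uw W ℓ)
      (fun ω => S.cell (S.α ^ ℓ) z ω - S.shift a (S.α ^ ℓ) n ω)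
      (fun ω => (S.cell (2 ^ J * S.α ^ ℓ) z ω, pre j ω)) ≤
      (S.β + ε) * ℓ - (S.β - ε) * n + (C + 2 * S.e₀ + Real.log 3 + S.shiftConst a) := by
  have hα := pow_pos S.α_pos ℓ
  set Q : (Fin ℓ → W) → ℤ × List W := fun ω => (S.cell (2 ^ J * S.α ^ ℓ) z ω, pre j ω) with hQ
  have hV : ∀ ω : Fin ℓ → W, S.V (z + a) (List.ofFn ω) =
      S.V z (List.ofFn ω) - a * S.X (List.ofFn ω) := fun ω => S.V_add z a _
  have hsh := S.abs_shift_sub_le (W := W) (a := a) hn hrn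
  have h1 := cent_le_add_log (p := uw W ℓ) uw_nonneg
    (fun ω => S.cell (S.α ^ ℓ) z ω - S.shift a (S.α ^ ℓ) n ω) (S.cell (S.α ^ ℓ) (z + a)) Q
    ⌈2 * (|a| * S.R / S.α) + 3⌉₊ fun ω ω' _ h => by
      have h2 : ((S.cell (S.α ^ ℓ) (z + a) ω : ℤ) : ℝ) = S.cell (S.α ^ ℓ) (z + a) ω' := by
        exact_mod_cast h
      have h3 := abs_le.1 (hsh ω)
      have h4 := abs_le.1 (hsh ω')
      have h5 := Nat.le_ceil (2 * (|a| * S.R / S.α) + 3)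
      have hsub : ∀ ω : Fin ℓ → W, S.V (z + a) (List.ofFn ω) / S.α ^ ℓ =
          S.V z (List.ofFn ω) / S.α ^ ℓ - a * S.X (List.ofFn ω) / S.α ^ ℓ := fun ω => by
        rw [hV, sub_div]
      unfold cell shift at *
      rw [hsub, hsub] at h2
      have e1 := Int.floor_le (S.V z (List.ofFn ω) / S.α ^ ℓ)
      have e2 := Int.lt_floor_add_one (S.V z (List.ofFn ω') / S.α ^ ℓ)
      have e3 := Int.lt_floor_add_one (a * S.X (pre n ω) / S.α ^ ℓ)
      have e4 := Int.floor_le (a * S.X (pre n ω') / S.α ^ ℓ)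
      have e5 := Int.lt_floor_add_one
        (S.V z (List.ofFn ω) / S.α ^ ℓ - a * S.X (List.ofFn ω) / S.α ^ ℓ)
      have e6 := Int.floor_le
        (S.V z (List.ofFn ω') / S.α ^ ℓ - a * S.X (List.ofFn ω') / S.α ^ ℓ)
      have : ((⌊S.V z (List.ofFn ω) / S.α ^ ℓ⌋ - ⌊a * S.X (pre n ω) / S.α ^ ℓ⌋ : ℤ) : ℝ) ≤
          ((⌊S.V z (List.ofFn ω') / S.α ^ ℓ⌋ - ⌊a * S.X (pre n ω') / S.α ^ ℓ⌋ +
            (⌈2 * (|a| * S.R / S.α) + 3⌉₊ : ℤ) : ℤ) : ℝ) := by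
        push_cast
        linarith
      exact_mod_cast this
  have hδ' : 0 < 2 ^ J * S.α ^ ℓ := by positivity
  have h2 : cent (uw W ℓ) (S.cell (2 ^ J * S.α ^ ℓ) (z + a)) Q ≤
      Real.log (⌈1 + 2 * |a| * S.R⌉₊ + 1) := by
    have := cent_floor_le (p := uw W ℓ) uw_nonneg
      (fun ω => S.V (z + a) (List.ofFn ω) / (2 ^ J * S.α ^ ℓ)) (fun _ => ()) Q
      (1 + 2 * |a| * S.R) fun ω ω' h _ => by
        have e1 := (abs_lt.1 (abs_sub_lt_of_floor_eq (Prod.ext_iff.1 h).1)).2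
        have e2 : pre j ω = pre j ω' := (Prod.ext_iff.1 h).2
        have e3 := S.abs_X_sub_pre (hj.trans hn) ω
        have e4 := S.abs_X_sub_pre (hj.trans hn) ω'
        rw [← e2] at e4
        have hR := S.R_nonneg
        have e5 : |S.X (List.ofFn ω) - S.X (List.ofFn ω')| ≤ 2 * S.R * (2 ^ J * S.α ^ ℓ) := by
          have : |S.X (List.ofFn ω) - S.X (List.ofFn ω')| ≤ S.r ^ j * S.R + S.r ^ j * S.R := by
            calc _ = |(S.X (List.ofFn ω) - S.X (pre j ω)) -
                  (S.X (List.ofFn ω') - S.X (pre j ω))| := by ring_nf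
              _ ≤ _ := (abs_sub _ _).trans (add_le_add e3 e4)
          nlinarith [mul_le_mul_of_nonneg_right (hrj.trans hJ) hR]
        have e6 : a * S.X (List.ofFn ω') - a * S.X (List.ofFn ω) ≤
            |a| * (2 * S.R * (2 ^ J * S.α ^ ℓ)) := by
          rw [← mul_sub]
          refine (le_abs_self _).trans ?_
          rw [abs_mul, abs_sub_comm]
          exact mul_le_mul_of_nonneg_left e5 (abs_nonneg a)
        rw [← sub_div, div_lt_one hδ'] at e1
        rw [hV, hV, div_le_iff₀ hδ', add_mul, div_mul_cancel₀ _ hδ'.ne']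
        linarith
    rw [sum_uw, one_mul, cent_eq_zero (f := fun _ : Fin ℓ → W => ()) fun _ _ _ => rfl,
      zero_add] at this
    exact this
  have h3 := cent_le_add (p := uw W ℓ) uw_nonneg (S.cell (S.α ^ ℓ) (z + a))
    (S.cell (2 ^ J * S.α ^ ℓ) (z + a)) Q
  have h4 : cent (uw W ℓ) (S.cell (S.α ^ ℓ) (z + a))
      (fun ω => (S.cell (2 ^ J * S.α ^ ℓ) (z + a) ω, Q ω)) ≤ _ :=
    (cent_anti uw_nonneg _ fun _ _ h => (Prod.ext_iff.1 h).1).trans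
      (S.cent_cell_cell_le hC hn hza hHa hJ hJ')
  rw [sum_uw, one_mul] at h1
  unfold shiftConst
  linarith

include hC hj hn hz hH hJ hJ' in
theorem cent_shift_sub_le : cent (uw W ℓ) (S.shift a (S.α ^ ℓ) n)
      (fun ω => (S.cell (2 ^ J * S.α ^ ℓ) z ω, pre j ω)) -
      cent (uw W ℓ) (S.shift a (S.α ^ ℓ) n) (fun ω => (S.cell (S.α ^ ℓ) z ω, pre j ω)) ≤
      2 * ε * ℓ + (2 * C + 4 * S.e₀ + Real.log 3) := by
  set Q : (Fin ℓ → W) → ℤ × List W := fun ω => (S.cell (2 ^ J * S.α ^ ℓ) z ω, pre j ω) with hQ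
  set V : (Fin ℓ → W) → ℤ := S.cell (S.α ^ ℓ) z with hV
  set A : (Fin ℓ → W) → ℤ := S.shift a (S.α ^ ℓ) n with hA
  have h1 : cent (uw W ℓ) A (fun ω => (V ω, pre j ω)) = cent (uw W ℓ) A (fun ω => (V ω, Q ω)) := by
    refine cent_congr (fun ω ω' => ?_) fun _ _ _ => Iff.rfl
    simp only [Prod.mk.injEq, hQ]
    exact ⟨fun h => ⟨h.1, cell_eq_of_eq S h.1, h.2⟩, fun h => ⟨h.1, h.2.2⟩⟩
  have h2 := cent_chain (p := uw W ℓ) A V Q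
  have h3 := cent_chain (p := uw W ℓ) V A Q
  have h4 : cent (uw W ℓ) (fun ω => (A ω, V ω)) Q = cent (uw W ℓ) (fun ω => (V ω, A ω)) Q :=
    cent_congr (fun _ _ => Iff.rfl) fun _ _ _ => by simp only [Prod.mk.injEq]; exact and_comm
  have h5 := S.cent_cell_coarse_le (j := j) hC hn hz hH hJ hJ'
  have h6 := S.le_cent_cell_fine hC hj hn hz hJ
  have h7 : cent (uw W ℓ) V (fun ω => (pre n ω, Q ω)) ≤
      cent (uw W ℓ) V (fun ω => (A ω, Q ω)) := by
    refine cent_anti uw_nonneg _ fun ω ω' h => ?_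
    simp only [Prod.mk.injEq] at h
    exact Prod.ext (by simp only [hA, shift, h.1]) h.2
  rw [h1]
  linarith

include hC hj hn hz hH in
theorem le_cent_pre_given : ((n : ℝ) - j) * (Real.log (Fintype.card W) - S.β) - 2 * ε * ℓ -
      (2 * C + 6 * S.e₀) + ε * (n - j) ≤
      cent (uw W ℓ) (pre n) (fun ω => (S.cell (S.α ^ ℓ) z ω, pre j ω)) := by
  have h1 := cent_chain (p := uw W ℓ) (pre n) (S.cell (S.α ^ ℓ) z) (pre j)
  have h2 := cent_chain (p := uw W ℓ) (S.cell (S.α ^ ℓ) z) (pre n) (pre j)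
  have h3 : cent (uw W ℓ) (fun ω => (pre n ω, S.cell (S.α ^ ℓ) z ω)) (pre j) =
      cent (uw W ℓ) (fun ω => (S.cell (S.α ^ ℓ) z ω, pre n ω)) (pre j) :=
    cent_congr (fun _ _ => Iff.rfl) fun _ _ _ => by simp only [Prod.mk.injEq]; exact and_comm
  have h4 := ent_id_uw_pre (W := W) hj hn
  have h5 : cent (uw W ℓ) (S.cell (S.α ^ ℓ) z) (fun ω => (pre n ω, pre j ω)) =
      cent (uw W ℓ) (S.cell (S.α ^ ℓ) z) (pre n) :=
    cent_congr (fun ω ω' => ⟨fun h => (Prod.ext_iff.1 h).1,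
      fun h => Prod.ext h (pre_eq_of_le hj h)⟩) fun _ _ _ => Iff.rfl
  have h6 := S.le_cent_cell_given_pre (W := W) hC hn hz
  have h7 := S.cent_cell_given_pre_le (W := W) hC (hj.trans hn) hz hH
  linarith

end Sys

section
variable {Ω : Type*} [Fintype Ω] {κ κ' : Type*} {ν : Ω → ℝ} {pre : Ω → κ}

/-- The probability that two independent copies given `pre` have different letters. -/
noncomputable def vary (ν : Ω → ℝ) (pre : Ω → κ) (letter : Ω → κ') : ℝ :=
  ∑ ω, ν ω * (1 - mass ν (fun ω => (letter ω, pre ω)) ω / mass ν pre ω)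

open Classical in
theorem sum_pairw_ne_eq (hν : ∀ ω, 0 ≤ ν ω) (letter : Ω → κ') :
    (∑ x : Ω × Ω, if letter x.1 ≠ letter x.2 then pairw ν pre x else 0) =
      vary ν pre letter := by
  rw [vary, Fintype.sum_prod_type]
  refine Finset.sum_congr rfl fun ω _ => ?_
  rcases (hν ω).eq_or_lt with h | h
  · simp [pairw, ← h]
  have hm := mass_pos hν pre h
  have h1 := sum_condw (Z := pre) hν h
  have h2 : ∑ ω', (if letter ω = letter ω' then condw ν pre ω ω' else 0) =
      mass ν (fun ω => (letter ω, pre ω)) ω / mass ν pre ω := by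
    unfold condw
    conv_rhs => rw [mass, Finset.sum_div]
    refine Finset.sum_congr rfl fun ω' _ => ?_
    have e : (letter ω = letter ω') = (letter ω' = letter ω) := propext eq_comm
    simp only [e]
    by_cases h3 : letter ω' = letter ω <;> by_cases h4 : pre ω' = pre ω <;> simp [h3, h4]
  rw [← h2, ← h1, ← Finset.sum_sub_distrib, Finset.mul_sum]
  refine Finset.sum_congr rfl fun ω' _ => ?_
  unfold pairw
  split_ifs <;> simp_all

theorem cent_le_of_vary [Fintype κ'] (hν : ∀ ω, 0 ≤ ν ω) (h1 : ∑ ω, ν ω = 1) (letter : Ω → κ')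
    {s : ℝ} (hs : 0 < s) : cent ν letter pre ≤
      s * vary ν pre letter + Fintype.card κ' / s := by
  have h2 := sum_mul_mass_div_le hν letter pre (fun _ _ => 1) (fun _ _ => zero_le_one)
    (Fintype.card κ') fun ω => by
      rw [Finset.sum_const, nsmul_one]
      exact_mod_cast Finset.card_le_univ _
  rw [h1, mul_one] at h2
  rw [vary, cent_eq_sum hν]
  calc _ ≤ ∑ ω, (s * (ν ω * (1 - mass ν (fun ω => (letter ω, pre ω)) ω / mass ν pre ω)) +
        (ν ω * (mass ν pre ω * 1 / mass ν (fun ω => (letter ω, pre ω)) ω)) / s) := by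
        refine Finset.sum_le_sum fun ω _ => ?_
        rcases (hν ω).eq_or_lt with h | h
        · simp [← h]
        have hm := mass_pos hν pre h
        have hm' := mass_pos hν (fun ω => (letter ω, pre ω)) h
        have hle : mass ν (fun ω => (letter ω, pre ω)) ω ≤ mass ν pre ω :=
          mass_mono hν fun ω' h => (Prod.ext_iff.1 h).2
        set M := mass ν pre ω
        set N := mass ν (fun ω => (letter ω, pre ω)) ω
        have : Real.log (M / N) ≤ s * (1 - N / M) + M / N / s := by
          set x := Real.sqrt (M / N)
          have hx : 0 < x := Real.sqrt_pos.2 (by positivity)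
          have hx2 : M / N = x ^ 2 := (Real.sq_sqrt (by positivity)).symm
          have hN : N / M = 1 / x ^ 2 := by rw [← hx2]; field_simp
          have hx1 : 1 ≤ x ^ 2 := by rw [← hx2]; exact (one_le_div hm').2 hle
          rw [hN, hx2, Real.log_pow]
          have hl := Real.log_le_sub_one_of_pos hx
          have h3 : 2 * (x - 1) ≤ s * (1 - 1 / x ^ 2) + x ^ 2 / s := by
            have e1 : 0 ≤ 1 - 1 / x ^ 2 := by
              rw [sub_nonneg, div_le_one (by positivity)]; exact hx1
            have e2 : 1 - 1 / x ^ 2 ≤ 1 := by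
              have : 0 ≤ 1 / x ^ 2 := by positivity
              linarith
            have e3 : (x - 1) ≤ x * (1 - 1 / x ^ 2) := by
              have : x * (1 - 1 / x ^ 2) = x - 1 / x := by field_simp
              rw [this]
              have : 1 / x ≤ 1 := by
                rw [div_le_one hx]; nlinarith
              linarith
            set u := 1 - 1 / x ^ 2
            have e4 : 2 * (x * u) ≤ s * u ^ 2 + x ^ 2 / s := by
              have : s * u ^ 2 + x ^ 2 / s - 2 * (x * u) = (s * u - x) ^ 2 / s := by
                field_simp
                ring
              have h5 : 0 ≤ (s * u - x) ^ 2 / s := by positivity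
              linarith
            nlinarith [mul_nonneg hs.le (mul_nonneg e1 (sub_nonneg.2 e2))]
          push_cast
          linarith
        calc ν ω * Real.log (M / N) ≤ ν ω * (s * (1 - N / M) + M / N / s) :=
              mul_le_mul_of_nonneg_left this h.le
          _ = _ := by ring
    _ = s * _ + (∑ ω, ν ω * (mass ν pre ω * 1 / mass ν (fun ω => (letter ω, pre ω)) ω)) / s := by
        rw [Finset.sum_add_distrib, ← Finset.mul_sum, Finset.sum_div]
    _ ≤ _ := by gcongr
end

namespace Sys
variable {W : Type*} [Fintype W] [Nonempty W] (S : Sys W)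

theorem exists_prefix_scale {ℓ n J k L t : ℕ}
    (hJ' : 2 ^ J * S.α ^ ℓ ≤ 2 * S.α ^ n) (hkJ : k + L ≤ J) (ht : 1 ≤ 2 ^ L * S.α ^ (t + 1))
    (ht' : 2 ≤ 2 ^ L * S.α ^ t) :
    ∃ i, n ≤ i ∧ S.α ^ i ≤ 2 ^ (k + L) * S.α ^ ℓ ∧ 2 ^ k * S.α ^ ℓ ≤ S.α ^ (i + t) := by
  have hα := S.α_pos
  have hδ := pow_pos hα ℓ
  have hJk : (2 : ℝ) ^ (k + L) * S.α ^ ℓ ≤ 2 * S.α ^ n := (mul_le_mul_of_nonneg_right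
    (pow_le_pow_right₀ one_le_two hkJ) hδ.le).trans hJ'
  by_cases h : S.α ^ n ≤ 2 ^ (k + L) * S.α ^ ℓ
  · refine ⟨n, le_rfl, h, ?_⟩
    rw [pow_add] at hJk ⊢
    have h2 : (0 : ℝ) < 2 ^ L := by positivity
    have hn' := pow_pos hα n
    refine le_of_mul_le_mul_right ?_ h2
    nlinarith [mul_le_mul_of_nonneg_left ht' hn'.le]
  · push Not at h
    have hex : ∃ i, S.α ^ i ≤ 2 ^ (k + L) * S.α ^ ℓ :=
      ⟨ℓ, le_mul_of_one_le_left hδ.le (one_le_pow₀ one_le_two)⟩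
    classical
    have hs := Nat.find_spec hex
    have hm := fun {i} => Nat.find_min (m := i) hex
    set i := Nat.find hex
    have hni : n < i := by
      by_contra hcon
      exact absurd ((pow_le_pow_of_le_one hα.le S.α_lt.le (not_lt.1 hcon)).trans hs) (not_le.2 h)
    obtain ⟨i', hi'⟩ : ∃ i', i = i' + 1 := ⟨i - 1, by omega⟩
    refine ⟨i, hni.le, hs, ?_⟩
    have h1 := not_le.1 (hm (i := i') (by omega))
    have h2 : (0 : ℝ) < 2 ^ L := by positivity
    have hi'' := pow_pos hα i'
    refine le_of_mul_le_mul_right ?_ h2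
    calc _ = 2 ^ (k + L) * S.α ^ ℓ := by ring
      _ ≤ S.α ^ i' * 1 := by linarith
      _ ≤ S.α ^ i' * (2 ^ L * S.α ^ (t + 1)) := mul_le_mul_of_nonneg_left ht hi''.le
      _ = _ := by rw [hi']; ring

theorem le_cent_window {ε C : ℝ} (hS : ∀ i t q : ℕ, ∀ z ∈ S.K,
    ∀ δ : ℝ, 0 < δ → δ ≤ S.α ^ (i + t) → ∀ E : Set (Fin (i + (t + q)) → W),
    (∑ ω, restr (uw W _) E ω) * ((S.β - ε) * t) - C ≤
      cent (restr (uw W _) E) (S.cell δ z) (pre i))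
    {ℓ n j J k L t : ℕ} (hj : j ≤ n) (hn : n ≤ ℓ) {z : ℝ} (hz : z ∈ S.K)
    (hJ' : 2 ^ J * S.α ^ ℓ ≤ 2 * S.α ^ n) (hkJ : k + L ≤ J) (ht : 1 ≤ 2 ^ L * S.α ^ (t + 1))
    (ht' : 2 ≤ 2 ^ L * S.α ^ t) (E : Set (Fin ℓ → W)) :
    (∑ ω, restr (uw W ℓ) E ω) * ((S.β - ε) * t) - (C + 2 * S.e₀) ≤
      cent (restr (uw W ℓ) E) (fun ω => S.cell (S.α ^ ℓ) z ω / 2 ^ k)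
        (fun ω => (S.cell (S.α ^ ℓ) z ω / 2 ^ (k + L),
          (S.cell (2 ^ J * S.α ^ ℓ) z ω, pre j ω))) := by
  have hα := S.α_pos
  have hδ := pow_pos hα ℓ
  obtain ⟨i, hni, h1, h2⟩ := S.exists_prefix_scale hJ' hkJ ht ht'
  have hit : i + t ≤ ℓ := by
    refine (pow_le_pow_iff_right_of_lt_one₀ hα S.α_lt).1 (le_trans ?_ h2)
    exact le_mul_of_one_le_left hδ.le (one_le_pow₀ one_le_two)
  have hp0 : ∀ ω, 0 ≤ restr (uw W ℓ) E ω := restr_nonneg uw_nonneg E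
  have hsum : ∑ ω, restr (uw W ℓ) E ω ≤ 1 := by
    rw [← sum_uw (W := W) ℓ]
    exact Finset.sum_le_sum fun ω _ => restr_le uw_nonneg E ω
  have hiJ : S.α ^ i ≤ 2 ^ J * S.α ^ ℓ := h1.trans
    (mul_le_mul_of_nonneg_right (pow_le_pow_right₀ one_le_two hkJ) hδ.le)
  have e0 : (∑ ω, restr (uw W ℓ) E ω) * S.e₀ ≤ S.e₀ := mul_le_of_le_one_left S.e₀_nonneg hsum
  have hmain : (∑ ω, restr (uw W ℓ) E ω) * ((S.β - ε) * t) - C ≤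
      cent (restr (uw W ℓ) E) (S.cell (2 ^ k * S.α ^ ℓ) z) (pre i) := by
    obtain ⟨q, hq⟩ := Nat.exists_eq_add_of_le hit
    have hq' : ℓ = i + (t + q) := by omega
    generalize S.α ^ ℓ = δ at *
    subst hq'
    exact hS i t q z hz _ (by positivity) h2 E
  simp only [← cell_two_pow_mul]
  have f1 := S.cent_le_cent_cell_pre (W := W) (by omega : i ≤ ℓ) hz hp0
    (S.cell (2 ^ k * S.α ^ ℓ) z) (pre i) (fun _ _ h => h) hiJ
  have f2 := S.cent_le_cent_cell_pre (W := W) (by omega : i ≤ ℓ) hz hp0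
    (S.cell (2 ^ k * S.α ^ ℓ) z) (fun ω => (S.cell (2 ^ J * S.α ^ ℓ) z ω, pre i ω))
    (fun _ _ h => (Prod.ext_iff.1 h).2) h1
  have f3 : cent (restr (uw W ℓ) E) (S.cell (2 ^ k * S.α ^ ℓ) z)
      (fun ω => (S.cell (2 ^ (k + L) * S.α ^ ℓ) z ω,
        (S.cell (2 ^ J * S.α ^ ℓ) z ω, pre i ω))) ≤
      cent (restr (uw W ℓ) E) (S.cell (2 ^ k * S.α ^ ℓ) z)
      (fun ω => (S.cell (2 ^ (k + L) * S.α ^ ℓ) z ω,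
        (S.cell (2 ^ J * S.α ^ ℓ) z ω, pre j ω))) := by
    refine cent_anti hp0 _ fun ω ω' h => ?_
    simp only [Prod.mk.injEq] at h ⊢
    exact ⟨h.1, h.2.1, pre_eq_of_le (hj.trans hni) h.2.2⟩
  linarith

end Sys

/-- The `i`-th letter of a word. -/
def letter {W : Type*} {ℓ : ℕ} (i : ℕ) (ω : Fin ℓ → W) : Option W := (List.ofFn ω)[i]?

theorem pre_succ_eq {W : Type*} {ℓ : ℕ} (i : ℕ) (ω : Fin ℓ → W) :
    pre (i + 1) ω = pre i ω ++ (letter i ω).toList := List.take_add_one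

theorem pre_succ_eq_iff {W : Type*} [Fintype W] {ℓ i : ℕ} (hi : i < ℓ) (ω ω' : Fin ℓ → W) :
    pre (i + 1) ω = pre (i + 1) ω' ↔ letter i ω = letter i ω' ∧ pre i ω = pre i ω' := by
  have hl : ∀ ω : Fin ℓ → W, letter i ω = some (ω ⟨i, hi⟩) := fun ω => by
    simp [letter, hi]
  constructor
  · intro h
    have h1 := pre_eq_of_le (Nat.le_succ i) h
    refine ⟨?_, h1⟩
    rw [pre_succ_eq, pre_succ_eq, h1, hl, hl] at h
    rw [hl, hl]
    simpa using h
  · rintro ⟨h1, h2⟩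
    rw [pre_succ_eq, pre_succ_eq, h1, h2]

theorem exists_pre_eq {W : Type*} {ℓ n i : ℕ} (hi : i < n) (hn : n ≤ ℓ) (ω : Fin ℓ → W) :
    ∃ w t, letter i ω = some w ∧ pre n ω = pre i ω ++ w :: t := by
  have hl : letter i ω = some (ω ⟨i, hi.trans_le hn⟩) := by simp [letter, hi.trans_le hn]
  refine ⟨_, (pre n ω).drop (i + 1), hl, ?_⟩
  have h1 : pre (i + 1) ω = (pre n ω).take (i + 1) := by
    simp [pre, List.take_take, Nat.min_eq_left (Nat.succ_le_of_lt hi)]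
  conv_lhs => rw [← List.take_append_drop (i + 1) (pre n ω), ← h1, pre_succ_eq, hl]
  simp

/-- Summation of letter entropies over a range of positions. -/
theorem cent_pre_eq_sum_letter {W : Type*} [Fintype W] {κ : Type*} {ℓ j d : ℕ} (hd : j + d ≤ ℓ)
    (p : (Fin ℓ → W) → ℝ) (Z : (Fin ℓ → W) → κ) (hZ : ∀ ω ω', Z ω = Z ω' → pre j ω = pre j ω') :
    cent p (pre (j + d)) Z =
      ∑ i ∈ range d, cent p (letter (j + i)) (fun ω => (pre (j + i) ω, Z ω)) := by
  induction d with
  | zero => simpa using cent_eq_zero hZ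
  | succ d ih =>
    rw [Finset.sum_range_succ, ← ih (by omega), ← cent_chain]
    exact cent_congr (fun _ _ => Iff.rfl) fun ω ω' _ => by
      rw [Prod.mk.injEq]
      exact pre_succ_eq_iff (by omega : j + d < ℓ) _ _

/-- Counting the events on which many letters carry entropy. -/
theorem sum_le_of_dichotomy {Ω : Type*} [Fintype Ω] {p : Ω → ℝ} (hp : ∀ ω, 0 ≤ p ω)
    (h1 : ∑ ω, p ω = 1) (I : Finset ℕ) (kk : ℕ → ℕ) (hkk : Set.InjOn kk I) {K : ℕ}
    (hK : ∀ i ∈ I, kk i < K) (κ hh : ℕ → Ω → ℝ) {κ₁ Λ η : ℝ} (hΛ : 0 ≤ Λ) (hη : 0 ≤ η)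
    (hs : ∀ i ∈ I, ∀ ω, 0 < p ω → hh i ω ≤ if κ₁ ≤ κ i ω then Λ else η) :
    ∑ i ∈ I, ∑ ω, p ω * hh i ω ≤ η * I.card +
      Λ * ∑ k ∈ range K, ∑ ω, restr p {ω | ∃ i ∈ I, kk i = k ∧ κ₁ ≤ κ i ω} ω := by
  classical
  set P : ℕ → ℝ := fun k => ∑ ω, restr p {ω | ∃ i ∈ I, kk i = k ∧ κ₁ ≤ κ i ω} ω with hP
  have hP0 : ∀ k, 0 ≤ P k := fun k => Finset.sum_nonneg fun ω _ => restr_nonneg hp _ ω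
  have h2 : ∑ i ∈ I, P (kk i) ≤ ∑ k ∈ range K, P k := by
    rw [← Finset.sum_image (f := P) hkk]
    refine Finset.sum_le_sum_of_subset_of_nonneg ?_ fun k _ _ => hP0 k
    intro k hk
    obtain ⟨i, hi, rfl⟩ := Finset.mem_image.1 hk
    exact Finset.mem_range.2 (hK i hi)
  have h3 : ∀ i ∈ I, ∑ ω, p ω * hh i ω ≤ η + Λ * P (kk i) := by
    intro i hi
    rw [← mul_one η, ← h1, hP, Finset.mul_sum, Finset.mul_sum, ← Finset.sum_add_distrib]
    refine Finset.sum_le_sum fun ω _ => ?_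
    rcases (hp ω).eq_or_lt with h | h
    · have := restr_nonneg hp {ω | ∃ i' ∈ I, kk i' = kk i ∧ κ₁ ≤ κ i' ω} ω
      rw [← h]
      simp only [zero_mul, mul_zero, zero_add]
      exact mul_nonneg hΛ this
    · have h4 := mul_le_mul_of_nonneg_left (hs i hi ω h) h.le
      split_ifs at h4 with h5
      · have : restr p {ω | ∃ i' ∈ I, kk i' = kk i ∧ κ₁ ≤ κ i' ω} ω = p ω :=
          Set.indicator_of_mem (show ω ∈ {ω | ∃ i' ∈ I, kk i' = kk i ∧ κ₁ ≤ κ i' ω} from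
            ⟨i, hi, rfl, h5⟩) p
        rw [this]
        nlinarith [mul_nonneg hη h.le]
      · have := mul_nonneg hΛ (restr_nonneg hp {ω | ∃ i' ∈ I, kk i' = kk i ∧ κ₁ ≤ κ i' ω} ω)
        linarith
  calc _ ≤ ∑ i ∈ I, (η + Λ * P (kk i)) := Finset.sum_le_sum h3
    _ = η * I.card + Λ * ∑ i ∈ I, P (kk i) := by
        rw [Finset.sum_add_distrib, Finset.sum_const, nsmul_eq_mul, ← Finset.mul_sum]
        ring
    _ ≤ _ := by gcongr

namespace Sys
variable {W : Type*} [Fintype W] [Nonempty W] (S : Sys W)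

/-- Words starting with different letters have well separated horizontal positions. -/
def Separated (g : ℝ) : Prop :=
  ∀ w w', w ≠ w' → ∀ t t' : List W, g ≤ |S.X (w :: t) - S.X (w' :: t')|

variable {S} {g : ℝ} (hg : 0 < g) (hsep : S.Separated g) {ℓ n i k : ℕ} (hi : i < n) (hn : n ≤ ℓ)
  {a δ : ℝ} (hδ : 0 < δ) (hk : 2 ^ (k + 1) ≤ |a| * g * S.r ^ i / δ)
include hi hn

theorem exists_X_pre_sub {ω ω' : Fin ℓ → W} (h : pre i ω = pre i ω') :
    ∃ w t w' t', letter i ω = some w ∧ letter i ω' = some w' ∧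
      |a * S.X (pre n ω) / δ - a * S.X (pre n ω') / δ| =
      |a| * S.r ^ i * |S.X (w :: t) - S.X (w' :: t')| / |δ| := by
  obtain ⟨w, t, h1, h2⟩ := exists_pre_eq hi hn ω
  obtain ⟨w', t', h1', h2'⟩ := exists_pre_eq hi hn ω'
  refine ⟨w, t, w', t', h1, h1', ?_⟩
  rw [h2, h2', X_append, X_append, h, length_pre (by omega), ← sub_div, abs_div]
  congr 1
  rw [← abs_of_nonneg (pow_nonneg S.r_pos.le i), ← abs_mul, ← abs_mul]
  congr 1
  rw [abs_of_nonneg (pow_nonneg S.r_pos.le i)]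
  ring

include hsep hδ hk in
theorem two_pow_le_shift_sub {ω ω' : Fin ℓ → W} (h : pre i ω = pre i ω')
    (hl : letter i ω ≠ letter i ω') : 2 ^ k ≤ |S.shift a δ n ω - S.shift a δ n ω'| := by
  obtain ⟨w, t, w', t', h1, h1', h2⟩ := exists_X_pre_sub (S := S) (a := a) (δ := δ) hi hn h
  have hww : w ≠ w' := fun e => hl (by rw [h1, h1', e])
  have h3 := hsep w w' hww t t'
  have h4 : 2 ^ (k + 1) ≤ |a * S.X (pre n ω) / δ - a * S.X (pre n ω') / δ| := by
    refine hk.trans ?_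
    rw [h2, abs_of_pos hδ]
    gcongr ?_ / _
    have := mul_le_mul_of_nonneg_left h3 (mul_nonneg (abs_nonneg a) (pow_nonneg S.r_pos.le i))
    linarith
  unfold shift
  set x := a * S.X (pre n ω) / δ
  set y := a * S.X (pre n ω') / δ
  have e1 := Int.floor_le x
  have e2 := Int.lt_floor_add_one x
  have e3 := Int.floor_le y
  have e4 := Int.lt_floor_add_one y
  have h5 : (2 : ℝ) ^ (k + 1) - 1 < |((⌊x⌋ - ⌊y⌋ : ℤ) : ℝ)| := by
    push_cast
    rcases le_abs.1 h4 with h | h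
    · exact lt_of_lt_of_le (by linarith) (le_abs_self _)
    · exact lt_of_lt_of_le (by linarith) (neg_le_abs _)
  have h6 : (2 : ℤ) ^ (k + 1) - 1 < |⌊x⌋ - ⌊y⌋| := by
    have : (((2 : ℤ) ^ (k + 1) - 1 : ℤ) : ℝ) < ((|⌊x⌋ - ⌊y⌋| : ℤ) : ℝ) := by
      push_cast at h5 ⊢
      exact h5
    exact_mod_cast this
  have h7 : (1 : ℤ) ≤ 2 ^ k := one_le_pow₀ one_le_two
  rw [pow_succ] at h6
  omega

include hδ hg in
theorem abs_shift_sub_le_mul {ω ω' : Fin ℓ → W} (h : pre i ω = pre i ω')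
    (hk' : |a| * g * S.r ^ i / δ < 2 ^ (k + 2)) :
    |((S.shift a δ n ω - S.shift a δ n ω' : ℤ) : ℝ)| ≤ (8 * S.R / g + 1) * 2 ^ k := by
  obtain ⟨w, t, w', t', h1, h1', h2⟩ := exists_X_pre_sub (S := S) (a := a) (δ := δ) hi hn h
  have h3 : |S.X (w :: t) - S.X (w' :: t')| ≤ 2 * S.R :=
    (abs_sub _ _).trans (by linarith [S.abs_X_le (w :: t), S.abs_X_le (w' :: t')])
  have hR := S.R_nonneg
  have h4 : |a * S.X (pre n ω) / δ - a * S.X (pre n ω') / δ| ≤ 8 * S.R / g * 2 ^ k := by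
    rw [h2, abs_of_pos hδ]
    calc _ ≤ |a| * S.r ^ i * (2 * S.R) / δ := by
          gcongr
          exact mul_nonneg (abs_nonneg a) (pow_nonneg S.r_pos.le i)
      _ = 2 * S.R / g * (|a| * g * S.r ^ i / δ) := by field_simp
      _ ≤ 2 * S.R / g * 2 ^ (k + 2) := by gcongr
      _ = _ := by ring
  unfold shift
  set x := a * S.X (pre n ω) / δ
  set y := a * S.X (pre n ω') / δ
  have e1 := Int.floor_le x
  have e2 := Int.lt_floor_add_one x
  have e3 := Int.floor_le y
  have e4 := Int.lt_floor_add_one y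
  have h7 : (1 : ℝ) ≤ 2 ^ k := one_le_pow₀ one_le_two
  push_cast
  have := abs_le.1 h4
  rw [abs_le]
  constructor <;> nlinarith

end Sys

namespace Sys
variable {W : Type*} [Fintype W] [Nonempty W] (S : Sys W)

theorem exists_scale_index {g : ℝ} (hg : 0 < g) {a δ : ℝ} (ha : a ≠ 0) (hδ : 0 < δ)
    {n j J L i₀ i₁ : ℕ} (hδn : δ ≤ S.r ^ n) (hJ : S.r ^ j ≤ 2 ^ J * δ)
    (hi₀ : 2 ≤ |a| * g * 2 ^ i₀) (hi₁ : |a| * g ≤ 2 ^ i₁) :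
    ∃ kk : ℕ → ℕ, Set.InjOn kk (Ico (j + i₁ + L) (n - i₀)) ∧
      ∀ i ∈ Ico (j + i₁ + L) (n - i₀), kk i < J - L ∧
        2 ^ (kk i + 1) ≤ |a| * g * S.r ^ i / δ ∧ |a| * g * S.r ^ i / δ < 2 ^ (kk i + 2) := by
  have hr := S.r_pos
  have hr2 := S.r_le
  have hag : 0 < |a| * g := mul_pos (abs_pos.2 ha) hg
  have h2r : 2 * S.r ≤ 1 := by linarith
  have hex : ∀ i, i ∈ Ico (j + i₁ + L) (n - i₀) → ∃ k : ℕ,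
      2 ^ (k + 1) ≤ |a| * g * S.r ^ i / δ ∧ |a| * g * S.r ^ i / δ < 2 ^ (k + 2) := by
    intro i hi
    rw [Finset.mem_Ico] at hi
    have h1 : 2 ≤ |a| * g * S.r ^ i / δ := by
      rw [le_div_iff₀ hδ]
      have h2 : 2 ^ i₀ * S.r ^ n ≤ S.r ^ i := by
        obtain ⟨d, hd⟩ := Nat.exists_eq_add_of_le (show i + i₀ ≤ n by omega)
        rw [hd, pow_add, pow_add]
        calc _ = S.r ^ i * ((2 * S.r) ^ i₀ * S.r ^ d) := by rw [mul_pow]; ring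
          _ ≤ S.r ^ i * 1 := by
            gcongr
            exact mul_le_one₀ (pow_le_one₀ (by positivity) h2r) (by positivity)
              (pow_le_one₀ hr.le (by linarith))
          _ = _ := mul_one _
      calc 2 * δ ≤ (|a| * g * 2 ^ i₀) * S.r ^ n := by gcongr
        _ = |a| * g * (2 ^ i₀ * S.r ^ n) := by ring
        _ ≤ _ := by gcongr
    obtain ⟨k, hk, hk'⟩ := exists_nat_pow_near (x := |a| * g * S.r ^ i / δ / 2) (y := 2)
      (by linarith) one_lt_two
    exact ⟨k, by rw [pow_succ]; linarith, by rw [pow_succ]; linarith⟩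
  choose! kk hkk using hex
  refine ⟨kk, ?_, fun i hi => ⟨?_, hkk i hi⟩⟩
  · have key : ∀ i ∈ Ico (j + i₁ + L) (n - i₀), ∀ i' ∈ Ico (j + i₁ + L) (n - i₀), i < i' →
        kk i ≠ kk i' := by
      intro i hi i' hi' hlt he
      have h1 := (hkk i hi).2
      have h2 := (hkk i' hi').1
      rw [← he] at h2
      have h3 : S.r ^ i' ≤ S.r ^ i * (1 / 2) := by
        obtain ⟨d, hd⟩ := Nat.exists_eq_add_of_lt hlt
        rw [hd, pow_succ, pow_add]
        have : S.r ^ d ≤ 1 := pow_le_one₀ hr.le (by linarith)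
        calc _ = S.r ^ i * (S.r ^ d * S.r) := by ring
          _ ≤ S.r ^ i * (1 * (1 / 2)) := by gcongr
          _ = _ := by ring
      have h4 : |a| * g * S.r ^ i' / δ ≤ |a| * g * S.r ^ i / δ * (1 / 2) := by
        calc _ ≤ |a| * g * (S.r ^ i * (1 / 2)) / δ := by gcongr
          _ = _ := by ring
      rw [pow_succ _ (kk i + 1)] at h1
      linarith
    intro i hi i' hi' he
    rcases lt_trichotomy i i' with h | h | h
    · exact absurd he (key i hi i' hi' h)
    · exact h
    · exact absurd he.symm (key i' hi' i hi h)
  · have h1 := (hkk i hi).1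
    rw [Finset.mem_Ico] at hi
    have h2 : |a| * g * S.r ^ i / δ * 2 ^ L ≤ 2 ^ J := by
      obtain ⟨d, hd⟩ := Nat.exists_eq_add_of_le hi.1
      rw [div_mul_eq_mul_div, div_le_iff₀ hδ, hd]
      have e1 : (2 * S.r) ^ i₁ ≤ 1 := pow_le_one₀ (by positivity) h2r
      have e2 : (2 * S.r) ^ L ≤ 1 := pow_le_one₀ (by positivity) h2r
      have e3 : S.r ^ d ≤ 1 := pow_le_one₀ hr.le (by linarith)
      calc |a| * g * S.r ^ (j + i₁ + L + d) * 2 ^ L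
          ≤ 2 ^ i₁ * S.r ^ (j + i₁ + L + d) * 2 ^ L := by gcongr
        _ = S.r ^ j * (((2 * S.r) ^ i₁ * (2 * S.r) ^ L) * S.r ^ d) := by
            simp only [mul_pow, pow_add]; ring
        _ ≤ S.r ^ j * ((1 * 1) * 1) := by gcongr
        _ ≤ _ := by linarith
    have h3 : (2 : ℝ) ^ (kk i + 1 + L) ≤ 2 ^ J := by
      rw [pow_add _ (kk i + 1)]
      exact (mul_le_mul_of_nonneg_right h1 (by positivity)).trans h2
    have h4 := (pow_le_pow_iff_right₀ (one_lt_two (α := ℝ))).1 h3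
    omega

/-- Lower bound for the entropy produced by random bits. -/
noncomputable def bitConst (g κ₁ : ℝ) : ℝ :=
  (5 - Real.log (κ₁ / 2)) / 2 +
    (Real.log geomZ + Real.log 2 * (3 + (8 * S.R / g + 1) ^ 2 / 4))

theorem le_cent_of_separated {S : Sys W} {g : ℝ} (hg : 0 < g) (hsep : S.Separated g)
    {ℓ n i k L : ℕ} (hi : i < n) (hn : n ≤ ℓ) {a δ : ℝ} (hδ : 0 < δ)
    (hk : 2 ^ (k + 1) ≤ |a| * g * S.r ^ i / δ) (hk' : |a| * g * S.r ^ i / δ < 2 ^ (k + 2))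
    {ν : (Fin ℓ → W) → ℝ} (hν : ∀ ω, 0 ≤ ν ω) (h1 : ∑ ω, ν ω = 1) {κ₁ : ℝ} (hκ₁ : 0 < κ₁)
    (hκL : 2 ≤ κ₁ * 4 ^ L)
    (hκ : κ₁ ≤ vary ν (pre i) (letter i)) (v : ℤ) :
    L * Real.log 2 - S.bitConst g κ₁ ≤
      cent (prodw ν (4 ^ L)) (fun τ => (v - ∑ i, S.shift a δ n (τ i)) / 2 ^ k)
        (fun τ => (v - ∑ i, S.shift a δ n (τ i)) / 2 ^ (k + L)) := by
  set κ := vary ν (pre i) (letter i) with hκd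
  have h4 : (0 : ℝ) < 4 ^ L := by positivity
  have hmono : κ₁ * 4 ^ L ≤ κ * 4 ^ L := by gcongr
  have h := le_cent_sum_of_bits (pre := pre i) hν h1 (S.shift a δ n) (letter i) k L (4 ^ L)
    (8 * S.R / g + 1)
    (fun ω ω' _ _ h hl => two_pow_le_shift_sub hsep hi hn hδ hk h hl)
    (fun ω ω' _ _ h => abs_shift_sub_le_mul hg hi hn hδ h hk') v (y := κ * 4 ^ L / 2)
    (by linarith) (by rw [sum_pairw_ne_eq hν, ← hκd]; push_cast; ring)
  refine le_trans ?_ h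
  have e1 : Real.log (κ₁ / 2) + L * (2 * Real.log 2) ≤ Real.log (κ * 4 ^ L / 2) := by
    have : L * (2 * Real.log 2) = Real.log (4 ^ L) := by
      rw [Real.log_pow, show (4 : ℝ) = 2 ^ 2 by norm_num, Real.log_pow]
      norm_num
    rw [this, ← Real.log_mul (by positivity) h4.ne']
    exact Real.log_le_log (by positivity) (by linarith)
  have e2 : (((4 ^ L : ℕ) : ℝ)) * (8 * S.R / g + 1) ^ 2 / 4 ^ L / 4 =
      (8 * S.R / g + 1) ^ 2 / 4 := by
    push_cast
    field_simp
  rw [e2]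
  unfold bitConst
  linarith

end Sys

namespace Sys
variable {W : Type*} [Fintype W] [Nonempty W] (S : Sys W)

theorem sum_cent_letter_le {ℓ n j I₀ I₁ : ℕ} (hj : j ≤ n) (hn : n ≤ ℓ) {κ : Type*}
    (Z : (Fin ℓ → W) → κ) (hZ : ∀ ω ω', Z ω = Z ω' → pre j ω = pre j ω') (hI : j ≤ I₀)
    (hI' : I₁ ≤ n)
    (kk : ℕ → ℕ) (hkk : Set.InjOn kk (Ico I₀ I₁)) {K : ℕ} (hK : ∀ i ∈ Ico I₀ I₁, kk i < K)
    {κ₁ s : ℝ} (hκ₁ : 0 ≤ κ₁) (hs : 0 < s) :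
    cent (uw W ℓ) (pre n) Z ≤ (s * κ₁ + (Fintype.card W + 1) / s) * n +
      Real.log (Fintype.card W + 1) * (∑ k ∈ range K, ∑ ω, restr (uw W ℓ) {ω |
        ∃ i ∈ Ico I₀ I₁, kk i = k ∧ κ₁ ≤ vary (condw (uw W ℓ) Z ω) (pre i) (letter i)} ω +
          (I₀ - j : ℝ) + ((n - I₁ : ℕ) : ℝ)) := by
  classical
  obtain ⟨d, rfl⟩ := Nat.exists_eq_add_of_le hj
  set p := uw W ℓ
  have hp : ∀ ω, 0 ≤ p ω := uw_nonneg
  have h1 : ∑ ω, p ω = 1 := sum_uw ℓ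
  set Λ := Real.log (Fintype.card W + 1 : ℝ) with hΛdef
  set η := s * κ₁ + (Fintype.card W + 1 : ℝ) / s
  have hη : 0 ≤ η := by positivity
  have hΛ : 0 ≤ Λ := Real.log_nonneg (by
    have : (0 : ℝ) ≤ Fintype.card W := by positivity
    linarith)
  set hh : ℕ → (Fin ℓ → W) → ℝ := fun i ω => cent (condw p Z ω) (letter i) (pre i)
  have hhle : ∀ i ω, 0 < p ω → hh i ω ≤ Λ := by
    intro i ω hω
    have := cent_le_log_card (condw_nonneg hp (Z := Z) ω) (letter i) (pre i)
    rw [sum_condw hp hω, one_mul, Fintype.card_option] at this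
    push_cast at this
    exact this
  have hsum : cent p (pre (j + d)) Z = ∑ i ∈ Ico j (j + d), ∑ ω, p ω * hh i ω := by
    rw [cent_pre_eq_sum_letter hn p Z hZ, Finset.sum_Ico_eq_sum_range]
    refine Finset.sum_congr (by simp) fun i _ => cent_eq_sum_condw hp _ _
  have hone : ∀ i, ∑ ω, p ω * hh i ω ≤ Λ := by
    intro i
    calc ∑ ω, p ω * hh i ω ≤ ∑ ω, p ω * Λ := by
          refine Finset.sum_le_sum fun ω _ => ?_
          exact mul_le_mul_of_nonneg_left (hhle i ω (uw_pos ω)) (hp ω)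
      _ = Λ := by rw [← Finset.sum_mul, h1, one_mul]
  have hdich := sum_le_of_dichotomy hp h1 (Ico I₀ I₁) kk hkk hK
    (fun i ω => vary (condw p Z ω) (pre i) (letter i)) hh (κ₁ := κ₁) hΛ hη (by
      intro i _ ω hω
      split_ifs with h
      · exact hhle i ω hω
      · refine (cent_le_of_vary (condw_nonneg hp ω) (sum_condw hp hω) (letter i) hs).trans ?_
        rw [Fintype.card_option]
        push_cast
        have := (not_le.1 h).le
        show _ ≤ s * κ₁ + _
        gcongr)
  rw [hsum]
  have hIle : ∑ i ∈ Ico j (j + d), ∑ ω, p ω * hh i ω ≤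
      ∑ i ∈ Ico I₀ I₁ , ∑ ω, p ω * hh i ω + ∑ i ∈ Ico j (j + d) \ Ico I₀ I₁, Λ := by
    have hnn : ∀ i, 0 ≤ ∑ ω, p ω * hh i ω := fun i => Finset.sum_nonneg fun ω _ =>
      mul_nonneg (hp ω) (cent_nonneg (condw_nonneg hp ω) _ _)
    rw [← Finset.sum_inter_add_sum_sdiff (Ico j (j + d)) (Ico I₀ I₁)]
    refine add_le_add ?_ (Finset.sum_le_sum fun i _ => hone i)
    exact Finset.sum_le_sum_of_subset_of_nonneg Finset.inter_subset_right fun i _ _ => hnn i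
  have hcard : ((Ico j (j + d) \ Ico I₀ I₁).card : ℝ) ≤ (I₀ - j : ℝ) + ((j + d - I₁ : ℕ) : ℝ) := by
    have hsub : Ico j (j + d) \ Ico I₀ I₁ ⊆ Ico j I₀ ∪ Ico I₁ (j + d) := by
      intro i
      simp only [mem_sdiff, mem_Ico, mem_union]
      omega
    have := (card_le_card hsub).trans (card_union_le _ _)
    rw [Nat.card_Ico, Nat.card_Ico] at this
    have h2 : ((I₀ - j : ℕ) : ℝ) = I₀ - j := Nat.cast_sub hI
    rw [← h2]
    exact_mod_cast this
  rw [Finset.sum_const, nsmul_eq_mul] at hIle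
  have hIc : ((Ico I₀ I₁).card : ℝ) ≤ (j + d : ℕ) := by
    rw [Nat.card_Ico]
    exact_mod_cast (by omega)
  have e1 : η * ((Ico I₀ I₁).card : ℝ) ≤ η * (j + d : ℕ) := by gcongr
  have e2 := mul_le_mul_of_nonneg_right hcard hΛ
  linarith

theorem core_inequality {g : ℝ} (hg : 0 < g) (hsep : S.Separated g) {ε C : ℝ}
    (hε : 0 ≤ ε) (hC0 : 0 ≤ C) (hC : ∀ n, ∀ z ∈ S.K, (S.β - ε) * n ≤ S.H n z + C) {ε' C' : ℝ}
    (hS : ∀ i t q : ℕ, ∀ z ∈ S.K, ∀ δ : ℝ, 0 < δ → δ ≤ S.α ^ (i + t) →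
      ∀ E : Set (Fin (i + (t + q)) → W), (∑ ω, restr (uw W _) E ω) * ((S.β - ε') * t) - C' ≤
        cent (restr (uw W _) E) (S.cell δ z) (pre i))
    {ℓ n j J : ℕ} (hj : j ≤ n) (hn : n ≤ ℓ) {z a : ℝ} (ha : a ≠ 0) (hz : z ∈ S.K)
    (hza : z + a ∈ S.K) (hH : S.H ℓ z ≤ (S.β + ε) * ℓ) (hHa : S.H ℓ (z + a) ≤ (S.β + ε) * ℓ)
    (hJ : S.α ^ n ≤ 2 ^ J * S.α ^ ℓ) (hJ' : 2 ^ J * S.α ^ ℓ ≤ 2 * S.α ^ n)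
    (hrj : S.r ^ j ≤ S.α ^ n) (hrn : S.r ^ n ≤ S.α ^ ℓ / S.α) (hrn' : S.α ^ ℓ ≤ S.r ^ n)
    {i₀ i₁ L t : ℕ} (hi₀ : 2 ≤ |a| * g * 2 ^ i₀) (hi₁ : |a| * g ≤ 2 ^ i₁)
    (ht : 1 ≤ 2 ^ L * S.α ^ (t + 1)) (ht' : 2 ≤ 2 ^ L * S.α ^ t) {κ₁ s : ℝ} (hκ₁ : 0 < κ₁)
    (hs : 0 < s) (hκL : 2 ≤ κ₁ * 4 ^ L) {D ι : ℝ}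
    (hD : D = 2 * ε * ℓ + (2 * C + 4 * S.e₀ + Real.log 3 + S.shiftConst a))
    (hι : ι = 2 * ε * ℓ + (2 * C + 4 * S.e₀ + Real.log 3)) :
    ∃ P : ℝ,
      ((n : ℝ) - j) * (Real.log (Fintype.card W) - S.β) - 2 * ε * ℓ - (2 * C + 6 * S.e₀) +
        ε * (n - j) ≤ (s * κ₁ + (Fintype.card W + 1) / s) * n +
          Real.log (Fintype.card W + 1) * (P + (i₁ + L) + i₀) ∧
      P * (L * Real.log 2 - S.bitConst g κ₁) + (((J - L : ℕ) : ℝ) - P) * ((S.β - ε') * t) -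
        ((J - L : ℕ) : ℝ) * (C' + 2 * S.e₀) ≤
      L * ((S.β + ε) * ℓ - (S.β - ε) * n + (C + 2 * S.e₀ + Real.log 3) + 4 ^ L * (D + ι) +
        4 ^ L * 4 ^ L * ι) + L * (4 ^ L * ι) + ((J - L : ℕ) : ℝ) * (3 * Real.log 2) := by
  classical
  have hα := S.α_pos
  have hδ : 0 < S.α ^ ℓ := pow_pos hα _
  set p := uw W ℓ with hpdef
  have hp : ∀ ω, 0 ≤ p ω := uw_nonneg
  have h1 : ∑ ω, p ω = 1 := sum_uw ℓ
  set V := S.cell (S.α ^ ℓ) z (n := ℓ) with hV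
  set A := S.shift a (S.α ^ ℓ) n (ℓ := ℓ) with hA
  set Z : (Fin ℓ → W) → ℤ × List W := fun ω => (V ω, pre j ω) with hZ
  set Q : (Fin ℓ → W) → ℤ × List W := fun ω => (S.cell (2 ^ J * S.α ^ ℓ) z ω, pre j ω) with hQ
  have hZpre : ∀ ω ω', Z ω = Z ω' → pre j ω = pre j ω' := fun ω ω' h => congrArg Prod.snd h
  have hZV : ∀ ω ω', Z ω = Z ω' → V ω = V ω' := fun ω ω' h => congrArg Prod.fst h
  have hZQ : ∀ ω ω', Z ω = Z ω' → Q ω = Q ω' := by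
    intro ω ω' h
    simp only [hQ, cell_two_pow_mul, Prod.mk.injEq]
    exact ⟨by have := hZV _ _ h; simp only [hV] at this; rw [this], hZpre _ _ h⟩
  obtain ⟨kk, hinj, hkk⟩ := S.exists_scale_index hg ha hδ (L := L) hrn' (hrj.trans hJ) hi₀ hi₁
  set G : ℕ → Set (Fin ℓ → W) := fun k => {ω | ∃ i ∈ Ico (j + i₁ + L) (n - i₀), kk i = k ∧
    κ₁ ≤ vary (condw p Z ω) (pre i) (letter i)} with hG
  set P := ∑ k ∈ range (J - L), ∑ ω, restr p (G k) ω with hP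
  refine ⟨P, ?_, ?_⟩
  · refine (S.le_cent_pre_given hC hj hn hz hH).trans ?_
    refine (sum_cent_letter_le hj hn Z hZpre (I₀ := j + i₁ + L) (I₁ := n - i₀) (by omega)
      (by omega) kk hinj (fun i hi => (hkk i hi).1) hκ₁.le hs).trans ?_
    have hΛ : 0 ≤ Real.log (Fintype.card W + 1 : ℝ) := Real.log_nonneg (by
      have : (0 : ℝ) ≤ Fintype.card W := by positivity
      linarith)
    have h2 : ((n - (n - i₀) : ℕ) : ℝ) ≤ i₀ := by exact_mod_cast (by omega)
    have h3 : ((j + i₁ + L : ℕ) : ℝ) - j = i₁ + L := by push_cast; ring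
    rw [h3]
    gcongr
  have hU := S.cent_cell_coarse_le hC (j := j) hn hz hH hJ hJ'
  have hι' := S.cent_shift_sub_le (a := a) hC hj hn hz hH hJ hJ'
  have hDle : cent p (fun ω => V ω - A ω) Q ≤ cent p V Q + D := by
    have e1 := S.cent_cell_sub_shift_le hC hj hn hza hHa hJ hJ' hrj hrn
    have e2 := S.le_cent_cell_fine hC hj hn hz hJ
    have e3 : cent p V (fun ω => (pre n ω, Q ω)) ≤ cent p V Q :=
      cent_anti hp V fun ω ω' h => congrArg Prod.snd h
    have e4 := e2.trans e3
    rw [hD]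
    linarith
  have hι0 : 0 ≤ ι := by
    rw [hι]
    have := S.e₀_nonneg
    have : 0 ≤ Real.log 3 := Real.log_nonneg (by norm_num)
    positivity
  have hwin := windows_le (m := 4 ^ L) hp h1 hZQ hZV (hι'.trans hι.ge) hι0 hDle (J - L) L G
    (a := L * Real.log 2 - S.bitConst g κ₁) (by
      rintro k - ω ⟨i, hi, rfl, hκ⟩ hω
      have hi' := Finset.mem_Ico.1 hi
      obtain ⟨-, hk1, hk2⟩ := hkk i hi
      exact le_cent_of_separated hg hsep (by omega) hn hδ hk1 hk2 (condw_nonneg hp ω)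
        (sum_condw hp hω) hκ₁ hκL hκ (V ω))
  push_cast at hwin
  have hterm : ∀ k ∈ range (J - L), (∑ ω, restr p (G k) ω) * (L * Real.log 2 - S.bitConst g κ₁) +
      ((1 - ∑ ω, restr p (G k) ω) * ((S.β - ε') * t) - (C' + 2 * S.e₀)) ≤
      (∑ ω, restr p (G k) ω) * (L * Real.log 2 - S.bitConst g κ₁) +
      cent (restr p (G k)ᶜ) (fun ω => V ω / 2 ^ k) (fun ω => (V ω / 2 ^ (k + L), Q ω)) := by
    intro k hk
    rw [Finset.mem_range] at hk
    have e := S.le_cent_window hS hj hn hz hJ' (k := k) (L := L) (by omega) ht ht' (G k)ᶜ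
    have e' : ∑ ω, restr p (G k)ᶜ ω = 1 - ∑ ω, restr p (G k) ω := by
      rw [eq_sub_iff_add_eq, ← Finset.sum_add_distrib, ← h1]
      exact Finset.sum_congr rfl fun ω _ => by rw [add_comm]; exact restr_add_compl _ _
    rw [← hpdef, e'] at e
    linarith
  have hsum := (Finset.sum_le_sum hterm).trans hwin
  have hL : (L : ℝ) * cent p V Q ≤ L * ((S.β + ε) * ℓ - (S.β - ε) * n +
      (C + 2 * S.e₀ + Real.log 3)) := by gcongr
  have hexp : ∑ k ∈ range (J - L), ((∑ ω, restr p (G k) ω) *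
      (L * Real.log 2 - S.bitConst g κ₁) +
      ((1 - ∑ ω, restr p (G k) ω) * ((S.β - ε') * t) - (C' + 2 * S.e₀))) =
      P * (L * Real.log 2 - S.bitConst g κ₁) + (((J - L : ℕ) : ℝ) - P) * ((S.β - ε') * t) -
        ((J - L : ℕ) : ℝ) * (C' + 2 * S.e₀) := by
    rw [Finset.sum_add_distrib, Finset.sum_sub_distrib, ← Finset.sum_mul, ← Finset.sum_mul,
      Finset.sum_sub_distrib, ← hP]
    simp only [Finset.sum_const, Finset.card_range, nsmul_eq_mul]
    ring
  rw [hexp] at hsum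
  linarith

end Sys

theorem linear_system_limit {σ θ μ K A₀ A₁ A₂ A₃ q B₀ B₁ B₂ B₃ : ℝ} {n₀ : ℕ} (hq : 0 ≤ q)
    (h : ∀ n : ℕ, n₀ ≤ n → ∃ ℓ j M P : ℝ, |ℓ - σ * n| ≤ K ∧ |j - θ * n| ≤ K ∧ |M - μ * n| ≤ K ∧
      A₀ * n + A₁ * ℓ + A₂ * j + A₃ ≤ P ∧ P * q + B₀ * n + B₁ * ℓ + B₂ * M + B₃ ≤ 0) :
    q * (A₀ + A₁ * σ + A₂ * θ) + B₀ + B₁ * σ + B₂ * μ ≤ 0 := by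
  by_contra hX
  push Not at hX
  set X := q * (A₀ + A₁ * σ + A₂ * θ) + B₀ + B₁ * σ + B₂ * μ with hXd
  set Y := |q * A₁ + B₁| * K + |q * A₂| * K + |B₂| * K + |q * A₃ + B₃|
  obtain ⟨n, hn⟩ := exists_nat_gt (Y / X)
  obtain ⟨ℓ, j, M, P, h1, h2, h3, h4, h5⟩ := h (max n n₀) (le_max_right _ _)
  set N : ℝ := ((max n n₀ : ℕ) : ℝ)
  have hN : (n : ℝ) ≤ N := Nat.cast_le.2 (le_max_left _ _)
  have hYN : Y < X * N := by
    rw [div_lt_iff₀ hX] at hn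
    nlinarith
  have h6 := mul_le_mul_of_nonneg_left h4 hq
  have aux : ∀ k e : ℝ, |e| ≤ K → -(|k| * K) ≤ k * e := by
    intro k e he
    have : |k * e| ≤ |k| * K := by rw [abs_mul]; gcongr
    exact (abs_le.1 this).1
  have e1 := aux (q * A₁ + B₁) _ h1
  have e2 := aux (q * A₂) _ h2
  have e3 := aux B₂ _ h3
  have e4 := neg_abs_le (q * A₃ + B₃)
  have : X * N ≤ Y := by
    simp only [Y, hXd]
    linarith
  linarith

namespace Sys
variable {W : Type*} [Fintype W] [Nonempty W] (S : Sys W)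

/-- The exponents `-log α` and `-log r`. -/
noncomputable def lam : ℝ := -Real.log S.α

noncomputable def rho : ℝ := -Real.log S.r

theorem lam_pos : 0 < S.lam := neg_pos.2 (Real.log_neg S.α_pos S.α_lt)

theorem lam_lt_rho : S.lam < S.rho := neg_lt_neg (Real.log_lt_log S.r_pos S.r_lt)

theorem pow_le_pow_of_lam_le {i n : ℕ} (h : n * S.lam ≤ i * S.rho) : S.r ^ i ≤ S.α ^ n := by
  rw [← Real.log_le_log_iff (pow_pos S.r_pos _) (pow_pos S.α_pos _), Real.log_pow, Real.log_pow]
  simp only [lam, rho] at h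
  linarith

theorem exists_scales (n : ℕ) : ∃ ℓ j J : ℕ, j ≤ n ∧ n ≤ ℓ ∧
    S.α ^ n ≤ 2 ^ J * S.α ^ ℓ ∧ 2 ^ J * S.α ^ ℓ ≤ 2 * S.α ^ n ∧ S.r ^ j ≤ S.α ^ n ∧
    S.r ^ n ≤ S.α ^ ℓ / S.α ∧ S.α ^ ℓ ≤ S.r ^ n ∧ |ℓ - S.rho / S.lam * n| ≤ 1 ∧
    |j - S.lam / S.rho * n| ≤ 1 ∧ |J - (ℓ - n) * S.lam / Real.log 2| ≤ 1 := by
  have hl := S.lam_pos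
  have hlr := S.lam_lt_rho
  have hρ := hl.trans hlr
  have h2 : 0 < Real.log 2 := Real.log_pos one_lt_two
  have hα := S.α_pos
  have hceil : ∀ x : ℝ, 0 ≤ x → |(⌈x⌉₊ : ℝ) - x| ≤ 1 := fun x hx => by
    rw [abs_le]
    have := Nat.le_ceil x
    have := Nat.ceil_lt_add_one hx
    constructor <;> linarith
  set ℓ := ⌈S.rho / S.lam * n⌉₊ with hℓ
  set j := ⌈S.lam / S.rho * n⌉₊ with hj
  have hℓ1 : S.rho * n ≤ ℓ * S.lam := by
    have := Nat.le_ceil (S.rho / S.lam * n)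
    rw [div_mul_eq_mul_div, div_le_iff₀ hl, ← div_mul_eq_mul_div] at this
    exact this
  have hℓ2 : (ℓ - 1) * S.lam ≤ S.rho * n := by
    have := Nat.ceil_lt_add_one (a := S.rho / S.lam * n) (by positivity)
    have h : (ℓ : ℝ) - 1 ≤ S.rho * n / S.lam := by rw [mul_div_right_comm]; linarith
    rwa [le_div_iff₀ hl] at h
  have hj1 : S.lam * n ≤ j * S.rho := by
    have := Nat.le_ceil (S.lam / S.rho * n)
    rw [div_mul_eq_mul_div, div_le_iff₀ hρ, ← div_mul_eq_mul_div] at this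
    exact this
  have hnℓ : n ≤ ℓ := by
    have h1 : (n : ℝ) ≤ S.rho / S.lam * n :=
      le_mul_of_one_le_left (by positivity) ((one_le_div hl).2 hlr.le)
    exact_mod_cast h1.trans (Nat.le_ceil _)
  have hnl : (0 : ℝ) ≤ ℓ - n := sub_nonneg.2 (by exact_mod_cast hnℓ)
  set J := ⌈(ℓ - n) * S.lam / Real.log 2⌉₊ with hJ
  have hx0 : 0 ≤ (ℓ - n) * S.lam / Real.log 2 := by positivity
  have hJ1 : (ℓ - n) * S.lam ≤ J * Real.log 2 := (div_le_iff₀ h2).1 (Nat.le_ceil _)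
  have hJ2 : (J - 1) * Real.log 2 ≤ (ℓ - n) * S.lam := by
    rw [← le_div_iff₀ h2]
    linarith [Nat.ceil_lt_add_one hx0]
  have hlam : S.lam = -Real.log S.α := rfl
  have hrho : S.rho = -Real.log S.r := rfl
  refine ⟨ℓ, j, J, ?_, hnℓ, ?_, ?_, S.pow_le_pow_of_lam_le (by linarith), ?_, ?_,
    hceil _ (by positivity), hceil _ (by positivity), hceil _ hx0⟩
  · refine Nat.ceil_le.2 (mul_le_of_le_one_left (by positivity) ((div_le_one hρ).2 hlr.le))
  · rw [← Real.log_le_log_iff (by positivity) (by positivity), Real.log_mul (by positivity)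
      (by positivity), Real.log_pow, Real.log_pow, Real.log_pow]
    rw [hlam] at hJ1
    linarith
  · rw [← Real.log_le_log_iff (by positivity) (by positivity), Real.log_mul (by positivity)
      (by positivity), Real.log_mul (by positivity)
      (by positivity), Real.log_pow, Real.log_pow, Real.log_pow]
    rw [hlam] at hJ2
    linarith
  · rw [← Real.log_le_log_iff (pow_pos S.r_pos _) (by positivity), Real.log_div (by positivity)
      (by positivity), Real.log_pow, Real.log_pow]
    rw [hlam, hrho] at hℓ2
    linarith
  · rw [← Real.log_le_log_iff (by positivity) (pow_pos S.r_pos _), Real.log_pow, Real.log_pow]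
    rw [hlam, hrho] at hℓ1
    linarith

theorem exists_window_depth {L : ℕ} (hL : Real.log 2 + S.lam ≤ L * Real.log 2) : ∃ t : ℕ,
    1 ≤ 2 ^ L * S.α ^ (t + 1) ∧ 2 ≤ 2 ^ L * S.α ^ t ∧ t * S.lam ≤ L * Real.log 2 ∧
    L * Real.log 2 - (Real.log 2 + 2 * S.lam) ≤ t * S.lam := by
  have hl := S.lam_pos
  have h2 : 0 < Real.log 2 := Real.log_pos one_lt_two
  have hα := S.α_pos
  have hlam : S.lam = -Real.log S.α := rfl
  set x := (L * Real.log 2 - Real.log 2 - S.lam) / S.lam with hx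
  have hx0 : 0 ≤ x := div_nonneg (by linarith) hl.le
  have h3 : ⌊x⌋₊ * S.lam ≤ L * Real.log 2 - Real.log 2 - S.lam :=
    (le_div_iff₀ hl).1 (Nat.floor_le hx0)
  have h4 : L * Real.log 2 - Real.log 2 - S.lam ≤ (⌊x⌋₊ + 1) * S.lam :=
    (div_le_iff₀ hl).1 (Nat.lt_floor_add_one x).le
  refine ⟨⌊x⌋₊, ?_, ?_, by linarith, by linarith⟩
  · rw [← Real.log_le_log_iff (by positivity) (by positivity), Real.log_mul (by positivity)
      (by positivity), Real.log_pow, Real.log_pow, Real.log_one]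
    push_cast
    rw [hlam] at h3
    linarith
  · rw [← Real.log_le_log_iff (by positivity) (by positivity), Real.log_mul (by positivity)
      (by positivity), Real.log_pow, Real.log_pow]
    rw [hlam] at h3
    linarith [hlam ▸ hl]

theorem limit_inequality {g : ℝ} (hg : 0 < g) (hsep : S.Separated g) {w w' : W}
    (hb : S.b w ≠ S.b w') {ε : ℝ} (hε : 0 < ε) {ε' C' : ℝ}
    (hS : ∀ i t q : ℕ, ∀ z ∈ S.K, ∀ δ : ℝ, 0 < δ → δ ≤ S.α ^ (i + t) →
      ∀ E : Set (Fin (i + (t + q)) → W), (∑ ω, restr (uw W _) E ω) * ((S.β - ε') * t) - C' ≤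
        cent (restr (uw W _) E) (S.cell δ z) (pre i))
    {L t : ℕ} (ht : 1 ≤ 2 ^ L * S.α ^ (t + 1)) (ht' : 2 ≤ 2 ^ L * S.α ^ t) {κ₁ s : ℝ}
    (hκ₁ : 0 < κ₁) (hs : 0 < s) (hκL : 2 ≤ κ₁ * 4 ^ L) {η Λ q σ θ μ : ℝ}
    (hη : η = s * κ₁ + (Fintype.card W + 1) / s) (hΛ : Λ = Real.log (Fintype.card W + 1))
    (hΛ0 : 0 < Λ) (hq : q = L * Real.log 2 - S.bitConst g κ₁ - (S.β - ε') * t) (hq0 : 0 ≤ q)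
    (hσ : σ = S.rho / S.lam) (hθ : θ = S.lam / S.rho) (hμ : μ = (σ - 1) * S.lam / Real.log 2) :
    q * (((Real.log (Fintype.card W) - S.β + ε) * (1 - θ) - η - 2 * ε * σ) / Λ) ≤
      L * (S.β * (σ - 1) + ε * (σ + 1) + 6 * 4 ^ L * ε * σ + 2 * 4 ^ L * 4 ^ L * ε * σ) -
        μ * ((S.β - ε') * t) + μ * (C' + 2 * S.e₀ + 3 * Real.log 2) := by
  obtain ⟨C, hC0, hC⟩ := S.exists_const_le_H hε
  obtain ⟨n₀, hn₀⟩ := S.exists_H_T_le hε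
  have hα := S.α_pos
  have hlam := S.lam_pos
  have h2 : 0 < Real.log 2 := Real.log_pos one_lt_two
  set a := (S.b w - S.b w') / S.α with ha
  have ha0 : a ≠ 0 := div_ne_zero (sub_ne_zero.2 hb) hα.ne'
  have hag : 0 < |a| * g := mul_pos (abs_pos.2 ha0) hg
  obtain ⟨i₀, hi₀⟩ := pow_unbounded_of_one_lt (2 / (|a| * g)) one_lt_two
  obtain ⟨i₁, hi₁⟩ := pow_unbounded_of_one_lt (|a| * g) one_lt_two
  rw [div_lt_iff₀' hag] at hi₀
  set m : ℝ := 4 ^ L with hm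
  set kι := 2 * C + 4 * S.e₀ + Real.log 3 with hkι
  set X := Real.log (Fintype.card W) - S.β + ε with hX
  have key := linear_system_limit (σ := σ) (θ := θ) (μ := μ) (K := L + 1 + S.lam / Real.log 2)
    (A₀ := (X - η) / Λ) (A₁ := -2 * ε / Λ) (A₂ := -X / Λ)
    (A₃ := -(2 * C + 6 * S.e₀) / Λ - (i₁ + L + i₀)) (q := q) (B₀ := L * (S.β - ε))
    (B₁ := -L * ((S.β + ε) + 6 * m * ε + 2 * m * m * ε))
    (B₂ := (S.β - ε') * t - (C' + 2 * S.e₀) - 3 * Real.log 2)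
    (B₃ := -L * ((C + 2 * S.e₀ + Real.log 3) + m * (kι + S.shiftConst a + kι) + m * m * kι +
      m * kι)) (n₀ := n₀) hq0 (by
    intro n hn
    obtain ⟨ℓ, j, J, hj, hnℓ, hJ, hJ', hrj, hrn, hrn', hℓe, hje, hJe⟩ := S.exists_scales n
    obtain ⟨z, hz, hHz⟩ := hn₀ ℓ (hn.trans hnℓ)
    have hadd : S.T w z + a = S.T w' z := by
      rw [ha]
      simp only [T]
      ring
    obtain ⟨P, hP1, hP2⟩ := S.core_inequality hg hsep hε.le hC0 hC hS hj hnℓ ha0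
      (S.T_mem hz w) (by rw [hadd]; exact S.T_mem hz w') (hHz w) (by rw [hadd]; exact hHz w')
      hJ hJ' hrj hrn hrn' hi₀.le hi₁.le ht ht' hκ₁ hs hκL rfl rfl
    have hl2 : 0 < S.lam / Real.log 2 := by positivity
    have hL0 : (0 : ℝ) ≤ L := by positivity
    refine ⟨ℓ, j, ((J - L : ℕ) : ℝ), P, ?_, ?_, ?_, ?_, ?_⟩
    · rw [hσ]; linarith
    · rw [hθ]; linarith
    · have e1 : |((J - L : ℕ) : ℝ) - J| ≤ L := by
        rw [abs_le]
        constructor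
        · have : (J : ℝ) ≤ ((J - L : ℕ) : ℝ) + L := by exact_mod_cast (by omega)
          linarith
        · have : ((J - L : ℕ) : ℝ) ≤ J := by exact_mod_cast (by omega)
          linarith
      have e2 : |(ℓ - n) * S.lam / Real.log 2 - μ * n| ≤ S.lam / Real.log 2 := by
        have : (ℓ - n) * S.lam / Real.log 2 - μ * n =
            (ℓ - S.rho / S.lam * n) * (S.lam / Real.log 2) := by
          rw [hμ, hσ]
          field_simp
          ring
        rw [this, abs_mul, abs_of_pos hl2]
        exact mul_le_of_le_one_left hl2.le hℓe
      have e3 := abs_sub_le ((J - L : ℕ) : ℝ) J (μ * n)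
      have e4 := abs_sub_le (J : ℝ) ((ℓ - n) * S.lam / Real.log 2) (μ * n)
      linarith
    · rw [← hη, ← hΛ] at hP1
      have : (X - η) / Λ * n + -2 * ε / Λ * ℓ + -X / Λ * j + (-(2 * C + 6 * S.e₀) / Λ -
          (i₁ + L + i₀)) = (((X - η) * n - 2 * ε * ℓ - X * j - (2 * C + 6 * S.e₀))) / Λ -
          (i₁ + L + i₀) := by ring
      rw [this, sub_le_iff_le_add, div_le_iff₀ hΛ0, hX]
      linarith
    · rw [hq]
      linarith)
  have e : q * ((X * (1 - θ) - η - 2 * ε * σ) / Λ) =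
      q * ((X - η) / Λ + -2 * ε / Λ * σ + -X / Λ * θ) := by ring
  rw [e]
  linarith

theorem lam_le_β {g : ℝ} (hg : 0 < g) (hsep : S.Separated g) {w w' : W} (hb : S.b w ≠ S.b w')
    (hN : 1 < Fintype.card W * S.α) : S.lam ≤ S.β := by
  by_contra hlt
  push Not at hlt
  have hB := S.β_nonneg
  have hlam := S.lam_pos
  have hlr := S.lam_lt_rho
  have hρ := hlam.trans hlr
  have hα := S.α_pos
  have h2 : 0 < Real.log 2 := Real.log_pos one_lt_two
  set N : ℝ := (Fintype.card W : ℝ) with hNdef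
  have hN1 : (1 : ℝ) ≤ N := Nat.one_le_cast.2 (Fintype.card_pos (α := W))
  have hlogN : S.lam < Real.log N := by
    have : 0 < Real.log (N * S.α) := Real.log_pos hN
    rw [Real.log_mul (by positivity) hα.ne'] at this
    simp only [lam]
    linarith
  set σ := S.rho / S.lam with hσ
  set θ := S.lam / S.rho with hθ
  have hσ1 : 1 < σ := (one_lt_div hlam).2 hlr
  have hθ1 : θ < 1 := (div_lt_one hρ).2 hlr
  set c := (1 - θ) * (Real.log N - S.β) with hc
  have hc0 : 0 < c := mul_pos (by linarith) (by linarith)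
  set Λ := Real.log (N + 1) with hΛ
  have hΛ0 : 0 < Λ := Real.log_pos (by linarith)
  set s := 8 * (N + 1) / c with hs
  have hs0 : 0 < s := by positivity
  set κ₁ := c / (8 * s) with hκ
  have hκ0 : 0 < κ₁ := by positivity
  have hη : s * κ₁ + (N + 1) / s = c / 4 := by
    have e1 : s * κ₁ = c / 8 := by rw [hκ]; field_simp
    have e2 : (N + 1) / s = c / 8 := by rw [hs]; field_simp
    rw [e1, e2]; ring
  set p₀ := c / (2 * Λ) with hp₀
  have hp0 : 0 < p₀ := by positivity
  set γ := Real.log 2 * (1 - S.β / S.lam) with hγ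
  have hγ0 : 0 < γ := mul_pos h2 (by rw [sub_pos, div_lt_one hlam]; exact hlt)
  set ε' := p₀ * γ / (4 * σ) * (S.lam / Real.log 2) * (Real.log 2 / S.lam) with hε'
  have hε'0 : 0 < ε' := by positivity
  obtain ⟨C', hC'0, hS⟩ := S.exists_le_cent_restr hε'0
  set bc := S.bitConst g κ₁ with hbc
  set μ := (σ - 1) * S.lam / Real.log 2 with hμ
  have hμ0 : 0 < μ := div_pos (mul_pos (by linarith) hlam) h2
  set c₁ := Real.log 2 + 2 * S.lam with hc₁
  set Y := p₀ * bc + μ * (C' + 2 * S.e₀ + 3 * Real.log 2) + S.β * (σ - 1) * c₁ / Real.log 2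
  obtain ⟨L, hL⟩ := exists_nat_gt (max (max (4 * Y / (p₀ * γ)) (bc / γ))
    (max (c₁ / Real.log 2) (2 / κ₁)))
  simp only [max_lt_iff] at hL
  obtain ⟨⟨hL1, hL2⟩, hL3, hL4⟩ := hL
  rw [div_lt_iff₀ (by positivity)] at hL1 hL2 hL3 hL4
  have hL0 : 0 < (L : ℝ) := by
    have : 0 < c₁ := by positivity
    exact pos_of_mul_pos_left (this.trans hL3) h2.le
  obtain ⟨t, ht, ht', htu, htl⟩ := S.exists_window_depth (L := L) (by linarith)
  have hκL : 2 ≤ κ₁ * 4 ^ L := by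
    have : (L : ℝ) ≤ 4 ^ L := by exact_mod_cast (Nat.lt_pow_self (by norm_num)).le
    rw [mul_comm]
    exact hL4.le.trans (mul_le_mul_of_nonneg_right this hκ0.le)
  set m : ℝ := 4 ^ L with hm
  set M := σ + 1 + 6 * m * σ + 2 * m * m * σ with hM
  have hM0 : 0 < M := by positivity
  set ε := min (c / (8 * σ)) (p₀ * γ / (4 * M)) with hε
  have hε0 : 0 < ε := by rw [hε]; positivity
  have hε1 : ε * (8 * σ) ≤ c := (le_div_iff₀ (by positivity)).1 (min_le_left _ _)
  have hε2 : ε * (4 * M) ≤ p₀ * γ := (le_div_iff₀ (by positivity)).1 (min_le_right _ _)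
  set q := L * Real.log 2 - bc - (S.β - ε') * t with hq
  have hBt : S.β * t ≤ S.β / S.lam * (L * Real.log 2) := by
    rw [div_mul_eq_mul_div, le_div_iff₀ hlam, mul_assoc]
    exact mul_le_mul_of_nonneg_left htu hB
  have hql : L * γ - bc ≤ q := by
    have h0 : 0 ≤ ε' * t := by positivity
    rw [hγ, hq]
    linarith only [h0, hBt]
  have hq0 : 0 ≤ q := by linarith only [hql, hL2]
  have key := S.limit_inequality hg hsep hb hε0 hS ht ht' hκ0 hs0 hκL rfl rfl hΛ0 rfl hq0
    rfl rfl rfl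
  rw [← hNdef, ← hΛ, ← hq, ← hσ, ← hθ, ← hμ, ← hm, hη] at key
  have hA : p₀ ≤ ((Real.log N - S.β + ε) * (1 - θ) - c / 4 - 2 * ε * σ) / Λ := by
    rw [hp₀, div_le_div_iff₀ (by positivity) hΛ0]
    have h0 : 0 ≤ ε * (1 - θ) := mul_nonneg hε0.le (by linarith only [hθ1])
    have h3 : c / 2 ≤ (Real.log N - S.β + ε) * (1 - θ) - c / 4 - 2 * ε * σ := by
      linarith only [hc, hε1, h0]
    have h4 := mul_le_mul_of_nonneg_right h3 hΛ0.le
    linarith only [h4]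
  have h1 : p₀ * (L * γ - bc) ≤
      q * (((Real.log N - S.β + ε) * (1 - θ) - c / 4 - 2 * ε * σ) / Λ) := by
    rw [mul_comm]
    exact mul_le_mul hql hA hp0.le hq0
  have h3 : μ * (ε' * t) ≤ p₀ * γ * L / 4 := by
    have e1 : μ * (ε' * t) = (p₀ * γ / 4) * ((σ - 1) / σ) * (t * S.lam / Real.log 2) := by
      rw [hμ, hε']
      field_simp
    have e2 : t * S.lam / Real.log 2 ≤ L := (div_le_iff₀ h2).2 htu
    have e3 : (σ - 1) / σ ≤ 1 := (div_le_one (by linarith)).2 (by linarith)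
    have e4 : 0 ≤ (σ - 1) / σ := div_nonneg (by linarith) (by linarith)
    rw [e1]
    calc _ ≤ (p₀ * γ / 4) * 1 * L := by gcongr
      _ = _ := by ring
  have h4 : S.β * (σ - 1) * L - S.β * (σ - 1) * c₁ / Real.log 2 ≤ μ * (S.β * t) := by
    have e1 : μ * (S.β * t) = S.β * (σ - 1) / Real.log 2 * (t * S.lam) := by
      rw [hμ]; ring
    have e2 : 0 ≤ S.β * (σ - 1) / Real.log 2 :=
      div_nonneg (mul_nonneg hB (by linarith)) h2.le
    rw [e1]
    calc _ = S.β * (σ - 1) / Real.log 2 * (L * Real.log 2 - c₁) := by field_simp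
      _ ≤ _ := by gcongr
  have h5 := mul_le_mul_of_nonneg_left hε2 hL0.le
  have h6 : 4 * (L * (ε * (σ + 1) + 6 * m * ε * σ + 2 * m * m * ε * σ)) = L * (ε * (4 * M)) := by
    rw [hM]; ring
  have h7 : 0 < p₀ * γ * L := by positivity
  simp only [Y] at hL1
  linarith only [hL1, key, h1, h3, h4, h5, h6, h7]

end Sys

/-- The first `n` letters of a sequence. -/
def pw {W : Type*} (n : ℕ) (ω : ℕ → W) : Fin n → W := fun i => ω i

/-- The `n`-th shift of a sequence. -/
def sh {W : Type*} (n : ℕ) (ω : ℕ → W) : ℕ → W := fun k => ω (n + k)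

theorem ofFn_pw_succ {W : Type*} (n : ℕ) (ω : ℕ → W) :
    List.ofFn (pw (n + 1) ω) = ω 0 :: List.ofFn (pw n (sh 1 ω)) := by
  rw [List.ofFn_succ]
  congr 2
  ext i
  simp [pw, sh, add_comm]

theorem sh_zero {W : Type*} (ω : ℕ → W) : sh 0 ω = ω := by
  ext k
  simp [sh]

theorem sh_sh {W : Type*} (m n : ℕ) (ω : ℕ → W) : sh n (sh m ω) = sh (m + n) ω := by
  ext k
  simp [sh, add_assoc]

/-- Two functions on sequences satisfying the coordinate equations of the system. -/
structure Coding {W : Type*} (S : Sys W) (x y : (ℕ → W) → ℝ) : Prop where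
  x_eq : ∀ ω, x ω = S.ξ (ω 0) + S.r * x (sh 1 ω)
  y_eq : ∀ ω, y ω = S.b (ω 0) * x (sh 1 ω) + S.α * y (sh 1 ω) + S.c (ω 0)
  bdd : ∃ M, ∀ ω, |x ω| ≤ M ∧ |y ω| ≤ M

namespace Coding
variable {W : Type*} [Fintype W] [Nonempty W] {S : Sys W} {x y : (ℕ → W) → ℝ} (hc : Coding S x y)
include hc

theorem x_eq_X (n : ℕ) (ω : ℕ → W) :
    x ω = S.X (List.ofFn (pw n ω)) + S.r ^ n * x (sh n ω) := by
  induction n generalizing ω with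
  | zero => simp [sh_zero]
  | succ n ih =>
    rw [hc.x_eq, ih (sh 1 ω), ofFn_pw_succ, sh_sh, add_comm 1 n]
    simp only [Sys.X]
    ring

theorem sub_eq_V (n : ℕ) (z : ℝ) (ω : ℕ → W) : y ω - z * x ω = S.V z (List.ofFn (pw n ω)) +
    S.α ^ n * (y (sh n ω) - S.Tl z (List.ofFn (pw n ω)) * x (sh n ω)) := by
  induction n generalizing ω z with
  | zero => simp [sh_zero]
  | succ n ih =>
    have h := ih (S.T (ω 0) z) (sh 1 ω)
    rw [ofFn_pw_succ]
    simp only [Sys.V, Sys.Tl]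
    rw [sh_sh, add_comm 1 n] at h
    have e : y ω - z * x ω = S.c (ω 0) - z * S.ξ (ω 0) +
        S.α * (y (sh 1 ω) - S.T (ω 0) z * x (sh 1 ω)) := by
      rw [hc.x_eq, hc.y_eq]
      have := S.α_pos.ne'
      simp only [Sys.T]
      field_simp
      ring
    rw [e, h]
    ring

theorem tendsto_X (ω : ℕ → W) : Filter.Tendsto (fun n => S.X (List.ofFn (pw n ω)))
    Filter.atTop (nhds (x ω)) := by
  obtain ⟨M, hM⟩ := hc.bdd
  have h : Filter.Tendsto (fun n => S.r ^ n * M) Filter.atTop (nhds 0) := by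
    simpa using (tendsto_pow_atTop_nhds_zero_of_lt_one S.r_pos.le
      (by linarith [S.r_le])).mul_const M
  rw [tendsto_iff_norm_sub_tendsto_zero]
  refine squeeze_zero (fun _ => norm_nonneg _) (fun n => ?_) h
  have e : S.X (List.ofFn (pw n ω)) - x ω = -(S.r ^ n * x (sh n ω)) := by
    rw [hc.x_eq_X n ω]; ring
  rw [e, norm_neg, norm_mul, Real.norm_of_nonneg (pow_nonneg S.r_pos.le _)]
  exact mul_le_mul_of_nonneg_left (hM _).1 (pow_nonneg S.r_pos.le _)

theorem tendsto_V {z : ℝ} (hz : z ∈ S.K) (ω : ℕ → W) :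
    Filter.Tendsto (fun n => S.V z (List.ofFn (pw n ω))) Filter.atTop (nhds (y ω - z * x ω)) := by
  obtain ⟨M, hM⟩ := hc.bdd
  have hM0 : 0 ≤ M := (abs_nonneg _).trans (hM ω).1
  have hα := S.α_pos
  have h : Filter.Tendsto (fun n => S.α ^ n * (M + S.Z₀ * M)) Filter.atTop (nhds 0) := by
    simpa using (tendsto_pow_atTop_nhds_zero_of_lt_one hα.le S.α_lt).mul_const (M + S.Z₀ * M)
  rw [tendsto_iff_norm_sub_tendsto_zero]
  refine squeeze_zero (fun _ => norm_nonneg _) (fun n => ?_) h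
  set z' := S.Tl z (List.ofFn (pw n ω)) with hz'
  have hzK : |z'| ≤ S.Z₀ := S.Tl_mem hz _
  have e : S.V z (List.ofFn (pw n ω)) - (y ω - z * x ω) =
      -(S.α ^ n * (y (sh n ω) - z' * x (sh n ω))) := by
    rw [hc.sub_eq_V n z ω]; ring
  rw [e, norm_neg, norm_mul, Real.norm_of_nonneg (pow_nonneg hα.le _)]
  gcongr
  refine (norm_sub_le _ _).trans (add_le_add (hM _).2 ?_)
  rw [norm_mul]
  exact mul_le_mul hzK (hM _).1 (norm_nonneg _) S.Z₀_nonneg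

theorem abs_sub_le {z : ℝ} (hz : z ∈ S.K) (ω : ℕ → W) : |y ω - z * x ω| ≤ S.R :=
  le_of_tendsto (hc.tendsto_V hz ω).abs (Filter.Eventually.of_forall fun _ => S.abs_V_le hz _)

theorem le_abs_sub {g : ℝ} (hsep : S.Separated g) {ω ω' : ℕ → W} (h : ω 0 ≠ ω' 0) :
    g ≤ |x ω - x ω'| := by
  refine ge_of_tendsto ((hc.tendsto_X ω).sub (hc.tendsto_X ω')).abs ?_
  filter_upwards [Filter.eventually_ge_atTop 1] with n hn
  obtain ⟨n, rfl⟩ := Nat.exists_eq_add_of_le' hn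
  rw [ofFn_pw_succ, ofFn_pw_succ]
  exact hsep _ _ h _ _

/-- Sequences whose first coordinates are close share a long prefix. -/
theorem pw_eq_of_abs_lt {g : ℝ} (hg : 0 < g) (hsep : S.Separated g) {n : ℕ} {ω ω' : ℕ → W}
    (h : |x ω - x ω'| < g * S.r ^ n) : pw n ω = pw n ω' := by
  classical
  by_contra hne
  have hex : ∃ i, ω i ≠ ω' i ∧ i < n := by
    by_contra hall
    push Not at hall
    exact hne (funext fun i => by_contra fun hi => absurd (hall i hi) (not_le.2 i.2))
  obtain ⟨hi, hin⟩ := Nat.find_spec hex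
  set i := Nat.find hex
  have hpre : pw i ω = pw i ω' := funext fun k => by_contra fun hk =>
    Nat.find_min hex k.2 ⟨hk, k.2.trans hin⟩
  have h0 : g ≤ |x (sh i ω) - x (sh i ω')| := hc.le_abs_sub hsep hi
  rw [hc.x_eq_X i ω, hc.x_eq_X i ω', hpre, add_sub_add_left_eq_sub, ← mul_sub, abs_mul,
    abs_of_pos (pow_pos S.r_pos _)] at h
  have h1 : S.r ^ n ≤ S.r ^ i := pow_le_pow_of_le_one S.r_pos.le (by linarith [S.r_le]) hin.le
  have h2 : S.r ^ i * g ≤ S.r ^ i * |x (sh i ω) - x (sh i ω')| :=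
    mul_le_mul_of_nonneg_left h0 (pow_nonneg S.r_pos.le _)
  nlinarith

/-- Sequences whose two coordinates are close have close projections of their tails. -/
theorem abs_V_sub_le {n t : ℕ} {d : ℝ} {ω ω' : ℕ → W} (hpw : pw n ω = pw n ω')
    (hd : d ≤ S.α ^ (n + t)) (h : |y ω - y ω'| ≤ d) {z : ℝ}
    (hz : z = S.Tl 0 (List.ofFn (pw n ω))) :
    |S.V z (List.ofFn (pw t (sh n ω))) - S.V z (List.ofFn (pw t (sh n ω')))| ≤ S.D * S.α ^ t := by
  have hα := S.α_pos
  have hzK : z ∈ S.K := hz ▸ S.Tl_mem S.zero_mem_K _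
  have h1 := hc.sub_eq_V n 0 ω
  have h2 := hc.sub_eq_V n 0 ω'
  rw [← hpw, ← hz] at h2
  rw [← hz] at h1
  have h3 := hc.sub_eq_V t z (sh n ω)
  have h4 := hc.sub_eq_V t z (sh n ω')
  set v := S.V z (List.ofFn (pw t (sh n ω)))
  set v' := S.V z (List.ofFn (pw t (sh n ω')))
  have b1 := hc.abs_sub_le (S.Tl_mem hzK (List.ofFn (pw t (sh n ω)))) (sh t (sh n ω))
  have b2 := hc.abs_sub_le (S.Tl_mem hzK (List.ofFn (pw t (sh n ω')))) (sh t (sh n ω'))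
  set e := y (sh t (sh n ω)) - S.Tl z (List.ofFn (pw t (sh n ω))) * x (sh t (sh n ω))
  set e' := y (sh t (sh n ω')) - S.Tl z (List.ofFn (pw t (sh n ω'))) * x (sh t (sh n ω'))
  set f := y (sh n ω) - z * x (sh n ω)
  set f' := y (sh n ω') - z * x (sh n ω')
  have h5 : S.α ^ n * (f - f') = y ω - y ω' := by linarith
  have h6 : |f - f'| ≤ S.α ^ t := by
    have : S.α ^ n * |f - f'| ≤ S.α ^ n * S.α ^ t := by
      rw [← abs_of_pos (pow_pos hα n), ← abs_mul, h5, abs_of_pos (pow_pos hα n), ← pow_add]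
      exact h.trans hd
    exact le_of_mul_le_mul_left this (pow_pos hα n)
  have h7 : v - v' = (f - f') - S.α ^ t * (e - e') := by linarith
  rw [h7]
  refine (abs_sub _ _).trans ?_
  rw [abs_mul, abs_of_pos (pow_pos hα t)]
  have h8 : |e - e'| ≤ 2 * S.R := (abs_sub _ _).trans (by linarith)
  have h9 := mul_le_mul_of_nonneg_left h8 (pow_nonneg hα.le t)
  have h10 := mul_le_mul_of_nonneg_right S.le_D (pow_nonneg hα.le t)
  linarith

end Coding

open MeasureTheory

/-- **Mass distribution principle** for the image of a measure under a map to the plane. -/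
theorem ofReal_le_dimH_of_measure_le {Ω : Type*} [MeasurableSpace Ω] (P : Measure Ω)
    {E : Set Ω} (hPE : P E ≠ 0) {x y : Ω → ℝ} (hx : Measurable x)
    (hy : Measurable y) {Γ : Set (ℝ × ℝ)} (hΓ : ∀ ω, (x ω, y ω) ∈ Γ) {C d₀ σ : ℝ} (hC : 0 < C)
    (hd₀ : 0 < d₀) (hσ : 0 < σ)
    (h : ∀ d, 0 < d → d < d₀ → ∀ A ⊆ E,
      (∀ ω ∈ A, ∀ ω' ∈ A, |x ω - x ω'| ≤ d ∧ |y ω - y ω'| ≤ d) →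
        P A ≤ ENNReal.ofReal (C * d ^ σ)) :
    ENNReal.ofReal σ ≤ dimH Γ := by
  have hu : Measurable (fun ω => (x ω, y ω)) := hx.prodMk hy
  set ν := (P.restrict E).map (fun ω => (x ω, y ω)) with hν
  have hC0 : ENNReal.ofReal C ≠ 0 := by simpa using hC
  have hle : (ENNReal.ofReal C)⁻¹ • ν ≤ Measure.hausdorffMeasure σ := by
    refine Measure.le_hausdorffMeasure σ _ (ENNReal.ofReal (d₀ / 2)) (by simpa using hd₀) ?_
    intro s hs
    have hsfin : Metric.ediam s ≠ ⊤ := ne_top_of_le_ne_top ENNReal.ofReal_ne_top hs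
    set d := (Metric.ediam s).toReal with hd
    have hd' : Metric.ediam s = ENNReal.ofReal d := (ENNReal.ofReal_toReal hsfin).symm
    have hdd : d ≤ d₀ / 2 := by
      rw [hd'] at hs
      exact (ENNReal.ofReal_le_ofReal_iff (by positivity)).1 hs
    have hdn : 0 ≤ d := ENNReal.toReal_nonneg
    set A := (fun ω => (x ω, y ω)) ⁻¹' closure s ∩ E with hA
    have hAd : ∀ ω ∈ A, ∀ ω' ∈ A, |x ω - x ω'| ≤ d ∧ |y ω - y ω'| ≤ d := by
      intro ω hω ω' hω'
      have h1 : edist (x ω, y ω) (x ω', y ω') ≤ Metric.ediam (closure s) :=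
        Metric.edist_le_ediam_of_mem hω.1 hω'.1
      rw [Metric.ediam_closure, hd', edist_dist, ENNReal.ofReal_le_ofReal_iff hdn,
        Prod.dist_eq, max_le_iff, Real.dist_eq, Real.dist_eq] at h1
      exact h1
    have key : P A ≤ ENNReal.ofReal (C * d ^ σ) := by
      rcases hdn.lt_or_eq with hpos | h0
      · exact h d hpos (by linarith) A Set.inter_subset_right hAd
      · have hlim : Filter.Tendsto (fun e : ℝ => ENNReal.ofReal (C * e ^ σ))
            (nhdsWithin 0 (Set.Ioi 0)) (nhds (ENNReal.ofReal (C * d ^ σ))) := by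
          have hc : ContinuousAt (fun e : ℝ => ENNReal.ofReal (C * e ^ σ)) 0 :=
            ENNReal.continuous_ofReal.continuousAt.comp
              (continuousAt_const.mul (Real.continuousAt_rpow_const _ _ (Or.inr hσ.le)))
          rw [← h0]
          exact hc.tendsto.mono_left nhdsWithin_le_nhds
        refine ge_of_tendsto hlim ?_
        filter_upwards [Ioo_mem_nhdsGT hd₀] with e he
        refine h e he.1 he.2 A Set.inter_subset_right fun ω hω ω' hω' => ?_
        have := hAd ω hω ω' hω'
        have := he.1
        constructor <;> linarith [hAd ω hω ω' hω']
    have h2 : ν s ≤ P A := by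
      refine (measure_mono subset_closure).trans ?_
      rw [hν, Measure.map_apply hu isClosed_closure.measurableSet,
        Measure.restrict_apply (hu isClosed_closure.measurableSet)]
    rw [Measure.smul_apply, smul_eq_mul]
    refine (mul_le_mul_right (h2.trans key) _).trans ?_
    rw [ENNReal.ofReal_mul hC.le, ← mul_assoc,
      ENNReal.inv_mul_cancel hC0 ENNReal.ofReal_ne_top, one_mul, hd',
      ENNReal.ofReal_rpow_of_nonneg hdn hσ.le]
  have hΓ0 : Measure.hausdorffMeasure ((σ.toNNReal : NNReal) : ℝ) Γ ≠ 0 := by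
    rw [Real.coe_toNNReal _ hσ.le]
    intro h0
    have h1 := hle Γ
    rw [h0, Measure.smul_apply, smul_eq_mul, nonpos_iff_eq_zero, mul_eq_zero] at h1
    rcases h1 with h1 | h1
    · simp at h1
    · have h2 := Measure.le_map_apply (μ := P.restrict E) hu.aemeasurable Γ
      rw [← hν, h1] at h2
      have h3 : (fun ω => (x ω, y ω)) ⁻¹' Γ = Set.univ := Set.eq_univ_of_forall hΓ
      rw [h3, Measure.restrict_apply_univ] at h2
      exact hPE (nonpos_iff_eq_zero.1 h2)
  exact le_dimH_of_hausdorffMeasure_ne_zero hΓ0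

theorem exists_measure_iInter_compl_ne_zero {Ω : Type*} [MeasurableSpace Ω] (P : Measure Ω)
    [IsProbabilityMeasure P] {s : ℕ → Set Ω} (hs : ∑' n, P (s n) ≠ ⊤) :
    ∃ n₀, P {ω | ∀ n, n₀ ≤ n → ω ∉ s n} ≠ 0 := by
  by_contra! hall
  have h1 := ae_eventually_notMem hs
  have h2 : ∀ᵐ ω ∂P, ∀ n₀ : ℕ, ω ∉ {ω | ∀ n, n₀ ≤ n → ω ∉ s n} :=
    ae_all_iff.2 fun n₀ => measure_eq_zero_iff_ae_notMem.1 (hall n₀)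
  obtain ⟨ω, h3, h4⟩ := (h1.and h2).exists
  obtain ⟨n₀, h5⟩ := Filter.eventually_atTop.1 h3
  exact h4 n₀ h5

section Coin
variable (W : Type*) [Fintype W] [Nonempty W] [MeasurableSpace W] [MeasurableSingletonClass W]

/-- The uniform product measure on sequences. -/
noncomputable def seqMeas : Measure (ℕ → W) :=
  Measure.infinitePi fun _ => (PMF.uniformOfFintype W).toMeasure

instance : IsProbabilityMeasure (seqMeas W) := by unfold seqMeas; infer_instance

variable {W}

theorem measurable_pw (k : ℕ) : Measurable (pw k : (ℕ → W) → Fin k → W) :=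
  measurable_pi_iff.2 fun _ => measurable_pi_apply _

theorem measurable_comp_pw {β : Type*} [MeasurableSpace β] (k : ℕ) (f : (Fin k → W) → β) :
    Measurable fun ω => f (pw k ω) :=
  (measurable_of_finite f).comp (measurable_pw k)

theorem seqMeas_pw_eq (k : ℕ) (v : Fin k → W) :
    seqMeas W {ω | pw k ω = v} = ENNReal.ofReal (uw W k v) := by
  have e : {ω | pw k ω = v} = Set.pi (range k : Set ℕ)
      (fun i => if h : i < k then {v ⟨i, h⟩} else Set.univ) := by
    ext ω
    simp only [Set.mem_ofPred_eq, funext_iff, Set.mem_pi, coe_range, Set.mem_Iio, pw]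
    constructor
    · intro h i hi
      simpa [hi] using h ⟨i, hi⟩
    · intro h i
      simpa using h i i.2
  rw [e, seqMeas, Measure.infinitePi_pi]
  · have hN : 0 < Fintype.card W := Fintype.card_pos
    rw [Finset.prod_congr rfl (g := fun _ => (Fintype.card W : ENNReal)⁻¹)]
    · rw [Finset.prod_const, Finset.card_range, uw, ENNReal.ofReal_pow (by positivity), one_div,
        ENNReal.ofReal_inv_of_pos (by exact_mod_cast hN), ENNReal.ofReal_natCast]
    · intro i hi
      rw [dif_pos (Finset.mem_range.1 hi),
        PMF.toMeasure_apply_singleton _ _ (measurableSet_singleton _),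
        PMF.uniformOfFintype_apply]
  · intro i hi
    rw [dif_pos (Finset.mem_range.1 hi)]
    exact measurableSet_singleton _

theorem seqMeas_pw_mem_le (k : ℕ) (A : Set (Fin k → W)) [DecidablePred (· ∈ A)] :
    seqMeas W {ω | pw k ω ∈ A} ≤ ENNReal.ofReal (∑ v, if v ∈ A then uw W k v else 0) := by
  have e : {ω | pw k ω ∈ A} = ⋃ v ∈ Finset.univ.filter (· ∈ A), {ω : ℕ → W | pw k ω = v} := by
    ext ω
    simp
  rw [e, ← Finset.sum_filter, ENNReal.ofReal_sum_of_nonneg fun _ _ => uw_nonneg _]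
  exact (measure_biUnion_finset_le _ _).trans (Finset.sum_le_sum fun v _ => (seqMeas_pw_eq k v).le)

end Coin

theorem seqMeas_pw_pw_le {W : Type*} [Fintype W] [Nonempty W] [MeasurableSpace W]
    [MeasurableSingletonClass W] (n t : ℕ) (Q : (Fin n → W) → (Fin t → W) → Prop)
    [∀ u v, Decidable (Q u v)] :
    seqMeas W {ω | Q (pw n ω) (pw t (sh n ω))} ≤
      ENNReal.ofReal (∑ u, uw W n u * ∑ v, if Q u v then uw W t v else 0) := by
  classical
  set A : Set (Fin (n + t) → W) :=
    {w | Q (fun i => w (Fin.castAdd t i)) (fun j => w (Fin.natAdd n j))} with hA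
  have h := seqMeas_pw_mem_le (n + t) A
  have e : {ω : ℕ → W | pw (n + t) ω ∈ A} = {ω | Q (pw n ω) (pw t (sh n ω))} := by
    ext ω
    rfl
  have e2 : ∑ w, (if w ∈ A then uw W (n + t) w else 0) =
      ∑ u, uw W n u * ∑ v, if Q u v then uw W t v else 0 := by
    have := sum_append (W := W) (s := n) (t := t) (fun w => if w ∈ A then (1 : ℝ) else 0)
    simp only [mul_ite, mul_one, mul_zero] at this
    rw [this]
    simp [hA]
  rw [e, e2] at h
  exact h

namespace Sys
variable {W : Type*} [Fintype W] [Nonempty W] (S : Sys W)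

theorem exists_depth {g : ℝ} (hg : 0 < g) (hg1 : g ≤ 1) (n : ℕ) : ∃ t : ℕ,
    g * S.r ^ n ≤ S.α ^ (n + t) ∧ t * S.lam ≤ n * (S.rho - S.lam) - Real.log g ∧
      n * (S.rho - S.lam) ≤ (t + 1) * S.lam := by
  have hr := S.r_pos
  have hα := S.α_pos
  have hq : 0 < S.r / S.α := by positivity
  have hq1 : S.r / S.α ≤ 1 := (div_le_one hα).2 S.r_lt.le
  obtain ⟨t, h1, h2⟩ := exists_nat_pow_near_of_lt_one (x := g * (S.r / S.α) ^ n) (y := S.α)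
    (by positivity) (mul_le_one₀ hg1 (by positivity) (pow_le_one₀ hq.le hq1)) hα S.α_lt
  refine ⟨t, ?_, ?_, ?_⟩
  · rw [pow_add]
    calc g * S.r ^ n = S.α ^ n * (g * (S.r / S.α) ^ n) := by
          rw [div_pow]; field_simp
      _ ≤ _ := mul_le_mul_of_nonneg_left h2 (by positivity)
  · have h3 := Real.log_le_log (by positivity) h2
    rw [Real.log_mul hg.ne' (by positivity), Real.log_pow, Real.log_pow,
      Real.log_div hr.ne' hα.ne'] at h3
    simp only [lam, rho]
    linarith
  · have h3 := Real.log_le_log (by positivity) h1.le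
    rw [Real.log_mul hg.ne' (by positivity), Real.log_pow, Real.log_pow,
      Real.log_div hr.ne' hα.ne'] at h3
    have := Real.log_nonpos hg.le hg1
    simp only [lam, rho]
    push_cast at h3
    linarith

end Sys

namespace Coding
variable {W : Type*} [Fintype W] [Nonempty W] {S : Sys W} {x y : (ℕ → W) → ℝ}

section
variable [MeasurableSpace W] [MeasurableSingletonClass W]

theorem measurable_x (hc : Coding S x y) : Measurable x :=
  measurable_of_tendsto_metrizable (fun n => measurable_comp_pw n fun v => S.X (List.ofFn v))
    (tendsto_pi_nhds.2 hc.tendsto_X)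

theorem measurable_y (hc : Coding S x y) : Measurable y := by
  refine measurable_of_tendsto_metrizable
    (fun n => measurable_comp_pw n fun v => S.V 0 (List.ofFn v)) (tendsto_pi_nhds.2 fun ω => ?_)
  simpa using hc.tendsto_V S.zero_mem_K ω

/-- The measure of a set of sequences with nearby codings. -/
theorem seqMeas_le (hc : Coding S x y) {g : ℝ} (hg : 0 < g) (hsep : S.Separated g) {n t : ℕ}
    {d : ℝ} (hdn : d < g * S.r ^ n) (hdt : d ≤ S.α ^ (n + t)) {A : Set (ℕ → W)} {ω : ℕ → W}
    (hA : ∀ ω' ∈ A, |x ω' - x ω| ≤ d ∧ |y ω' - y ω| ≤ d) :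
    seqMeas W A ≤ ENNReal.ofReal ((1 / Fintype.card W : ℝ) ^ n *
      S.NN t (S.Tl 0 (List.ofFn (pw n ω))) (pw t (sh n ω))) := by
  classical
  set z := S.Tl 0 (List.ofFn (pw n ω)) with hz
  set Q : (Fin n → W) → (Fin t → W) → Prop := fun u v => u = pw n ω ∧
    |S.V z (List.ofFn v) - S.V z (List.ofFn (pw t (sh n ω)))| ≤ S.D * S.α ^ t with hQ
  have hsub : A ⊆ {ω' | Q (pw n ω') (pw t (sh n ω'))} := by
    intro ω' hω'
    obtain ⟨h1, h2⟩ := hA ω' hω'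
    have h3 : pw n ω' = pw n ω := hc.pw_eq_of_abs_lt hg hsep (h1.trans_lt hdn)
    exact ⟨h3, hc.abs_V_sub_le h3 hdt h2 (by rw [h3])⟩
  refine (measure_mono hsub).trans ((seqMeas_pw_pw_le n t Q).trans_eq ?_)
  congr 1
  rw [Finset.sum_eq_single (pw n ω)]
  · simp only [hQ, true_and]
    rfl
  · intro u _ hu
    simp [hQ, hu]
  · simp

theorem seqMeas_bad_le {a c C : ℝ} {t : ℕ}
    (h : ∀ z ∈ S.K, ∑ v, (if a < S.NN t z v then uw W t v else 0) ≤ C * Real.exp (-c * t))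
    (n : ℕ) : seqMeas W {ω | a < S.NN t (S.Tl 0 (List.ofFn (pw n ω))) (pw t (sh n ω))} ≤
      ENNReal.ofReal (C * Real.exp (-c * t)) := by
  classical
  refine (seqMeas_pw_pw_le n t
    (fun u v => a < S.NN t (S.Tl 0 (List.ofFn u)) v)).trans (ENNReal.ofReal_le_ofReal ?_)
  rw [← sum_uw_mul_const (W := W) n (C * Real.exp (-c * t))]
  exact Finset.sum_le_sum fun u _ =>
    mul_le_mul_of_nonneg_left (h _ (S.Tl_mem S.zero_mem_K _)) (uw_nonneg _)

end

theorem ofReal_le_dimH (hc : Coding S x y) {g : ℝ} (hg : 0 < g) (hg1 : g ≤ 1)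
    (hsep : S.Separated g) {w w' : W} (hb : S.b w ≠ S.b w') (hN : 1 < Fintype.card W * S.α)
    {Γ : Set (ℝ × ℝ)} (hΓ : ∀ ω, (x ω, y ω) ∈ Γ) {η : ℝ} (hη : 0 < η)
    (hσ : 0 < 1 + (Real.log (Fintype.card W) - S.lam) / S.rho - η) :
    ENNReal.ofReal (1 + (Real.log (Fintype.card W) - S.lam) / S.rho - η) ≤ dimH Γ := by
  let : MeasurableSpace W := ⊤
  have : MeasurableSingletonClass W := ⟨fun _ => trivial⟩
  have hβ := S.lam_le_β hg hsep hb hN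
  have hlam := S.lam_pos
  have hrho := S.lam_lt_rho
  set σ := 1 + (Real.log (Fintype.card W) - S.lam) / S.rho - η with hσd
  obtain ⟨C, c, hC, hcc, htail⟩ := S.exists_tail (ε := η * S.lam) (by positivity)
  choose t ht1 ht2 ht3 using S.exists_depth hg hg1
  set bad : ℕ → Set (ℕ → W) := fun n => {ω | C * Real.exp (-(S.β - η * S.lam) * t n) <
    S.NN (t n) (S.Tl 0 (List.ofFn (pw n ω))) (pw (t n) (sh n ω))} with hbad
  have hsum : ∑' n, seqMeas W (bad n) ≠ ⊤ := by
    set q := Real.exp (-(c * (S.rho - S.lam) / S.lam)) with hq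
    have hq1 : q < 1 := Real.exp_lt_one_iff.2
      (neg_neg_of_pos (div_pos (mul_pos hcc (by linarith)) hlam))
    have hS : Summable fun n : ℕ => C * Real.exp c * q ^ n :=
      (summable_geometric_of_lt_one (Real.exp_pos _).le hq1).mul_left _
    refine ne_top_of_le_ne_top (b := ∑' n : ℕ, ENNReal.ofReal (C * Real.exp c * q ^ n))
      hS.tsum_ofReal_ne_top (ENNReal.tsum_le_tsum fun n => ?_)
    refine (seqMeas_bad_le (htail (t n)) n).trans (ENNReal.ofReal_le_ofReal ?_)
    rw [mul_assoc, hq, ← Real.exp_nat_mul, ← Real.exp_add]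
    gcongr
    have h1 : n * (S.rho - S.lam) / S.lam ≤ t n + 1 := (div_le_iff₀ hlam).2 (ht3 n)
    have h2 := mul_le_mul_of_nonneg_left h1 hcc.le
    have h3 : (n : ℝ) * -(c * (S.rho - S.lam) / S.lam) = -(c * (n * (S.rho - S.lam) / S.lam)) := by
      ring
    rw [h3]
    linarith
  obtain ⟨n₀, hn₀⟩ := exists_measure_iInter_compl_ne_zero (seqMeas W) hsum
  have hr := S.r_pos
  have hr1 : S.r < 1 := by linarith [S.r_le]
  have hN0 : (0 : ℝ) < Fintype.card W := by exact_mod_cast Fintype.card_pos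
  set κ := S.lam - η * Real.log g with hκ
  refine ofReal_le_dimH_of_measure_le (seqMeas W) hn₀ hc.measurable_x hc.measurable_y hΓ
    (C := C * Real.exp κ * (1 / (g * S.r)) ^ σ) (d₀ := g * S.r ^ n₀) (by positivity)
    (by positivity) hσ ?_
  intro d hd hdd A hAE hA
  rcases A.eq_empty_or_nonempty with rfl | ⟨ω, hω⟩
  · simp
  obtain ⟨n, hn1, hn2⟩ : ∃ n : ℕ, g * S.r ^ (n + 1) ≤ d ∧ d < g * S.r ^ n := by
    classical
    have hex : ∃ n : ℕ, g * S.r ^ (n + 1) ≤ d := by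
      obtain ⟨n, hn⟩ := exists_pow_lt_of_lt_one (div_pos hd hg) hr1
      refine ⟨n, ?_⟩
      have h1 : S.r ^ (n + 1) ≤ d / g := (pow_le_pow_of_le_one hr.le hr1.le n.le_succ).trans hn.le
      rw [le_div_iff₀ hg] at h1
      linarith
    refine ⟨Nat.find hex, Nat.find_spec hex, ?_⟩
    rcases hm : Nat.find hex with _ | m
    · exact hdd.trans_le (mul_le_mul_of_nonneg_left (pow_le_pow_of_le_one hr.le hr1.le
        n₀.zero_le) hg.le)
    · exact not_le.1 (Nat.find_min hex (hm ▸ m.lt_succ_self))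
  have hnn : n₀ ≤ n := by
    by_contra! hlt
    have := mul_le_mul_of_nonneg_left (pow_le_pow_of_le_one hr.le hr1.le
      (Nat.succ_le_of_lt hlt)) hg.le
    rw [Nat.succ_eq_add_one] at this
    linarith
  refine (hc.seqMeas_le hg hsep hn2 (hn2.le.trans (ht1 n))
    (fun ω' hω' => hA ω' hω' ω hω)).trans (ENNReal.ofReal_le_ofReal ?_)
  have h1 : S.NN (t n) (S.Tl 0 (List.ofFn (pw n ω))) (pw (t n) (sh n ω)) ≤
      C * Real.exp (-(S.β - η * S.lam) * t n) := not_lt.1 (hAE hω n hnn)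
  refine (mul_le_mul_of_nonneg_left h1 (by positivity)).trans ?_
  have h2 : S.r ^ n ≤ 1 / (g * S.r) * d := by
    rw [pow_succ] at hn1
    rw [div_mul_eq_mul_div, one_mul, le_div_iff₀ (by positivity)]
    linarith
  have h3 : (S.r ^ n) ^ σ ≤ (1 / (g * S.r)) ^ σ * d ^ σ := by
    rw [← Real.mul_rpow (by positivity) hd.le]
    exact Real.rpow_le_rpow (by positivity) h2 hσ.le
  have h4 : (1 / Fintype.card W : ℝ) ^ n * Real.exp (-(S.β - η * S.lam) * t n) ≤
      Real.exp κ * (S.r ^ n) ^ σ := by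
    have e1 : (1 / Fintype.card W : ℝ) ^ n = Real.exp (-(n * Real.log (Fintype.card W))) := by
      rw [← mul_neg, Real.exp_nat_mul, Real.exp_neg, Real.exp_log hN0, one_div]
    have e2 : (S.r ^ n) ^ σ = Real.exp (-(n * S.rho * σ)) := by
      rw [Real.rpow_def_of_pos (by positivity), Real.log_pow]
      simp only [Sys.rho]
      ring_nf
    rw [e1, e2, ← Real.exp_add, ← Real.exp_add, Real.exp_le_exp]
    have e3 : S.rho * σ = S.rho + Real.log (Fintype.card W) - S.lam - η * S.rho := by
      have : S.rho ≠ 0 := by linarith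
      rw [hσd]
      field_simp
      ring
    have e4 : (n : ℝ) * S.rho * σ =
        n * (S.rho + Real.log (Fintype.card W) - S.lam - η * S.rho) := by rw [mul_assoc, e3]
    rw [e4, hκ]
    have h5 := mul_le_mul_of_nonneg_right hβ (Nat.cast_nonneg (α := ℝ) (t n))
    have h6 := mul_le_mul_of_nonneg_left (ht2 n) hη.le
    have h7 := mul_nonneg (mul_nonneg hη.le (Nat.cast_nonneg (α := ℝ) n)) hlam.le
    linarith [ht3 n]
  calc (1 / Fintype.card W : ℝ) ^ n * (C * Real.exp (-(S.β - η * S.lam) * t n))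
      = C * ((1 / Fintype.card W : ℝ) ^ n * Real.exp (-(S.β - η * S.lam) * t n)) := by ring
    _ ≤ C * (Real.exp κ * ((1 / (g * S.r)) ^ σ * d ^ σ)) := 
        mul_le_mul_of_nonneg_left (h4.trans (by gcongr)) hC.le
    _ = _ := by ring

end Coding

/-- The affine map `(x, y) ↦ (r x + ξ, b x + a y + c)` of the plane. -/
structure Aff where
  r : ℝ
  ξ : ℝ
  b : ℝ
  a : ℝ
  c : ℝ

namespace Aff

/-- The identity map. -/
def one : Aff := ⟨1, 0, 0, 1, 0⟩

/-- Composition of maps. -/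
def comp (f g : Aff) : Aff :=
  ⟨f.r * g.r, f.r * g.ξ + f.ξ, f.b * g.r + f.a * g.b, f.a * g.a, f.b * g.ξ + f.a * g.c + f.c⟩

@[simp] theorem comp_r (f g : Aff) : (f.comp g).r = f.r * g.r := rfl
@[simp] theorem comp_ξ (f g : Aff) : (f.comp g).ξ = f.r * g.ξ + f.ξ := rfl
@[simp] theorem comp_b (f g : Aff) : (f.comp g).b = f.b * g.r + f.a * g.b := rfl
@[simp] theorem comp_a (f g : Aff) : (f.comp g).a = f.a * g.a := rfl
@[simp] theorem comp_c (f g : Aff) : (f.comp g).c = f.b * g.ξ + f.a * g.c + f.c := rfl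

/-- The map sends the graph of `G` over the unit interval into itself. -/
structure Adm (G : ℝ → ℝ) (f : Aff) : Prop where
  r_pos : 0 < f.r
  ξ_nonneg : 0 ≤ f.ξ
  le_one : f.ξ + f.r ≤ 1
  eq : ∀ t, 0 ≤ t → t ≤ 1 → G (f.r * t + f.ξ) = f.b * t + f.a * G t + f.c

theorem Adm.one (G : ℝ → ℝ) : Adm G one :=
  ⟨by simp [Aff.one], by simp [Aff.one], by simp [Aff.one], by simp [Aff.one]⟩

theorem Adm.mem {G : ℝ → ℝ} {f : Aff} (hf : Adm G f) {t : ℝ} (h0 : 0 ≤ t) (h1 : t ≤ 1) :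
    f.ξ ≤ f.r * t + f.ξ ∧ f.r * t + f.ξ ≤ f.ξ + f.r := by
  have := hf.r_pos
  constructor <;> nlinarith

theorem Adm.comp {G : ℝ → ℝ} {f g : Aff} (hf : Adm G f) (hg : Adm G g) : Adm G (f.comp g) where
  r_pos := mul_pos hf.r_pos hg.r_pos
  ξ_nonneg := add_nonneg (mul_nonneg hf.r_pos.le hg.ξ_nonneg) hf.ξ_nonneg
  le_one := by
    have := hf.le_one
    have := mul_le_mul_of_nonneg_left hg.le_one hf.r_pos.le
    simp only [comp_ξ, comp_r]
    linarith
  eq t h0 h1 := by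
    have h2 := hg.mem h0 h1
    have h3 := hf.eq (g.r * t + g.ξ) (by linarith [hg.ξ_nonneg]) (by linarith [hg.le_one])
    rw [hg.eq t h0 h1] at h3
    simp only [comp_ξ, comp_r, comp_a, comp_b, comp_c]
    rw [← add_assoc, mul_assoc, ← mul_add, h3]
    ring

/-- The images of the unit interval under the first coordinates do not overlap. -/
def Dis (f g : Aff) : Prop := f.ξ + f.r ≤ g.ξ ∨ g.ξ + g.r ≤ f.ξ

theorem Dis.comp {G : ℝ → ℝ} {f g h k : Aff} (hd : Dis f g) (hf : Adm G f) (hg : Adm G g)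
    (hh : Adm G h) (hk : Adm G k) : Dis (f.comp h) (g.comp k) := by
  have h1 := mul_le_mul_of_nonneg_left hh.le_one hf.r_pos.le
  have h2 := mul_le_mul_of_nonneg_left hk.le_one hg.r_pos.le
  have h3 := mul_nonneg hf.r_pos.le hh.ξ_nonneg
  have h4 := mul_nonneg hg.r_pos.le hk.ξ_nonneg
  simp only [Dis, comp_ξ, comp_r]
  rcases hd with hd | hd
  · left; linarith
  · right; linarith

theorem Dis.comp_left {G : ℝ → ℝ} {f h k : Aff} (hf : Adm G f) (hd : Dis h k) :
    Dis (f.comp h) (f.comp k) := by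
  simp only [Dis, comp_ξ, comp_r]
  rcases hd with hd | hd
  · left; nlinarith [mul_le_mul_of_nonneg_left hd hf.r_pos.le]
  · right; nlinarith [mul_le_mul_of_nonneg_left hd hf.r_pos.le]

theorem Dis.comp_interior {G : ℝ → ℝ} {f g : Aff} (hd : Dis f g) (hf : Adm G f) (hg : Adm G g) :
    0 < (f.comp g).ξ ∧ (f.comp g).ξ + (f.comp g).r < 1 := by
  have h1 := hf.r_pos
  have h2 := hg.r_pos
  have h3 := hf.ξ_nonneg
  have h4 := hg.ξ_nonneg
  have h5 := hf.le_one
  have h6 := hg.le_one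
  simp only [comp_ξ, comp_r]
  rcases hd with hd | hd
  · have h7 : 0 < f.r * g.ξ := mul_pos h1 (by linarith)
    have h8 := mul_le_mul_of_nonneg_left h6 h1.le
    constructor
    · linarith
    · linarith
  · have h7 : 0 ≤ f.r * g.ξ := mul_nonneg h1.le h4
    have h8 : f.r * (g.ξ + g.r) < f.r * 1 := mul_lt_mul_of_pos_left (by linarith) h1
    constructor <;> linarith

variable {ι : Type*}

/-- The composition of the maps along a word. -/
def wd (f : ι → Aff) : ∀ n, (Fin n → ι) → Aff
  | 0, _ => one
  | n + 1, v => (f (v 0)).comp (wd f n (Fin.tail v))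

theorem wd_adm {G : ℝ → ℝ} {f : ι → Aff} (hf : ∀ i, Adm G (f i)) :
    ∀ n (v : Fin n → ι), Adm G (wd f n v)
  | 0, _ => Adm.one G
  | n + 1, _ => (hf _).comp (wd_adm hf n _)

theorem wd_r (f : ι → Aff) : ∀ n (v : Fin n → ι), (wd f n v).r = ∏ k, (f (v k)).r
  | 0, _ => by simp [wd, one]
  | n + 1, v => by
    rw [Fin.prod_univ_succ, wd, comp_r, wd_r f n]
    rfl

theorem wd_a (f : ι → Aff) : ∀ n (v : Fin n → ι), (wd f n v).a = ∏ k, (f (v k)).a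
  | 0, _ => by simp [wd, one]
  | n + 1, v => by
    rw [Fin.prod_univ_succ, wd, comp_a, wd_a f n]
    rfl

theorem wd_dis {G : ℝ → ℝ} {f : ι → Aff} (hf : ∀ i, Adm G (f i))
    (hd : ∀ i j, i ≠ j → Dis (f i) (f j)) :
    ∀ n (v w : Fin n → ι), v ≠ w → Dis (wd f n v) (wd f n w)
  | 0, v, w, h => absurd (Subsingleton.elim v w) h
  | n + 1, v, w, h => by
    by_cases h0 : v 0 = w 0
    · have ht : Fin.tail v ≠ Fin.tail w := by
        intro ht
        apply h
        rw [← Fin.cons_self_tail v, ← Fin.cons_self_tail w, h0, ht]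
      rw [wd, wd, h0]
      exact Dis.comp_left (hf _) (wd_dis hf hd n _ _ ht)
    · exact (hd _ _ h0).comp (hf _) (hf _) (wd_adm hf n _) (wd_adm hf n _)

theorem exists_wd {f : ι → Aff}
    (hcov : ∀ t : ℝ, 0 ≤ t → t ≤ 1 → ∃ i t', 0 ≤ t' ∧ t' ≤ 1 ∧ t = (f i).r * t' + (f i).ξ) :
    ∀ n (t : ℝ), 0 ≤ t → t ≤ 1 → ∃ v : Fin n → ι, ∃ t', 0 ≤ t' ∧ t' ≤ 1 ∧
      t = (wd f n v).r * t' + (wd f n v).ξ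
  | 0, t, h0, h1 => ⟨Fin.elim0, t, h0, h1, by simp [wd, one]⟩
  | n + 1, t, h0, h1 => by
    obtain ⟨i, t', h2, h3, h4⟩ := hcov t h0 h1
    obtain ⟨v, t'', h5, h6, h7⟩ := exists_wd hcov n t' h2 h3
    refine ⟨Fin.cons i v, t'', h5, h6, ?_⟩
    simp only [wd, Fin.cons_zero, Fin.tail_cons, comp_r, comp_ξ]
    rw [h4, h7]
    ring

theorem sum_word_succ [Fintype ι] (n : ℕ) (φ : (Fin (n + 1) → ι) → ℝ) :
    ∑ v, φ v = ∑ i, ∑ u : Fin n → ι, φ (Fin.cons i u) := by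
  rw [← Fintype.sum_prod_type', ← (Fin.consEquiv fun _ : Fin (n + 1) => ι).sum_comp]
  rfl

theorem sum_wd_r_mul [Fintype ι] {f : ι → Aff} (hr : ∀ i, 0 < (f i).r) (e : ℝ) (n : ℕ) :
    ∑ u : Fin n → ι, (wd f n u).r * (wd f n u).r ^ e = (∑ i, (f i).r * (f i).r ^ e) ^ n := by
  rw [Fintype.sum_pow (fun i => (f i).r * (f i).r ^ e) n]
  refine Finset.sum_congr rfl fun u _ => ?_
  rw [wd_r, ← Real.finsetProd_rpow _ _ (fun k _ => (hr _).le), Finset.prod_mul_distrib]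

theorem sum_abs_wd_a_mul [Fintype ι] {f : ι → Aff} (hr : ∀ i, 0 < (f i).r) (e : ℝ) (n : ℕ) :
    ∑ u : Fin n → ι, |(wd f n u).a| * (wd f n u).r ^ e = (∑ i, |(f i).a| * (f i).r ^ e) ^ n := by
  rw [Fintype.sum_pow (fun i => |(f i).a| * (f i).r ^ e) n]
  refine Finset.sum_congr rfl fun u _ => ?_
  rw [wd_r, wd_a, ← Real.finsetProd_rpow _ _ (fun k _ => (hr _).le), Finset.abs_prod,
    Finset.prod_mul_distrib]

/-- If every letter sum is contracting then so are the level `n` sums of heights. -/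
theorem sum_abs_b_le [Fintype ι] {f : ι → Aff} (hr : ∀ i, 0 < (f i).r) {e θ : ℝ} (hθ : 0 < θ)
    (h1 : ∑ i, |(f i).a| * (f i).r ^ e ≤ θ) (h2 : ∑ i, (f i).r * (f i).r ^ e ≤ θ) :
    ∀ n : ℕ, ∑ v : Fin n → ι, |(wd f n v).b| * (wd f n v).r ^ e ≤
      n * ((∑ i, |(f i).b| * (f i).r ^ e) / θ) * θ ^ n
  | 0 => by simp [wd, one]
  | n + 1 => by
    have ih := sum_abs_b_le hr hθ h1 h2 n
    have hrn : ∀ u : Fin n → ι, 0 < (wd f n u).r := fun u => by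
      rw [wd_r]; exact Finset.prod_pos fun k _ => hr _
    have h3 : ∑ u : Fin n → ι, (wd f n u).r * (wd f n u).r ^ e ≤ θ ^ n := by
      rw [sum_wd_r_mul hr]
      exact pow_le_pow_left₀ (Finset.sum_nonneg fun i _ =>
        mul_nonneg (hr i).le (Real.rpow_nonneg (hr i).le _)) h2 n
    set B := ∑ i, |(f i).b| * (f i).r ^ e with hB
    have hB0 : 0 ≤ B := Finset.sum_nonneg fun i _ =>
      mul_nonneg (abs_nonneg _) (Real.rpow_nonneg (hr i).le _)
    set S := ∑ u : Fin n → ι, |(wd f n u).b| * (wd f n u).r ^ e with hS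
    have hS0 : 0 ≤ S := Finset.sum_nonneg fun u _ =>
      mul_nonneg (abs_nonneg _) (Real.rpow_nonneg (hrn u).le _)
    set S' := ∑ u : Fin n → ι, (wd f n u).r * (wd f n u).r ^ e with hS'
    calc ∑ v : Fin (n + 1) → ι, |(wd f (n + 1) v).b| * (wd f (n + 1) v).r ^ e
        ≤ ∑ i, ((|(f i).b| * (f i).r ^ e) * S' + (|(f i).a| * (f i).r ^ e) * S) := by
          rw [sum_word_succ]
          refine Finset.sum_le_sum fun i _ => ?_
          rw [hS, hS', Finset.mul_sum, Finset.mul_sum, ← Finset.sum_add_distrib]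
          refine Finset.sum_le_sum fun u _ => ?_
          simp only [wd, Fin.cons_zero, Fin.tail_cons, comp_b, comp_r]
          rw [Real.mul_rpow (hr i).le (hrn u).le]
          have h4 : |(f i).b * (wd f n u).r + (f i).a * (wd f n u).b| ≤
              |(f i).b| * (wd f n u).r + |(f i).a| * |(wd f n u).b| := by
            refine (abs_add_le _ _).trans ?_
            rw [abs_mul, abs_mul, abs_of_pos (hrn u)]
          have h5 : 0 ≤ (f i).r ^ e * (wd f n u).r ^ e :=
            mul_nonneg (Real.rpow_nonneg (hr i).le _) (Real.rpow_nonneg (hrn u).le _)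
          have := mul_le_mul_of_nonneg_right h4 h5
          linarith
      _ = B * S' + (∑ i, |(f i).a| * (f i).r ^ e) * S := by
          rw [Finset.sum_add_distrib, ← Finset.sum_mul, ← Finset.sum_mul]
      _ ≤ B * θ ^ n + θ * (n * (B / θ) * θ ^ n) :=
          add_le_add (mul_le_mul_of_nonneg_left h3 hB0) (mul_le_mul h1 ih hS0 hθ.le)
      _ = ((n + 1 : ℕ) : ℝ) * (B / θ) * θ ^ (n + 1) := by
          push_cast
          field_simp
          ring

end Aff

/-- The graph of a function over the unit interval. -/
def graphI (G : ℝ → ℝ) : Set (ℝ × ℝ) := {p | ∃ t ∈ Set.Icc (0 : ℝ) 1, p = (t, G t)}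

namespace Aff

/-- A square of side `r` in the strip above the image of the unit interval. -/
def box (f : Aff) (H : ℝ) (k : ℕ) : Set (ℝ × ℝ) :=
  Set.Icc f.ξ (f.ξ + f.r) ×ˢ Set.Icc (f.c - H + k * f.r) (f.c - H + (k + 1) * f.r)

theorem ediam_box_le (f : Aff) (H : ℝ) (k : ℕ) :
    Metric.ediam (f.box H k) ≤ ENNReal.ofReal f.r := by
  refine Metric.ediam_le fun p hp q hq => ?_
  obtain ⟨⟨h1, h2⟩, h3, h4⟩ := hp
  obtain ⟨⟨h5, h6⟩, h7, h8⟩ := hq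
  rw [edist_dist]
  refine ENNReal.ofReal_le_ofReal ?_
  rw [Prod.dist_eq, max_le_iff, Real.dist_eq, Real.dist_eq, abs_le, abs_le]
  refine ⟨⟨?_, ?_⟩, ?_, ?_⟩ <;> linarith

theorem Adm.exists_box {G : ℝ → ℝ} {M : ℝ} (hM : ∀ t, 0 ≤ t → t ≤ 1 → |G t| ≤ M) {f : Aff}
    (hf : Adm G f) {t : ℝ} (h0 : 0 ≤ t) (h1 : t ≤ 1) :
    ∃ k < ⌊2 * (|f.b| + M * |f.a|) / f.r⌋₊ + 1,
      (f.r * t + f.ξ, G (f.r * t + f.ξ)) ∈ f.box (|f.b| + M * |f.a|) k := by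
  set H := |f.b| + M * |f.a| with hH
  have hr := hf.r_pos
  have h2 : |f.b * t + f.a * G t| ≤ H := by
    refine (abs_add_le _ _).trans (add_le_add ?_ ?_)
    · rw [abs_mul, abs_of_nonneg h0]
      exact mul_le_of_le_one_right (abs_nonneg _) h1
    · rw [abs_mul, mul_comm]
      exact mul_le_mul_of_nonneg_right (hM t h0 h1) (abs_nonneg _)
  obtain ⟨h3, h4⟩ := abs_le.1 h2
  set q := (f.b * t + f.a * G t + H) / f.r with hq
  have hq0 : 0 ≤ q := div_nonneg (by linarith) hr.le
  have hqr : q * f.r = f.b * t + f.a * G t + H := div_mul_cancel₀ _ hr.ne'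
  refine ⟨⌊q⌋₊, Nat.lt_succ_of_le (Nat.floor_mono ?_), ?_⟩
  · exact div_le_div_of_nonneg_right (by linarith) hr.le
  · have h5 := mul_le_mul_of_nonneg_right (Nat.floor_le hq0) hr.le
    have h6 := mul_le_mul_of_nonneg_right (Nat.lt_floor_add_one q).le hr.le
    obtain ⟨h7, h8⟩ := hf.mem h0 h1
    refine ⟨⟨h7, h8⟩, ?_⟩
    simp only [hf.eq t h0 h1]
    constructor <;> linarith

theorem dimH_graphI_le {ι : Type*} [Fintype ι] {G : ℝ → ℝ} {f : ι → Aff} (hf : ∀ i, Adm G (f i))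
    (hcov : ∀ t : ℝ, 0 ≤ t → t ≤ 1 → ∃ i t', 0 ≤ t' ∧ t' ≤ 1 ∧ t = (f i).r * t' + (f i).ξ)
    {M : ℝ} (hM : ∀ t, 0 ≤ t → t ≤ 1 → |G t| ≤ M) {q : ℝ} (hq : q < 1) (hr : ∀ i, (f i).r ≤ q)
    {d : ℝ} (hd : 0 < d) (h1 : ∑ i, |(f i).a| * (f i).r ^ (d - 1) < 1)
    (h2 : ∑ i, (f i).r * (f i).r ^ (d - 1) < 1) :
    dimH (graphI G) ≤ ENNReal.ofReal d := by
  have hM0 : 0 ≤ M := (abs_nonneg _).trans (hM 0 le_rfl zero_le_one)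
  have hrp : ∀ i, 0 < (f i).r := fun i => (hf i).r_pos
  have hq0 : 0 < q := by
    obtain ⟨i, -⟩ := hcov 0 le_rfl zero_le_one
    exact (hrp i).trans_le (hr i)
  set e := d - 1 with he
  obtain ⟨θ, hθ, hθ1⟩ := exists_between (max_lt (max_lt h1 h2) (zero_lt_one' ℝ))
  rw [max_lt_iff, max_lt_iff] at hθ
  obtain ⟨⟨h3, h4⟩, hθ0⟩ := hθ
  set B := (∑ i, |(f i).b| * (f i).r ^ e) / θ with hB
  set H : Aff → ℝ := fun g => |g.b| + M * |g.a| with hH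
  set Nb : Aff → ℕ := fun g => ⌊2 * H g / g.r⌋₊ + 1 with hNb
  have hwp : ∀ n (v : Fin n → ι), 0 < (wd f n v).r := fun n v => (wd_adm hf n v).r_pos
  have hsum : ∀ n : ℕ, ∑ v : Fin n → ι, (Nb (wd f n v) : ℝ) * (wd f n v).r ^ d ≤
      2 * (n * B * θ ^ n) + (2 * M + 1) * θ ^ n := by
    intro n
    have e1 : ∑ v : Fin n → ι, (Nb (wd f n v) : ℝ) * (wd f n v).r ^ d ≤
        ∑ v : Fin n → ι, (2 * (|(wd f n v).b| * (wd f n v).r ^ e) +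
          2 * M * (|(wd f n v).a| * (wd f n v).r ^ e) + (wd f n v).r * (wd f n v).r ^ e) := by
      refine Finset.sum_le_sum fun v _ => ?_
      have hg := hwp n v
      set g := wd f n v
      have hHg : 0 ≤ H g := by simp only [hH]; positivity
      have e2 : (Nb g : ℝ) * g.r ≤ 2 * H g + g.r := by
        have := Nat.floor_le (div_nonneg (mul_nonneg zero_le_two hHg) hg.le)
        rw [le_div_iff₀ hg] at this
        simp only [hNb]
        push_cast
        linarith
      have e3 : g.r ^ d = g.r * g.r ^ e := by
        rw [he, Real.rpow_sub_one hg.ne']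
        field_simp
      rw [e3, ← mul_assoc]
      refine (mul_le_mul_of_nonneg_right e2 (Real.rpow_nonneg hg.le _)).trans_eq ?_
      simp only [hH]
      ring
    refine e1.trans ?_
    rw [Finset.sum_add_distrib, Finset.sum_add_distrib, ← Finset.mul_sum, ← Finset.mul_sum,
      sum_abs_wd_a_mul hrp, sum_wd_r_mul hrp]
    have e4 := sum_abs_b_le hrp hθ0 h3.le h4.le n
    have e5 : (∑ i, |(f i).a| * (f i).r ^ e) ^ n ≤ θ ^ n := pow_le_pow_left₀
      (Finset.sum_nonneg fun i _ => mul_nonneg (abs_nonneg _) (Real.rpow_nonneg (hrp i).le _))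
      h3.le n
    have e6 : (∑ i, (f i).r * (f i).r ^ e) ^ n ≤ θ ^ n := pow_le_pow_left₀
      (Finset.sum_nonneg fun i _ => mul_nonneg (hrp i).le (Real.rpow_nonneg (hrp i).le _))
      h4.le n
    have e7 := mul_le_mul_of_nonneg_left e5 (by positivity : 0 ≤ 2 * M)
    linarith
  have hlim : Filter.Tendsto (fun n : ℕ => ENNReal.ofReal
      (2 * (n * B * θ ^ n) + (2 * M + 1) * θ ^ n)) Filter.atTop (nhds 0) := by
    rw [← ENNReal.ofReal_zero]
    refine (ENNReal.continuous_ofReal.tendsto 0).comp ?_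
    have t1 := (tendsto_self_mul_const_pow_of_lt_one hθ0.le hθ1).const_mul (2 * B)
    have t2 := (tendsto_pow_atTop_nhds_zero_of_lt_one hθ0.le hθ1).const_mul (2 * M + 1)
    have t3 := t1.add t2
    rw [mul_zero, mul_zero, add_zero] at t3
    refine t3.congr fun n => ?_
    ring
  have hz : Measure.hausdorffMeasure d (graphI G) ≤ 0 := by
    refine (Measure.hausdorffMeasure_le_liminf_sum (l := Filter.atTop)
      (ι := fun n : ℕ => Σ v : Fin n → ι, Fin (Nb (wd f n v))) d (graphI G)
      (fun n => ENNReal.ofReal (q ^ n)) ?_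
      (fun n i => (wd f n i.1).box (H (wd f n i.1)) i.2) ?_ ?_).trans ?_
    · rw [← ENNReal.ofReal_zero]
      exact (ENNReal.continuous_ofReal.tendsto 0).comp
        (tendsto_pow_atTop_nhds_zero_of_lt_one hq0.le hq)
    · refine Filter.Eventually.of_forall fun n i => (ediam_box_le _ _ _).trans
        (ENNReal.ofReal_le_ofReal ?_)
      rw [wd_r]
      refine (Finset.prod_le_prod (fun k _ => (hrp _).le) fun k _ => hr _).trans_eq ?_
      simp
    · refine Filter.Eventually.of_forall fun n => ?_
      rintro p ⟨t, ⟨ht0, ht1⟩, rfl⟩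
      obtain ⟨v, t', h5, h6, h7⟩ := exists_wd hcov n t ht0 ht1
      obtain ⟨k, hk, hb⟩ := (wd_adm hf n v).exists_box hM h5 h6
      rw [← h7] at hb
      exact Set.mem_iUnion.2 ⟨⟨v, ⟨k, hk⟩⟩, hb⟩
    · rw [← hlim.liminf_eq]
      refine Filter.liminf_le_liminf (Filter.Eventually.of_forall fun n => ?_)
      refine le_trans ?_ (ENNReal.ofReal_le_ofReal (hsum n))
      rw [ENNReal.ofReal_sum_of_nonneg fun v _ =>
        mul_nonneg (Nat.cast_nonneg _) (Real.rpow_nonneg (hwp n v).le _), Fintype.sum_sigma]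
      refine Finset.sum_le_sum fun v _ => ?_
      rw [ENNReal.ofReal_mul (Nat.cast_nonneg _), ENNReal.ofReal_natCast,
        ← ENNReal.ofReal_rpow_of_pos (hwp n v)]
      refine (Finset.sum_le_sum (g := fun _ => ENNReal.ofReal (wd f n v).r ^ d) fun k _ =>
        ENNReal.rpow_le_rpow (ediam_box_le _ _ _) hd.le).trans_eq ?_
      simp
  have := dimH_le_of_hausdorffMeasure_ne_top (s := graphI G) (d := d.toNNReal)
    (by rw [Real.coe_toNNReal _ hd.le, nonpos_iff_eq_zero.1 hz]; exact ENNReal.zero_ne_top)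
  exact this

end Aff

open Aff

/-- A finite homogeneous family of affine maps whose first coordinates are separated. -/
structure HomFam (G : ℝ → ℝ) {W : Type*} (P : W → Aff) (h : Aff) (r a : ℝ) : Prop where
  adm : ∀ w, Adm G (P w)
  adm_h : Adm G h
  dis : ∀ w w', w ≠ w' → Dis (P w) (P w')
  interior : 0 < h.ξ ∧ h.ξ + h.r < 1
  r_eq : ∀ w, ((P w).comp h).r = r
  a_eq : ∀ w, ((P w).comp h).a = a
  r_le : r ≤ 1 / 2
  r_lt : r < a
  a_lt : a < 1

namespace HomFam
variable {G : ℝ → ℝ} {W : Type*} {P : W → Aff} {h : Aff} {r a : ℝ}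

theorem adm_comp (H : HomFam G P h r a) (w : W) : Adm G ((P w).comp h) := (H.adm w).comp H.adm_h

theorem r_pos [Nonempty W] (H : HomFam G P h r a) : 0 < r :=
  (Classical.arbitrary W |> fun w => H.r_eq w ▸ (H.adm_comp w).r_pos)

/-- The homogeneous system of a homogeneous family. -/
noncomputable def sys [Nonempty W] (H : HomFam G P h r a) : Sys W where
  r := r
  α := a
  ξ w := ((P w).comp h).ξ
  b w := ((P w).comp h).b
  c w := ((P w).comp h).c
  r_pos := H.r_pos
  r_le := H.r_le
  r_lt := H.r_lt
  α_lt := H.a_lt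

variable [Nonempty W] (H : HomFam G P h r a)
include H

theorem X_mem : ∀ l : List W, 0 ≤ H.sys.X l ∧ H.sys.X l ≤ 1
  | [] => by simp [Sys.X]
  | w :: l => by
    obtain ⟨h1, h2⟩ := X_mem l
    have h3 := (H.adm_comp w).mem h1 h2
    have h4 := (H.adm_comp w).ξ_nonneg
    have h5 := (H.adm_comp w).le_one
    have e : H.sys.X (w :: l) = ((P w).comp h).r * H.sys.X l + ((P w).comp h).ξ := by
      rw [H.r_eq, add_comm]
      rfl
    rw [e]
    constructor <;> linarith

theorem h_r_pos : 0 < h.r := H.adm_h.r_pos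

theorem separated : H.sys.Separated (r / h.r * min h.ξ (1 - h.ξ - h.r)) := by
  have hr := H.r_pos
  have hhr := H.h_r_pos
  have hPr : ∀ w, (P w).r = r / h.r := fun w => by
    rw [eq_div_iff hhr.ne', ← H.r_eq w]; rfl
  have key : ∀ w w' l l', (P w).ξ + (P w).r ≤ (P w').ξ →
      r / h.r * min h.ξ (1 - h.ξ - h.r) ≤ H.sys.X (w' :: l') - H.sys.X (w :: l) := by
    intro w w' l l' hd
    obtain ⟨h1, h2⟩ := H.X_mem l
    obtain ⟨h3, h4⟩ := H.X_mem l'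
    have e : ∀ w l, H.sys.X (w :: l) = (P w).r * h.ξ + (P w).ξ + (P w).r * h.r * H.sys.X l :=
      fun w l => by
        have : (P w).r * h.r = r := H.r_eq w
        rw [this]
        rfl
    rw [e, e, hPr, hPr]
    rw [hPr] at hd
    have hq : 0 < r / h.r := by positivity
    set q := r / h.r
    have h5 := mul_le_mul_of_nonneg_left (min_le_right h.ξ (1 - h.ξ - h.r)) hq.le
    have h6 := mul_le_mul_of_nonneg_left h2 (mul_pos hq hhr).le
    have h7 := mul_nonneg (mul_pos hq hhr).le h3
    have h8 := mul_nonneg hq.le H.adm_h.ξ_nonneg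
    linarith
  intro w w' hw t t'
  rcases H.dis w w' hw with hd | hd
  · exact (key w w' t t' hd).trans (by rw [abs_sub_comm]; exact le_abs_self _)
  · exact (key w' w t' t hd).trans (le_abs_self _)

omit H [Nonempty W] in
/-- The first coordinate of the point coded by a sequence. -/
noncomputable def cx (_ : HomFam G P h r a) (ω : ℕ → W) : ℝ :=
  ∑' k, ((P (ω k)).comp h).ξ * r ^ k

omit H in
theorem r_lt_one (H : HomFam G P h r a) : r < 1 := by linarith [H.r_le]

theorem summable_cx (ω : ℕ → W) : Summable fun k => ((P (ω k)).comp h).ξ * r ^ k := by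
  have hr := H.r_pos
  refine Summable.of_nonneg_of_le (fun k => mul_nonneg (H.adm_comp _).ξ_nonneg (by positivity))
    (fun k => ?_) (summable_geometric_of_lt_one hr.le H.r_lt_one)
  refine mul_le_of_le_one_left (by positivity) ?_
  linarith [(H.adm_comp (ω k)).le_one, (H.adm_comp (ω k)).r_pos]

theorem cx_eq (ω : ℕ → W) :
    H.cx ω = ((P (ω 0)).comp h).ξ + r * H.cx (sh 1 ω) := by
  rw [cx, (H.summable_cx ω).tsum_eq_zero_add, cx, ← tsum_mul_left]
  simp only [pow_zero, mul_one, sh]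
  congr 1
  refine tsum_congr fun k => ?_
  rw [pow_succ, add_comm 1 k]
  ring

theorem cx_mem (ω : ℕ → W) : 0 ≤ H.cx ω ∧ H.cx ω ≤ 1 := by
  have hr := H.r_pos
  have hr1 := H.r_lt_one
  constructor
  · exact tsum_nonneg fun k => mul_nonneg (H.adm_comp _).ξ_nonneg (by positivity)
  · have hs := (summable_geometric_of_lt_one hr.le hr1).mul_left (1 - r)
    refine ((H.summable_cx ω).tsum_le_tsum (fun k => ?_) hs).trans_eq ?_
    · refine mul_le_mul_of_nonneg_right ?_ (by positivity)
      have := (H.adm_comp (ω k)).le_one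
      rw [H.r_eq] at this
      linarith
    · rw [tsum_mul_left, tsum_geometric_of_lt_one hr.le hr1, mul_inv_cancel₀ (by linarith)]

theorem coding {M : ℝ} (hM : ∀ t, 0 ≤ t → t ≤ 1 → |G t| ≤ M) :
    Coding H.sys H.cx (fun ω => G (H.cx ω)) where
  x_eq := H.cx_eq
  y_eq ω := by
    have h1 := H.cx_mem (sh 1 ω)
    have h2 := (H.adm_comp (ω 0)).eq _ h1.1 h1.2
    rw [H.r_eq, H.a_eq, add_comm (r * _), ← H.cx_eq] at h2
    exact h2
  bdd := by
    refine ⟨max 1 M, fun ω => ?_⟩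
    have h1 := H.cx_mem ω
    refine ⟨?_, (hM _ h1.1 h1.2).trans (le_max_right _ _)⟩
    rw [abs_of_nonneg h1.1]
    exact h1.2.trans (le_max_left _ _)

theorem ofReal_le_dimH_graphI [Fintype W] {M : ℝ} (hM : ∀ t, 0 ≤ t → t ≤ 1 → |G t| ≤ M)
    {w w' : W} (hb : ((P w).comp h).b ≠ ((P w').comp h).b) (hN : 1 < Fintype.card W * a) {η : ℝ}
    (hη : 0 < η)
    (hσ : 0 < 1 + (Real.log (Fintype.card W) + Real.log a) / (-Real.log r) - η) :
    ENNReal.ofReal (1 + (Real.log (Fintype.card W) + Real.log a) / (-Real.log r) - η) ≤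
      dimH (graphI G) := by
  have hr := H.r_pos
  have hhr := H.h_r_pos
  have hmin : 0 < min h.ξ (1 - h.ξ - h.r) :=
    lt_min H.interior.1 (by linarith [H.interior.2])
  have hg : 0 < r / h.r * min h.ξ (1 - h.ξ - h.r) := by positivity
  have e : (Real.log (Fintype.card W) + Real.log a) / (-Real.log r) =
      (Real.log (Fintype.card W) - H.sys.lam) / H.sys.rho := by
    simp only [Sys.lam, Sys.rho, sys]
    ring
  rw [e] at hσ ⊢
  have hΓ : ∀ ω, (H.cx ω, G (H.cx ω)) ∈ graphI G := fun ω => ⟨H.cx ω, H.cx_mem ω, rfl⟩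
  exact (H.coding hM).ofReal_le_dimH (lt_min hg one_pos) (min_le_right _ 1)
    (fun w w' hw t t' => (min_le_left _ _).trans (H.separated w w' hw t t')) hb hN
    hΓ hη hσ

end HomFam

theorem exists_type_class {ι : Type*} [Fintype ι] {n : ℕ} {p : (Fin n → ι) → ℝ}
    (hp : ∑ v, p v = 1) : ∃ T : Finset (Fin n → ι),
      (∀ φ : ι → ℝ, ∀ v ∈ T, ∀ w ∈ T, ∏ k, φ (v k) = ∏ k, φ (w k)) ∧
      1 ≤ ((n + 1 : ℕ) : ℝ) ^ Fintype.card ι * ∑ v ∈ T, p v := by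
  classical
  set cnt : (Fin n → ι) → ι → Fin (n + 1) := fun v i =>
    ⟨#{k | v k = i}, Nat.lt_succ_of_le ((card_le_univ _).trans_eq (Fintype.card_fin n))⟩ with hcnt
  obtain ⟨κ, hκ⟩ : ∃ κ, 1 ≤ ((n + 1 : ℕ) : ℝ) ^ Fintype.card ι * ∑ v with cnt v = κ, p v := by
    by_contra! hall
    have h1 : ∑ κ, ((n + 1 : ℕ) : ℝ) ^ Fintype.card ι * ∑ v with cnt v = κ, p v <
        ∑ _κ : ι → Fin (n + 1), (1 : ℝ) :=
      Finset.sum_lt_sum_of_nonempty Finset.univ_nonempty fun κ _ => hall κ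
    rw [← Finset.mul_sum, Finset.sum_fiberwise, hp] at h1
    simp at h1
  refine ⟨univ.filter fun v => cnt v = κ, fun φ v hv w hw => ?_, hκ⟩
  have key : ∀ v : Fin n → ι, ∏ k, φ (v k) = ∏ i, φ i ^ (cnt v i : ℕ) := by
    intro v
    rw [← Finset.prod_fiberwise univ v]
    refine Finset.prod_congr rfl fun i _ => ?_
    rw [Finset.prod_congr rfl (g := fun _ => φ i) fun k hk => by rw [(mem_filter.1 hk).2],
      Finset.prod_const]
  rw [key, key, (mem_filter.1 hv).2, (mem_filter.1 hw).2]

theorem exists_nat_mul_log_le {δ : ℝ} (hδ : 0 < δ) (m κ : ℝ) (hm : 0 ≤ m) :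
    ∃ n : ℕ, m * Real.log ((n + 1 : ℕ) : ℝ) + κ ≤ δ * n := by
  have h1 := (Real.isLittleO_log_id_atTop.def (c := δ / (2 * (m + 1))) (by positivity))
  have h2 : Filter.Tendsto (fun n : ℕ => ((n + 1 : ℕ) : ℝ)) Filter.atTop Filter.atTop :=
    tendsto_natCast_atTop_atTop.comp (Filter.tendsto_add_atTop_nat 1)
  have h3 : ∀ᶠ n : ℕ in Filter.atTop, δ + 2 * κ ≤ δ * n :=
    (tendsto_natCast_atTop_atTop.const_mul_atTop hδ).eventually_ge_atTop _
  obtain ⟨n, h4, h5⟩ := ((h2.eventually h1).and h3).exists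
  refine ⟨n, ?_⟩
  have h6 : Real.log ((n + 1 : ℕ) : ℝ) ≤ δ / (2 * (m + 1)) * (n + 1) := by
    refine (le_abs_self _).trans ?_
    rw [Real.norm_eq_abs, id, Real.norm_of_nonneg (Nat.cast_nonneg _)] at h4
    push_cast at h4 ⊢
    exact h4
  have h7 := mul_le_mul_of_nonneg_left h6 hm
  have h8 : m * (δ / (2 * (m + 1)) * (n + 1)) ≤ δ * (n + 1) / 2 := by
    have e : m * (δ / (2 * (m + 1)) * (n + 1)) = m / (m + 1) * (δ * (n + 1) / 2) := by
      field_simp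
    rw [e]
    exact mul_le_of_le_one_left (by positivity) ((div_le_one (by positivity)).2 (by linarith))
  linarith

/-- Two letters of a word type class in alternating order give a homogeneous family. -/
theorem homFam_of_class {ι : Type*} {G : ℝ → ℝ} {f : ι → Aff} (hf : ∀ i, Adm G (f i))
    (hd : ∀ i j, i ≠ j → Dis (f i) (f j)) {i j : ι} (hij : i ≠ j) {n : ℕ}
    {T : Finset (Fin n → ι)} {R A : ℝ} (hR : ∀ v ∈ T, (wd f n v).r = R)
    (hA : ∀ v ∈ T, (wd f n v).a = A)
    (hr : R ^ 2 * ((f i).r * (f j).r) ^ 2 ≤ 1 / 2)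
    (hra : R ^ 2 * ((f i).r * (f j).r) ^ 2 < A ^ 2 * ((f i).a * (f j).a) ^ 2)
    (ha : A ^ 2 * ((f i).a * (f j).a) ^ 2 < 1) :
    HomFam G (fun w : T × T × Bool => (wd f n w.1).comp ((wd f n w.2.1).comp
      (if w.2.2 then (f i).comp (f j) else (f j).comp (f i)))) ((f i).comp (f j))
      (R ^ 2 * ((f i).r * (f j).r) ^ 2) (A ^ 2 * ((f i).a * (f j).a) ^ 2) := by
  have hw := fun v => wd_adm hf n v
  have hij' : ∀ β : Bool, Adm G (if β then (f i).comp (f j) else (f j).comp (f i)) := by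
    rintro (_ | _)
    · exact (hf j).comp (hf i)
    · exact (hf i).comp (hf j)
  refine ⟨fun w => (hw _).comp ((hw _).comp (hij' _)), (hf i).comp (hf j), ?_,
    (hd i j hij).comp_interior (hf i) (hf j), ?_, ?_, hr, hra, ha⟩
  · rintro ⟨⟨v, hv⟩, ⟨v', hv'⟩, β⟩ ⟨⟨w, hw1⟩, ⟨w', hw1'⟩, γ⟩ hne
    by_cases h1 : v = w
    · subst h1
      refine Dis.comp_left (hw _) ?_
      by_cases h2 : v' = w'
      · subst h2
        refine Dis.comp_left (hw _) ?_
        have h3 : β ≠ γ := fun h => hne (by rw [h])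
        have h4 := (hd i j hij).comp (hf i) (hf j) (hf j) (hf i)
        have h5 := (hd j i hij.symm).comp (hf j) (hf i) (hf i) (hf j)
        rcases β with _ | _ <;> rcases γ with _ | _
        · exact absurd rfl h3
        · exact h5
        · exact h4
        · exact absurd rfl h3
      · exact (wd_dis hf hd n _ _ h2).comp (hw _) (hw _) (hij' _) (hij' _)
    · exact (wd_dis hf hd n _ _ h1).comp (hw _) (hw _) ((hw _).comp (hij' _))
        ((hw _).comp (hij' _))
  · rintro ⟨⟨v, hv⟩, ⟨v', hv'⟩, _ | _⟩ <;> simp [hR v hv, hR v' hv'] <;> ring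
  · rintro ⟨⟨v, hv⟩, ⟨v', hv'⟩, _ | _⟩ <;> simp [hA v hv, hA v' hv'] <;> ring

set_option maxHeartbeats 1000000 in
theorem ofReal_le_dimH_graphI {ι : Type*} [Fintype ι] {G : ℝ → ℝ} {f : ι → Aff}
    (hf : ∀ i, Adm G (f i)) (hd : ∀ i j, i ≠ j → Dis (f i) (f j)) {M : ℝ}
    (hM : ∀ t, 0 ≤ t → t ≤ 1 → |G t| ≤ M) (ha0 : ∀ i, (f i).a ≠ 0) (ha1 : ∀ i, |(f i).a| < 1)
    (hr1 : ∑ i, (f i).r ≤ 1) {i j : ι} (hij : i ≠ j)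
    (hb : ((f i).comp (f j)).b ≠ ((f j).comp (f i)).b) {e : ℝ} (he : 0 < e)
    (hp : ∑ i, |(f i).a| * (f i).r ^ e = 1) : ENNReal.ofReal (1 + e) ≤ dimH (graphI G) := by
  classical
  have hrp : ∀ i, 0 < (f i).r := fun i => (hf i).r_pos
  obtain ⟨q, hq1, hq⟩ : ∃ q < 1, ∀ k, (f k).r ≤ q := by
    have hlt : ∀ k, (f k).r < 1 := by
      intro k
      obtain ⟨l, hl⟩ : ∃ l, l ≠ k := by
        by_cases h : i = k
        · exact ⟨j, fun h' => hij (h.trans h'.symm)⟩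
        · exact ⟨i, h⟩
      have h1 := hf k
      have h2 := hf l
      rcases hd l k hl with h | h <;>
        linarith [h1.le_one, h1.ξ_nonneg, h2.le_one, h2.ξ_nonneg, h2.r_pos]
    obtain ⟨k, -, hk⟩ := Finset.exists_max_image univ (fun k => (f k).r) ⟨i, mem_univ _⟩
    exact ⟨(f k).r, hlt k, fun l => hk l (mem_univ _)⟩
  have hq0 : 0 < q := (hrp i).trans_le (hq i)
  have hlq : 0 < -Real.log q := neg_pos.2 (Real.log_neg hq0 hq1)
  have key : ∀ ε, 0 < ε → ε < e → ε < 1 → ENNReal.ofReal (1 + e - 2 * ε) ≤ dimH (graphI G) := by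
    intro ε hε hεe hε1
    set ra := (f i).r * (f j).r with hra
    set aa := (f i).a * (f j).a with haa
    have hra0 : 0 < ra := mul_pos (hrp i) (hrp j)
    have hra4 : ra ≤ 1 / 4 := by
      have h1 : (f i).r + (f j).r ≤ 1 := by
        rcases hd i j hij with h | h <;>
          linarith [(hf i).le_one, (hf i).ξ_nonneg, (hf j).le_one, (hf j).ξ_nonneg]
      nlinarith [sq_nonneg ((f i).r - (f j).r), hrp i, hrp j]
    have haa0 : aa ≠ 0 := mul_ne_zero (ha0 i) (ha0 j)
    have haa1 : |aa| < 1 := by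
      rw [haa, abs_mul]
      exact mul_lt_one_of_nonneg_of_lt_one_left (abs_nonneg _) (ha1 i) (ha1 j).le
    set κ := Real.log 2 + Real.log (aa ^ 2) + e * Real.log (ra ^ 2) with hκ
    obtain ⟨n, hn⟩ := exists_nat_mul_log_le (δ := ε * (2 * -Real.log q)) (by positivity)
      (2 * Fintype.card ι) (-κ) (by positivity)
    have hpn : ∑ v : Fin n → ι, |(wd f n v).a| * (wd f n v).r ^ e = 1 := by
      rw [sum_abs_wd_a_mul hrp, hp, one_pow]
    obtain ⟨T, hT, hT1⟩ := exists_type_class hpn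
    have hTne : T.Nonempty := by
      rw [Finset.nonempty_iff_ne_empty]
      rintro rfl
      norm_num at hT1
    obtain ⟨v₀, hv₀⟩ := hTne
    set R := (wd f n v₀).r with hR
    set A := (wd f n v₀).a with hA
    have hTR : ∀ v ∈ T, (wd f n v).r = R := fun v hv => by
      rw [hR, wd_r, wd_r]; exact hT (fun k => (f k).r) v hv v₀ hv₀
    have hTA : ∀ v ∈ T, (wd f n v).a = A := fun v hv => by
      rw [hA, wd_a, wd_a]; exact hT (fun k => (f k).a) v hv v₀ hv₀
    have hR0 : 0 < R := (wd_adm hf n v₀).r_pos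
    have hRq : R ≤ q ^ n := by
      rw [hR, wd_r]
      refine (Finset.prod_le_prod (fun k _ => (hrp _).le) fun k _ => hq _).trans_eq ?_
      simp
    have hA0 : A ≠ 0 := by
      rw [hA, wd_a]; exact Finset.prod_ne_zero_iff.2 fun k _ => ha0 _
    have hA1 : |A| ≤ 1 := by
      rw [hA, wd_a, Finset.abs_prod]
      exact Finset.prod_le_one (fun k _ => abs_nonneg _) fun k _ => (ha1 _).le
    set t : ℝ := (T.card : ℝ) with ht
    have ht0 : 0 < t := by rw [ht]; exact_mod_cast Finset.card_pos.2 ⟨v₀, hv₀⟩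
    have hsumT : ∑ v ∈ T, |(wd f n v).a| * (wd f n v).r ^ e = t * (|A| * R ^ e) := by
      rw [Finset.sum_congr rfl (g := fun _ => |A| * R ^ e) fun v hv => by
        rw [hTR v hv, hTA v hv], Finset.sum_const, nsmul_eq_mul]
    rw [hsumT] at hT1
    have htR : t * R ≤ 1 := by
      have h1 : t * R = ∑ v ∈ T, (wd f n v).r := by
        rw [Finset.sum_congr rfl (g := fun _ => R) fun v hv => hTR v hv,
          Finset.sum_const, nsmul_eq_mul]
      have h2 := sum_wd_r_mul hrp 0 n
      simp only [Real.rpow_zero, mul_one] at h2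
      rw [h1]
      refine (Finset.sum_le_sum_of_subset_of_nonneg (Finset.subset_univ T) fun v _ _ =>
        (wd_adm hf n v).r_pos.le).trans ?_
      rw [h2]
      exact pow_le_one₀ (Finset.sum_nonneg fun k _ => (hrp k).le) hr1
    set r := R ^ 2 * ra ^ 2 with hr
    set a := A ^ 2 * aa ^ 2 with ha
    have hr0 : 0 < r := by positivity
    have ha0' : 0 < a := by positivity
    have hlogT : -(Fintype.card ι * Real.log ((n + 1 : ℕ) : ℝ)) ≤
        Real.log t + Real.log |A| + e * Real.log R := by
      have h1 := Real.log_le_log one_pos hT1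
      have hA' : 0 < |A| := abs_pos.2 hA0
      rw [Real.log_one, Real.log_mul (by positivity) (by positivity), Real.log_pow,
        Real.log_mul ht0.ne' (by positivity), Real.log_mul hA'.ne' (by positivity),
        Real.log_rpow hR0] at h1
      linarith
    have hcard : (Fintype.card (T × T × Bool) : ℝ) = 2 * t ^ 2 := by
      simp only [Fintype.card_prod, Fintype.card_coe, Fintype.card_bool]
      push_cast
      ring
    set N : ℝ := (Fintype.card (T × T × Bool) : ℝ) with hN
    have hlogr : Real.log r = 2 * Real.log R + Real.log (ra ^ 2) := by
      rw [hr, Real.log_mul (by positivity) (by positivity), Real.log_pow]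
      push_cast; ring
    have hloga : Real.log a = 2 * Real.log |A| + Real.log (aa ^ 2) := by
      rw [ha, Real.log_mul (by positivity) (by positivity), Real.log_pow, Real.log_abs]
      push_cast; ring
    have hlogN : Real.log N = Real.log 2 + 2 * Real.log t := by
      rw [hcard, Real.log_mul two_ne_zero (by positivity), Real.log_pow]
      push_cast; ring
    have hlogr' : n * (2 * -Real.log q) ≤ -Real.log r := by
      have h1 := Real.log_le_log hR0 hRq
      rw [Real.log_pow] at h1
      have h2 : Real.log (ra ^ 2) ≤ 0 := Real.log_nonpos (by positivity)
        (pow_le_one₀ hra0.le (by linarith))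
      rw [hlogr]
      linarith
    have hR1 : R ≤ 1 := hRq.trans (pow_le_one₀ hq0.le hq1.le)
    have hr16 : ra ^ 2 ≤ 1 / 16 :=
      (pow_le_pow_left₀ hra0.le hra4 2).trans_eq (by norm_num)
    have hr2 : r ≤ 1 / 2 := by
      have : R ^ 2 ≤ 1 := pow_le_one₀ hR0.le hR1
      have := mul_le_mul this hr16 (by positivity) zero_le_one
      linarith
    have hρ : 0 < -Real.log r := neg_pos.2 (Real.log_neg hr0 (by linarith))
    have hmain : (e - ε) * -Real.log r ≤ Real.log N + Real.log a := by
      have h1 := mul_le_mul_of_nonneg_left hlogr' hε.le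
      have h2 : Real.log N + Real.log a + e * Real.log r =
          2 * (Real.log t + Real.log |A| + e * Real.log R) + κ := by
        rw [hlogr, hloga, hlogN]; ring
      linarith
    have hN0 : 0 < N := by rw [hcard]; positivity
    have hNa : 1 < N * a := by
      have h1 : 0 < Real.log (N * a) := by
        rw [Real.log_mul hN0.ne' ha0'.ne']
        exact (mul_pos (by linarith) hρ).trans_le hmain
      exact (Real.log_pos_iff (by positivity)).1 h1
    have hNr : N * r ≤ 1 := by
      have h1 : (t * R) ^ 2 ≤ 1 := pow_le_one₀ (by positivity) htR
      have h2 := mul_le_mul h1 hr16 (by positivity) zero_le_one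
      have h3 : N * r = 2 * ((t * R) ^ 2 * ra ^ 2) := by rw [hcard, hr]; ring
      rw [h3]
      linarith
    have hra' : r < a := lt_of_mul_lt_mul_left (hNr.trans_lt hNa) hN0.le
    have ha1' : a < 1 := by
      have h1 : A ^ 2 ≤ 1 := (sq_le_one_iff_abs_le_one A).2 hA1
      have h2 : aa ^ 2 < 1 := (sq_lt_one_iff_abs_lt_one aa).2 haa1
      calc a ≤ 1 * aa ^ 2 := mul_le_mul_of_nonneg_right h1 (sq_nonneg _)
        _ < 1 := by linarith
    have H := homFam_of_class hf hd hij hTR hTA hr2 hra' ha1'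
    have : Nonempty T := ⟨⟨v₀, hv₀⟩⟩
    have hdiv : e - ε ≤ (Real.log N + Real.log a) / -Real.log r := (le_div_iff₀ hρ).2 hmain
    refine (ENNReal.ofReal_le_ofReal ?_).trans (H.ofReal_le_dimH_graphI hM
      (w := (⟨v₀, hv₀⟩, ⟨v₀, hv₀⟩, true)) (w' := (⟨v₀, hv₀⟩, ⟨v₀, hv₀⟩, false)) ?_ hNa hε ?_)
    · linarith
    · intro hcon
      apply hb
      simp only [comp_b, comp_r, comp_a, if_true, Bool.false_eq_true, if_false] at hcon ⊢
      have h1 := (hrp i).ne'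
      have h2 := (hrp j).ne'
      have h3 : A * A * ((f i).r * (f j).r) *
          (((f i).b * (f j).r + (f i).a * (f j).b) - ((f j).b * (f i).r + (f j).a * (f i).b))
            = 0 := by
        linear_combination hcon
      have h4 : A * A * ((f i).r * (f j).r) ≠ 0 := by positivity
      exact sub_eq_zero.1 ((mul_eq_zero.1 h3).resolve_left h4)
    · change 0 < 1 + (Real.log N + Real.log a) / -Real.log r - ε
      linarith
  have hlim : Filter.Tendsto (fun ε : ℝ => ENNReal.ofReal (1 + e - 2 * ε))
      (nhdsWithin 0 (Set.Ioi 0)) (nhds (ENNReal.ofReal (1 + e))) := by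
    have hc : Continuous fun ε : ℝ => ENNReal.ofReal (1 + e - 2 * ε) :=
      ENNReal.continuous_ofReal.comp (by fun_prop)
    have := hc.tendsto 0
    rw [mul_zero, sub_zero] at this
    exact this.mono_left nhdsWithin_le_nhds
  refine le_of_tendsto hlim ?_
  filter_upwards [Ioo_mem_nhdsGT he, Ioo_mem_nhdsGT one_pos] with ε hε hε'
  exact key ε hε.1 hε.2 hε'.2

end FIF

/-- B\'ar\'any–Hochman–Rapaport: if `Σ|α_i| > 1` and the non-degeneracy condition holds for
some `i ≠ j`, then the Hausdorff dimension of the graph of the fractal interpolation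
function equals the unique `s` with `Σ |α_i| (x_i - x_{i-1})^{s-1} = 1`. -/
theorem fif_graph_dimH (m : ℕ) (hm : 1 ≤ m) (x y : Fin (m + 1) → ℝ) (α : Fin m → ℝ)
    (hx0 : x 0 = 0) (hxm : x (Fin.last m) = 1) (hxmono : StrictMono x)
    (hα : ∀ i, α i ≠ 0 ∧ |α i| < 1)
    (G : ℝ → ℝ) (hGc : ContinuousOn G (Set.Icc (0:ℝ) 1))
    (hGdata : ∀ i, G (x i) = y i)
    (hattr : {p : ℝ × ℝ | ∃ t ∈ Set.Icc (0:ℝ) 1, p = (t, G t)} =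
      ⋃ i : Fin m, fifMap m x y α i '' {p : ℝ × ℝ | ∃ t ∈ Set.Icc (0:ℝ) 1, p = (t, G t)})
    (hsum : 1 < ∑ i, |α i|)
    (hnodeg : ∃ i j : Fin m, i ≠ j ∧
      x i.succ - x i.castSucc ≠ α i ∧ x j.succ - x j.castSucc ≠ α j ∧
      (y i.succ - y i.castSucc - α i * (y (Fin.last m) - y 0)) /
          (x i.succ - x i.castSucc - α i) ≠
        (y j.succ - y j.castSucc - α j * (y (Fin.last m) - y 0)) /
          (x j.succ - x j.castSucc - α j))
    (s : ℝ) (hs : ∑ i, |α i| * (x i.succ - x i.castSucc) ^ (s - 1) = 1) :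
    dimH {p : ℝ × ℝ | ∃ t ∈ Set.Icc (0:ℝ) 1, p = (t, G t)} = ENNReal.ofReal s := by
  obtain ⟨i₀, j₀, hij, hi, hj, hne⟩ := hnodeg
  set f : Fin m → FIF.Aff := fun i => ⟨x i.succ - x i.castSucc, x i.castSucc,
    y i.succ - y i.castSucc - α i * (y (Fin.last m) - y 0), α i,
    y i.castSucc - α i * y 0⟩ with hfdef
  have hr0 : ∀ i : Fin m, 0 < x i.succ - x i.castSucc := fun i =>
    sub_pos.2 (hxmono Fin.castSucc_lt_succ)
  have hxnn : ∀ k, 0 ≤ x k := fun k => hx0 ▸ hxmono.monotone (Fin.zero_le k)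
  have hxle : ∀ k, x k ≤ 1 := fun k => hxm ▸ hxmono.monotone (Fin.le_last k)
  have hf : ∀ i, FIF.Aff.Adm G (f i) := fun i => by
    refine ⟨hr0 i, hxnn _, ?_, fun t ht0 ht1 => ?_⟩
    · simpa [hfdef] using hxle i.succ
    · have hmem : fifMap m x y α i (t, G t) ∈
          {p : ℝ × ℝ | ∃ t ∈ Set.Icc (0:ℝ) 1, p = (t, G t)} := by
        rw [hattr]
        exact Set.mem_iUnion.2 ⟨i, _, ⟨t, ⟨ht0, ht1⟩, rfl⟩, rfl⟩
      obtain ⟨u, -, hu⟩ := hmem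
      rw [fifMap, Prod.mk.injEq] at hu
      change G ((x i.succ - x i.castSucc) * t + x i.castSucc) = _
      rw [hu.1, ← hu.2]
      simp only [hfdef]
      ring
  have hcov : ∀ t : ℝ, 0 ≤ t → t ≤ 1 →
      ∃ i t', 0 ≤ t' ∧ t' ≤ 1 ∧ t = (f i).r * t' + (f i).ξ := fun t ht0 ht1 => by
    have hmem : (t, G t) ∈ {p : ℝ × ℝ | ∃ t ∈ Set.Icc (0:ℝ) 1, p = (t, G t)} :=
      ⟨t, ⟨ht0, ht1⟩, rfl⟩
    rw [hattr] at hmem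
    obtain ⟨i, _, ⟨u, hu, rfl⟩, hp⟩ := Set.mem_iUnion.1 hmem
    exact ⟨i, u, hu.1, hu.2, (congrArg Prod.fst hp).symm⟩
  have hlt : ∀ i j : Fin m, i < j → (f i).ξ + (f i).r ≤ (f j).ξ := fun i j h => by
    have : x i.succ ≤ x j.castSucc := hxmono.monotone (by
      rw [Fin.le_def]; simpa using Nat.succ_le_of_lt (Fin.lt_def.1 h))
    simpa [hfdef] using this
  have hd : ∀ i j, i ≠ j → FIF.Aff.Dis (f i) (f j) := fun i j h =>
    h.lt_or_gt.imp (hlt i j) (hlt j i)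
  obtain ⟨M, hM'⟩ := isCompact_Icc.exists_bound_of_continuousOn hGc
  have hM : ∀ t, 0 ≤ t → t ≤ 1 → |G t| ≤ M := fun t h0 h1 => hM' t ⟨h0, h1⟩
  have hr1 : ∑ i : Fin m, (x i.succ - x i.castSucc) = 1 := by
    have h1 := Fin.sum_univ_succ x
    have h2 := Fin.sum_univ_castSucc x
    rw [Finset.sum_sub_distrib]
    linarith
  have hs1 : 1 < s := by
    by_contra! h
    refine hsum.not_ge (hs ▸ Finset.sum_le_sum fun i _ => ?_)
    refine le_mul_of_one_le_right (abs_nonneg _) ?_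
    refine Real.one_le_rpow_of_pos_of_le_one_of_nonpos (hr0 i) ?_ (by linarith)
    linarith [hxle i.succ, hxnn i.castSucc]
  have hrlt : ∀ i : Fin m, x i.succ - x i.castSucc < 1 := fun i => by
    obtain ⟨k, hk⟩ : ∃ k, k ≠ i := by
      by_cases h : i₀ = i
      · exact ⟨j₀, fun h' => hij (h.trans h'.symm)⟩
      · exact ⟨i₀, h⟩
    have := Finset.add_le_sum (s := Finset.univ) (fun l _ => (hr0 l).le) 
      (Finset.mem_univ i) (Finset.mem_univ k) hk.symm
    linarith [hr0 k]
  refine le_antisymm ?_ ?_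
  · have key : ∀ d, s < d → dimH (FIF.graphI G) ≤ ENNReal.ofReal d := fun d hd' => by
      have : Nonempty (Fin m) := ⟨i₀⟩
      obtain ⟨k, hk⟩ := Finite.exists_max fun i : Fin m => x i.succ - x i.castSucc
      refine FIF.Aff.dimH_graphI_le hf hcov hM (hrlt k) hk (by linarith) ?_ ?_
      · rw [← hs]
        refine Finset.sum_lt_sum_of_nonempty Finset.univ_nonempty fun i _ => ?_
        exact mul_lt_mul_of_pos_left
          (Real.rpow_lt_rpow_of_exponent_gt (hr0 i) (hrlt i) (by linarith))
          (abs_pos.2 (hα i).1)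
      · rw [← hr1]
        refine Finset.sum_lt_sum_of_nonempty Finset.univ_nonempty fun i _ => ?_
        exact mul_lt_of_lt_one_right (hr0 i) (Real.rpow_lt_one (hr0 i).le (hrlt i) (by linarith))
    have hlim : Filter.Tendsto (fun d : ℝ => ENNReal.ofReal d)
        (nhdsWithin s (Set.Ioi s)) (nhds (ENNReal.ofReal s)) :=
      (ENNReal.continuous_ofReal.tendsto s).mono_left nhdsWithin_le_nhds
    refine ge_of_tendsto hlim ?_
    filter_upwards [self_mem_nhdsWithin] with d hd'
    exact key d hd'
  · have hb : ((f i₀).comp (f j₀)).b ≠ ((f j₀).comp (f i₀)).b := by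
      intro hcon
      apply hne
      rw [div_eq_div_iff (sub_ne_zero.2 hi) (sub_ne_zero.2 hj)]
      simp only [FIF.Aff.comp_b, hfdef] at hcon
      linear_combination hcon
    have h := FIF.ofReal_le_dimH_graphI hf hd hM (fun i => (hα i).1) (fun i => (hα i).2)
      hr1.le hij hb (sub_pos.2 hs1) hs
    rwa [add_sub_cancel] at h
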